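/- Let C = Γ(4/3)²/Γ(5/3). For every ε > 0 and every δ > 0 there exists x₀ such that for all real x > x₀ and all real Q with x^{3/5+ε} < Q ≤ x, one has | V(x,Q) / (2 C Q x^{2/3}) − 1 | < δ; that is, V(x,Q) ∼ 2 C Q x^{2/3} uniformly for x^{3/5+ε} < Q ≤ x. -/

import Mathlib

open Classical Finset

/-- `r₂(n) = #{(u,v) ∈ ℕ², u,v ≥ 1 : u³ + v³ = n}`. -/
noncomputable def rtwocubes (n : ℕ) : ℕ :=
  Nat.card {p : ℕ × ℕ // 1 ≤ p.1 ∧ 1 ≤ p.2 ∧ p.1 ^ 3 + p.2 ^ 3 = n}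

/-- `ρ(q,a) = #{(u,v) ∈ (ℤ/q)² : u³ + v³ ≡ a (mod q)}`. -/
noncomputable def rhotwocubes (q a : ℕ) : ℕ :=
  Nat.card {p : ZMod q × ZMod q // p.1 ^ 3 + p.2 ^ 3 = (a : ZMod q)}

/-- `C = Γ(4/3)²/Γ(5/3)`. -/
noncomputable def Ctwocubes : ℝ := Real.Gamma (4 / 3) ^ 2 / Real.Gamma (5 / 3)

/-- `V(x,Q) = Σ_{q ≤ Q} Σ_{a=1}^{q} |Σ_{n ≤ x, n ≡ a (q)} r₂(n) − (ρ(q,a)/q²) C x^{2/3}|²`. -/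
noncomputable def Vtwocubes (x Q : ℝ) : ℝ :=
  ∑ q ∈ Finset.Icc 1 ⌊Q⌋₊, ∑ a ∈ Finset.Icc 1 q,
    ((∑ n ∈ (Finset.Icc 1 ⌊x⌋₊).filter (fun n => n % q = a % q), (rtwocubes n : ℝ)) -
      (rhotwocubes q a : ℝ) / (q : ℝ) ^ 2 * Ctwocubes * x ^ ((2 : ℝ) / 3)) ^ 2

namespace TwoCubes

/-- The additive character `e(t) = exp(2πit)`. -/
noncomputable def ex (t : ℝ) : ℂ := Complex.exp (2 * Real.pi * t * Complex.I)

lemma ex_eq (t : ℝ) : ex t = Complex.exp ((2 * Real.pi * t : ℝ) * Complex.I) := by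
  simp [ex]

lemma norm_ex (t : ℝ) : ‖ex t‖ = 1 := by
  rw [ex_eq, Complex.norm_exp_ofReal_mul_I]

lemma ex_add (s t : ℝ) : ex (s + t) = ex s * ex t := by
  rw [ex, ex, ex, ← Complex.exp_add]; congr 1; push_cast; ring

lemma ex_zero : ex 0 = 1 := by simp [ex]

lemma ex_int (n : ℤ) : ex n = 1 := by
  rw [ex, Complex.exp_eq_one_iff]
  exact ⟨n, by push_cast; ring⟩

lemma ex_add_int (t : ℝ) (n : ℤ) : ex (t + n) = ex t := by
  rw [ex_add, ex_int, mul_one]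

lemma ex_neg (t : ℝ) : ex (-t) = (starRingEnd ℂ) (ex t) := by
  rw [ex_eq, ex_eq, ← Complex.exp_conj, map_mul, Complex.conj_I, Complex.conj_ofReal]
  congr 1
  push_cast; ring

lemma ex_nat_mul (n : ℕ) (t : ℝ) : ex (n * t) = ex t ^ n := by
  rw [ex, ex, ← Complex.exp_nat_mul]; congr 1; push_cast; ring

lemma ex_sub (s t : ℝ) : ex (s - t) = ex s * (starRingEnd ℂ) (ex t) := by
  rw [sub_eq_add_neg, ex_add, ex_neg]

lemma re_ex (t : ℝ) : (ex t).re = Real.cos (2 * Real.pi * t) := by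
  rw [ex_eq, Complex.exp_ofReal_mul_I_re]

lemma ex_eq_one_iff (t : ℝ) : ex t = 1 ↔ ∃ n : ℤ, t = n := by
  constructor
  · intro h
    rw [ex, Complex.exp_eq_one_iff] at h
    obtain ⟨n, hn⟩ := h
    refine ⟨n, ?_⟩
    have h2 : (2 * Real.pi * Complex.I : ℂ) ≠ 0 := Complex.two_pi_I_ne_zero
    have : (t : ℂ) = n := by
      apply mul_right_cancel₀ h2
      linear_combination hn
    exact_mod_cast this
  · rintro ⟨n, rfl⟩; exact ex_int n

/-- Distance to the nearest integer. -/
noncomputable def nd (t : ℝ) : ℝ := |t - round t|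

lemma nd_nonneg (t : ℝ) : 0 ≤ nd t := abs_nonneg _

lemma nd_add_int (t : ℝ) (n : ℤ) : nd (t + n) = nd t := by
  simp [nd, round_add_intCast]

lemma nd_le (t : ℝ) (n : ℤ) : nd t ≤ |t - n| := round_le t n

lemma nd_neg (t : ℝ) : nd (-t) = nd t := by
  apply le_antisymm
  · refine (nd_le (-t) (-round t)).trans ?_
    rw [nd, ← abs_neg]; apply le_of_eq; congr 1; push_cast; ring
  · refine (nd_le t (-round (-t))).trans ?_
    rw [nd, ← abs_neg]; apply le_of_eq; congr 1; push_cast; ring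

lemma norm_ex_sub_one (t : ℝ) : 4 * nd t ≤ ‖ex t - 1‖ := by
  have h1 : ex t = ex (t - round t) := by
    have := ex_add_int (t - round t) (round t); rw [← this]; congr 1; ring
  have h2 : ‖ex t - 1‖ = ‖2 * Real.sin (2 * Real.pi * (t - round t) / 2)‖ := by
    rw [h1, ex_eq, mul_comm, Complex.norm_exp_I_mul_ofReal_sub_one]
  rw [h2]
  set s := t - round t with hs
  have hs2 : |s| ≤ 1 / 2 := abs_sub_round t
  have h3 : ‖2 * Real.sin (2 * Real.pi * s / 2)‖ = 2 * |Real.sin (Real.pi * s)| := by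
    rw [norm_mul, show 2 * Real.pi * s / 2 = Real.pi * s by ring]; simp
  rw [h3]
  have h4 : |Real.sin (Real.pi * s)| = Real.sin (Real.pi * |s|) := by
    rcases abs_cases s with ⟨h, h'⟩ | ⟨h, h'⟩
    · rw [h, abs_of_nonneg]
      apply Real.sin_nonneg_of_nonneg_of_le_pi
      · positivity
      · nlinarith [Real.pi_pos]
    · rw [h, mul_neg, Real.sin_neg, abs_of_nonpos]
      rw [show Real.pi * s = -(Real.pi * (-s)) by ring, Real.sin_neg, neg_nonpos]
      apply Real.sin_nonneg_of_nonneg_of_le_pi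
      · exact mul_nonneg Real.pi_pos.le (by linarith)
      · nlinarith [Real.pi_pos]
  have h5 := Real.mul_le_sin (x := Real.pi * |s|) (by positivity) (by nlinarith [Real.pi_pos])
  rw [h4]
  have h6 : 2 / Real.pi * (Real.pi * |s|) = 2 * |s| := by field_simp
  have : nd t = |s| := rfl
  rw [this]; linarith

/-- The size bound for a geometric sum of length `Y` at phase `t`. -/
noncomputable def gmin (Y t : ℝ) : ℝ := if nd t = 0 then Y else min Y (1 / (2 * nd t))

lemma gmin_le_left (Y t : ℝ) : gmin Y t ≤ Y := by
  unfold gmin; split_ifs <;> simp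

lemma gmin_nonneg {Y : ℝ} (hY : 0 ≤ Y) (t : ℝ) : 0 ≤ gmin Y t := by
  unfold gmin; split_ifs
  · exact hY
  · exact le_min hY (by have := nd_nonneg t; positivity)

lemma gmin_le_inv {Y t D : ℝ} (hD : 0 < D) (h : D ≤ nd t) : gmin Y t ≤ 1 / (2 * D) := by
  unfold gmin; rw [if_neg (by linarith)]
  refine (min_le_right _ _).trans ?_
  gcongr

lemma gmin_mono {Y Y' : ℝ} (h : Y ≤ Y') (t : ℝ) : gmin Y t ≤ gmin Y' t := by
  unfold gmin; split_ifs
  · exact h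
  · exact min_le_min_right _ h

lemma gmin_neg (Y t : ℝ) : gmin Y (-t) = gmin Y t := by simp [gmin, nd_neg]

lemma gmin_add_int (Y t : ℝ) (n : ℤ) : gmin Y (t + n) = gmin Y t := by simp [gmin, nd_add_int]

lemma norm_geom_le (Y : ℕ) (t : ℝ) : ‖∑ j ∈ range Y, ex (j * t)‖ ≤ gmin Y t := by
  have h1 : ‖∑ j ∈ range Y, ex (j * t)‖ ≤ Y := by
    refine (norm_sum_le _ _).trans ?_
    simp [norm_ex]
  unfold gmin; split_ifs with h
  · exact h1
  · refine le_min h1 ?_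
    have hpos : 0 < nd t := (nd_nonneg t).lt_of_ne' h
    have h2 : (∑ j ∈ range Y, ex (j * t)) * (ex t - 1) = ex t ^ Y - 1 := by
      simp_rw [ex_nat_mul]; exact geom_sum_mul _ _
    have h3 : ‖∑ j ∈ range Y, ex (j * t)‖ * ‖ex t - 1‖ ≤ 2 := by
      rw [← norm_mul, h2]
      refine (norm_sub_le _ _).trans ?_
      rw [norm_pow, norm_ex]; norm_num
    have h4 := norm_ex_sub_one t
    rw [le_div_iff₀ (by positivity)]
    nlinarith [norm_nonneg (∑ j ∈ range Y, ex (j * t))]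

/-- Orthogonality of additive characters. -/
lemma sum_ex_orth (q : ℕ) (hq : 0 < q) (h : ℤ) :
    ∑ b ∈ range q, ex (b * h / q) = if (q : ℤ) ∣ h then (q : ℂ) else 0 := by
  have hq' : (q : ℝ) ≠ 0 := by positivity
  have h0 : ∀ b : ℕ, ex (b * h / q) = ex (h / q) ^ b := fun b => by
    rw [← ex_nat_mul]; congr 1; ring
  simp_rw [h0]
  split_ifs with hd
  · obtain ⟨k, rfl⟩ := hd
    have : ex (((q : ℤ) * k : ℤ) / q) = 1 := by
      rw [show (((q : ℤ) * k : ℤ) : ℝ) / q = (k : ℤ) by push_cast; field_simp]; exact ex_int k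
    rw [this]; simp
  · have hne : ex (h / q) ≠ 1 := by
      intro h1
      rw [ex_eq_one_iff] at h1
      obtain ⟨n, hn⟩ := h1
      apply hd
      refine ⟨n, ?_⟩
      rw [div_eq_iff hq'] at hn
      have : (h : ℝ) = ((q * n : ℤ) : ℝ) := by push_cast; linarith
      exact_mod_cast this
    rw [geom_sum_eq hne, ← ex_nat_mul]
    rw [show (q : ℝ) * (h / q) = (h : ℤ) by field_simp, ex_int]; simp

lemma normSq_sum_ex {ι : Type*} (s : Finset ι) (c : ι → ℝ) :
    ‖∑ i ∈ s, ex (c i)‖ ^ 2 = ∑ i ∈ s, ∑ j ∈ s, Real.cos (2 * Real.pi * (c i - c j)) := by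
  have h : ((‖∑ i ∈ s, ex (c i)‖ ^ 2 : ℝ) : ℂ) = ∑ i ∈ s, ∑ j ∈ s, ex (c i - c j) := by
    push_cast
    rw [← Complex.mul_conj', map_sum, sum_mul_sum]
    simp_rw [ex_sub]
  have h2 := congrArg Complex.re h
  rw [Complex.ofReal_re] at h2
  rw [h2, Complex.re_sum]
  refine sum_congr rfl fun i _ => ?_
  rw [Complex.re_sum]
  exact sum_congr rfl fun j _ => re_ex _

lemma card_divisors_le_rpow {τ : ℝ} (hτ : 0 < τ) :
    ∃ C : ℝ, 1 ≤ C ∧ ∀ n : ℕ, 0 < n → (n.divisors.card : ℝ) ≤ C * (n : ℝ) ^ τ := by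
  have hl2 : 0 < Real.log 2 := Real.log_pos (by norm_num)
  set A : ℝ := 1 + 1 / (τ * Real.log 2) with hA
  have hA1 : 1 ≤ A := by rw [hA]; have : 0 < 1 / (τ * Real.log 2) := by positivity
                         linarith
  set b : ℕ := ⌈(2 : ℝ) ^ (1 / τ)⌉₊ with hb
  have key : ∀ p f : ℕ, 2 ≤ p → ((f : ℝ) + 1) ≤ (if p < b then A else 1) * (p : ℝ) ^ (τ * f) := by
    intro p f hp
    have hp0 : (0 : ℝ) < p := by positivity
    split_ifs with h
    · have h1 : (2 : ℝ) ^ (τ * f) ≤ (p : ℝ) ^ (τ * f) := by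
        apply Real.rpow_le_rpow (by norm_num) (by exact_mod_cast hp) (by positivity)
      have h2 : τ * f * Real.log 2 + 1 ≤ (2 : ℝ) ^ (τ * f) := by
        rw [Real.rpow_def_of_pos (by norm_num), mul_comm (Real.log 2)]
        exact Real.add_one_le_exp _
      have h3 : (f : ℝ) + 1 ≤ A * (τ * f * Real.log 2 + 1) := by
        rw [hA]
        have : 1 / (τ * Real.log 2) * (τ * f * Real.log 2) = f := by field_simp
        have h4 : 0 < 1 / (τ * Real.log 2) := by positivity
        have h5 : 0 ≤ τ * f * Real.log 2 := by positivity
        nlinarith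
      exact h3.trans (by gcongr; linarith)
    · rw [one_mul]
      have h1 : (2 : ℝ) ^ (1 / τ) ≤ p := (Nat.le_ceil _).trans (by exact_mod_cast not_lt.mp h)
      have h2 : (2 : ℝ) ≤ (p : ℝ) ^ τ := by
        calc (2 : ℝ) = ((2 : ℝ) ^ (1 / τ)) ^ τ := by
              rw [← Real.rpow_mul (by norm_num)]; field_simp; simp
          _ ≤ _ := Real.rpow_le_rpow (by positivity) h1 hτ.le
      rw [Real.rpow_mul hp0.le, Real.rpow_natCast]
      have h3 : (f : ℝ) + 1 ≤ 2 ^ f := by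
        exact_mod_cast Nat.lt_two_pow_self (n := f)
      exact h3.trans (pow_le_pow_left₀ (by norm_num) h2 f)
  refine ⟨A ^ b, one_le_pow₀ hA1, fun n hn => ?_⟩
  rw [Nat.card_divisors hn.ne']
  have hn' : (n : ℝ) ^ τ = ∏ p ∈ n.primeFactors, (p : ℝ) ^ (τ * n.factorization p) := by
    conv_lhs => rw [← Nat.prod_factorization_pow_eq_self hn.ne']
    rw [Finsupp.prod, Nat.support_factorization, Nat.cast_prod,
      ← Real.finsetProd_rpow _ _ (fun i _ => by positivity)]
    refine prod_congr rfl fun p _ => ?_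
    rw [Nat.cast_pow, mul_comm, Real.rpow_mul (by positivity), Real.rpow_natCast]
  push_cast
  calc ∏ p ∈ n.primeFactors, ((n.factorization p : ℝ) + 1)
      ≤ ∏ p ∈ n.primeFactors, ((if p < b then A else 1) * (p : ℝ) ^ (τ * n.factorization p)) :=
        prod_le_prod (fun _ _ => by positivity)
          fun p hp => key p _ (Nat.prime_of_mem_primeFactors hp).two_le
    _ = (∏ p ∈ n.primeFactors, (if p < b then A else 1)) * (n : ℝ) ^ τ := by
        rw [prod_mul_distrib, hn']
    _ ≤ A ^ b * (n : ℝ) ^ τ := by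
        gcongr
        rw [prod_ite, prod_const, prod_const_one, mul_one]
        apply pow_le_pow_right₀ hA1
        calc _ ≤ (range b).card := card_le_card fun p hp => by
                rw [mem_filter] at hp; exact mem_range.2 hp.2
          _ = b := card_range b

/-- `T` dominates the divisor function and the harmonic sums up to `B`. -/
structure Dom (B : ℕ) (T : ℝ) : Prop where
  one_le : 1 ≤ T
  div_le : ∀ n : ℕ, 0 < n → n ≤ B → (n.divisors.card : ℝ) ≤ T
  harm_le : ∀ n : ℕ, n ≤ B → ∑ k ∈ Icc 1 n, (1 : ℝ) / k ≤ T

lemma Dom.mono {B B' : ℕ} {T : ℝ} (h : Dom B T) (hB : B' ≤ B) : Dom B' T :=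
  ⟨h.one_le, fun n hn hn' => h.div_le n hn (hn'.trans hB), fun n hn => h.harm_le n (hn.trans hB)⟩

lemma exists_dom {τ : ℝ} (hτ : 0 < τ) :
    ∃ C : ℝ, 1 ≤ C ∧ ∀ B : ℕ, 1 ≤ B → Dom B (C * (B : ℝ) ^ τ) := by
  obtain ⟨C, hC1, hC⟩ := card_divisors_le_rpow hτ
  refine ⟨C + (1 + 1 / τ), by have : 0 < 1 / τ := by positivity
                              linarith, fun B hB => ?_⟩
  have hBr : (1 : ℝ) ≤ B := by exact_mod_cast hB
  have hB1 : (1 : ℝ) ≤ (B : ℝ) ^ τ := Real.one_le_rpow hBr hτ.le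
  have hτ' : 0 < 1 / τ := by positivity
  refine ⟨?_, fun n hn hnB => ?_, fun n hnB => ?_⟩
  · nlinarith
  · have h1 := hC n hn
    have h2 : (n : ℝ) ^ τ ≤ (B : ℝ) ^ τ :=
      Real.rpow_le_rpow (by positivity) (by exact_mod_cast hnB) hτ.le
    nlinarith
  · have h1 : ∑ k ∈ Icc 1 n, (1 : ℝ) / k = (harmonic n : ℝ) := by
      rw [harmonic_eq_sum_Icc]; push_cast; simp
    rw [h1]
    have h2 := harmonic_le_one_add_log n
    rcases Nat.eq_zero_or_pos n with rfl | hn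
    · simp; positivity
    have h3 : Real.log n ≤ Real.log B := Real.log_le_log (by positivity) (by exact_mod_cast hnB)
    have h4 := Real.log_le_rpow_div (x := B) (by positivity) hτ
    have h5 : (B : ℝ) ^ τ / τ = 1 / τ * (B : ℝ) ^ τ := by ring
    nlinarith

lemma normSq_sum_range (z : ℕ → ℂ) (N : ℕ) :
    ‖∑ v ∈ range N, z v‖ ^ 2 = ∑ v ∈ range N, ‖z v‖ ^ 2 +
      2 * (∑ h ∈ range N, ∑ v ∈ range (N - (h + 1)), z (v + (h + 1)) *
        (starRingEnd ℂ) (z v)).re := by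
  induction N with
  | zero => simp
  | succ N ih =>
    have h1 : ∑ h ∈ range (N + 1), ∑ v ∈ range (N + 1 - (h + 1)), z (v + (h + 1)) *
        (starRingEnd ℂ) (z v) = (∑ h ∈ range N, ∑ v ∈ range (N - (h + 1)), z (v + (h + 1)) *
        (starRingEnd ℂ) (z v)) + z N * (starRingEnd ℂ) (∑ v ∈ range N, z v) := by
      rw [sum_range_succ]
      simp only [Nat.sub_self, range_zero, sum_empty, add_zero]
      rw [map_sum, mul_sum, ← sum_range_reflect (fun v => z N * (starRingEnd ℂ) (z v)),
        ← sum_add_distrib]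
      refine sum_congr rfl fun h hh => ?_
      have hh := mem_range.1 hh
      rw [show N + 1 - (h + 1) = (N - (h + 1)) + 1 by omega, sum_range_succ]
      congr 2
      · congr 1; omega
      · congr 2; omega
    rw [sum_range_succ, h1, sum_range_succ, Complex.add_re, Complex.sq_norm, Complex.normSq_add,
      ← Complex.sq_norm, ← Complex.sq_norm, ih]
    have h2 : ((∑ v ∈ range N, z v) * (starRingEnd ℂ) (z N)).re =
        (z N * (starRingEnd ℂ) (∑ v ∈ range N, z v)).re := by
      rw [← Complex.conj_re]; simp [mul_comm]
    rw [h2]; ring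

lemma normSq_sum_range_le (z : ℕ → ℂ) (N : ℕ) (hz : ∀ v, ‖z v‖ = 1) :
    ‖∑ v ∈ range N, z v‖ ^ 2 ≤ N +
      2 * ∑ h ∈ range N, ‖∑ v ∈ range (N - (h + 1)), z (v + (h + 1)) *
        (starRingEnd ℂ) (z v)‖ := by
  rw [normSq_sum_range]
  simp only [hz, one_pow, sum_const, card_range, nsmul_eq_mul, mul_one]
  gcongr
  exact (Complex.re_le_norm _).trans (norm_sum_le _ _)

lemma norm_quad_sum_sq_le (a c : ℝ) (N : ℕ) (d : ℝ) :
    ‖∑ v ∈ range N, ex (a * v ^ 2 + c * v + d)‖ ^ 2 ≤ N +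
      2 * ∑ l ∈ range N, gmin N (2 * a * (l + 1)) := by
  refine (normSq_sum_range_le _ N fun v => norm_ex _).trans ?_
  gcongr with l hl
  have h : ∀ v : ℕ, ex (a * ((v + (l + 1) : ℕ) : ℝ) ^ 2 + c * ((v + (l + 1) : ℕ) : ℝ) + d) *
      (starRingEnd ℂ) (ex (a * v ^ 2 + c * v + d)) =
      ex (v * (2 * a * (l + 1))) * ex (a * (l + 1) ^ 2 + c * (l + 1)) := by
    intro v
    rw [← ex_sub, ← ex_add]; congr 1; push_cast; ring
  simp_rw [h]
  rw [← sum_mul, norm_mul, norm_ex, mul_one]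
  refine (norm_geom_le _ _).trans (gmin_mono ?_ _)
  exact_mod_cast Nat.sub_le _ _

lemma norm_cubic_sum_pow_le (a k c : ℝ) (N : ℕ) :
    ‖∑ v ∈ range N, ex (a * v ^ 3 + k * v ^ 2 + c * v)‖ ^ 4 ≤ 2 * N ^ 2 + 8 * N ^ 3 +
      16 * N * ∑ h ∈ range N, ∑ l ∈ range N, gmin N (6 * a * ((h + 1) * (l + 1))) := by
  set W : ℕ → ℝ := fun h => ‖∑ v ∈ range (N - (h + 1)),
    ex (3 * a * (h + 1) * v ^ 2 + (3 * a * (h + 1) ^ 2 + 2 * k * (h + 1)) * v +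
      (a * (h + 1) ^ 3 + k * (h + 1) ^ 2 + c * (h + 1)))‖ with hW
  have h1 : ‖∑ v ∈ range N, ex (a * v ^ 3 + k * v ^ 2 + c * v)‖ ^ 2 ≤ N +
      2 * ∑ h ∈ range N, W h := by
    refine (normSq_sum_range_le _ N fun v => norm_ex _).trans (le_of_eq ?_)
    congr 2
    refine sum_congr rfl fun h _ => ?_
    rw [hW]
    refine congrArg _ (sum_congr rfl fun v _ => ?_)
    rw [← ex_sub]; congr 1; push_cast; ring
  have h2 : ∀ h ∈ range N, W h ^ 2 ≤ N +
      2 * ∑ l ∈ range N, gmin N (6 * a * ((h + 1) * (l + 1))) := by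
    intro h _
    refine (norm_quad_sum_sq_le _ _ _ _).trans ?_
    have hle : ((N - (h + 1) : ℕ) : ℝ) ≤ N := by exact_mod_cast Nat.sub_le _ _
    gcongr
    calc _ ≤ ∑ l ∈ range (N - (h + 1)), gmin N (6 * a * ((h + 1) * (l + 1))) := by
          refine sum_le_sum fun l _ => ?_
          rw [show 2 * (3 * a * ((h : ℝ) + 1)) * (l + 1) = 6 * a * ((h + 1) * (l + 1)) by ring]
          exact gmin_mono hle _
      _ ≤ _ := sum_le_sum_of_subset_of_nonneg
          (range_subset_range.2 (Nat.sub_le _ _)) fun _ _ _ => gmin_nonneg (by positivity) _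
  have h3 : (∑ h ∈ range N, W h) ^ 2 ≤ N * ∑ h ∈ range N, W h ^ 2 := by
    have := sq_sum_le_card_mul_sum_sq (s := range N) (f := W)
    simpa using this
  have h4 := sum_le_sum h2
  rw [sum_add_distrib, ← mul_sum] at h4
  simp only [sum_const, card_range, nsmul_eq_mul] at h4
  set S := ‖∑ v ∈ range N, ex (a * v ^ 3 + k * v ^ 2 + c * v)‖
  set G := ∑ h ∈ range N, ∑ l ∈ range N, gmin N (6 * a * ((h + 1) * (l + 1)))
  set s := ∑ h ∈ range N, W h
  have hs : 0 ≤ s := sum_nonneg fun _ _ => norm_nonneg _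
  have hN : (0 : ℝ) ≤ N := by positivity
  calc S ^ 4 = (S ^ 2) ^ 2 := by ring
    _ ≤ (N + 2 * s) ^ 2 := by gcongr
    _ ≤ 2 * N ^ 2 + 8 * s ^ 2 := by nlinarith [sq_nonneg ((N : ℝ) - 2 * s)]
    _ ≤ 2 * N ^ 2 + 8 * (N * (N * N + 2 * G)) := by
        gcongr; exact h3.trans (by gcongr)
    _ = _ := by ring

/-- Distance bound used for points near `s/r`. -/
lemma nd_lower {r s : ℕ} (hr : 0 < r) {t : ℝ} (ht1 : -1 ≤ t) (ht2 : t ≤ 2) :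
    min ((s : ℝ) - 1) ((r : ℝ) - s - 2) / r ≤ nd ((s + t) / r) := by
  have hr' : (0 : ℝ) < r := by exact_mod_cast hr
  rw [div_le_iff₀ hr', nd]
  set n := round (((s : ℝ) + t) / r)
  have h : |((s : ℝ) + t) / r - n| * r = |(s + t) - n * r| := by
    rw [← abs_of_pos hr', ← abs_mul, abs_of_pos hr']; congr 1; field_simp
  rw [h]
  rcases le_or_gt n 0 with hn | hn
  · have : (n : ℝ) ≤ 0 := by exact_mod_cast hn
    refine (min_le_left _ _).trans (le_trans ?_ (le_abs_self _))
    nlinarith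
  · have : (1 : ℝ) ≤ n := by exact_mod_cast hn
    refine (min_le_right _ _).trans (le_trans ?_ (neg_le_abs _))
    nlinarith

lemma sum_gmin_block {α : ℝ} {b : ℤ} {r : ℕ} (hr : 0 < r) (hb : IsCoprime b (r : ℤ))
    (hα : |α - b / r| ≤ 1 / (r : ℝ) ^ 2) {Y T : ℝ} (hY : 0 ≤ Y)
    (hT : ∑ k ∈ Icc 1 r, (1 : ℝ) / k ≤ T) (γ : ℝ) :
    ∑ j ∈ range r, gmin Y (γ + α * j) ≤ 4 * Y + r * T := by
  have hr' : (0 : ℝ) < r := by exact_mod_cast hr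
  have hrz : (0 : ℤ) < r := by exact_mod_cast hr
  set c : ℤ := ⌊r * γ⌋ with hc
  set s : ℕ → ℕ := fun j => ((c + j * b) % r).toNat with hs
  have hs0 : ∀ j, ((s j : ℕ) : ℤ) = (c + j * b) % r := fun j =>
    Int.toNat_of_nonneg (Int.emod_nonneg _ hrz.ne')
  have hslt : ∀ j, s j < r := fun j => by
    have := Int.emod_lt_of_pos (c + j * b) hrz
    rw [← hs0] at this; exact_mod_cast this
  have hinj : Set.InjOn s (range r : Set ℕ) := by
    intro i hi j hj hij
    have h1 : (c + i * b) % r = (c + j * b) % (r : ℤ) := by rw [← hs0, ← hs0, hij]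
    have h2 : (r : ℤ) ∣ ((i : ℤ) - j) * b := by
      have := Int.ModEq.dvd (show (c + j * b) ≡ (c + i * b) [ZMOD r] from h1.symm)
      convert this using 1; ring
    have h3 : (r : ℤ) ∣ (i : ℤ) - j := hb.symm.dvd_of_dvd_mul_right h2
    have hi := mem_range.1 (mem_coe.1 hi)
    have hj := mem_range.1 (mem_coe.1 hj)
    have := Int.eq_zero_of_abs_lt_dvd h3 (by rw [abs_lt]; constructor <;> omega)
    omega
  have himg : (range r).image s = range r := by
    apply eq_of_subset_of_card_le
    · intro x hx; obtain ⟨j, _, rfl⟩ := mem_image.1 hx; exact mem_range.2 (hslt j)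
    · rw [card_image_of_injOn hinj]
  set i : ℕ → ℝ := fun s => if s < 2 then 1 else 0 with hi
  set g : ℕ → ℝ := fun s => if 2 ≤ s then 1 / ((s : ℝ) - 1) else 0 with hg
  set G : ℕ → ℝ := fun s => Y * (i s + i (r - 1 - s)) + r / 2 * (g s + g (r - 1 - s)) with hG
  have hi0 : ∀ s, 0 ≤ i s := fun s => by simp only [hi]; split_ifs <;> simp
  have hg0 : ∀ s, 0 ≤ g s := fun s => by
    simp only [hg]; split_ifs with h
    · have : (2 : ℝ) ≤ s := by exact_mod_cast h
      apply div_nonneg <;> linarith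
    · rfl
  have hpt : ∀ j ∈ range r, gmin Y (γ + α * j) ≤ G (s j) := by
    intro j hj
    have hj := mem_range.1 hj
    by_cases hsm : s j < 2 ∨ r - 1 - s j < 2
    · refine (gmin_le_left _ _).trans ?_
      have h1 : 1 ≤ i (s j) + i (r - 1 - s j) := by
        rcases hsm with h | h
        · have : i (s j) = 1 := if_pos h
          linarith [hi0 (r - 1 - s j)]
        · have : i (r - 1 - s j) = 1 := if_pos h
          linarith [hi0 (s j)]
      have h2 : 0 ≤ (r : ℝ) / 2 * (g (s j) + g (r - 1 - s j)) :=
        mul_nonneg (by positivity) (add_nonneg (hg0 _) (hg0 _))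
      simp only [hG]; nlinarith
    · push Not at hsm
      obtain ⟨hs2, hs3⟩ := hsm
      set β := α - b / r with hβ
      set t : ℝ := (r * γ - c) + r * j * β with ht
      have hf1 : 0 ≤ r * γ - c := by have := Int.floor_le (r * γ); linarith
      have hf2 : r * γ - c < 1 := by have := Int.lt_floor_add_one (r * γ); linarith
      have hβ1 : |r * j * β| ≤ 1 := by
        rw [abs_mul, abs_of_nonneg (by positivity)]
        have hj' : (j : ℝ) ≤ r := by exact_mod_cast hj.le
        calc (r : ℝ) * j * |β| ≤ r * r * (1 / (r : ℝ) ^ 2) := by gcongr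
          _ = 1 := by field_simp
      rw [abs_le] at hβ1
      have hm : γ + α * j = ((s j : ℝ) + t) / r + (((c + j * b) / r : ℤ) : ℝ) := by
        have h1 : ((s j : ℕ) : ℤ) + r * ((c + j * b) / r) = c + j * b := by
          rw [hs0]; exact Int.emod_add_mul_ediv _ _
        have h2 : (s j : ℝ) + r * (((c + j * b) / r : ℤ) : ℝ) = c + j * b := by exact_mod_cast h1
        rw [ht, hβ]; field_simp; linear_combination -h2
      rw [hm, gmin_add_int]
      have hlow := nd_lower hr (s := s j) (t := t) (by linarith) (by linarith)
      have hs2' : (2 : ℝ) ≤ s j := by exact_mod_cast hs2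
      have hs3' : (s j : ℝ) + 3 ≤ r := by
        have : s j + 3 ≤ r := by omega
        exact_mod_cast this
      have hpos1 : 0 < (s j : ℝ) - 1 := by linarith
      have hpos2 : 0 < (r : ℝ) - s j - 2 := by linarith
      refine (gmin_le_inv (by have := lt_min hpos1 hpos2; positivity) hlow).trans ?_
      have hi1 : 0 ≤ Y * (i (s j) + i (r - 1 - s j)) :=
        mul_nonneg hY (add_nonneg (hi0 _) (hi0 _))
      have hg1 : g (s j) = 1 / ((s j : ℝ) - 1) := by simp [hg, hs2]
      have hg2 : g (r - 1 - s j) = 1 / ((r : ℝ) - s j - 2) := by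
        have : ((r - 1 - s j : ℕ) : ℝ) = r - 1 - s j := by
          rw [Nat.cast_sub (by omega), Nat.cast_sub (by omega)]; simp
        simp only [hg, if_pos hs3, this]; congr 1; ring
      have hfin : 1 / (2 * (min ((s j : ℝ) - 1) ((r : ℝ) - s j - 2) / r)) ≤
          r / 2 * (g (s j) + g (r - 1 - s j)) := by
        rw [hg1, hg2]
        have e : ∀ y : ℝ, 0 < y → 1 / (2 * (y / r)) = r / 2 * (1 / y) := by
          intro y hy; field_simp
        rw [e _ (lt_min hpos1 hpos2)]
        have := one_div_pos.2 hpos1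
        have := one_div_pos.2 hpos2
        gcongr
        rcases min_choice ((s j : ℝ) - 1) ((r : ℝ) - s j - 2) with h | h <;> rw [h] <;> linarith
      simp only [hG]; linarith
  have hsum : ∑ j ∈ range r, G (s j) = ∑ x ∈ range r, G x := by
    conv_rhs => rw [← himg]
    rw [sum_image hinj]
  have hi2 : ∑ x ∈ range r, i x ≤ 2 := by
    simp only [hi]
    rw [sum_ite, sum_const, sum_const_zero, add_zero, nsmul_eq_mul, mul_one]
    have : ((range r).filter (fun x => x < 2)).card ≤ (range 2).card :=
      card_le_card fun x hx => mem_range.2 (mem_filter.1 hx).2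
    simpa using this
  have hg2 : ∑ x ∈ range r, g x ≤ T := by
    refine le_trans ?_ hT
    obtain ⟨R, rfl⟩ : ∃ R, r = R + 1 := ⟨r - 1, by omega⟩
    rw [sum_range_succ' g]
    have : g 0 = 0 := by simp [hg]
    rw [this, add_zero]
    rw [show Icc 1 (R + 1) = Ico 1 (R + 2) by rfl, sum_Ico_eq_sum_range,
      show R + 2 - 1 = R + 1 by omega]
    calc ∑ k ∈ range R, g (k + 1) ≤ ∑ k ∈ range (R + 1), g (k + 1) := by
          apply sum_le_sum_of_subset_of_nonneg (range_subset_range.2 (by omega))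
          exact fun _ _ _ => hg0 _
      _ = ∑ k ∈ range R, g (k + 2) := by
          rw [sum_range_succ', show g (0 + 1) = 0 from if_neg (by norm_num), add_zero]
      _ ≤ ∑ k ∈ range R, 1 / ((1 + k : ℕ) : ℝ) := by
          refine sum_le_sum fun k _ => ?_
          simp only [hg, if_pos (show 2 ≤ k + 2 by omega)]
          apply le_of_eq; congr 1; push_cast; ring
      _ ≤ _ := by
          apply sum_le_sum_of_subset_of_nonneg (range_subset_range.2 (by omega))
          exact fun _ _ _ => by positivity
  calc _ ≤ ∑ j ∈ range r, G (s j) := sum_le_sum hpt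
    _ = Y * (∑ x ∈ range r, i x + ∑ x ∈ range r, i (r - 1 - x)) +
        r / 2 * (∑ x ∈ range r, g x + ∑ x ∈ range r, g (r - 1 - x)) := by
        rw [hsum]; simp only [hG]
        rw [sum_add_distrib, ← mul_sum, ← mul_sum, sum_add_distrib, sum_add_distrib]
    _ ≤ Y * (2 + 2) + r / 2 * (T + T) := by
        rw [sum_range_reflect i, sum_range_reflect g]; gcongr
    _ = _ := by ring

lemma sum_gmin_le {α : ℝ} {b : ℤ} {r : ℕ} (hr : 0 < r) (hb : IsCoprime b (r : ℤ))
    (hα : |α - b / r| ≤ 1 / (r : ℝ) ^ 2) {Y T : ℝ} (hY : 0 ≤ Y)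
    (hT : ∑ k ∈ Icc 1 r, (1 : ℝ) / k ≤ T) (M : ℕ) :
    ∑ m ∈ Icc 1 M, gmin Y (α * m) ≤ ((M : ℝ) / r + 1) * (4 * Y + r * T) := by
  have hr' : (0 : ℝ) < r := by exact_mod_cast hr
  have hT0 : 0 ≤ T := le_trans (sum_nonneg fun _ _ => by positivity) hT
  have hk : ∀ k : ℕ, ∑ m ∈ range (k * r), gmin Y (α + α * m) ≤ k * (4 * Y + r * T) := by
    intro k
    induction k with
    | zero => simp
    | succ k ih =>
      rw [add_mul, one_mul, sum_range_add]
      have h := sum_gmin_block hr hb hα hY hT (α + α * (k * r))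
      have e : ∀ j : ℕ, α + α * (k * r) + α * j = α + α * ((k * r + j : ℕ) : ℝ) := by
        intro j; push_cast; ring
      simp_rw [e] at h
      push_cast at h ih ⊢
      linarith
  have h1 : ∑ m ∈ Icc 1 M, gmin Y (α * m) = ∑ m ∈ range M, gmin Y (α + α * m) := by
    rw [show Icc 1 M = Ico 1 (M + 1) by rfl, sum_Ico_eq_sum_range, Nat.add_sub_cancel]
    refine sum_congr rfl fun m _ => ?_
    congr 1; push_cast; ring
  have hle : M ≤ (M / r + 1) * r := by
    have := Nat.lt_div_mul_add hr (a := M); rw [add_mul, one_mul]; exact this.le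
  rw [h1]
  calc _ ≤ ∑ m ∈ range ((M / r + 1) * r), gmin Y (α + α * m) :=
        sum_le_sum_of_subset_of_nonneg (range_subset_range.2 hle)
          fun _ _ _ => gmin_nonneg hY _
    _ ≤ _ := hk _
    _ ≤ _ := by
        push_cast
        have : ((M / r : ℕ) : ℝ) ≤ M / r := Nat.cast_div_le
        gcongr

/-- Weyl's inequality for cubic polynomials. -/
lemma weyl_cubic {α : ℝ} {b : ℤ} {r : ℕ} (hr : 0 < r) (hb : IsCoprime b (r : ℤ))
    (hα : |α - b / r| ≤ 1 / (r : ℝ) ^ 2) {B N : ℕ} {T : ℝ} (hT : Dom B T)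
    (hN : 6 * N ^ 2 ≤ B) (hrB : r ≤ B) (k c : ℝ) :
    ‖∑ v ∈ range N, ex (α * v ^ 3 + k * v ^ 2 + c * v)‖ ^ 4 ≤
      600 * T ^ 2 * ((N : ℝ) ^ 4 / r + N ^ 3 + N * r) := by
  have hr' : (1 : ℝ) ≤ r := by exact_mod_cast hr
  have hT1 := hT.one_le
  rcases Nat.eq_zero_or_pos N with rfl | hN0
  · simp
  have hN1 : (1 : ℝ) ≤ N := by exact_mod_cast hN0
  refine (norm_cubic_sum_pow_le α k c N).trans ?_
  have h1 : ∑ h ∈ range N, ∑ l ∈ range N, gmin N (6 * α * (((h : ℝ) + 1) * (l + 1))) ≤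
      T * ∑ m ∈ Icc (1 : ℕ) (6 * N ^ 2), gmin N (α * m) := by
    rw [← sum_product']
    set φ : ℕ × ℕ → ℕ := fun p => 6 * ((p.1 + 1) * (p.2 + 1)) with hφ
    have hmap : ∀ p ∈ range N ×ˢ range N, φ p ∈ Icc 1 (6 * N ^ 2) := by
      intro p hp
      rw [mem_product, mem_range, mem_range] at hp
      rw [mem_Icc]
      constructor
      · simp only [hφ]; nlinarith
      · simp only [hφ]; rw [sq]; gcongr <;> omega
    rw [← sum_fiberwise_of_maps_to hmap, mul_sum]
    refine sum_le_sum fun m hm => ?_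
    rw [mem_Icc] at hm
    have h2 : ∀ p ∈ (range N ×ˢ range N).filter (fun p => φ p = m),
        gmin N (6 * α * (((p.1 : ℝ) + 1) * (p.2 + 1))) = gmin N (α * m) := by
      intro p hp
      rw [← (mem_filter.1 hp).2]; simp only [hφ]; congr 1; push_cast; ring
    rw [sum_congr rfl h2, sum_const, nsmul_eq_mul]
    refine mul_le_mul_of_nonneg_right ?_ (gmin_nonneg (by positivity) _)
    refine le_trans ?_ (hT.div_le m hm.1 (hm.2.trans hN))
    norm_cast
    refine card_le_card_of_injOn (fun p => p.1 + 1) ?_ ?_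
    · intro p hp
      have := (mem_filter.1 (mem_coe.1 hp)).2
      simp only [mem_coe, Nat.mem_divisors]
      refine ⟨⟨6 * (p.2 + 1), ?_⟩, by omega⟩
      rw [← this]; simp only [hφ]; ring
    · intro p hp p' hp' hpp
      have e1 := (mem_filter.1 (mem_coe.1 hp)).2
      have e2 := (mem_filter.1 (mem_coe.1 hp')).2
      simp only [hφ] at e1 e2 hpp
      rw [← e2, hpp] at e1
      have : p.2 + 1 = p'.2 + 1 := by
        apply Nat.eq_of_mul_eq_mul_left (Nat.succ_pos p'.1)
        simp only [Nat.succ_eq_add_one]; omega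
      ext <;> omega
  have h2 := sum_gmin_le hr hb hα (Y := N) (by positivity) (hT.harm_le r hrB) (6 * N ^ 2)
  push_cast at h2
  have h3 : (6 * (N : ℝ) ^ 2 / r + 1) * (4 * N + r * T) ≤
      T * (24 * N ^ 3 / r + 6 * N ^ 2 + 4 * N + r) := by
    have e : (6 * (N : ℝ) ^ 2 / r + 1) * (4 * N + r * T) =
      24 * N ^ 3 / r + 6 * N ^ 2 * T + 4 * N + r * T := by field_simp; ring
    rw [e]
    have a1 : 24 * (N : ℝ) ^ 3 / r ≤ T * (24 * N ^ 3 / r) :=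
      le_mul_of_one_le_left (by positivity) hT1
    have a2 : 4 * (N : ℝ) ≤ T * (4 * N) := le_mul_of_one_le_left (by positivity) hT1
    nlinarith
  have h4 : ∑ h ∈ range N, ∑ l ∈ range N, gmin N (6 * α * (((h : ℝ) + 1) * (l + 1))) ≤
      T * (T * (24 * N ^ 3 / r + 6 * N ^ 2 + 4 * N + r)) :=
    h1.trans (by gcongr; exact h2.trans h3)
  have hT2 : 1 ≤ T ^ 2 := one_le_pow₀ hT1
  have b1 : (N : ℝ) ^ 2 ≤ N ^ 3 := pow_le_pow_right₀ hN1 (by norm_num)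
  have b2 : (0 : ℝ) ≤ (N : ℝ) ^ 4 / r := by positivity
  calc _ ≤ 2 * (N : ℝ) ^ 2 + 8 * N ^ 3 +
        16 * N * (T * (T * (24 * N ^ 3 / r + 6 * N ^ 2 + 4 * N + r))) := by gcongr
    _ = 2 * (N : ℝ) ^ 2 + 8 * N ^ 3 +
        T ^ 2 * (384 * (N ^ 4 / r) + 96 * N ^ 3 + 64 * N ^ 2 + 16 * (N * r)) := by
        field_simp; ring
    _ ≤ T ^ 2 * (10 * N ^ 3) +
        T ^ 2 * (384 * (N ^ 4 / r) + 96 * N ^ 3 + 64 * N ^ 2 + 16 * (N * r)) := by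
        gcongr; nlinarith [pow_pos (show (0 : ℝ) < N by linarith) 3]
    _ = T ^ 2 * (10 * N ^ 3 + (384 * (N ^ 4 / r) + 96 * N ^ 3 + 64 * N ^ 2 + 16 * (N * r))) := by
        ring
    _ ≤ T ^ 2 * (600 * ((N : ℝ) ^ 4 / r + N ^ 3 + N * r)) := by
        have : (0 : ℝ) ≤ N * r := by positivity
        have : (0 : ℝ) ≤ (N : ℝ) ^ 3 := by positivity
        gcongr; linarith
    _ = _ := by ring

/-- Pairs of positive integers with sum of cubes at most `X`. -/
noncomputable def Om (N X : ℕ) : Finset (ℕ × ℕ) :=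
  (Icc 1 N ×ˢ Icc 1 N).filter fun p => p.1 ^ 3 + p.2 ^ 3 ≤ X

/-- The sum of two cubes. -/
def cub (p : ℕ × ℕ) : ℕ := p.1 ^ 3 + p.2 ^ 3

/-- The exponential sum over sums of two cubes. -/
noncomputable def F (N X : ℕ) (α : ℝ) : ℂ := ∑ p ∈ Om N X, ex (α * cub p)

/-- Reduced residues. -/
noncomputable def star (r : ℕ) : Finset ℕ := (range r).filter fun b => Nat.Coprime b r

/-- Pairs of cubes congruent modulo `r`. -/
noncomputable def Nr (N r : ℕ) : ℕ :=
  ((Icc 1 N ×ˢ Icc 1 N).filter fun p => (r : ℤ) ∣ (p.1 : ℤ) ^ 3 - (p.2 : ℤ) ^ 3).card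

lemma star_subset (r : ℕ) : star r ⊆ range r := filter_subset _ _

lemma meanSq {ι : Type*} (s : Finset ι) (c : ι → ℂ) (n : ι → ℤ) {lam : ℝ}
    (hc : ∀ u ∈ s, ‖c u‖ ≤ lam) {r : ℕ} (hr : 0 < r) :
    ∑ b ∈ range r, ‖∑ u ∈ s, c u * ex (b * n u / r)‖ ^ 2 ≤
      lam ^ 2 * (r * ((s ×ˢ s).filter fun p => (r : ℤ) ∣ n p.1 - n p.2).card) := by
  have h1 : ((∑ b ∈ range r, ‖∑ u ∈ s, c u * ex (b * n u / r)‖ ^ 2 : ℝ) : ℂ) =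
      ∑ p ∈ s ×ˢ s, c p.1 * (starRingEnd ℂ) (c p.2) *
        (if (r : ℤ) ∣ n p.1 - n p.2 then (r : ℂ) else 0) := by
    push_cast
    simp_rw [← Complex.mul_conj', map_sum, sum_mul_sum]
    rw [sum_product, sum_comm]
    refine sum_congr rfl fun u _ => ?_
    rw [sum_comm]
    refine sum_congr rfl fun u' _ => ?_
    rw [← sum_ex_orth r hr, mul_sum]
    refine sum_congr rfl fun b _ => ?_
    rw [map_mul, show (b : ℝ) * ((n u - n u' : ℤ) : ℝ) / r =
      b * n u / r - b * n u' / r by push_cast; ring, ex_sub]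
    ring
  have h2 : (∑ b ∈ range r, ‖∑ u ∈ s, c u * ex (b * n u / r)‖ ^ 2 : ℝ) =
      ‖∑ p ∈ s ×ˢ s, c p.1 * (starRingEnd ℂ) (c p.2) *
        (if (r : ℤ) ∣ n p.1 - n p.2 then (r : ℂ) else 0)‖ := by
    rw [← h1, Complex.norm_real, Real.norm_of_nonneg (sum_nonneg fun _ _ => by positivity)]
  rw [h2]
  refine (norm_sum_le _ _).trans ?_
  rw [card_filter, Nat.cast_sum, mul_sum, mul_sum]
  refine sum_le_sum fun p hp => ?_
  rw [mem_product] at hp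
  rw [norm_mul, norm_mul, RCLike.norm_conj]
  have h3 := hc _ hp.1
  have h4 := hc _ hp.2
  split_ifs
  · simp only [Complex.norm_natCast, Nat.cast_one, mul_one]
    have : 0 ≤ lam := (norm_nonneg _).trans h3
    rw [sq]; gcongr
  · simp

lemma exists_cut (P : ℕ → Prop) (hP : ∀ i j, i ≤ j → P j → P i) (N : ℕ) :
    ∃ p ≤ N, ∀ v < N, (P v ↔ v < p) := by
  induction N with
  | zero => exact ⟨0, le_rfl, by simp⟩
  | succ N ih =>
    by_cases h : P N
    · exact ⟨N + 1, le_rfl, fun v hv => ⟨fun _ => hv, fun _ => hP v N (by omega) h⟩⟩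
    · obtain ⟨p, hp, hpv⟩ := ih
      refine ⟨p, by omega, fun v hv => ?_⟩
      rcases Nat.lt_succ_iff_lt_or_eq.1 hv with h' | rfl
      · exact hpv v h'
      · exact ⟨fun h' => absurd h' h, fun h' => by omega⟩

lemma completion {N p : ℕ} (hN : 0 < N) (hp : p ≤ N) {v : ℕ} (hv : v < N) :
    (if v < p then (1 : ℂ) else 0) = ∑ m ∈ range N,
      ((1 / N : ℝ) * ∑ w ∈ range p, ex (w * (-(m / N)))) * ex (m * v / N) := by
  have hN' : (N : ℂ) ≠ 0 := by exact_mod_cast hN.ne'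
  have h1 : ∀ m ∈ range N, (((1 / N : ℝ) : ℂ) * ∑ w ∈ range p, ex (w * (-(m / N)))) *
      ex (m * v / N) = ∑ w ∈ range p, ((1 / N : ℝ) : ℂ) * ex (m * ((v : ℤ) - (w : ℤ) : ℤ) / N) := by
    intro m _
    rw [mul_sum, sum_mul]
    refine sum_congr rfl fun w _ => ?_
    rw [mul_assoc, ← ex_add]; congr 2; push_cast; ring
  rw [sum_congr rfl h1, sum_comm]
  simp_rw [← mul_sum, sum_ex_orth N hN, mul_sum]
  have h2 : ∀ w ∈ range p, ((1 / N : ℝ) : ℂ) * (if (N : ℤ) ∣ (v : ℤ) - w then (N : ℂ) else 0) =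
      if v = w then 1 else 0 := by
    intro w hw
    have hw := mem_range.1 hw
    have : (N : ℤ) ∣ (v : ℤ) - w ↔ v = w := by
      constructor
      · intro h
        have := Int.eq_zero_of_abs_lt_dvd h (by rw [abs_lt]; constructor <;> omega)
        omega
      · rintro rfl; simp
    simp only [this]
    split_ifs
    · push_cast; field_simp
    · simp
  rw [sum_congr rfl h2, sum_ite_eq]
  simp

/-- The star mean square of `F` near fractions of denominator `r`. -/
lemma starMeanSq_le {B N X r : ℕ} {T β : ℝ} (hT : Dom B T) (hN : 6 * N ^ 2 ≤ B) (hr : 0 < r)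
    (hrB : r ≤ B) (hβ : |β| ≤ 1 / (r : ℝ) ^ 2) :
    ∑ b ∈ star r, ‖F N X (b / r + β)‖ ^ 2 ≤
      25 * T ^ 2 * √(600 * T ^ 2 * ((N : ℝ) ^ 4 / r + N ^ 3 + N * r)) * (r * Nr N r) := by
  rcases Nat.eq_zero_or_pos N with rfl | hN0
  · simp [F, Om]
  have hT1 := hT.one_le
  set E : ℝ := 600 * T ^ 2 * ((N : ℝ) ^ 4 / r + N ^ 3 + N * r) with hE
  have hE0 : 0 ≤ E := by positivity
  have hcut : ∀ u : ℕ, ∃ p ≤ N, ∀ v < N, (u ^ 3 + (v + 1) ^ 3 ≤ X ↔ v < p) := fun u =>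
    exists_cut (fun v => u ^ 3 + (v + 1) ^ 3 ≤ X)
      (fun i j hij h => le_trans (by gcongr) h) N
  choose p hpN hp using hcut
  set ch : ℕ → ℕ → ℂ := fun u m => ((1 / N : ℝ) : ℂ) * ∑ w ∈ range (p u), ex (w * (-(m / N)))
  set lam : ℕ → ℝ := fun m => 1 / N * gmin N (m / N) with hlam
  have hNr : (0 : ℝ) < N := by exact_mod_cast hN0
  have hch : ∀ u m, ‖ch u m‖ ≤ lam m := by
    intro u m
    simp only [ch, hlam, norm_mul, Complex.norm_real]
    rw [Real.norm_of_nonneg (by positivity)]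
    gcongr
    refine (norm_geom_le _ _).trans ?_
    rw [gmin_neg]
    exact gmin_mono (by exact_mod_cast hpN u) _
  have hlampos : ∀ m, 0 < lam m := by
    intro m
    simp only [hlam]
    refine mul_pos (by positivity) ?_
    unfold gmin; split_ifs with h
    · exact hNr
    · exact lt_min hNr (by have := (nd_nonneg (m / N : ℝ)).lt_of_ne' h; positivity)
  have hlamsum : ∑ m ∈ range N, lam m ≤ 5 * T := by
    have h := sum_gmin_block (α := 1 / N) (b := 1) hN0 isCoprime_one_left
      (by simp) hNr.le (hT.harm_le N (by nlinarith)) 0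
    simp only [hlam, ← mul_sum]
    have e : ∀ m : ℕ, (0 : ℝ) + 1 / N * m = m / N := fun m => by ring
    simp_rw [e] at h
    calc _ ≤ 1 / N * (4 * N + N * T) := by gcongr
      _ = 4 + T := by field_simp
      _ ≤ 5 * T := by linarith
  set U : ℕ → ℕ → ℂ := fun m b => ∑ u ∈ Icc 1 N,
    (ch u m * ex (β * u ^ 3)) * ex (b * ((u ^ 3 : ℕ) : ℤ) / r)
  have hFU : ∀ b ∈ star r, ‖F N X (b / r + β)‖ ^ 2 ≤
      √E * (5 * T) * ∑ m ∈ range N, ‖U m b‖ ^ 2 / lam m := by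
    intro b hb
    set α : ℝ := b / r + β with hα
    set G : ℕ → ℂ := fun m => ∑ v ∈ range N, ex (m * v / N) * ex (α * (v + 1) ^ 3)
    have hG : ∀ m, ‖G m‖ ^ 4 ≤ E := by
      intro m
      have h := weyl_cubic (α := α) (b := b) hr
        (Nat.isCoprime_iff_coprime.2 (mem_filter.1 hb).2) (by rw [hα]; simpa using hβ)
        hT hN hrB (3 * α) (3 * α + m / N)
      have e : G m = (∑ v ∈ range N, ex (α * v ^ 3 + 3 * α * v ^ 2 + (3 * α + m / N) * v)) *
          ex α := by
        rw [sum_mul]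
        refine sum_congr rfl fun v _ => ?_
        rw [← ex_add, ← ex_add]; congr 1; ring
      rw [e, norm_mul, norm_ex, mul_one]; exact h
    have hG2 : ∀ m, ‖G m‖ ^ 2 ≤ √E := by
      intro m
      rw [Real.le_sqrt (by positivity) hE0, ← pow_mul]; exact hG m
    have hF : F N X α = ∑ m ∈ range N, U m b * G m := by
      rw [F, Om, sum_filter, sum_product]
      have e1 : ∀ u ∈ Icc 1 N, (∑ v ∈ Icc 1 N,
          if u ^ 3 + v ^ 3 ≤ X then ex (α * cub (u, v)) else 0) =
          ∑ m ∈ range N, (ch u m * ex (β * u ^ 3)) * ex (b * ((u ^ 3 : ℕ) : ℤ) / r) * G m := by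
        intro u _
        rw [show Icc 1 N = Ico 1 (N + 1) by rfl, sum_Ico_eq_sum_range, Nat.add_sub_cancel]
        have e2 : ∀ v ∈ range N, (if u ^ 3 + (1 + v) ^ 3 ≤ X then ex (α * cub (u, 1 + v)) else 0) =
            ∑ m ∈ range N, (ch u m * ex (β * u ^ 3)) * ex (b * ((u ^ 3 : ℕ) : ℤ) / r) *
              (ex (m * v / N) * ex (α * (v + 1) ^ 3)) := by
          intro v hv
          have hv := mem_range.1 hv
          have e3 : ex (α * cub (u, 1 + v)) =
              ex (β * u ^ 3) * ex (b * ((u ^ 3 : ℕ) : ℤ) / r) * ex (α * (v + 1) ^ 3) := by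
            rw [← ex_add, ← ex_add, cub, hα]; congr 1; push_cast; ring
          have e4 : (if u ^ 3 + (1 + v) ^ 3 ≤ X then ex (α * cub (u, 1 + v)) else 0) =
              (if v < p u then (1 : ℂ) else 0) * ex (α * cub (u, 1 + v)) := by
            rw [add_comm 1 v]
            simp only [hp u v hv]
            split_ifs <;> simp
          rw [e4, completion hN0 (hpN u) hv, e3, sum_mul]
          refine sum_congr rfl fun m _ => ?_
          simp only [ch]; ring
        rw [sum_congr rfl e2, sum_comm]
        refine sum_congr rfl fun m _ => ?_
        rw [← mul_sum]
      rw [sum_congr rfl e1, sum_comm]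
      refine sum_congr rfl fun m _ => ?_
      rw [← sum_mul]
    have hsq : (∑ m ∈ range N, ‖U m b‖) ^ 2 ≤
        (∑ m ∈ range N, lam m) * ∑ m ∈ range N, ‖U m b‖ ^ 2 / lam m :=
      sum_sq_le_sum_mul_sum_of_sq_le_mul _ (fun m _ => (hlampos m).le)
        (fun m _ => div_nonneg (by positivity) (hlampos m).le)
        (fun m _ => by have := hlampos m; apply le_of_eq; field_simp)
    have hs0 : 0 ≤ ∑ m ∈ range N, ‖U m b‖ ^ 2 / lam m :=
      sum_nonneg fun m _ => div_nonneg (by positivity) (hlampos m).le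
    have hW : ∀ m, ‖G m‖ ≤ √(√E) := fun m => by
      apply Real.le_sqrt_of_sq_le (hG2 m)
    have h1 : ‖F N X α‖ ≤ √(√E) * ∑ m ∈ range N, ‖U m b‖ := by
      rw [hF, mul_sum]
      refine (norm_sum_le _ _).trans (sum_le_sum fun m _ => ?_)
      rw [norm_mul, mul_comm]; gcongr; exact hW m
    calc ‖F N X α‖ ^ 2 ≤ (√(√E) * ∑ m ∈ range N, ‖U m b‖) ^ 2 := by gcongr
      _ = √E * (∑ m ∈ range N, ‖U m b‖) ^ 2 := by
          rw [mul_pow, Real.sq_sqrt (Real.sqrt_nonneg _)]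
      _ ≤ √E * ((5 * T) * ∑ m ∈ range N, ‖U m b‖ ^ 2 / lam m) := by
          gcongr; exact hsq.trans (by gcongr)
      _ = _ := by ring
  have hU : ∀ m, ∑ b ∈ star r, ‖U m b‖ ^ 2 ≤ lam m ^ 2 * (r * Nr N r) := by
    intro m
    refine (sum_le_sum_of_subset_of_nonneg (star_subset r) fun _ _ _ => by positivity).trans ?_
    have := meanSq (Icc 1 N) (fun u => ch u m * ex (β * u ^ 3)) (fun u => ((u ^ 3 : ℕ) : ℤ))
      (lam := lam m) (fun u _ => by rw [norm_mul, norm_ex, mul_one]; exact hch u m) hr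
    simpa [Nr, U] using this
  calc _ ≤ ∑ b ∈ star r, √E * (5 * T) * ∑ m ∈ range N, ‖U m b‖ ^ 2 / lam m := sum_le_sum hFU
    _ = √E * (5 * T) * ∑ m ∈ range N, (∑ b ∈ star r, ‖U m b‖ ^ 2) / lam m := by
        rw [← mul_sum, sum_comm]; simp_rw [sum_div]
    _ ≤ √E * (5 * T) * ∑ m ∈ range N, lam m * (r * Nr N r) := by
        gcongr with m _
        rw [div_le_iff₀ (hlampos m)]
        refine (hU m).trans (le_of_eq (by ring))
    _ = √E * (5 * T) * ((∑ m ∈ range N, lam m) * (r * Nr N r)) := by rw [sum_mul]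
    _ ≤ √E * (5 * T) * ((5 * T) * (r * Nr N r)) := by gcongr
    _ = _ := by ring

lemma sum_Nr_le {B N R : ℕ} {T : ℝ} (hT : Dom B T) (hN : N ^ 3 ≤ B) :
    ∑ r ∈ Icc 1 R, (Nr N r : ℝ) ≤ R * N + N ^ 2 * T := by
  have h1 : ∑ r ∈ Icc 1 R, (Nr N r : ℝ) = ∑ p ∈ Icc 1 N ×ˢ Icc 1 N,
      (((Icc 1 R).filter fun r : ℕ => (r : ℤ) ∣ (p.1 : ℤ) ^ 3 - (p.2 : ℤ) ^ 3).card : ℝ) := by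
    simp_rw [Nr, card_filter]
    push_cast
    rw [sum_comm]
  have h2 : ∀ p ∈ Icc 1 N ×ˢ Icc 1 N,
      (((Icc 1 R).filter fun r : ℕ => (r : ℤ) ∣ (p.1 : ℤ) ^ 3 - (p.2 : ℤ) ^ 3).card : ℝ) ≤
        (if p.1 = p.2 then (R : ℝ) else 0) + T := by
    intro p hp
    simp only [mem_product, mem_Icc] at hp
    by_cases h : p.1 = p.2
    · rw [if_pos h]
      have : ((Icc 1 R).filter fun r : ℕ => (r : ℤ) ∣ (p.1 : ℤ) ^ 3 - (p.2 : ℤ) ^ 3).card ≤ R := by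
        refine (card_filter_le _ _).trans (by simp)
      have h' : (((Icc 1 R).filter fun r : ℕ => (r : ℤ) ∣ (p.1 : ℤ) ^ 3 - (p.2 : ℤ) ^ 3).card : ℝ)
        ≤ R := by exact_mod_cast this
      linarith [hT.one_le]
    · rw [if_neg h, zero_add]
      set n := ((p.1 : ℤ) ^ 3 - (p.2 : ℤ) ^ 3).natAbs with hn
      have hn0 : 0 < n := by
        rw [hn, Int.natAbs_pos, sub_ne_zero]
        intro h'
        have : p.1 ^ 3 = p.2 ^ 3 := by exact_mod_cast h'
        exact h (Nat.pow_left_injective (n := 3) (by norm_num) this)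
      have hnB : n ≤ B := by
        refine le_trans ?_ hN
        have a1 : p.1 ^ 3 ≤ N ^ 3 := Nat.pow_le_pow_left hp.1.2 3
        have a2 : p.2 ^ 3 ≤ N ^ 3 := Nat.pow_le_pow_left hp.2.2 3
        zify at a1 a2 ⊢
        rw [hn, Int.natCast_natAbs, abs_le]
        have b1 : (0 : ℤ) ≤ (p.1 : ℤ) ^ 3 := by positivity
        have b2 : (0 : ℤ) ≤ (p.2 : ℤ) ^ 3 := by positivity
        constructor <;> linarith
      refine le_trans ?_ (hT.div_le n hn0 hnB)
      norm_cast
      refine card_le_card fun r hr => ?_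
      rw [mem_filter] at hr
      rw [Nat.mem_divisors]
      refine ⟨Int.natCast_dvd.1 ?_, hn0.ne'⟩
      exact_mod_cast hr.2
  rw [h1]
  refine (sum_le_sum h2).trans ?_
  rw [sum_add_distrib]
  apply le_of_eq
  congr 1
  · rw [sum_product, sum_congr rfl (fun u hu => by rw [sum_ite_eq, if_pos hu])]
    simp [mul_comm]
  · simp [sq]

/-- Pairs of residues with congruent cubes. -/
noncomputable def Nc (r : ℕ) : ℕ :=
  ((range r ×ˢ range r).filter fun p => (r : ℤ) ∣ (p.1 : ℤ) ^ 3 - (p.2 : ℤ) ^ 3).card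

lemma sum_Nc_le {B R : ℕ} {T : ℝ} (hT : Dom B T) (hR : R ^ 3 ≤ B) :
    ∑ r ∈ Icc 1 R, (Nc r : ℝ) / (r : ℝ) ^ 2 ≤ 3 * T ^ 2 := by
  have hT1 := hT.one_le
  have hRB : R ≤ B := le_trans (Nat.le_self_pow (by norm_num) R) hR
  have hH := hT.harm_le R hRB
  set D : ℕ → ℕ → ℕ → Prop := fun r u v => (r : ℤ) ∣ (v : ℤ) ^ 3 - (u : ℤ) ^ 3 with hD
  -- the ordered off-diagonal part
  have h1 : ∀ r ∈ Icc 1 R, (Nc r : ℝ) / (r : ℝ) ^ 2 ≤ 1 / r +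
      2 * ∑ v ∈ Icc 1 R, ∑ u ∈ range v, if D r u v then (if v < r then 1 / (v : ℝ) ^ 2 else 0)
        else 0 := by
    intro r hr
    rw [mem_Icc] at hr
    have hr0 : (0 : ℝ) < r := by exact_mod_cast hr.1
    have e1 : (Nc r : ℝ) ≤ r + 2 * ∑ v ∈ range r, ∑ u ∈ range v, if D r u v then (1 : ℝ) else 0 := by
      have a1 : (Nc r : ℝ) = ∑ v ∈ range r, ∑ u ∈ range r, if D r u v then (1 : ℝ) else 0 := by
        rw [Nc, card_filter, sum_product]; push_cast; rfl
      have a2 : ∀ v ∈ range r, ∀ u ∈ range r, (if D r u v then (1 : ℝ) else 0) ≤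
          (if u = v then 1 else 0) + (if u < v then (if D r u v then (1 : ℝ) else 0) else 0) +
          (if v < u then (if D r v u then (1 : ℝ) else 0) else 0) := by
        intro v _ u _
        have hsymm : D r u v ↔ D r v u := by
          simp only [hD]; rw [← dvd_neg, neg_sub]
        rcases lt_trichotomy u v with h | h | h
        · simp [h, h.ne, h.not_gt]
        · subst h; simp; split_ifs <;> norm_num
        · simp [h, h.ne', h.not_gt, hsymm]
      have a3 : ∀ v ∈ range r, ∑ u ∈ range r, (if u < v then (if D r u v then (1 : ℝ) else 0) else 0)
          = ∑ u ∈ range v, if D r u v then (1 : ℝ) else 0 := by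
        intro v hv
        have hv := mem_range.1 hv
        rw [← sum_filter]
        refine sum_congr ?_ fun _ _ => rfl
        ext u; simp only [mem_filter, mem_range]; omega
      rw [a1]
      refine (sum_le_sum fun v hv => sum_le_sum (a2 v hv)).trans ?_
      simp_rw [sum_add_distrib]
      have a4 : ∑ v ∈ range r, ∑ u ∈ range r, (if v < u then (if D r v u then (1 : ℝ) else 0) else 0)
          = ∑ v ∈ range r, ∑ u ∈ range v, if D r u v then (1 : ℝ) else 0 := by
        rw [sum_comm]; exact sum_congr rfl a3
      rw [a4, sum_congr rfl a3]
      have a5 : ∑ v ∈ range r, ∑ u ∈ range r, (if u = v then (1 : ℝ) else 0) = r := by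
        rw [sum_congr rfl (fun v hv => by rw [sum_ite_eq' , if_pos hv])]; simp
      rw [a5]; linarith
    have e2 : ∑ v ∈ Icc 1 R, ∑ u ∈ range v,
        (if D r u v then (if v < r then 1 / (v : ℝ) ^ 2 else 0) else 0) ≥
        (∑ v ∈ range r, ∑ u ∈ range v, if D r u v then (1 : ℝ) else 0) / (r : ℝ) ^ 2 := by
      have b1 : ∑ v ∈ range r, ∑ u ∈ range v, (if D r u v then (1 : ℝ) else 0) =
          ∑ v ∈ Icc 1 (r - 1), ∑ u ∈ range v, if D r u v then (1 : ℝ) else 0 := by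
        symm
        apply sum_subset_zero_on_sdiff
        · intro v hv; rw [mem_Icc] at hv; rw [mem_range]; omega
        · intro v hv
          simp only [mem_sdiff, mem_range, mem_Icc] at hv
          have : v = 0 := by omega
          subst this; simp
        · intros; rfl
      rw [b1, sum_div]
      refine (sum_le_sum (g := fun v => ∑ u ∈ range v,
        (if D r u v then (if v < r then 1 / (v : ℝ) ^ 2 else 0) else 0)) fun v hv => ?_).trans
        (sum_le_sum_of_subset_of_nonneg (Icc_subset_Icc le_rfl (by omega)) fun v _ _ =>
          sum_nonneg fun u _ => by split_ifs <;> positivity)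
      rw [mem_Icc] at hv
      rw [sum_div]
      refine sum_le_sum fun u _ => ?_
      have hv0 : (0 : ℝ) < v := by exact_mod_cast hv.1
      split_ifs with h1 h2
      · have : (v : ℝ) ≤ r := by exact_mod_cast h2.le
        gcongr
      · omega
      · simp
    calc (Nc r : ℝ) / (r : ℝ) ^ 2 ≤
        (r + 2 * ∑ v ∈ range r, ∑ u ∈ range v, if D r u v then (1 : ℝ) else 0) / (r : ℝ) ^ 2 := by
          gcongr
      _ = 1 / r + 2 * ((∑ v ∈ range r, ∑ u ∈ range v, if D r u v then (1 : ℝ) else 0) /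
          (r : ℝ) ^ 2) := by field_simp
      _ ≤ _ := by gcongr
  refine (sum_le_sum h1).trans ?_
  rw [sum_add_distrib, ← mul_sum]
  have h2 : ∑ r ∈ Icc 1 R, ∑ v ∈ Icc 1 R, ∑ u ∈ range v,
      (if D r u v then (if v < r then 1 / (v : ℝ) ^ 2 else 0) else 0) ≤ T * T := by
    rw [sum_comm]
    calc _ ≤ ∑ v ∈ Icc 1 R, 1 / (v : ℝ) * T := by
          refine sum_le_sum fun v hv => ?_
          rw [mem_Icc] at hv
          have hv0 : (0 : ℝ) < v := by exact_mod_cast hv.1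
          rw [sum_comm]
          calc _ ≤ ∑ u ∈ range v, T * (1 / (v : ℝ) ^ 2) := by
                refine sum_le_sum fun u hu => ?_
                have hu := mem_range.1 hu
                calc _ ≤ ∑ r ∈ Icc 1 R, (if D r u v then (1 / (v : ℝ) ^ 2) else 0) := by
                      refine sum_le_sum fun r _ => ?_
                      split_ifs <;> first | rfl | positivity
                  _ = (((Icc 1 R).filter fun r => D r u v).card : ℝ) * (1 / (v : ℝ) ^ 2) := by
                      rw [← sum_filter, sum_const, nsmul_eq_mul]
                  _ ≤ _ := by
                      gcongr
                      have hlt : u ^ 3 < v ^ 3 := Nat.pow_lt_pow_left hu (by norm_num)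
                      refine le_trans ?_ (hT.div_le (v ^ 3 - u ^ 3) (by omega) (le_trans
                        (Nat.sub_le _ _) (le_trans (Nat.pow_le_pow_left hv.2 3) hR)))
                      norm_cast
                      refine card_le_card fun r hr => ?_
                      rw [mem_filter] at hr
                      rw [Nat.mem_divisors]
                      refine ⟨?_, by omega⟩
                      have := hr.2
                      simp only [hD] at this
                      zify [hlt.le]; exact this
            _ = 1 / (v : ℝ) * T := by
                rw [sum_const, card_range, nsmul_eq_mul]; field_simp
      _ = (∑ v ∈ Icc 1 R, 1 / (v : ℝ)) * T := by rw [sum_mul]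
      _ ≤ T * T := by gcongr
  nlinarith

/-- Number of coincidences between sums of two cubes. -/
noncomputable def Z (N X : ℕ) : ℕ :=
  ((Om N X ×ˢ Om N X).filter fun p => cub p.1 = cub p.2).card

lemma cub_le {N X : ℕ} {p : ℕ × ℕ} (hp : p ∈ Om N X) : cub p ≤ X := (mem_filter.1 hp).2

lemma farey_eq {r r' b b' : ℕ} (hr : 0 < r) (hr' : 0 < r') (hb : b < r) (hb' : b' < r')
    (hc : Nat.Coprime b r) (hc' : Nat.Coprime b' r') {k : ℤ}
    (h : (b : ℤ) * r' - b' * r = k * (r * r')) : r = r' ∧ b = b' := by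
  have hk : k = 0 := by
    have h1 : (b : ℤ) * r' < r * r' := by
      have : (b : ℤ) < r := by exact_mod_cast hb
      have : (0 : ℤ) < r' := by exact_mod_cast hr'
      nlinarith
    have h2 : (b' : ℤ) * r < r * r' := by
      have : (b' : ℤ) < r' := by exact_mod_cast hb'
      have : (0 : ℤ) < r := by exact_mod_cast hr
      nlinarith
    have h3 : (0 : ℤ) ≤ (b : ℤ) * r' := by positivity
    have h4 : (0 : ℤ) ≤ (b' : ℤ) * r := by positivity
    have h5 : (0 : ℤ) < r * r' := by positivity
    have h6 : k < 1 := by by_contra hh; push Not at hh; nlinarith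
    have h7 : -1 < k := by by_contra hh; push Not at hh; nlinarith
    omega
  rw [hk, zero_mul, sub_eq_zero] at h
  have h' : b * r' = b' * r := by exact_mod_cast h
  have d1 : r ∣ r' := hc.symm.dvd_of_dvd_mul_left (Dvd.intro_left b' h'.symm)
  have d2 : r' ∣ r := hc'.symm.dvd_of_dvd_mul_left (Dvd.intro_left b h')
  have e := Nat.dvd_antisymm d1 d2
  subst e
  exact ⟨rfl, Nat.eq_of_mul_eq_mul_right hr h'⟩

set_option maxHeartbeats 1000000 in
lemma large_sieve (N X R : ℕ) (hR : 0 < R) :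
    ∑ r ∈ Icc 1 R, ∑ b ∈ star r, ‖F N X (b / r)‖ ^ 2 ≤ 8 * ((R : ℝ) ^ 2 + 3 * X) * Z N X := by
  set A : ℕ := R ^ 2 + 3 * X with hA
  have hApos : 0 < A := by positivity
  obtain ⟨H, hH⟩ : ∃ H : ℕ, H = R.factorial := ⟨_, rfl⟩
  have hHpos : 0 < H := hH ▸ Nat.factorial_pos R
  set L : ℕ := 4 * A * H with hL
  have hLpos : 0 < L := by positivity
  have hLr : (0 : ℝ) < L := by exact_mod_cast hLpos
  have hHr : (0 : ℝ) < H := by exact_mod_cast hHpos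
  have hAr : (0 : ℝ) < A := by exact_mod_cast hApos
  set J : ℝ := 2 * H + 1 with hJ
  have hJpos : 0 < J := by positivity
  set w : ℕ → ℂ := fun n => ((1 / J : ℝ) : ℂ) * ∑ m ∈ range (2 * H + 1), ex (((m : ℝ) - H) * n / L)
  have hw : ∀ n ≤ X, 1 / 2 ≤ ‖w n‖ := by
    intro n hn
    refine le_trans ?_ (Complex.re_le_norm _)
    simp only [w]
    rw [Complex.re_ofReal_mul, Complex.re_sum]
    have h1 : ∀ m ∈ range (2 * H + 1), (1 / 2 : ℝ) ≤ (ex (((m : ℝ) - H) * n / L)).re := by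
      intro m hm
      have hm : m ≤ 2 * H := Nat.lt_succ_iff.1 (mem_range.1 hm)
      have hm' : (m : ℝ) ≤ 2 * H := by exact_mod_cast hm
      rw [re_ex]
      refine le_trans ?_ Real.one_sub_sq_div_two_le_cos
      have h2 : |2 * Real.pi * (((m : ℝ) - H) * n / L)| ≤ 1 := by
        rw [abs_mul, abs_of_pos (by positivity : 0 < 2 * Real.pi), abs_div, abs_mul,
          abs_of_pos hLr, Nat.abs_cast]
        have h3 : |(m : ℝ) - H| ≤ H := by
          rw [abs_le]; constructor <;> [linarith [Nat.cast_nonneg (α := ℝ) m]; linarith]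
        have hn' : (n : ℝ) ≤ X := by exact_mod_cast hn
        have hX : 3 * (X : ℝ) ≤ A := by
          rw [hA]; push_cast; nlinarith [sq_nonneg (R : ℝ)]
        calc 2 * Real.pi * (|(m : ℝ) - H| * n / L) ≤ 2 * Real.pi * (H * (A / 3) / L) := by
              gcongr; linarith
          _ = Real.pi / 6 := by rw [hL]; push_cast; field_simp; norm_num
          _ ≤ 1 := by linarith [Real.pi_lt_four]
      have := sq_le_one_iff_abs_le_one _ |>.2 h2
      linarith
    have h2 := card_nsmul_le_sum _ _ _ h1
    rw [card_range, nsmul_eq_mul] at h2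
    push_cast at h2
    rw [one_div_mul_eq_div, le_div_iff₀ hJpos]
    linarith
  have hw0 : ∀ n ≤ X, w n ≠ 0 := fun n hn h => by
    have := hw n hn; rw [h, norm_zero] at this; norm_num at this
  set Ft : ℝ → ℂ := fun α => ∑ p ∈ Om N X, (w (cub p))⁻¹ * ex (α * cub p) with hFt
  -- smoothing
  have hsm : ∀ α : ℝ, F N X α = ((1 / J : ℝ) : ℂ) *
      ∑ m ∈ range (2 * H + 1), Ft (α + ((m : ℝ) - H) / L) := by
    intro α
    simp only [hFt]
    rw [sum_comm, mul_sum, F]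
    refine sum_congr rfl fun p hp => ?_
    have h := hw0 _ (cub_le hp)
    have e : ∀ m : ℕ, (w (cub p))⁻¹ * ex ((α + ((m : ℝ) - H) / L) * cub p) =
        (w (cub p))⁻¹ * ex (α * cub p) * ex (((m : ℝ) - H) * cub p / L) := by
      intro m; rw [mul_assoc, ← ex_add]; congr 2; ring
    simp_rw [e]
    rw [← mul_sum]
    have e2 : ((1 / J : ℝ) : ℂ) * ∑ m ∈ range (2 * H + 1), ex (((m : ℝ) - H) * cub p / L) =
        w (cub p) := rfl
    calc ex (α * cub p) = (w (cub p))⁻¹ * ex (α * cub p) * w (cub p) := by field_simp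
      _ = _ := by rw [← e2]; ring
  have hcs : ∀ α : ℝ, ‖F N X α‖ ^ 2 ≤ 1 / J *
      ∑ m ∈ range (2 * H + 1), ‖Ft (α + ((m : ℝ) - H) / L)‖ ^ 2 := by
    intro α
    have h1 : ‖F N X α‖ ≤ 1 / J * ∑ m ∈ range (2 * H + 1), ‖Ft (α + ((m : ℝ) - H) / L)‖ := by
      rw [hsm, norm_mul, Complex.norm_real, Real.norm_of_nonneg (by positivity)]
      gcongr; exact norm_sum_le _ _
    have h2 := sq_sum_le_card_mul_sum_sq (s := range (2 * H + 1))
      (f := fun m : ℕ => ‖Ft (α + ((m : ℝ) - H) / L)‖)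
    rw [card_range] at h2
    push_cast at h2
    calc ‖F N X α‖ ^ 2 ≤ (1 / J * ∑ m ∈ range (2 * H + 1), ‖Ft (α + ((m : ℝ) - H) / L)‖) ^ 2 := by
          gcongr
      _ = (1 / J) ^ 2 * (∑ m ∈ range (2 * H + 1), ‖Ft (α + ((m : ℝ) - H) / L)‖) ^ 2 := by ring
      _ ≤ (1 / J) ^ 2 * (J * ∑ m ∈ range (2 * H + 1), ‖Ft (α + ((m : ℝ) - H) / L)‖ ^ 2) := by
          gcongr
      _ = _ := by field_simp
  -- complete mean square
  have hms : ∑ k ∈ range L, ‖Ft (k / L)‖ ^ 2 ≤ 4 * (L * Z N X) := by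
    have h := meanSq (Om N X) (fun p => (w (cub p))⁻¹) (fun p => (cub p : ℤ)) (lam := 2)
      (fun p hp => by
        rw [norm_inv]
        have := hw _ (cub_le hp)
        rw [inv_le_comm₀ (by linarith) (by norm_num)]; linarith) hLpos
    have e : ((Om N X ×ˢ Om N X).filter fun p => (L : ℤ) ∣ (cub p.1 : ℤ) - cub p.2).card =
        Z N X := by
      rw [Z]; congr 1
      refine filter_congr fun p hp => ?_
      rw [mem_product] at hp
      have h1 := cub_le hp.1
      have h2 := cub_le hp.2
      have hXL : X < L := by
        rw [hL]; nlinarith [Nat.mul_le_mul (show 1 + 3 * X ≤ A by rw [hA]; nlinarith) hHpos]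
      constructor
      · intro h
        have := Int.eq_zero_of_abs_lt_dvd h (by rw [abs_lt]; constructor <;> omega)
        omega
      · intro h; rw [h]; simp
    rw [e] at h
    norm_num at h
    refine le_trans (le_of_eq ?_) h
    refine sum_congr rfl fun k _ => ?_
    simp only [hFt]
    congr 2
    refine sum_congr rfl fun p _ => ?_
    congr 2; ring
  -- injectivity
  set S := (Icc 1 R).sigma star with hS
  set κ : (Σ _ : ℕ, ℕ) × ℕ → ℕ := fun q =>
    ((((L / q.1.1 * q.1.2 : ℕ) : ℤ) + q.2 - H) % L).toNat with hκ
  have hLz : (0 : ℤ) < L := by exact_mod_cast hLpos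
  have hκ0 : ∀ q, ((κ q : ℕ) : ℤ) = (((L / q.1.1 * q.1.2 : ℕ) : ℤ) + q.2 - H) % L := fun q =>
    Int.toNat_of_nonneg (Int.emod_nonneg _ hLz.ne')
  have hdiv : ∀ r, 1 ≤ r → r ≤ R → r ∣ L := fun r h1 h2 =>
    (hH ▸ Nat.dvd_factorial h1 h2 : r ∣ H).trans (Dvd.intro_left _ rfl)
  have hinj : Set.InjOn κ (S ×ˢ range (2 * H + 1) : Finset _) := by
    rintro ⟨⟨r, b⟩, m⟩ hq ⟨⟨r', b'⟩, m'⟩ hq' heq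
    simp only [mem_coe, mem_product, hS, mem_sigma, mem_Icc, mem_range, star, mem_filter] at hq hq'
    obtain ⟨⟨⟨hr1, hrR⟩, hbr, hbc⟩, hm⟩ := hq
    obtain ⟨⟨⟨hr1', hrR'⟩, hbr', hbc'⟩, hm'⟩ := hq'
    have h1 := hκ0 ⟨⟨r, b⟩, m⟩
    rw [heq, hκ0] at h1
    simp only at h1
    have h2 := Int.ModEq.dvd (show _ ≡ _ [ZMOD L] from h1)
    obtain ⟨k, hk⟩ := h2
    obtain ⟨s, hs⟩ := hdiv r hr1 hrR
    obtain ⟨s', hs'⟩ := hdiv r' hr1' hrR'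
    have e1 : L / r = s := by rw [hs]; exact Nat.mul_div_cancel_left s hr1
    have e2 : L / r' = s' := by rw [hs']; exact Nat.mul_div_cancel_left s' hr1'
    rw [e1, e2] at hk
    push_cast at hk
    have hsz : (L : ℤ) = r * s := by exact_mod_cast hs
    have hsz' : (L : ℤ) = r' * s' := by exact_mod_cast hs'
    -- multiply by r r'
    have h3 : (L : ℤ) * (b * r' - b' * r - k * (r * r')) = (r * r') * ((m' : ℤ) - m) := by
      have a1 : (s : ℤ) * b + m - H - (s' * b' + m' - H) = L * k := hk
      have : (r * r' : ℤ) * ((s : ℤ) * b + m - H - (s' * b' + m' - H)) = (r * r') * (L * k) := by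
        rw [a1]
      have t1 : (r * r' : ℤ) * (s * b) = L * (b * r') := by rw [hsz]; ring
      have t2 : (r * r' : ℤ) * (s' * b') = L * (b' * r) := by rw [hsz']; ring
      linear_combination this - t1 + t2
    have hz : (b : ℤ) * r' - b' * r - k * (r * r') = 0 := by
      by_contra hne
      have h4 : (L : ℤ) ≤ |(r * r' : ℤ) * ((m' : ℤ) - m)| := by
        rw [← h3, abs_mul, abs_of_pos hLz]
        exact le_mul_of_one_le_right hLz.le (Int.one_le_abs hne)
      rw [abs_mul, abs_of_nonneg (by positivity)] at h4
      have h5 : |(m' : ℤ) - m| ≤ 2 * H := by rw [abs_le]; constructor <;> omega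
      have h6 : (r * r' : ℤ) ≤ R ^ 2 := by
        have : r * r' ≤ R ^ 2 := by rw [sq]; exact Nat.mul_le_mul hrR hrR'
        exact_mod_cast this
      have h7 : (L : ℤ) ≤ R ^ 2 * (2 * H) :=
        h4.trans (mul_le_mul h6 h5 (abs_nonneg _) (by positivity))
      have h8 : (L : ℤ) = 4 * (R ^ 2 + 3 * X) * H := by rw [hL, hA]; push_cast; ring
      rw [h8] at h7
      have : (0 : ℤ) < H := by exact_mod_cast hHpos
      have : (0 : ℤ) < (R : ℤ) ^ 2 := by positivity
      have : (0 : ℤ) ≤ X := by positivity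
      nlinarith [mul_pos (show (0 : ℤ) < (R : ℤ) ^ 2 by positivity)
        (show (0 : ℤ) < H by exact_mod_cast hHpos)]
    rw [hz, mul_zero] at h3
    have hmm : (m' : ℤ) - m = 0 := by
      rcases mul_eq_zero.1 h3.symm with h | h
      · exfalso; have : (0 : ℤ) < r * r' := by positivity
        omega
      · exact h
    obtain ⟨rfl, rfl⟩ := farey_eq hr1 hr1' hbr hbr' hbc hbc' (sub_eq_zero.1 hz)
    have : m = m' := by omega
    subst this; rfl
  have hval : ∀ q ∈ S ×ˢ range (2 * H + 1),
      ‖Ft ((q.1.2 : ℝ) / q.1.1 + ((q.2 : ℝ) - H) / L)‖ ^ 2 = ‖Ft ((κ q : ℝ) / L)‖ ^ 2 := by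
    rintro ⟨⟨r, b⟩, m⟩ hq
    simp only [mem_product, hS, mem_sigma, mem_Icc, mem_range] at hq
    obtain ⟨s, hs⟩ := hdiv r hq.1.1.1 hq.1.1.2
    have hr0 : (0 : ℝ) < r := by exact_mod_cast hq.1.1.1
    have hsz : (L : ℝ) = r * s := by exact_mod_cast hs
    have h1 := hκ0 ⟨⟨r, b⟩, m⟩
    simp only at h1
    have e1 : L / r = s := by rw [hs]; exact Nat.mul_div_cancel_left s hq.1.1.1
    rw [e1] at h1
    obtain ⟨k, hk⟩ : ∃ k : ℤ, (κ ⟨⟨r, b⟩, m⟩ : ℤ) + L * k = ((s * b : ℕ) : ℤ) + m - H :=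
      ⟨_, by rw [h1]; exact Int.emod_add_mul_ediv _ _⟩
    have hk' : (κ ⟨⟨r, b⟩, m⟩ : ℝ) + L * k = s * b + m - H := by exact_mod_cast hk
    have hs0 : (s : ℝ) ≠ 0 := by
      intro h; rw [h, mul_zero] at hsz; linarith
    have e2 : (b : ℝ) / r + ((m : ℝ) - H) / L = (κ ⟨⟨r, b⟩, m⟩ : ℝ) / L + k := by
      have : (b : ℝ) / r = s * b / L := by rw [hsz]; field_simp
      rw [this]; field_simp; linarith
    simp only
    rw [e2]
    congr 2
    simp only [hFt]
    refine sum_congr rfl fun p _ => ?_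
    congr 1
    rw [show ((κ ⟨⟨r, b⟩, m⟩ : ℝ) / L + k) * cub p =
      (κ ⟨⟨r, b⟩, m⟩ : ℝ) / L * cub p + ((k * cub p : ℤ) : ℝ) by push_cast; ring, ex_add_int]
  have hmain : ∑ q ∈ S ×ˢ range (2 * H + 1),
      ‖Ft ((q.1.2 : ℝ) / q.1.1 + ((q.2 : ℝ) - H) / L)‖ ^ 2 ≤ 4 * (L * Z N X) := by
    rw [sum_congr rfl hval, ← sum_image (f := fun k : ℕ => ‖Ft ((k : ℝ) / L)‖ ^ 2) hinj]
    refine (sum_le_sum_of_subset_of_nonneg ?_ fun _ _ _ => by positivity).trans hms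
    intro k hk
    obtain ⟨q, _, rfl⟩ := mem_image.1 hk
    rw [mem_range]
    have := Int.emod_lt_of_pos (((L / q.1.1 * q.1.2 : ℕ) : ℤ) + q.2 - H) hLz
    rw [← hκ0] at this; exact_mod_cast this
  rw [sum_sigma']
  calc _ ≤ ∑ x ∈ S, 1 / J * ∑ m ∈ range (2 * H + 1),
        ‖Ft ((x.2 : ℝ) / x.1 + ((m : ℝ) - H) / L)‖ ^ 2 := sum_le_sum fun x _ => hcs _
    _ = 1 / J * ∑ q ∈ S ×ˢ range (2 * H + 1),
        ‖Ft ((q.1.2 : ℝ) / q.1.1 + ((q.2 : ℝ) - H) / L)‖ ^ 2 := by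
        rw [← mul_sum, sum_product]
    _ ≤ 1 / J * (4 * (L * Z N X)) := by gcongr
    _ ≤ 1 / (2 * H) * (4 * (L * Z N X)) := by
        have : 2 * (H : ℝ) ≤ J := by rw [hJ]; linarith
        gcongr
    _ = _ := by
        have hLe : (L : ℝ) = 4 * ((R : ℝ) ^ 2 + 3 * X) * H := by rw [hL, hA]; push_cast; ring
        rw [hLe]; field_simp; ring

lemma sum_range_eq_sum_star {M : Type*} [AddCommMonoid M] (g : ℕ → ℕ → M)
    (hg : ∀ k q b, 0 < k → 0 < q → g (k * q) (k * b) = g q b) {q : ℕ} (hq : 0 < q) :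
    ∑ b ∈ range q, g q b = ∑ r ∈ q.divisors, ∑ b ∈ star r, g r b := by
  have hmap : ∀ b ∈ range q, q / b.gcd q ∈ q.divisors := fun b _ =>
    Nat.mem_divisors.2 ⟨Nat.div_dvd_of_dvd (Nat.gcd_dvd_right b q), hq.ne'⟩
  rw [← sum_fiberwise_of_maps_to hmap]
  refine sum_congr rfl fun r hr => ?_
  obtain ⟨hrd, -⟩ := Nat.mem_divisors.1 hr
  obtain ⟨k, hk⟩ := hrd
  have hr0 : 0 < r := Nat.pos_of_ne_zero fun h => by rw [h, zero_mul] at hk; omega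
  have hk0 : 0 < k := Nat.pos_of_ne_zero fun h => by rw [h, mul_zero] at hk; omega
  symm
  refine sum_nbij (fun b => k * b) ?_ ?_ ?_ ?_
  · intro b hb
    obtain ⟨hb1, hb2⟩ := mem_filter.1 hb
    rw [mem_range] at hb1
    rw [mem_filter, mem_range, hk]
    constructor
    · rw [mul_comm r]; exact Nat.mul_lt_mul_of_pos_left hb1 hk0
    · rw [mul_comm r k, Nat.gcd_mul_left, Nat.Coprime.gcd_eq_one hb2, mul_one,
        Nat.mul_div_cancel_left r hk0]
  · intro a _ b _ h
    exact Nat.eq_of_mul_eq_mul_left hk0 h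
  · intro b hb
    obtain ⟨hb1, hb2⟩ := mem_filter.1 (mem_coe.1 hb)
    rw [mem_range] at hb1
    have hg' : b.gcd q = k := by
      have h1 := Nat.div_mul_cancel (Nat.gcd_dvd_right b q)
      rw [hb2] at h1
      have : r * b.gcd q = r * k := by rw [h1, hk]
      exact Nat.eq_of_mul_eq_mul_left hr0 this
    obtain ⟨b', hb'⟩ : k ∣ b := hg' ▸ Nat.gcd_dvd_left b q
    refine ⟨b', ?_, hb'.symm⟩
    rw [mem_coe, star, mem_filter, mem_range]
    subst hb'
    rw [hk, mul_comm r k] at hb1 hg'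
    refine ⟨Nat.lt_of_mul_lt_mul_left hb1, ?_⟩
    rw [Nat.gcd_mul_left] at hg'
    exact Nat.eq_of_mul_eq_mul_left hk0 (by rw [hg', mul_one])
  · intro b _
    rw [hk, mul_comm r k, hg k r b hk0 hr0]

lemma sum_range_mul_of_periodic {M : Type*} [AddCommMonoid M] (f : ℕ → M) (q : ℕ)
    (hf : ∀ n, f (n + q) = f n) (k : ℕ) :
    ∑ u ∈ range (k * q), f u = k • ∑ u ∈ range q, f u := by
  have hf' : ∀ k n, f (k * q + n) = f n := by
    intro k; induction k with
    | zero => intro n; simp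
    | succ k ih => intro n; rw [add_mul, one_mul, add_right_comm, hf, ih]
  induction k with
  | zero => simp
  | succ k ih =>
    rw [add_mul, one_mul, sum_range_add, ih, add_smul, one_smul]
    simp_rw [hf']

/-- The normalized cubic Gauss sum. -/
noncomputable def gs (q b : ℕ) : ℂ := (1 / q : ℝ) * ∑ u ∈ range q, ex (b * u ^ 3 / q)

lemma gs_mul (k q b : ℕ) (hk : 0 < k) (hq : 0 < q) : gs (k * q) (k * b) = gs q b := by
  have hk' : (k : ℝ) ≠ 0 := by positivity
  have hq' : (q : ℝ) ≠ 0 := by positivity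
  unfold gs
  have h1 : ∀ u : ℕ, ex (((k * b : ℕ) : ℝ) * u ^ 3 / ((k * q : ℕ) : ℝ)) = ex (b * u ^ 3 / q) := by
    intro u; congr 1; push_cast; field_simp
  simp_rw [h1]
  rw [sum_range_mul_of_periodic (fun u : ℕ => ex (b * u ^ 3 / q)) q, nsmul_eq_mul]
  · push_cast
    have : (k : ℂ) ≠ 0 := by exact_mod_cast hk.ne'
    field_simp
  · intro n
    have : (b : ℝ) * ((n + q : ℕ) : ℝ) ^ 3 / q =
        b * n ^ 3 / q + ((b * (3 * n ^ 2 + 3 * n * q + q ^ 2) : ℤ) : ℝ) := by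
      push_cast; field_simp; ring
    simp only [this, ex_add_int]

lemma F_mul (N X k q b : ℕ) (hk : 0 < k) :
    F N X (((k * b : ℕ) : ℝ) / ((k * q : ℕ) : ℝ)) = F N X (b / q) := by
  congr 1; push_cast
  have hk' : (k : ℝ) ≠ 0 := by positivity
  rw [mul_div_mul_left _ _ hk']

/-- Star sum of `|F|²`. -/
noncomputable def fr (N X r : ℕ) : ℝ := ∑ b ∈ star r, ‖F N X (b / r)‖ ^ 2

/-- Star sum of the squared main term. -/
noncomputable def mr (μ : ℝ) (r : ℕ) : ℝ := ∑ b ∈ star r, ‖(μ : ℂ) * gs r b ^ 2‖ ^ 2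

/-- Star sum of the squared error term. -/
noncomputable def vr (N X : ℕ) (μ : ℝ) (r : ℕ) : ℝ :=
  ∑ b ∈ star r, ‖F N X (b / r) - μ * gs r b ^ 2‖ ^ 2

lemma fr_nonneg (N X r : ℕ) : 0 ≤ fr N X r := sum_nonneg fun _ _ => by positivity
lemma mr_nonneg (μ : ℝ) (r : ℕ) : 0 ≤ mr μ r := sum_nonneg fun _ _ => by positivity
lemma vr_nonneg (N X : ℕ) (μ : ℝ) (r : ℕ) : 0 ≤ vr N X μ r := sum_nonneg fun _ _ => by positivity

/-- Count of sums of two cubes in a residue class. -/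
noncomputable def Rc (N X q a : ℕ) : ℕ := ((Om N X).filter fun p => cub p % q = a % q).card

/-- Count of residue pairs with given sum of cubes. -/
noncomputable def rho (q a : ℕ) : ℕ :=
  ((range q ×ˢ range q).filter fun p => cub p % q = a % q).card

/-- The variance in a fixed modulus. -/
noncomputable def Vq (N X : ℕ) (μ : ℝ) (q : ℕ) : ℝ :=
  ∑ a ∈ range q, ((Rc N X q a : ℝ) - rho q a / (q : ℝ) ^ 2 * μ) ^ 2

lemma ex_mod (q b n : ℕ) (hq : 0 < q) : ex (b * (n % q : ℕ) / q) = ex (b * n / q) := by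
  have hq' : (q : ℝ) ≠ 0 := by positivity
  obtain ⟨k, hk⟩ : ∃ k : ℕ, n = n % q + q * k := ⟨n / q, (Nat.mod_add_div n q).symm⟩
  have h : (n : ℝ) = (n % q : ℕ) + q * k := by exact_mod_cast hk
  have : (b : ℝ) * n / q = b * (n % q : ℕ) / q + ((b * k : ℤ) : ℝ) := by
    rw [h]
    push_cast; field_simp
  rw [this, ex_add_int]

lemma sum_ex_fiber {s : Finset (ℕ × ℕ)} {q : ℕ} (hq : 0 < q) (b : ℕ) :
    ∑ a ∈ range q, ((s.filter fun p => cub p % q = a % q).card : ℂ) * ex (b * a / q) =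
      ∑ p ∈ s, ex (b * cub p / q) := by
  have hmap : ∀ p ∈ s, cub p % q ∈ range q := fun p _ => mem_range.2 (Nat.mod_lt _ hq)
  rw [← sum_fiberwise_of_maps_to hmap]
  refine sum_congr rfl fun a ha => ?_
  have ha' : a % q = a := Nat.mod_eq_of_lt (mem_range.1 ha)
  rw [ha']
  rw [sum_congr rfl (g := fun _ => ex (b * a / q))]
  · rw [sum_const, nsmul_eq_mul]
  · intro p hp
    rw [← ex_mod q b (cub p) hq, (mem_filter.1 hp).2]

lemma parseval (q : ℕ) (hq : 0 < q) (g : ℕ → ℝ) :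
    ∑ b ∈ range q, ‖∑ a ∈ range q, (g a : ℂ) * ex (b * a / q)‖ ^ 2 =
      q * ∑ a ∈ range q, g a ^ 2 := by
  have h1 : ((∑ b ∈ range q, ‖∑ a ∈ range q, (g a : ℂ) * ex (b * a / q)‖ ^ 2 : ℝ) : ℂ) =
      ((q * ∑ a ∈ range q, g a ^ 2 : ℝ) : ℂ) := by
    push_cast
    simp_rw [← Complex.mul_conj', map_sum, sum_mul_sum]
    rw [sum_comm, mul_sum]
    refine sum_congr rfl fun a ha => ?_
    rw [sum_comm]
    have h2 : ∀ a' ∈ range q, ∑ b ∈ range q, (g a : ℂ) * ex (b * a / q) *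
        (starRingEnd ℂ) ((g a' : ℂ) * ex (b * a' / q)) =
        if a' = a then (g a : ℂ) * g a' * q else 0 := by
      intro a' ha'
      have h3 : ∀ b : ℕ, (g a : ℂ) * ex (b * a / q) *
        (starRingEnd ℂ) ((g a' : ℂ) * ex (b * a' / q)) =
          (g a : ℂ) * g a' * ex (b * ((a : ℤ) - a' : ℤ) / q) := by
        intro b
        rw [map_mul, Complex.conj_ofReal, show (b : ℝ) * (((a : ℤ) - a' : ℤ) : ℝ) / q =
          b * a / q - b * a' / q by push_cast; ring, ex_sub]
        ring
      simp_rw [h3]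
      rw [← mul_sum, sum_ex_orth q hq]
      have ha := mem_range.1 ha
      have ha' := mem_range.1 ha'
      have : (q : ℤ) ∣ (a : ℤ) - a' ↔ a' = a := by
        constructor
        · intro h
          have := Int.eq_zero_of_abs_lt_dvd h (by rw [abs_lt]; constructor <;> omega)
          omega
        · rintro rfl; simp
      simp only [this]
      split_ifs <;> simp
    rw [sum_congr rfl h2, sum_ite_eq', if_pos ha]; ring
  exact_mod_cast h1

lemma Vq_eq (N X : ℕ) (μ : ℝ) {q : ℕ} (hq : 0 < q) :
    Vq N X μ q = 1 / q * ∑ r ∈ q.divisors, vr N X μ r := by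
  have hq' : (q : ℝ) ≠ 0 := by positivity
  have hqc : (q : ℂ) ≠ 0 := by exact_mod_cast hq.ne'
  have h1 := parseval q hq fun a => (Rc N X q a : ℝ) - rho q a / (q : ℝ) ^ 2 * μ
  have h2 : ∀ b ∈ range q, ‖∑ a ∈ range q, (((Rc N X q a : ℝ) - rho q a / (q : ℝ) ^ 2 * μ : ℝ) : ℂ) *
      ex (b * a / q)‖ ^ 2 = ‖F N X (b / q) - μ * gs q b ^ 2‖ ^ 2 := by
    intro b _
    have e1 := sum_ex_fiber (s := Om N X) hq b
    have e2 := sum_ex_fiber (s := range q ×ˢ range q) hq b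
    have e3 : ∑ p ∈ range q ×ˢ range q, ex (b * cub p / q) =
        (∑ u ∈ range q, ex (b * u ^ 3 / q)) ^ 2 := by
      rw [sq, sum_mul_sum, sum_product]
      refine sum_congr rfl fun u _ => sum_congr rfl fun v _ => ?_
      rw [← ex_add, cub]; congr 1; push_cast; ring
    have e4 : F N X (b / q) = ∑ p ∈ Om N X, ex (b * cub p / q) := by
      rw [F]; refine sum_congr rfl fun p _ => ?_
      congr 1; ring
    rw [e4, gs, ← e1, mul_pow, ← e3, ← e2, mul_sum, mul_sum, ← sum_sub_distrib]
    congr 2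
    refine sum_congr rfl fun a _ => ?_
    rw [Rc, rho]; push_cast; field_simp
  rw [sum_congr rfl h2, sum_range_eq_sum_star
    (fun q b => ‖F N X (b / q) - μ * gs q b ^ 2‖ ^ 2) ?_ hq] at h1
  · rw [Vq]
    have : ∑ r ∈ q.divisors, vr N X μ r = q *
      ∑ a ∈ range q, ((Rc N X q a : ℝ) - rho q a / (q : ℝ) ^ 2 * μ) ^ 2 := h1
    rw [this, ← mul_assoc, one_div_mul_cancel hq', one_mul]
  · intro k q b hk hq
    rw [F_mul N X k q b hk, gs_mul k q b hk hq]

lemma Vq_nonneg (N X : ℕ) (μ : ℝ) (q : ℕ) : 0 ≤ Vq N X μ q := sum_nonneg fun _ _ => sq_nonneg _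

/-- Ramanujan sums. -/
noncomputable def Ram (r : ℕ) (h : ℤ) : ℝ := ∑ b ∈ star r, Real.cos (2 * Real.pi * (b * h / r))

lemma sum_Ram {k : ℕ} (hk : 0 < k) (h : ℤ) :
    ∑ r ∈ k.divisors, Ram r h = if (k : ℤ) ∣ h then (k : ℝ) else 0 := by
  have h1 := sum_range_eq_sum_star (fun q b => Real.cos (2 * Real.pi * ((b : ℝ) * h / q))) ?_ hk
  · have h2 := congrArg Complex.re (sum_ex_orth k hk h)
    rw [Complex.re_sum] at h2
    simp_rw [re_ex] at h2
    unfold Ram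
    rw [← h1, h2]
    split_ifs <;> simp
  · intro k q b hk hq
    have hk' : (k : ℝ) ≠ 0 := by positivity
    congr 2; push_cast; rw [mul_assoc, mul_div_mul_left _ _ hk']

lemma abs_Ram_le {r : ℕ} (hr : 0 < r) (h : ℤ) :
    |Ram r h| ≤ ∑ d ∈ r.divisors, if (d : ℤ) ∣ h then (d : ℝ) else 0 := by
  have h1 := (ArithmeticFunction.sum_eq_iff_sum_mul_moebius_eq (R := ℝ)
    (f := fun r => Ram r h) (g := fun k => if (k : ℤ) ∣ h then (k : ℝ) else 0)).1
    (fun k hk => sum_Ram hk h) r hr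
  rw [← h1, Nat.sum_divisorsAntidiagonal' (fun a b =>
    ((ArithmeticFunction.moebius a : ℤ) : ℝ) * if (b : ℤ) ∣ h then (b : ℝ) else 0)]
  refine (abs_sum_le_sum_abs _ _).trans (sum_le_sum fun d _ => ?_)
  rw [abs_mul]
  have h2 : |((ArithmeticFunction.moebius (r / d) : ℤ) : ℝ)| ≤ 1 := by
    exact_mod_cast ArithmeticFunction.abs_moebius_le_one
  have h3 : |if (d : ℤ) ∣ h then (d : ℝ) else 0| = if (d : ℤ) ∣ h then (d : ℝ) else 0 := by
    apply abs_of_nonneg; split_ifs <;> simp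
  rw [h3]
  exact mul_le_of_le_one_left (by split_ifs <;> simp) h2

lemma fr_eq_sum_Ram (N X r : ℕ) :
    fr N X r = ∑ p ∈ Om N X, ∑ p' ∈ Om N X, Ram r ((cub p : ℤ) - cub p') := by
  unfold fr Ram
  simp_rw [F, normSq_sum_ex]
  rw [sum_comm]
  refine sum_congr rfl fun p _ => ?_
  rw [sum_comm]
  refine sum_congr rfl fun p' _ => sum_congr rfl fun b _ => ?_
  congr 1; push_cast; ring

lemma vr_le (N X : ℕ) (μ : ℝ) (r : ℕ) : vr N X μ r ≤ 2 * fr N X r + 2 * mr μ r := by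
  unfold vr fr mr
  rw [mul_sum, mul_sum, ← sum_add_distrib]
  refine sum_le_sum fun b _ => ?_
  have := norm_sub_le (F N X (b / r)) (μ * gs r b ^ 2)
  have h0 := norm_nonneg (F N X (b / r) - μ * gs r b ^ 2)
  nlinarith [sq_nonneg (‖F N X (b / r)‖ - ‖(μ : ℂ) * gs r b ^ 2‖)]

lemma abs_vr_sub_fr_le (N X : ℕ) (μ : ℝ) (r : ℕ) {θ : ℝ} (hθ : 0 < θ) :
    |vr N X μ r - fr N X r| ≤ θ * fr N X r + (1 + 1 / θ) * mr μ r := by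
  unfold vr fr mr
  rw [← sum_sub_distrib, mul_sum, mul_sum, ← sum_add_distrib]
  refine (abs_sum_le_sum_abs _ _).trans (sum_le_sum fun b _ => ?_)
  set z := F N X (b / r)
  set w := (μ : ℂ) * gs r b ^ 2
  have h1 : |‖z - w‖ - ‖z‖| ≤ ‖w‖ := by
    have := abs_norm_sub_norm_le (z - w) z
    simpa using this
  have h2 : |‖z - w‖ ^ 2 - ‖z‖ ^ 2| ≤ 2 * ‖z‖ * ‖w‖ + ‖w‖ ^ 2 := by
    rw [abs_le] at h1 ⊢
    have a1 := norm_nonneg z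
    have a2 := norm_nonneg w
    have a3 := norm_nonneg (z - w)
    constructor <;> nlinarith
  refine h2.trans ?_
  have h3 : 2 * ‖z‖ * ‖w‖ ≤ θ * ‖z‖ ^ 2 + 1 / θ * ‖w‖ ^ 2 := by
    have e : θ * ‖z‖ ^ 2 + 1 / θ * ‖w‖ ^ 2 - 2 * ‖z‖ * ‖w‖ = (θ * ‖z‖ - ‖w‖) ^ 2 / θ := by
      field_simp; ring
    have : 0 ≤ (θ * ‖z‖ - ‖w‖) ^ 2 / θ := by positivity
    linarith
  linarith

lemma mr_le {B r : ℕ} {T : ℝ} (μ : ℝ) (hT : Dom B T) (hr : 0 < r) (hB : 6 * r ^ 2 ≤ B) :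
    mr μ r / r ≤ 43 * μ ^ 2 * T / √r * (Nc r / (r : ℝ) ^ 2) := by
  have hr' : (0 : ℝ) < r := by exact_mod_cast hr
  have hT1 := hT.one_le
  have hrB : r ≤ B := by nlinarith
  set g : ℕ → ℂ := fun b => ∑ u ∈ range r, ex (b * u ^ 3 / r) with hg
  have h1 : ∀ b ∈ star r, ‖g b‖ ^ 2 ≤ 43 * T * r * √r := by
    intro b hb
    have hcop : IsCoprime (b : ℤ) (r : ℤ) := Nat.isCoprime_iff_coprime.2 (mem_filter.1 hb).2
    have h := weyl_cubic (N := r) (α := (b : ℝ) / r) hr hcop (by simp) hT hB hrB 0 0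
    have e : ∑ v ∈ range r, ex ((b : ℝ) / r * (v : ℝ) ^ 3 + 0 * (v : ℝ) ^ 2 + 0 * v) = g b := by
      refine sum_congr rfl fun v _ => ?_
      congr 1; ring
    rw [e] at h
    have h2 : ‖g b‖ ^ 4 ≤ 1800 * T ^ 2 * (r : ℝ) ^ 3 := by
      refine h.trans ?_
      have : (r : ℝ) ^ 4 / r + (r : ℝ) ^ 3 + r * r ≤ 3 * (r : ℝ) ^ 3 := by
        have h1r : (1 : ℝ) ≤ r := by exact_mod_cast hr
        have e : (r : ℝ) ^ 4 / r = (r : ℝ) ^ 3 := by field_simp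
        rw [e]; nlinarith [mul_le_mul_of_nonneg_left h1r (sq_nonneg (r : ℝ))]
      nlinarith [mul_le_mul_of_nonneg_left this (by positivity : (0 : ℝ) ≤ 600 * T ^ 2)]
    have h3 : (‖g b‖ ^ 2) ^ 2 ≤ (43 * T * r * √r) ^ 2 := by
      have : (43 * T * r * √r) ^ 2 = 1849 * T ^ 2 * (r : ℝ) ^ 3 := by
        rw [mul_pow, Real.sq_sqrt hr'.le]; ring
      rw [this, ← pow_mul]
      refine h2.trans ?_
      gcongr; norm_num
    exact le_of_sq_le_sq h3 (by positivity)
  have h4 : ∑ b ∈ range r, ‖g b‖ ^ 2 ≤ r * Nc r := by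
    have := meanSq (range r) (fun _ => (1 : ℂ)) (fun u => (u : ℤ) ^ 3) (lam := 1) (by simp) hr
    simpa [Nc, hg] using this
  have h5 : mr μ r ≤ μ ^ 2 / (r : ℝ) ^ 4 * (43 * T * r * √r * (r * Nc r)) := by
    have : mr μ r = μ ^ 2 / (r : ℝ) ^ 4 * ∑ b ∈ star r, ‖g b‖ ^ 2 * ‖g b‖ ^ 2 := by
      rw [mr, mul_sum]
      refine sum_congr rfl fun b _ => ?_
      rw [norm_mul, norm_pow, gs, norm_mul, Complex.norm_real, Complex.norm_real]
      have : ‖(1 / r : ℝ)‖ = 1 / r := Real.norm_of_nonneg (by positivity)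
      rw [this, mul_pow, Real.norm_eq_abs, sq_abs]; simp only [hg]; field_simp
    rw [this]
    refine mul_le_mul_of_nonneg_left ?_ (by positivity)
    calc _ ≤ ∑ b ∈ star r, 43 * T * r * √r * ‖g b‖ ^ 2 :=
          sum_le_sum fun b hb => mul_le_mul_of_nonneg_right (h1 b hb) (by positivity)
      _ = 43 * T * r * √r * ∑ b ∈ star r, ‖g b‖ ^ 2 := by rw [mul_sum]
      _ ≤ _ := by
        refine mul_le_mul_of_nonneg_left (le_trans ?_ h4) (by positivity)
        exact sum_le_sum_of_subset_of_nonneg (star_subset r) fun _ _ _ => by positivity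
  calc mr μ r / r ≤ μ ^ 2 / (r : ℝ) ^ 4 * (43 * T * r * √r * (r * Nc r)) / r := by gcongr
    _ = 43 * μ ^ 2 * T / √r * (Nc r / (r : ℝ) ^ 2) := by
      have hs : √(r : ℝ) ^ 2 = r := Real.sq_sqrt hr'.le
      have hs' : √(r : ℝ) ≠ 0 := by positivity
      field_simp
      rw [hs]

lemma sum_mr_le {B R1 R : ℕ} {T : ℝ} (μ : ℝ) (hT : Dom B T) (hR1 : 0 < R1) (hB : 6 * R ^ 3 ≤ B) :
    ∑ r ∈ Ioc R1 R, mr μ r / r ≤ 129 * μ ^ 2 * T ^ 3 / √R1 := by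
  have hT1 := hT.one_le
  have hR1' : (0 : ℝ) < R1 := by exact_mod_cast hR1
  calc _ ≤ ∑ r ∈ Ioc R1 R, 43 * μ ^ 2 * T / √R1 * (Nc r / (r : ℝ) ^ 2) := by
        refine sum_le_sum fun r hr => ?_
        rw [mem_Ioc] at hr
        refine (mr_le μ hT (by omega) ?_).trans ?_
        · calc 6 * r ^ 2 ≤ 6 * R ^ 2 := by gcongr; exact hr.2
            _ ≤ 6 * R ^ 3 := by
              have : 1 ≤ R := by omega
              gcongr; omega
            _ ≤ B := hB
        · have : (R1 : ℝ) ≤ r := by exact_mod_cast hr.1.le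
          gcongr
    _ = 43 * μ ^ 2 * T / √R1 * ∑ r ∈ Ioc R1 R, (Nc r / (r : ℝ) ^ 2) := by rw [mul_sum]
    _ ≤ 43 * μ ^ 2 * T / √R1 * (3 * T ^ 2) := by
      refine mul_le_mul_of_nonneg_left (le_trans ?_ (sum_Nc_le hT (by nlinarith : R ^ 3 ≤ B)))
        (by positivity)
      refine sum_le_sum_of_subset_of_nonneg ?_ fun _ _ _ => by positivity
      intro r hr
      rw [mem_Ioc] at hr; rw [mem_Icc]; omega
    _ = _ := by ring

lemma le_Nr {N r : ℕ} : N ≤ Nr N r := by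
  unfold Nr
  calc N = ((Icc 1 N).image fun u => (u, u)).card := by
        rw [card_image_of_injective _ (fun a b h => by simpa using h), Nat.card_Icc]; omega
    _ ≤ _ := by
      refine card_le_card fun p hp => ?_
      rw [mem_image] at hp
      obtain ⟨u, hu, rfl⟩ := hp
      rw [mem_filter, mem_product]
      exact ⟨⟨hu, hu⟩, by simp⟩

lemma sum_weight_Nr_le {B N R1 R : ℕ} {T : ℝ} (hT : Dom B T) (hN : N ^ 3 ≤ B) (w : ℕ → ℝ) {W : ℝ}
    (hW : 0 ≤ W) (hw : ∀ r ∈ Ioc R1 R, w r ≤ W) :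
    ∑ r ∈ Ioc R1 R, w r * Nr N r ≤ N * ∑ r ∈ Ioc R1 R, w r + W * (N ^ 2 * T) := by
  have h1 : ∑ r ∈ Icc 1 R, ((Nr N r : ℝ) - N) ≤ N ^ 2 * T := by
    rw [sum_sub_distrib, sum_const, Nat.card_Icc, nsmul_eq_mul]
    have := sum_Nr_le (R := R) hT hN
    have e : ((R + 1 - 1 : ℕ) : ℝ) = R := by simp
    rw [e]; linarith
  have h0 : ∀ r, (0 : ℝ) ≤ (Nr N r : ℝ) - N := fun r => sub_nonneg.2 (by exact_mod_cast le_Nr)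
  calc ∑ r ∈ Ioc R1 R, w r * Nr N r
      = N * ∑ r ∈ Ioc R1 R, w r + ∑ r ∈ Ioc R1 R, w r * ((Nr N r : ℝ) - N) := by
        rw [mul_sum, ← sum_add_distrib]; exact sum_congr rfl fun r _ => by ring
    _ ≤ N * ∑ r ∈ Ioc R1 R, w r + ∑ r ∈ Ioc R1 R, W * ((Nr N r : ℝ) - N) := by
        gcongr with r hr
        · exact h0 r
        · exact hw r hr
    _ ≤ N * ∑ r ∈ Ioc R1 R, w r + ∑ r ∈ Icc 1 R, W * ((Nr N r : ℝ) - N) := by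
        refine add_le_add le_rfl
          (sum_le_sum_of_subset_of_nonneg ?_ fun r _ _ => mul_nonneg hW (h0 r))
        intro r hr
        rw [mem_Ioc] at hr; rw [mem_Icc]; omega
    _ ≤ _ := by
        rw [← mul_sum]; gcongr

/-- The parameters of the argument: `S` is the fourth root of `N`. -/
structure Par (N X R1 K1 B : ℕ) (S T μ : ℝ) : Prop where
  S4 : S ^ 4 = N
  hS : 2 ≤ S
  R1_le : (R1 : ℝ) ≤ S ^ 2
  R1_ge : S ^ 2 / 2 ≤ R1
  K1_le : (K1 : ℝ) ≤ S ^ 5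
  K1_ge : S ^ 5 / 2 ≤ K1
  le_X : N ^ 3 ≤ X
  X_lt : X < (N + 1) ^ 3
  dom : Dom B T
  big : 10 ^ 4 * N ^ 10 ≤ B
  mu_nonneg : 0 ≤ μ
  mu_le : μ ≤ 4 * S ^ 8
  om : |((Om N X).card : ℝ) - μ| ≤ 6 * N

/-- The weight from the fourth moment Weyl bound. -/
noncomputable def Ew (N r : ℕ) : ℝ := √((N : ℝ) ^ 4 / r + (N : ℝ) ^ 3 + N * r)

section
variable {N X R1 K1 B : ℕ} {S T μ : ℝ}

lemma Par.N_ge (h : Par N X R1 K1 B S T μ) : 16 ≤ N := by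
  have h1 := h.hS
  have : (16 : ℝ) ≤ N := by
    rw [← h.S4]
    calc (16 : ℝ) = 2 ^ 4 := by norm_num
      _ ≤ S ^ 4 := by gcongr
  exact_mod_cast this

lemma Par.S_pos (h : Par N X R1 K1 B S T μ) : 0 < S := by linarith [h.hS]

lemma Par.R1_pos (h : Par N X R1 K1 B S T μ) : 0 < R1 := by
  have h1 := h.hS
  have h2 := h.R1_ge
  have : (0 : ℝ) < R1 := by nlinarith
  exact_mod_cast this

lemma Par.K1_pos (h : Par N X R1 K1 B S T μ) : 0 < K1 := by
  have h1 := h.S_pos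
  have h2 := h.K1_ge
  have : (0 : ℝ) < K1 := lt_of_lt_of_le (by positivity) h2
  exact_mod_cast this

lemma Par.K1_le_sq (h : Par N X R1 K1 B S T μ) : K1 ≤ N ^ 2 := by
  have h1 := h.hS
  have : (K1 : ℝ) ≤ (N : ℝ) ^ 2 := by
    refine h.K1_le.trans ?_
    rw [← h.S4, ← pow_mul]
    exact pow_le_pow_right₀ (by linarith) (by norm_num)
  exact_mod_cast this

lemma Par.big_of (h : Par N X R1 K1 B S T μ) {c k : ℕ} (hc : c ≤ 10 ^ 4) (hk : k ≤ 10) :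
    c * N ^ k ≤ B :=
  (Nat.mul_le_mul hc (Nat.pow_le_pow_right (by have := h.N_ge; omega) hk)).trans h.big

lemma Par.X_le (h : Par N X R1 K1 B S T μ) : X ≤ 2 * N ^ 3 := by
  have h1 := h.N_ge
  have h2 := h.X_lt
  have : (N + 1) ^ 3 ≤ 2 * N ^ 3 := by nlinarith [mul_le_mul h1 h1 (by norm_num) (by omega), mul_le_mul_of_nonneg_left h1 (Nat.zero_le (N^2))]
  omega

lemma Ew_le (h : Par N X R1 K1 B S T μ) {r : ℕ} (hr : 0 < r) (hr2 : r ≤ K1) :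
    Ew N r ≤ S ^ 8 / √r + 2 * S ^ 6 := by
  have hr' : (0 : ℝ) < r := by exact_mod_cast hr
  have hS := h.hS
  have hSp := h.S_pos
  refine Real.sqrt_le_iff.2 ⟨by positivity, ?_⟩
  have e : (S ^ 8 / √r + 2 * S ^ 6) ^ 2 = S ^ 16 / r + 4 * S ^ 14 / √r + 4 * S ^ 12 := by
    have hs : √(r : ℝ) ^ 2 = r := Real.sq_sqrt hr'.le
    have : (S ^ 8 / √r) ^ 2 = S ^ 16 / r := by rw [div_pow, hs]; ring
    rw [add_sq, this]; ring
  rw [e, ← h.S4]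
  have h1 : S ^ 4 * (r : ℝ) ≤ S ^ 12 := by
    have : (r : ℝ) ≤ S ^ 5 := le_trans (by exact_mod_cast hr2) h.K1_le
    calc S ^ 4 * (r : ℝ) ≤ S ^ 4 * S ^ 5 := by gcongr
      _ = S ^ 9 := by ring
      _ ≤ S ^ 12 := pow_le_pow_right₀ (by linarith) (by norm_num)
  have h2 : 0 ≤ 4 * S ^ 14 / √r := by positivity
  have h3 : 0 ≤ S ^ 12 := by positivity
  have e2 : (S ^ 4) ^ 4 = S ^ 16 := by ring
  have e3 : (S ^ 4) ^ 3 = S ^ 12 := by ring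
  rw [e2, e3]; linarith

lemma sum_inv_sqrt_le (R : ℕ) : ∑ r ∈ Icc 1 R, 1 / √(r : ℝ) ≤ 2 * √R := by
  induction R with
  | zero => simp
  | succ n ih =>
    rw [sum_Icc_succ_top (by omega)]
    have h1 : √(n : ℝ) ^ 2 = n := Real.sq_sqrt (by positivity)
    have h2 : √((n + 1 : ℕ) : ℝ) ^ 2 = n + 1 := by rw [Real.sq_sqrt (by positivity)]; push_cast; ring
    have h3 : 0 < √((n + 1 : ℕ) : ℝ) := by positivity
    have h4 : 0 ≤ √(n : ℝ) := by positivity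
    have h5 : 1 / √((n + 1 : ℕ) : ℝ) ≤ 2 * √((n + 1 : ℕ) : ℝ) - 2 * √(n : ℝ) := by
      rw [div_le_iff₀ h3]
      nlinarith [sq_nonneg (√((n + 1 : ℕ) : ℝ) - √(n : ℝ))]
    linarith

lemma sum_Ew_Nr_le (h : Par N X R1 K1 B S T μ) :
    ∑ r ∈ Ioc R1 K1, Ew N r * Nr N r ≤ 8 * T * S ^ 15 := by
  have hS := h.hS
  have hSp := h.S_pos
  have hT := h.dom.one_le
  have hR1 := h.R1_pos
  have hN3 : N ^ 3 ≤ B := by simpa using h.big_of (c := 1) (k := 3) (by norm_num) (by norm_num)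
  have hW : ∀ r ∈ Ioc R1 K1, Ew N r ≤ 4 * S ^ 7 := by
    intro r hr
    rw [mem_Ioc] at hr
    refine (Ew_le h (by omega) hr.2).trans ?_
    have h1 : S / 2 ≤ √(r : ℝ) := by
      refine Real.le_sqrt_of_sq_le ?_
      have h2 : (R1 : ℝ) ≤ r := by exact_mod_cast hr.1.le
      have := h.R1_ge
      nlinarith
    have h2 : S ^ 8 / √r ≤ S ^ 8 / (S / 2) := by gcongr
    have h3 : S ^ 8 / (S / 2) = 2 * S ^ 7 := by field_simp
    have h4 : S ^ 6 ≤ S ^ 7 := pow_le_pow_right₀ (by linarith) (by norm_num)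
    linarith
  refine (sum_weight_Nr_le h.dom hN3 (Ew N) (by positivity) hW).trans ?_
  have h5 : ∑ r ∈ Ioc R1 K1, Ew N r ≤ 4 * S ^ 11 := by
    calc ∑ r ∈ Ioc R1 K1, Ew N r ≤ ∑ r ∈ Icc 1 K1, (S ^ 8 * (1 / √r) + 2 * S ^ 6) := by
          refine (sum_le_sum fun r hr => ?_).trans (sum_le_sum_of_subset_of_nonneg
            (s := Ioc R1 K1) ?_ fun r _ _ => by positivity)
          · rw [mem_Ioc] at hr
            refine (Ew_le h (by omega) hr.2).trans (le_of_eq (by ring))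
          · intro r hr
            rw [mem_Ioc] at hr; rw [mem_Icc]; omega
      _ = S ^ 8 * ∑ r ∈ Icc 1 K1, 1 / √(r : ℝ) + K1 * (2 * S ^ 6) := by
          rw [sum_add_distrib, mul_sum, sum_const, Nat.card_Icc]; simp
      _ ≤ S ^ 8 * (2 * S ^ 3) + S ^ 5 * (2 * S ^ 6) := by
          gcongr
          · refine (sum_inv_sqrt_le K1).trans ?_
            gcongr
            refine Real.sqrt_le_iff.2 ⟨by positivity, h.K1_le.trans ?_⟩
            rw [← pow_mul]; exact pow_le_pow_right₀ (by linarith) (by norm_num)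
          · exact h.K1_le
      _ = _ := by ring
  rw [← h.S4]
  calc S ^ 4 * ∑ r ∈ Ioc R1 K1, Ew N r + 4 * S ^ 7 * ((S ^ 4) ^ 2 * T)
      ≤ S ^ 4 * (4 * S ^ 11) + 4 * S ^ 7 * ((S ^ 4) ^ 2 * T) := by gcongr
    _ = 4 * 1 * S ^ 15 + 4 * T * S ^ 15 := by ring
    _ ≤ 4 * T * S ^ 15 + 4 * T * S ^ 15 := by gcongr
    _ = _ := by ring

lemma starMeanSq_le_Ew (h : Par N X R1 K1 B S T μ) {r : ℕ} (hr : 0 < r) (hrK : r ≤ K1) {β : ℝ}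
    (hβ : |β| ≤ 1 / (r : ℝ) ^ 2) :
    (∑ b ∈ star r, ‖F N X (b / r + β)‖ ^ 2) / r ≤ 625 * T ^ 3 * (Ew N r * Nr N r) := by
  have hr' : (0 : ℝ) < r := by exact_mod_cast hr
  have hT := h.dom.one_le
  have hrB : r ≤ B := by
    have := h.big_of (c := 1) (k := 2) (by norm_num) (by norm_num)
    have := h.K1_le_sq; omega
  have h1 := starMeanSq_le (X := X) h.dom (h.big_of (c := 6) (k := 2) (by norm_num) (by norm_num)) hr hrB hβ
  have h2 : √(600 * T ^ 2 * ((N : ℝ) ^ 4 / r + (N : ℝ) ^ 3 + N * r)) ≤ 25 * T * Ew N r := by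
    refine Real.sqrt_le_iff.2 ⟨by unfold Ew; positivity, ?_⟩
    rw [mul_pow, Ew, Real.sq_sqrt (by positivity), mul_pow]
    gcongr; norm_num
  rw [div_le_iff₀ hr']
  calc _ ≤ _ := h1
    _ ≤ 25 * T ^ 2 * (25 * T * Ew N r) * (r * Nr N r) := by gcongr
    _ = _ := by ring

lemma sum_fr_small_le (h : Par N X R1 K1 B S T μ) :
    ∑ r ∈ Ioc R1 K1, fr N X r / r ≤ 5000 * T ^ 4 * S ^ 15 := by
  have hT := h.dom.one_le
  calc _ ≤ ∑ r ∈ Ioc R1 K1, 625 * T ^ 3 * (Ew N r * Nr N r) := by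
        refine sum_le_sum fun r hr => ?_
        rw [mem_Ioc] at hr
        have := starMeanSq_le_Ew h (r := r) (β := 0) (by omega) hr.2 (by simp)
        simpa [fr] using this
    _ = 625 * T ^ 3 * ∑ r ∈ Ioc R1 K1, Ew N r * Nr N r := by rw [mul_sum]
    _ ≤ 625 * T ^ 3 * (8 * T * S ^ 15) := by
        gcongr; exact sum_Ew_Nr_le h
    _ = _ := by ring

lemma sum_mr_large_le (h : Par N X R1 K1 B S T μ) {R : ℕ} (hR : R ≤ 8 * N ^ 3) :
    ∑ r ∈ Ioc R1 R, mr μ r / r ≤ 4128 * T ^ 3 * S ^ 15 := by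
  have hT := h.dom.one_le
  have hSp := h.S_pos
  have hB : 6 * R ^ 3 ≤ B := by
    calc 6 * R ^ 3 ≤ 6 * (8 * N ^ 3) ^ 3 := by gcongr
      _ = 3072 * N ^ 9 := by ring
      _ ≤ B := h.big_of (by norm_num) (by norm_num)
  refine (sum_mr_le μ h.dom h.R1_pos hB).trans ?_
  have h1 : S / 2 ≤ √(R1 : ℝ) := by
    refine Real.le_sqrt_of_sq_le ?_
    have := h.R1_ge
    nlinarith
  have h2 : μ ^ 2 ≤ (4 * S ^ 8) ^ 2 := pow_le_pow_left₀ h.mu_nonneg h.mu_le 2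
  calc 129 * μ ^ 2 * T ^ 3 / √R1 ≤ 129 * (4 * S ^ 8) ^ 2 * T ^ 3 / (S / 2) := by gcongr
    _ = _ := by field_simp; ring

lemma abel_inv {K R : ℕ} (hKR : K ≤ R) (f : ℕ → ℝ) {A D : ℝ}
    (hS : ∀ R, 0 < R → ∑ r ∈ Ioc K R, f r ≤ A * (R : ℝ) ^ 2 + D) (hA : 0 ≤ A) :
    ∑ r ∈ Ioc K R, f r / r ≤ (∑ r ∈ Ioc K R, f r) / (R + 1) + A * R +
      D * (1 / (K + 1) - 1 / (R + 1)) := by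
  induction R, hKR using Nat.le_induction with
  | base => simp; positivity
  | succ R hR ih =>
    rw [sum_Ioc_succ_top hR]
    have h1 := hS (R + 1) (by omega)
    rw [sum_Ioc_succ_top hR] at h1 ⊢
    set s := ∑ r ∈ Ioc K R, f r
    have hR0 : (0 : ℝ) ≤ R := by positivity
    push_cast at h1 ⊢
    have e : s / (R + 1) + f (R + 1) / (R + 1) =
        (s + f (R + 1)) / (R + 1 + 1) + (s + f (R + 1)) / ((R + 1) * (R + 1 + 1)) := by
      field_simp
    have h2 : (s + f (R + 1)) / (((R : ℝ) + 1) * (R + 1 + 1)) ≤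
        (A * ((R : ℝ) + 1) ^ 2 + D) / ((R + 1) * (R + 1 + 1)) := by gcongr
    have h3 : (A * ((R : ℝ) + 1) ^ 2 + D) / ((R + 1) * (R + 1 + 1)) =
        A * ((R + 1) / (R + 1 + 1)) + D * (1 / (R + 1) - 1 / (R + 1 + 1)) := by
      field_simp; ring
    have h4 : A * (((R : ℝ) + 1) / (R + 1 + 1)) ≤ A * 1 := by
      gcongr; rw [div_le_one (by positivity)]; linarith
    nlinarith

lemma sum_fr_large_le {N X K R : ℕ} (hK : 0 < K) :
    ∑ r ∈ Ioc K R, fr N X r / r ≤ 8 * (2 * R + 3 * X * (2 / K)) * Z N X := by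
  rcases le_or_gt R K with hR | hR
  · rw [Ioc_eq_empty (by omega), sum_empty]; positivity
  have hKr : (0 : ℝ) < K := by exact_mod_cast hK
  have hRr : (K : ℝ) < R := by exact_mod_cast hR
  have hS : ∀ R, 0 < R → ∑ r ∈ Ioc K R, fr N X r ≤
      8 * (Z N X : ℝ) * (R : ℝ) ^ 2 + 8 * (3 * X) * Z N X := by
    intro R hR
    have h1 : ∑ r ∈ Ioc K R, fr N X r ≤ ∑ r ∈ Icc 1 R, fr N X r := by
      refine sum_le_sum_of_subset_of_nonneg ?_ fun r _ _ => fr_nonneg _ _ _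
      intro r hr
      rw [mem_Ioc] at hr; rw [mem_Icc]; omega
    have h2 := large_sieve N X R hR
    have h3 : ∑ r ∈ Icc 1 R, fr N X r ≤ 8 * ((R : ℝ) ^ 2 + 3 * X) * Z N X := h2
    nlinarith
  refine (abel_inv hR.le _ hS (by positivity)).trans ?_
  have h4 := hS R (by omega)
  have hZ : (0 : ℝ) ≤ Z N X := by positivity
  have hX : (0 : ℝ) ≤ X := by positivity
  have h5 : (∑ r ∈ Ioc K R, fr N X r) / (R + 1) ≤
      8 * (Z N X : ℝ) * R + 8 * (3 * X) * Z N X * (1 / (R + 1)) := by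
    rw [div_le_iff₀ (by positivity)]
    refine h4.trans ?_
    have : (8 * (Z N X : ℝ) * R + 8 * (3 * X) * Z N X * (1 / (R + 1))) * (R + 1) =
      8 * (Z N X : ℝ) * R ^ 2 + 8 * (Z N X : ℝ) * R + 8 * (3 * X) * Z N X := by
      field_simp
    rw [this]
    have : 0 ≤ 8 * (Z N X : ℝ) * R := by positivity
    linarith
  have h6 : 8 * (3 * X) * (Z N X : ℝ) * (1 / (K + 1)) ≤ 8 * (3 * X) * (Z N X : ℝ) * (2 / K) := by
    gcongr <;> linarith
  have e : 8 * (2 * R + 3 * X * (2 / K)) * (Z N X : ℝ) =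
    16 * R * Z N X + 8 * (3 * X) * (Z N X : ℝ) * (2 / K) := by ring
  rw [e]
  nlinarith

end

lemma integral_betaPDFReal {α β : ℝ} (hα : 0 < α) (hβ : 0 < β) :
    ∫ x, ProbabilityTheory.betaPDFReal α β x = 1 := by
  rw [MeasureTheory.integral_eq_lintegral_of_nonneg_ae]
  · have := ProbabilityTheory.lintegral_betaPDF_eq_one hα hβ
    unfold ProbabilityTheory.betaPDF at this
    rw [this]; simp
  · refine Filter.Eventually.of_forall fun x => ?_
    by_cases h : 0 < x ∧ x < 1
    · exact (ProbabilityTheory.betaPDFReal_pos h.1 h.2 hα hβ).le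
    · simp [ProbabilityTheory.betaPDFReal, h]
  · exact (ProbabilityTheory.measurable_betaPDFReal α β).aestronglyMeasurable

lemma beta_eq : ProbabilityTheory.beta (1 / 3) (4 / 3) = 3 * Ctwocubes := by
  have h : Real.Gamma (4 / 3) = 1 / 3 * Real.Gamma (1 / 3) := by
    rw [← Real.Gamma_add_one (by norm_num)]; norm_num
  rw [ProbabilityTheory.beta, Ctwocubes]
  have : Real.Gamma (1 / 3) = 3 * Real.Gamma (4 / 3) := by linarith
  rw [this]; norm_num; ring

lemma Ctwocubes_pos : 0 < Ctwocubes := by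
  have := Real.Gamma_pos_of_pos (show (0 : ℝ) < 4 / 3 by norm_num)
  have := Real.Gamma_pos_of_pos (show (0 : ℝ) < 5 / 3 by norm_num)
  unfold Ctwocubes; positivity

lemma integral_eq_Ctwocubes : ∫ t in (0 : ℝ)..1, (1 - t ^ 3) ^ ((1 : ℝ) / 3) = Ctwocubes := by
  have hC := Ctwocubes_pos
  have h1 := MeasureTheory.integral_comp_rpow_Ioi_of_pos (E := ℝ)
    (g := ProbabilityTheory.betaPDFReal (1 / 3) (4 / 3)) (p := 3) (by norm_num)
  have h2 : ∫ y in Set.Ioi (0 : ℝ), ProbabilityTheory.betaPDFReal (1 / 3) (4 / 3) y = 1 := by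
    refine Eq.trans ?_ (integral_betaPDFReal (α := 1 / 3) (β := 4 / 3) (by norm_num) (by norm_num))
    refine MeasureTheory.setIntegral_eq_integral_of_forall_compl_eq_zero fun x hx => ?_
    rw [Set.mem_Ioi, not_lt] at hx
    rw [ProbabilityTheory.betaPDFReal, if_neg (fun h => absurd h.1 (not_lt.2 hx))]
  rw [h2] at h1
  have h3 : ∫ x in Set.Ioi (0 : ℝ), (3 * x ^ ((3 : ℝ) - 1)) •
      ProbabilityTheory.betaPDFReal (1 / 3) (4 / 3) (x ^ (3 : ℝ)) =
      ∫ x in Set.Ioo (0 : ℝ) 1, 1 / Ctwocubes * (1 - x ^ 3) ^ ((1 : ℝ) / 3) := by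
    rw [← Set.Ioi_inter_Iio, ← MeasureTheory.setIntegral_indicator measurableSet_Iio]
    refine MeasureTheory.setIntegral_congr_fun measurableSet_Ioi fun x hx => ?_
    rw [Set.mem_Ioi] at hx
    have hx3 : x ^ (3 : ℝ) = x ^ 3 := by exact_mod_cast Real.rpow_natCast x 3
    simp only [Set.indicator, Set.mem_Iio, ProbabilityTheory.betaPDFReal]
    rw [hx3]
    by_cases h : x < 1
    · rw [if_pos ⟨by positivity, pow_lt_one₀ hx.le h (by norm_num)⟩, if_pos h, beta_eq]
      have e1 : (x ^ 3) ^ ((1 : ℝ) / 3 - 1) = x ^ (-2 : ℝ) := by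
        rw [← hx3, ← Real.rpow_mul hx.le]; norm_num
      have e2 : x ^ ((3 : ℝ) - 1) * x ^ (-2 : ℝ) = 1 := by
        rw [← Real.rpow_add hx]; norm_num
      rw [e1, smul_eq_mul]
      have e3 : (4 / 3 - 1 : ℝ) = 1 / 3 := by norm_num
      rw [e3]
      calc _ = (x ^ ((3 : ℝ) - 1) * x ^ (-2 : ℝ)) * (3 * (1 / (3 * Ctwocubes))) *
            (1 - x ^ 3) ^ ((1 : ℝ) / 3) := by ring
        _ = _ := by rw [e2]; field_simp
    · rw [if_neg h, if_neg, smul_zero]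
      rintro ⟨-, h'⟩
      exact h (by by_contra h2; exact absurd h' (not_lt.2 (one_le_pow₀ (not_lt.1 h2))))
  rw [h3, MeasureTheory.integral_const_mul] at h1
  rw [intervalIntegral.integral_of_le zero_le_one, MeasureTheory.integral_Ioc_eq_integral_Ioo]
  field_simp at h1
  exact h1

lemma card_Om_bounds {N X : ℕ} {x P : ℝ} (hP : 1 ≤ P) (hx : P ^ 3 = x) (hN : N = ⌊P⌋₊)
    (hX : X = ⌊x⌋₊) :
    Ctwocubes * P ^ 2 - 3 * P ≤ (Om N X).card ∧ ((Om N X).card : ℝ) ≤ Ctwocubes * P ^ 2 := by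
  have hP0 : (0 : ℝ) < P := by linarith
  have hNP : (N : ℝ) ≤ P := hN ▸ Nat.floor_le hP0.le
  have hPN : P < N + 1 := hN ▸ Nat.lt_floor_add_one P
  set φ : ℝ → ℝ := fun t => (P ^ 3 - t ^ 3) ^ ((1 : ℝ) / 3) with hφ
  have hanti : AntitoneOn φ (Set.Icc 0 P) := by
    intro a ha b hb hab
    have h1 : b ^ 3 ≤ P ^ 3 := pow_le_pow_left₀ hb.1 hb.2 3
    have h2 : a ^ 3 ≤ b ^ 3 := pow_le_pow_left₀ ha.1 hab 3
    exact Real.rpow_le_rpow (by linarith) (by linarith) (by norm_num)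
  have hφ0 : ∀ t ∈ Set.Icc 0 P, 0 ≤ φ t ∧ φ t ≤ P := by
    intro t ht
    have h1 : t ^ 3 ≤ P ^ 3 := pow_le_pow_left₀ ht.1 ht.2 3
    have h2 : 0 ≤ t ^ 3 := pow_nonneg ht.1 3
    refine ⟨Real.rpow_nonneg (by linarith) _, ?_⟩
    calc φ t ≤ (P ^ 3) ^ ((1 : ℝ) / 3) := Real.rpow_le_rpow (by linarith) (by linarith) (by norm_num)
      _ = P := by
        rw [← Real.rpow_natCast, ← Real.rpow_mul hP0.le]; norm_num
  have hcount : ∀ u ∈ Icc 1 N, (((Icc 1 N).filter fun v => u ^ 3 + v ^ 3 ≤ X).card : ℕ) =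
      ⌊φ u⌋₊ := by
    intro u hu
    rw [mem_Icc] at hu
    have huP : (u : ℝ) ≤ P := le_trans (by exact_mod_cast hu.2) hNP
    have hu0 : (0 : ℝ) ≤ u := by positivity
    have h0 := hφ0 u ⟨hu0, huP⟩
    have h3 : φ u ^ 3 = P ^ 3 - u ^ 3 := by
      have h1 : (u : ℝ) ^ 3 ≤ P ^ 3 := pow_le_pow_left₀ hu0 huP 3
      rw [hφ]
      simp only
      rw [← Real.rpow_natCast, ← Real.rpow_mul (by linarith)]; norm_num
    have : ((Icc 1 N).filter fun v => u ^ 3 + v ^ 3 ≤ X) = Icc 1 ⌊φ u⌋₊ := by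
      ext v
      rw [mem_filter, mem_Icc, mem_Icc]
      have key : u ^ 3 + v ^ 3 ≤ X ↔ v ≤ ⌊φ u⌋₊ := by
        rw [hX, Nat.le_floor_iff (by rw [← hx]; positivity), Nat.le_floor_iff h0.1, ← hx]
        push_cast
        constructor
        · intro h
          refine le_of_pow_le_pow_left₀ (n := 3) (by norm_num) h0.1 ?_
          rw [h3]; linarith
        · intro h
          have := pow_le_pow_left₀ (by positivity) h 3
          rw [h3] at this; linarith
      rw [key]
      constructor
      · rintro ⟨h1, h2⟩; exact ⟨h1.1, h2⟩
      · rintro ⟨h1, h2⟩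
        refine ⟨⟨h1, ?_⟩, h2⟩
        rw [hN]
        exact h2.trans (Nat.floor_le_floor h0.2)
    rw [this, Nat.card_Icc]; omega
  have hcard : (Om N X).card = ∑ u ∈ Icc 1 N, ⌊φ u⌋₊ := by
    rw [Om, card_filter, sum_product]
    refine sum_congr rfl fun u hu => ?_
    rw [← hcount u hu, card_filter]
  have hshift : ∀ f : ℕ → ℝ, ∑ u ∈ Icc 1 N, f u = ∑ i ∈ range N, f (i + 1) := by
    intro f
    rw [range_eq_Ico, sum_Ico_add' f 0 N 1]
    rfl
  have hantiN : AntitoneOn φ (Set.Icc 0 (0 + (N : ℝ))) :=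
    hanti.mono (Set.Icc_subset_Icc le_rfl (by linarith))
  have hI1 := hantiN.sum_le_integral
  have hI2 := hantiN.integral_le_sum
  have hint : ∀ a b, a ∈ Set.Icc 0 P → b ∈ Set.Icc 0 P → IntervalIntegrable φ MeasureTheory.volume a b := by
    intro a b ha hb
    refine AntitoneOn.intervalIntegrable (hanti.mono ?_)
    exact (Set.uIcc_subset_Icc ha hb)
  have hN0 : (N : ℝ) ∈ Set.Icc 0 P := ⟨by positivity, hNP⟩
  have hadd := intervalIntegral.integral_add_adjacent_intervals
    (hint 0 N ⟨le_rfl, hP0.le⟩ hN0) (hint N P hN0 ⟨hP0.le, le_rfl⟩)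
  have htail0 : 0 ≤ ∫ t in (N : ℝ)..P, φ t :=
    intervalIntegral.integral_nonneg hNP fun t ht => (hφ0 t ⟨hN0.1.trans ht.1, ht.2⟩).1
  have htail1 : ∫ t in (N : ℝ)..P, φ t ≤ P := by
    calc ∫ t in (N : ℝ)..P, φ t ≤ ∫ t in (N : ℝ)..P, P := by
          refine intervalIntegral.integral_mono_on hNP (hint N P hN0 ⟨hP0.le, le_rfl⟩) (by simp) ?_
          intro t ht
          exact (hφ0 t ⟨hN0.1.trans ht.1, ht.2⟩).2
      _ = (P - N) * P := by simp
      _ ≤ 1 * P := by gcongr; linarith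
      _ = P := one_mul P
  have hfull : ∫ t in (0 : ℝ)..P, φ t = Ctwocubes * P ^ 2 := by
    have h1 := intervalIntegral.integral_comp_mul_left φ hP0.ne' (a := 0) (b := 1)
    rw [mul_zero, mul_one] at h1
    have h2 : ∫ t in (0 : ℝ)..1, φ (P * t) = ∫ t in (0 : ℝ)..1, P * (1 - t ^ 3) ^ ((1 : ℝ) / 3) := by
      refine intervalIntegral.integral_congr fun t ht => ?_
      rw [Set.uIcc_of_le zero_le_one] at ht
      have h4 : t ^ 3 ≤ 1 := pow_le_one₀ ht.1 ht.2
      simp only [hφ]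
      rw [show P ^ 3 - (P * t) ^ 3 = P ^ 3 * (1 - t ^ 3) by ring,
        Real.mul_rpow (by positivity) (by linarith)]
      congr 1
      rw [← Real.rpow_natCast, ← Real.rpow_mul hP0.le]; norm_num
    rw [h2, intervalIntegral.integral_const_mul, integral_eq_Ctwocubes, smul_eq_mul] at h1
    have : ∫ t in (0 : ℝ)..P, φ t = P * (P⁻¹ * ∫ t in (0 : ℝ)..P, φ t) := by field_simp
    rw [this, ← h1]; ring
  have hsum_eq : (((Om N X).card : ℕ) : ℝ) = ∑ i ∈ range N, (⌊φ (0 + ((i + 1 : ℕ) : ℝ))⌋₊ : ℝ) := by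
    rw [hcard]; push_cast
    rw [hshift fun u => (⌊φ u⌋₊ : ℝ)]; simp
  have hmem : ∀ i ∈ range N, ((0 : ℝ) + ((i + 1 : ℕ) : ℝ)) ∈ Set.Icc 0 P := by
    intro i hi
    rw [mem_range] at hi
    refine ⟨by positivity, ?_⟩
    rw [zero_add]
    refine le_trans ?_ hNP
    exact_mod_cast hi
  rw [zero_add] at hI1 hI2
  rw [hsum_eq]
  constructor
  · have h1 : ∑ i ∈ range N, φ (0 + (i : ℝ)) ≤ P + ∑ i ∈ range N, φ (0 + ((i + 1 : ℕ) : ℝ)) := by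
      have e := sum_range_succ' (fun i : ℕ => φ (0 + (i : ℝ))) N
      rw [sum_range_succ] at e
      have h2 := (hφ0 (0 + (N : ℝ)) (by rw [zero_add]; exact hN0)).1
      have h3 := (hφ0 (0 + ((0 : ℕ) : ℝ)) (by simpa using hP0.le)).2
      linarith
    have h4 : ∑ i ∈ range N, (φ (0 + ((i + 1 : ℕ) : ℝ)) - 1) ≤
        ∑ i ∈ range N, (⌊φ (0 + ((i + 1 : ℕ) : ℝ))⌋₊ : ℝ) :=
      sum_le_sum fun i _ => (Nat.sub_one_lt_floor _).le
    rw [sum_sub_distrib, sum_const, card_range, nsmul_eq_mul, mul_one] at h4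
    linarith
  · have h4 : ∑ i ∈ range N, (⌊φ (0 + ((i + 1 : ℕ) : ℝ))⌋₊ : ℝ) ≤
        ∑ i ∈ range N, φ (0 + ((i + 1 : ℕ) : ℝ)) :=
      sum_le_sum fun i hi => Nat.floor_le (hφ0 _ (hmem i hi)).1
    linarith

/-- Points of `Om` in a residue class. -/
noncomputable def cls (N X q : ℕ) (s : ℕ × ℕ) : ℕ :=
  ((Om N X).filter fun p => p.1 % q = s.1 ∧ p.2 % q = s.2).card

lemma card_mod_le {N q t : ℕ} :
    ((Icc 1 N).filter fun v => v % q = t).card ≤ N / q + 1 := by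
  calc _ ≤ ((range (N / q + 1)).image fun j => q * j + t).card := by
        refine card_le_card fun v hv => ?_
        rw [mem_filter, mem_Icc] at hv
        rw [mem_image]
        refine ⟨v / q, mem_range.2 (Nat.lt_succ_of_le (Nat.div_le_div_right hv.1.2)), ?_⟩
        rw [← hv.2, add_comm]; exact Nat.mod_add_div v q
    _ ≤ _ := card_image_le.trans (by simp)

lemma cls_le {N X q : ℕ} (hq : 0 < q) {s s' : ℕ × ℕ} (hs' : s' ∈ range q ×ˢ range q) :
    cls N X q s ≤ cls N X q s' + 2 * (N / q + 1) := by
  rw [mem_product, mem_range, mem_range] at hs'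
  set A := (Om N X).filter fun p => p.1 % q = s.1 ∧ p.2 % q = s.2
  set B := (Om N X).filter fun p => p.1 % q = s'.1 ∧ p.2 % q = s'.2
  set w : ℕ → ℕ → ℕ := fun c u => q * (u / q - 1) + (if c = 0 then q else c) with hw
  have hwle : ∀ c u, c < q → q ≤ u → 1 ≤ w c u ∧ w c u ≤ u ∧ w c u % q = c := by
    intro c u hc hu
    have h1 : 1 ≤ u / q := (Nat.one_le_div_iff hq).2 hu
    obtain ⟨k, hk⟩ : ∃ k, u / q = k + 1 := ⟨u / q - 1, by omega⟩
    have h2 : q * (u / q) ≤ u := Nat.mul_div_le u q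
    simp only [hw, hk, Nat.add_sub_cancel]
    rw [hk, mul_add, mul_one] at h2
    split_ifs with h
    · subst h
      refine ⟨by omega, by omega, ?_⟩
      rw [← mul_add_one, Nat.mul_mod_right]
    · refine ⟨by omega, by omega, ?_⟩
      rw [Nat.mul_add_mod, Nat.mod_eq_of_lt hc]
  have hwinj : ∀ c u u', q ≤ u → q ≤ u' → u % q = u' % q → w c u = w c u' → u = u' := by
    intro c u u' hu hu' hm h
    have h1 : 1 ≤ u / q := (Nat.one_le_div_iff hq).2 hu
    have h1' : 1 ≤ u' / q := (Nat.one_le_div_iff hq).2 hu'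
    simp only [hw, add_left_inj] at h
    have h2 := Nat.eq_of_mul_eq_mul_left hq h
    rw [← Nat.mod_add_div u q, ← Nat.mod_add_div u' q, hm]
    congr 2; omega
  have hsplit : A ⊆ (A.filter fun p => q ≤ p.1 ∧ q ≤ p.2) ∪
      (((Icc 1 N).filter fun v => v % q = s.2).image fun v => (s.1, v)) ∪
      (((Icc 1 N).filter fun v => v % q = s.1).image fun v => (v, s.2)) := by
    intro p hp
    have hp' := hp
    simp only [A, Om, mem_filter, mem_product] at hp'
    simp only [mem_union, mem_filter, mem_image]
    by_cases h1 : q ≤ p.1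
    · by_cases h2 : q ≤ p.2
      · exact Or.inl (Or.inl ⟨hp, h1, h2⟩)
      · refine Or.inr ⟨p.1, ⟨hp'.1.1.1, hp'.2.1⟩, ?_⟩
        rw [← hp'.2.2, Nat.mod_eq_of_lt (by omega)]
    · refine Or.inl (Or.inr ⟨p.2, ⟨hp'.1.1.2, hp'.2.2⟩, ?_⟩)
      rw [← hp'.2.1, Nat.mod_eq_of_lt (by omega)]
  have hA : (A.filter fun p => q ≤ p.1 ∧ q ≤ p.2).card ≤ B.card := by
    refine card_le_card_of_injOn (fun p => (w s'.1 p.1, w s'.2 p.2)) ?_ ?_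
    · intro p hp
      simp only [coe_filter, A, Om, mem_filter, mem_product, Set.mem_ofPred_eq, mem_Icc] at hp
      obtain ⟨a1, a2, a3⟩ := hwle s'.1 p.1 hs'.1 hp.2.1
      obtain ⟨b1, b2, b3⟩ := hwle s'.2 p.2 hs'.2 hp.2.2
      simp only [B, Om, mem_filter, mem_product, mem_coe, mem_Icc]
      refine ⟨⟨⟨⟨a1, by omega⟩, ⟨b1, by omega⟩⟩, ?_⟩, a3, b3⟩
      calc w s'.1 p.1 ^ 3 + w s'.2 p.2 ^ 3 ≤ p.1 ^ 3 + p.2 ^ 3 := by gcongr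
        _ ≤ X := hp.1.1.2
    · intro p hp p' hp' h
      simp only [coe_filter, A, mem_filter, Set.mem_ofPred_eq] at hp hp'
      simp only [Prod.mk.injEq] at h
      exact Prod.ext (hwinj _ _ _ hp.2.1 hp'.2.1 (by rw [hp.1.2.1, hp'.1.2.1]) h.1)
        (hwinj _ _ _ hp.2.2 hp'.2.2 (by rw [hp.1.2.2, hp'.1.2.2]) h.2)
  calc A.card ≤ _ := card_le_card hsplit
    _ ≤ _ := card_union_le _ _
    _ ≤ _ := add_le_add (card_union_le _ _) le_rfl
    _ ≤ B.card + (N / q + 1) + (N / q + 1) := by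
      refine add_le_add (add_le_add hA ?_) ?_
      · exact card_image_le.trans card_mod_le
      · exact card_image_le.trans card_mod_le
    _ = _ := by change _ = B.card + _; ring

lemma sum_cls {N X q : ℕ} (hq : 0 < q) : ∑ s ∈ range q ×ˢ range q, cls N X q s = (Om N X).card := by
  rw [card_eq_sum_card_fiberwise (f := fun p : ℕ × ℕ => (p.1 % q, p.2 % q))
    (t := range q ×ˢ range q)]
  · refine sum_congr rfl fun s _ => ?_
    rw [cls]; congr 1
    ext p; simp [Prod.ext_iff]
  · intro p _
    simp [Nat.mod_lt _ hq]

lemma abs_cls_sub_le {N X q : ℕ} (hq : 0 < q) (hqN : q ≤ N) {s : ℕ × ℕ}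
    (hs : s ∈ range q ×ˢ range q) :
    |(cls N X q s : ℝ) - (Om N X).card / (q : ℝ) ^ 2| ≤ 4 * N / q := by
  have hq' : (0 : ℝ) < q := by exact_mod_cast hq
  have hE : (2 * ((N / q : ℕ) + 1) : ℝ) ≤ 4 * N / q := by
    have h1 : ((N / q : ℕ) : ℝ) ≤ N / q := Nat.cast_div_le
    have h2 : (1 : ℝ) ≤ N / q := by rw [one_le_div hq']; exact_mod_cast hqN
    have : (4 * N / q : ℝ) = 4 * (N / q) := by ring
    rw [this]; linarith
  have hc : ((range q ×ˢ range q).card : ℝ) = (q : ℝ) ^ 2 := by simp [sq]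
  have hsum : ∑ s ∈ range q ×ˢ range q, (cls N X q s : ℝ) = (Om N X).card := by
    exact_mod_cast sum_cls hq
  have key : |(q : ℝ) ^ 2 * cls N X q s - (Om N X).card| ≤ (q : ℝ) ^ 2 * (4 * N / q) := by
    rw [← hsum, ← hc, ← nsmul_eq_mul, ← nsmul_eq_mul, ← sum_const, ← sum_const, ← sum_sub_distrib]
    refine (abs_sum_le_sum_abs _ _).trans (sum_le_sum fun s' hs' => ?_)
    have h1 : (cls N X q s : ℝ) ≤ cls N X q s' + 2 * ((N / q : ℕ) + 1) := by
      exact_mod_cast cls_le hq hs'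
    have h2 : (cls N X q s' : ℝ) ≤ cls N X q s + 2 * ((N / q : ℕ) + 1) := by
      exact_mod_cast cls_le hq hs
    rw [abs_le]; constructor <;> linarith
  have e : (cls N X q s : ℝ) - (Om N X).card / (q : ℝ) ^ 2 =
      ((q : ℝ) ^ 2 * cls N X q s - (Om N X).card) / (q : ℝ) ^ 2 := by field_simp
  rw [e, abs_div, abs_of_pos (by positivity : (0 : ℝ) < (q : ℝ) ^ 2), div_le_iff₀ (by positivity)]
  linarith

lemma Rc_eq {N X q a : ℕ} (hq : 0 < q) :
    Rc N X q a = ∑ s ∈ (range q ×ˢ range q).filter (fun p => cub p % q = a % q), cls N X q s := by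
  rw [Rc, card_eq_sum_card_fiberwise (f := fun p : ℕ × ℕ => (p.1 % q, p.2 % q))
    (t := (range q ×ˢ range q).filter (fun p => cub p % q = a % q))]
  · refine sum_congr rfl fun s hs => ?_
    rw [mem_filter] at hs
    rw [cls]; congr 1
    ext p
    simp only [mem_filter, Prod.ext_iff]
    constructor
    · rintro ⟨⟨h1, _⟩, h2⟩; exact ⟨h1, h2⟩
    · rintro ⟨h1, h2⟩
      refine ⟨⟨h1, ?_⟩, h2⟩
      rw [← hs.2, cub, cub, ← h2.1, ← h2.2]
      simp [Nat.add_mod, Nat.pow_mod]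
  · intro p hp
    rw [mem_coe, mem_filter] at hp
    rw [mem_coe, mem_filter, mem_product, mem_range, mem_range]
    refine ⟨⟨Nat.mod_lt _ hq, Nat.mod_lt _ hq⟩, ?_⟩
    rw [← hp.2, cub, cub]
    simp [Nat.add_mod, Nat.pow_mod]

lemma rho_le (q a : ℕ) : rho q a ≤ q ^ 2 := by
  refine (card_le_card (filter_subset _ _)).trans ?_
  simp [sq]

lemma sum_rho {q : ℕ} (hq : 0 < q) : ∑ a ∈ range q, rho q a = q ^ 2 := by
  have : (range q ×ˢ range q).card = q ^ 2 := by simp [sq]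
  rw [← this, card_eq_sum_card_fiberwise (f := fun p : ℕ × ℕ => cub p % q) (t := range q)]
  · refine sum_congr rfl fun a ha => ?_
    rw [rho, Nat.mod_eq_of_lt (mem_range.1 ha)]
  · intro p _
    simp [Nat.mod_lt _ hq]

lemma Vq_le {N X q : ℕ} {μ : ℝ} (hq : 0 < q) (hqN : q ≤ N) (hμ : |((Om N X).card : ℝ) - μ| ≤ 6 * N) :
    Vq N X μ q ≤ 100 * (N : ℝ) ^ 2 * (q : ℝ) ^ 2 := by
  have hq' : (1 : ℝ) ≤ q := by exact_mod_cast hq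
  have hterm : ∀ a, |(Rc N X q a : ℝ) - rho q a / (q : ℝ) ^ 2 * μ| ≤ rho q a * (10 * N / q) := by
    intro a
    have h1 : |(Rc N X q a : ℝ) - rho q a * ((Om N X).card / (q : ℝ) ^ 2)| ≤
        rho q a * (4 * N / q) := by
      rw [Rc_eq hq, rho, ← nsmul_eq_mul, ← nsmul_eq_mul, ← sum_const, ← sum_const, Nat.cast_sum,
        ← sum_sub_distrib]
      refine (abs_sum_le_sum_abs _ _).trans (sum_le_sum fun s hs => ?_)
      exact abs_cls_sub_le hq hqN (mem_filter.1 hs).1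
    have h2 : |rho q a * ((Om N X).card / (q : ℝ) ^ 2) - rho q a / (q : ℝ) ^ 2 * μ| ≤
        rho q a * (6 * N / q) := by
      have e : rho q a * ((Om N X).card / (q : ℝ) ^ 2) - rho q a / (q : ℝ) ^ 2 * μ =
        rho q a / (q : ℝ) ^ 2 * ((Om N X).card - μ) := by ring
      rw [e, abs_mul, abs_of_nonneg (by positivity : (0 : ℝ) ≤ rho q a / (q : ℝ) ^ 2)]
      calc rho q a / (q : ℝ) ^ 2 * |((Om N X).card : ℝ) - μ| ≤ rho q a / (q : ℝ) ^ 2 * (6 * N) := by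
            gcongr
        _ ≤ rho q a / (q : ℝ) * (6 * N) := by
            gcongr; nlinarith
        _ = _ := by ring
    calc _ ≤ _ := abs_sub_le _ (rho q a * ((Om N X).card / (q : ℝ) ^ 2)) _
      _ ≤ _ := add_le_add h1 h2
      _ = _ := by ring
  have hrho : ∑ a ∈ range q, (rho q a : ℝ) ^ 2 ≤ (q : ℝ) ^ 4 := by
    calc ∑ a ∈ range q, (rho q a : ℝ) ^ 2 ≤ ∑ a ∈ range q, (q : ℝ) ^ 2 * rho q a := by
          refine sum_le_sum fun a _ => ?_
          rw [sq]
          refine mul_le_mul_of_nonneg_right ?_ (by positivity)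
          exact_mod_cast rho_le q a
      _ = (q : ℝ) ^ 2 * ∑ a ∈ range q, (rho q a : ℝ) := by rw [mul_sum]
      _ = _ := by
        have : ∑ a ∈ range q, (rho q a : ℝ) = (q : ℝ) ^ 2 := by exact_mod_cast sum_rho hq
        rw [this]; ring
  calc Vq N X μ q ≤ ∑ a ∈ range q, ((rho q a : ℝ) * (10 * N / q)) ^ 2 :=
        sum_le_sum fun a _ => sq_le_sq' (by linarith [(abs_le.1 (hterm a)).1]) (abs_le.1 (hterm a)).2
    _ = (10 * N / q : ℝ) ^ 2 * ∑ a ∈ range q, (rho q a : ℝ) ^ 2 := by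
        rw [mul_sum]; exact sum_congr rfl fun _ _ => by ring
    _ ≤ (10 * N / q : ℝ) ^ 2 * (q : ℝ) ^ 4 := by gcongr
    _ = _ := by field_simp; ring

lemma vr_div_le_Vq (N X : ℕ) (μ : ℝ) {r : ℕ} (hr : 0 < r) : vr N X μ r / r ≤ Vq N X μ r := by
  rw [Vq_eq N X μ hr, div_eq_inv_mul, one_div]
  refine mul_le_mul_of_nonneg_left ?_ (by positivity)
  exact single_le_sum (f := fun r => vr N X μ r) (fun _ _ => vr_nonneg _ _ _ _)
    (Nat.mem_divisors_self r hr.ne')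

lemma sum_vr_small_le {N X R1 K1 B : ℕ} {S T μ : ℝ} (h : Par N X R1 K1 B S T μ) :
    ∑ r ∈ Icc 1 R1, vr N X μ r / r ≤ 100 * S ^ 14 := by
  have hS := h.hS
  have hSp := h.S_pos
  have hR1N : R1 ≤ N := by
    have : (R1 : ℝ) ≤ N := by
      rw [← h.S4]
      exact h.R1_le.trans (pow_le_pow_right₀ (by linarith) (by norm_num))
    exact_mod_cast this
  calc _ ≤ ∑ r ∈ Icc 1 R1, 100 * (N : ℝ) ^ 2 * (R1 : ℝ) ^ 2 := by
        refine sum_le_sum fun r hr => ?_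
        rw [mem_Icc] at hr
        refine (vr_div_le_Vq N X μ hr.1).trans ((Vq_le hr.1 (by omega) h.om).trans ?_)
        have : (r : ℝ) ≤ R1 := by exact_mod_cast hr.2
        gcongr
    _ = 100 * (N : ℝ) ^ 2 * (R1 : ℝ) ^ 3 := by
        rw [sum_const, Nat.card_Icc, nsmul_eq_mul, Nat.add_sub_cancel]; ring
    _ ≤ 100 * (N : ℝ) ^ 2 * (S ^ 2) ^ 3 := by gcongr; exact h.R1_le
    _ = _ := by rw [← h.S4]; ring

/-- Divisor switching for sums of `Vq`. -/
lemma sum_weight_Vq (N X Q : ℕ) (μ : ℝ) (w : ℕ → ℝ) :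
    ∑ q ∈ Icc 1 Q, w q * Vq N X μ q =
      ∑ r ∈ Icc 1 Q, (∑ q ∈ (Icc 1 Q).filter (fun q => r ∣ q), w q / q) * vr N X μ r := by
  have h1 : ∀ q ∈ Icc 1 Q, w q * Vq N X μ q =
      ∑ r ∈ Icc 1 Q, if r ∣ q then w q / q * vr N X μ r else 0 := by
    intro q hq
    rw [mem_Icc] at hq
    rw [Vq_eq N X μ hq.1, ← sum_filter]
    have : (Icc 1 Q).filter (fun r => r ∣ q) = q.divisors := by
      ext r
      rw [mem_filter, mem_Icc, Nat.mem_divisors]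
      constructor
      · rintro ⟨_, h⟩; exact ⟨h, by omega⟩
      · rintro ⟨h, h0⟩
        have := Nat.le_of_dvd (by omega) h
        have := Nat.pos_of_dvd_of_pos h (by omega)
        exact ⟨⟨by omega, by omega⟩, h⟩
    rw [this, mul_sum, mul_sum]
    exact sum_congr rfl fun _ _ => by ring
  rw [sum_congr rfl h1, sum_comm]
  refine sum_congr rfl fun r _ => ?_
  rw [← sum_filter, sum_mul]

lemma sum_inv_dvd_le {B Q r : ℕ} {T : ℝ} (hT : Dom B T) (hQ : Q ≤ B) (hr : 0 < r) :
    ∑ q ∈ (Icc 1 Q).filter (fun q => r ∣ q), (1 : ℝ) / q ≤ T / r := by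
  have hr' : (0 : ℝ) < r := by exact_mod_cast hr
  have h1 := hT.harm_le (Q / r) ((Nat.div_le_self _ _).trans hQ)
  have h2 : ∑ q ∈ (Icc 1 Q).filter (fun q => r ∣ q), (1 : ℝ) / q =
      ∑ k ∈ Icc 1 (Q / r), (1 : ℝ) / ((r * k : ℕ) : ℝ) := by
    symm
    refine sum_nbij (fun k => r * k) ?_ ?_ ?_ ?_
    · intro k hk
      rw [mem_Icc] at hk
      rw [mem_filter, mem_Icc]
      refine ⟨⟨Nat.mul_pos hr hk.1, ?_⟩, dvd_mul_right _ _⟩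
      exact (Nat.mul_le_mul_left r hk.2).trans (Nat.mul_div_le Q r)
    · intro a _ b _ hab
      exact Nat.eq_of_mul_eq_mul_left hr hab
    · intro q hq
      rw [mem_coe, mem_filter, mem_Icc] at hq
      obtain ⟨⟨h1, h2⟩, k, rfl⟩ := hq
      refine ⟨k, ?_, rfl⟩
      rw [mem_coe, mem_Icc]
      refine ⟨Nat.pos_of_mul_pos_left h1, (Nat.le_div_iff_mul_le hr).2 (by rwa [mul_comm])⟩
    · intro k _; rfl
  rw [h2, le_div_iff₀ hr', sum_mul]
  refine le_trans (le_of_eq ?_) h1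
  refine sum_congr rfl fun k hk => ?_
  rw [mem_Icc] at hk
  have : (0 : ℝ) < k := by exact_mod_cast hk.1
  push_cast; field_simp

/-- First bound for the variance. -/
lemma sum_Vq_le {N X R1 K1 B : ℕ} {S T μ : ℝ} (h : Par N X R1 K1 B S T μ) {Q : ℕ} (hQ : Q ≤ 8 * N ^ 3)
    (hZ : (Z N X : ℝ) ≤ T * S ^ 8) :
    ∑ q ∈ Icc 1 Q, Vq N X μ q ≤ 20000 * T ^ 5 * S ^ 15 + 32 * T ^ 2 * Q * S ^ 8 := by
  have hS := h.hS
  have hSp := h.S_pos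
  have hT := h.dom.one_le
  have hQB : Q ≤ B := hQ.trans (h.big_of (by norm_num) (by norm_num))
  have hK1 := h.K1_pos
  have h0 := sum_weight_Vq N X Q μ (fun _ => 1)
  simp only [one_mul] at h0
  rw [h0]
  have h1 : ∑ r ∈ Icc 1 Q, (∑ q ∈ (Icc 1 Q).filter (fun q => r ∣ q), (1 : ℝ) / q) * vr N X μ r ≤
      T * ∑ r ∈ Icc 1 Q, vr N X μ r / r := by
    rw [mul_sum]
    refine sum_le_sum fun r hr => ?_
    rw [mem_Icc] at hr
    calc _ ≤ T / r * vr N X μ r :=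
          mul_le_mul_of_nonneg_right (sum_inv_dvd_le h.dom hQB hr.1) (vr_nonneg _ _ _ _)
      _ = _ := by ring
  refine h1.trans ?_
  have hv0 : ∀ r : ℕ, 0 ≤ vr N X μ r / r := fun r => div_nonneg (vr_nonneg _ _ _ _) (by positivity)
  have h2 : ∑ r ∈ Icc 1 Q, vr N X μ r / r ≤ ∑ r ∈ Icc 1 R1, vr N X μ r / r +
      ∑ r ∈ Ioc R1 Q, vr N X μ r / r := by
    rw [← sum_union]
    · refine sum_le_sum_of_subset_of_nonneg ?_ fun r _ _ => hv0 r
      intro r hr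
      rw [mem_Icc] at hr
      rw [mem_union, mem_Icc, mem_Ioc]; omega
    · rw [disjoint_left]; intro r h1 h2
      rw [mem_Icc] at h1; rw [mem_Ioc] at h2; omega
  have h3 : ∑ r ∈ Ioc R1 Q, vr N X μ r / r ≤ 2 * ∑ r ∈ Ioc R1 Q, fr N X r / r +
      2 * ∑ r ∈ Ioc R1 Q, mr μ r / r := by
    rw [mul_sum, mul_sum, ← sum_add_distrib]
    refine sum_le_sum fun r _ => ?_
    calc vr N X μ r / r ≤ (2 * fr N X r + 2 * mr μ r) / r := by
          gcongr; exact vr_le N X μ r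
      _ = _ := by ring
  have h4 : ∑ r ∈ Ioc R1 Q, fr N X r / r ≤ ∑ r ∈ Ioc R1 K1, fr N X r / r +
      ∑ r ∈ Ioc K1 Q, fr N X r / r := by
    have hf0 : ∀ r : ℕ, 0 ≤ fr N X r / r := fun r => div_nonneg (fr_nonneg _ _ _) (by positivity)
    rw [← sum_union]
    · refine sum_le_sum_of_subset_of_nonneg ?_ fun r _ _ => hf0 r
      intro r hr
      rw [mem_Ioc] at hr
      rw [mem_union, mem_Ioc, mem_Ioc]; omega
    · rw [disjoint_left]; intro r h1 h2
      rw [mem_Ioc] at h1 h2; omega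
  have h5 := sum_fr_small_le h
  have h6 : ∑ r ∈ Ioc K1 Q, fr N X r / r ≤ 16 * T * Q * S ^ 8 + 192 * T * S ^ 15 := by
    refine (sum_fr_large_le (N := N) (X := X) (R := Q) hK1).trans ?_
    have hX : (X : ℝ) ≤ 2 * S ^ 12 := by
      have : (X : ℝ) ≤ 2 * (N : ℝ) ^ 3 := by exact_mod_cast h.X_le
      rw [← h.S4] at this; linarith [this, show (S ^ 4) ^ 3 = S ^ 12 by ring]
    calc 8 * (2 * Q + 3 * X * (2 / K1)) * (Z N X : ℝ)
        ≤ 8 * (2 * Q + 3 * (2 * S ^ 12) * (2 / (S ^ 5 / 2))) * (T * S ^ 8) := by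
          gcongr; exact h.K1_ge
      _ = _ := by field_simp; ring
  have h7 := sum_mr_large_le h hQ
  have h8 := sum_vr_small_le h
  have e1 : S ^ 14 ≤ S ^ 15 := pow_le_pow_right₀ (by linarith) (by norm_num)
  have e2 : T * S ^ 14 ≤ T ^ 5 * S ^ 15 := by
    have : T ≤ T ^ 5 := le_self_pow₀ hT (by norm_num)
    gcongr
  have e3 : T * (T * S ^ 15) ≤ T ^ 5 * S ^ 15 := by
    have : T ^ 2 ≤ T ^ 5 := pow_le_pow_right₀ hT (by norm_num)
    calc _ = T ^ 2 * S ^ 15 := by ring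
      _ ≤ _ := by gcongr
  have e4 : T * (T ^ 3 * S ^ 15) ≤ T ^ 5 * S ^ 15 := by
    have : T ^ 4 ≤ T ^ 5 := pow_le_pow_right₀ hT (by norm_num)
    calc _ = T ^ 4 * S ^ 15 := by ring
      _ ≤ _ := by gcongr
  calc T * ∑ r ∈ Icc 1 Q, vr N X μ r / r
      ≤ T * (100 * S ^ 14 + (2 * (5000 * T ^ 4 * S ^ 15 + (16 * T * Q * S ^ 8 + 192 * T * S ^ 15)) +
          2 * (4128 * T ^ 3 * S ^ 15))) := by
        refine mul_le_mul_of_nonneg_left ?_ (by linarith)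
        linarith
    _ = 100 * (T * S ^ 14) + 10000 * (T ^ 5 * S ^ 15) + 32 * T ^ 2 * Q * S ^ 8 +
          384 * (T * (T * S ^ 15)) + 8256 * (T * (T ^ 3 * S ^ 15)) := by ring
    _ ≤ _ := by
      have e5 : 0 ≤ T ^ 5 * S ^ 15 := by positivity
      have e6 : 20000 * T ^ 5 * S ^ 15 = 20000 * (T ^ 5 * S ^ 15) := by ring
      rw [e6]
      linarith only [e2, e3, e4, e5]

/-- The sum of the `e` with `e²` dividing `n`. -/
noncomputable def sqs (n : ℕ) : ℕ := ∑ e ∈ n.divisors.filter (fun e => e ^ 2 ∣ n), e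

lemma le_sqs {n e : ℕ} (hn : 0 < n) (h : e ^ 2 ∣ n) : e ≤ sqs n := by
  refine single_le_sum (f := fun e => e) (fun _ _ => Nat.zero_le _) ?_
  rw [mem_filter, Nat.mem_divisors]
  exact ⟨⟨(Dvd.intro_left _ (by rw [sq]) : e ∣ e ^ 2).trans h, hn.ne'⟩, h⟩

lemma one_le_sqs {n : ℕ} (hn : 0 < n) : 1 ≤ sqs n := le_sqs hn (by simp)

lemma sum_sqs_le {B M : ℕ} {T : ℝ} (hT : Dom B T) (hM : M ≤ B) :
    ∑ n ∈ Icc 1 M, (sqs n : ℝ) ≤ M * T := by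
  have h1 : ∀ n ∈ Icc 1 M, (sqs n : ℝ) ≤ ∑ e ∈ Icc 1 M, if e ^ 2 ∣ n then (e : ℝ) else 0 := by
    intro n hn
    rw [mem_Icc] at hn
    rw [← sum_filter, sqs, Nat.cast_sum]
    refine sum_le_sum_of_subset_of_nonneg ?_ fun _ _ _ => by positivity
    intro e he
    rw [mem_filter, Nat.mem_divisors] at he
    rw [mem_filter, mem_Icc]
    have := Nat.le_of_dvd (by omega) he.1.1
    have := Nat.pos_of_dvd_of_pos he.1.1 (by omega)
    exact ⟨⟨by omega, by omega⟩, he.2⟩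
  calc _ ≤ _ := sum_le_sum h1
    _ = ∑ e ∈ Icc 1 M, (((Icc 1 M).filter fun n => e ^ 2 ∣ n).card : ℝ) * e := by
      rw [sum_comm]
      refine sum_congr rfl fun e _ => ?_
      rw [← sum_filter, sum_const, nsmul_eq_mul]
    _ ≤ ∑ e ∈ Icc 1 M, M * ((1 : ℝ) / e) := by
      refine sum_le_sum fun e he => ?_
      rw [mem_Icc] at he
      have he' : (0 : ℝ) < e := by exact_mod_cast he.1
      have h2 : ((Icc 1 M).filter fun n => e ^ 2 ∣ n).card = M / e ^ 2 := by
        rw [← Nat.Ioc_filter_dvd_card_eq_div]; rfl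
      rw [h2]
      have h3 : ((M / e ^ 2 : ℕ) : ℝ) ≤ M / (e : ℝ) ^ 2 := by
        have := @Nat.cast_div_le ℝ _ _ _ M (e ^ 2)
        simpa using this
      calc ((M / e ^ 2 : ℕ) : ℝ) * e ≤ M / (e : ℝ) ^ 2 * e := by gcongr
        _ = _ := by field_simp
    _ = M * ∑ e ∈ Icc 1 M, (1 : ℝ) / e := by rw [mul_sum]
    _ ≤ _ := by gcongr; exact hT.harm_le M hM

lemma sep_card {ι : Type*} (s : Finset ι) (f : ι → ℝ) {e Λ : ℝ} (he : 1 ≤ e) (hΛ : 1 ≤ Λ)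
    (h1 : ∀ i ∈ s, 1 ≤ f i ∧ f i ≤ Λ)
    (hsep : ∀ i ∈ s, ∀ j ∈ s, i ≠ j → f j ≤ f i → f j / e ≤ f i - f j) :
    (s.card : ℝ) ≤ 1 + 2 * e * Real.log Λ := by
  have hlog : 0 ≤ 2 * e * Real.log Λ := mul_nonneg (by linarith) (Real.log_nonneg hΛ)
  have key : ∀ i ∈ s, ∀ j ∈ s, i ≠ j → f j ≤ f i →
      2 * e * Real.log (f j) + 1 ≤ 2 * e * Real.log (f i) := by
    intro i hi j hj hij hle
    have hj0 : 0 < f j := by linarith [(h1 j hj).1]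
    have hi0 : 0 < f i := by linarith [(h1 i hi).1]
    have h2 := hsep i hi j hj hij hle
    have h3 : 1 + 1 / e ≤ f i / f j := by
      rw [le_div_iff₀ hj0]
      have : (1 + 1 / e) * f j = f j + f j / e := by ring
      linarith
    have h4 := Real.one_sub_inv_le_log_of_pos (show 0 < f i / f j by positivity)
    rw [Real.log_div hi0.ne' hj0.ne'] at h4
    have h5 : (f i / f j)⁻¹ ≤ (1 + 1 / e)⁻¹ := by gcongr
    have h6 : (1 + 1 / e)⁻¹ = 1 - 1 / (e + 1) := by field_simp; ring
    have h7 : 1 / (2 * e) ≤ 1 / (e + 1) := by gcongr; linarith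
    have h8 : 1 / (2 * e) ≤ Real.log (f i) - Real.log (f j) := by linarith
    rw [div_le_iff₀ (by linarith)] at h8
    linarith
  have hinj : s.card ≤ (range (⌊2 * e * Real.log Λ⌋₊ + 1)).card := by
    refine card_le_card_of_injOn (fun i => ⌊2 * e * Real.log (f i)⌋₊) ?_ ?_
    · intro i hi
      have := h1 i hi
      rw [mem_coe, mem_range]
      refine Nat.lt_succ_of_le (Nat.floor_le_floor ?_)
      have : Real.log (f i) ≤ Real.log Λ := Real.log_le_log (by linarith) this.2
      gcongr
    · intro i hi j hj hij
      by_contra hne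
      rw [mem_coe] at hi hj
      have hpos : ∀ k ∈ s, 0 ≤ 2 * e * Real.log (f k) := fun k hk =>
        mul_nonneg (by linarith) (Real.log_nonneg (h1 k hk).1)
      simp only at hij
      rcases le_total (f j) (f i) with h | h
      · have h2 := Nat.floor_le_floor (key i hi j hj hne h)
        rw [Nat.floor_add_one (hpos j hj)] at h2; omega
      · have h2 := Nat.floor_le_floor (key j hj i hi (Ne.symm hne) h)
        rw [Nat.floor_add_one (hpos i hi)] at h2; omega
  rw [card_range] at hinj
  have h2 : (s.card : ℝ) ≤ (⌊2 * e * Real.log Λ⌋₊ : ℝ) + 1 := by exact_mod_cast hinj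
  have := Nat.floor_le hlog
  linarith

lemma coprime_pair_eq {A B A' B' : ℕ} (h : Nat.Coprime A B) (h' : Nat.Coprime A' B')
    (hD : A * B' = A' * B) : A = A' ∧ B = B' := by
  have h1 : A ∣ A' := h.dvd_of_dvd_mul_right (hD ▸ dvd_mul_right A B')
  have h2 : A' ∣ A := h'.dvd_of_dvd_mul_right (hD ▸ dvd_mul_right A' B)
  have h3 : B ∣ B' := h.symm.dvd_of_dvd_mul_left (hD ▸ dvd_mul_left B A')
  have h4 : B' ∣ B := h'.symm.dvd_of_dvd_mul_left (hD ▸ dvd_mul_left B' A)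
  exact ⟨Nat.dvd_antisymm h1 h2, Nat.dvd_antisymm h3 h4⟩

lemma conic_sep {x y x' y' c D e s : ℝ} (hx1 : 1 ≤ x) (hy1 : 1 ≤ y) (hle : y ≤ x)
    (hxx : x * x' = c) (hyy : y * y' = c) (hcD : |c| ≤ e * |D|)
    (hcross : y * x' - x * y' = 2 * s * D) (hs : 1 ≤ s) (hc : c ≠ 0) (he : 1 ≤ e) :
    y / e ≤ x - y := by
  have hsq : 0 ≤ x ^ 2 - y ^ 2 := by nlinarith
  have hc' : 0 < |c| := abs_pos.2 hc
  have h1 : x * y * (y * x' - x * y') = c * (y ^ 2 - x ^ 2) := by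
    have : x * y * (y * x' - x * y') = y ^ 2 * (x * x') - x ^ 2 * (y * y') := by ring
    rw [this, hxx, hyy]; ring
  have h2 : x * y * (2 * |D|) ≤ |c| * (x ^ 2 - y ^ 2) := by
    have h3 : |x * y * (y * x' - x * y')| = |c| * (x ^ 2 - y ^ 2) := by
      rw [h1, abs_mul, abs_sub_comm, abs_of_nonneg (a := x ^ 2 - y ^ 2) hsq]
    rw [← h3, hcross, abs_mul, abs_of_pos (a := x * y) (by positivity), abs_mul,
      abs_of_pos (a := 2 * s) (by positivity)]
    gcongr; linarith
  have h4 : x * y * (2 * |c|) ≤ e * (|c| * (x ^ 2 - y ^ 2)) := by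
    calc x * y * (2 * |c|) ≤ x * y * (2 * (e * |D|)) := by gcongr
      _ = e * (x * y * (2 * |D|)) := by ring
      _ ≤ _ := by gcongr
  have h5 : 2 * (x * y) ≤ e * (x ^ 2 - y ^ 2) := by
    refine le_of_mul_le_mul_right ?_ hc'
    linarith
  have h6 : e * (x ^ 2 - y ^ 2) ≤ e * ((x - y) * (2 * x)) := by
    refine mul_le_mul_of_nonneg_left ?_ (by linarith)
    nlinarith
  rw [div_le_iff₀ (by linarith)]
  have h7 : y * (2 * x) ≤ (x - y) * e * (2 * x) := by linarith
  exact le_of_mul_le_mul_right h7 (by linarith)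

lemma conic_class {a b M e : ℕ} {c : ℤ} (ha : 0 < a) (hb : 0 < b) (hc : c ≠ 0) (he : 0 < e)
    (hM : 0 < M) (S : Finset (ℕ × ℕ)) (hS : ∀ p ∈ S, Nat.Coprime p.1 p.2 ∧ p.1 ≤ M ∧ p.2 ≤ M ∧
      (a : ℤ) * p.1 ^ 2 - b * p.2 ^ 2 = c)
    (hD : ∀ p ∈ S, ∀ p' ∈ S, c ∣ e * ((p.1 : ℤ) * p'.2 - p'.1 * p.2)) :
    (S.card : ℝ) ≤ 1 + 2 * e * Real.log ((a + b) * M) := by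
  have ha' : (1 : ℝ) ≤ a := by exact_mod_cast ha
  have hb' : (1 : ℝ) ≤ b := by exact_mod_cast hb
  have he' : (1 : ℝ) ≤ e := by exact_mod_cast he
  have hM' : (1 : ℝ) ≤ M := by exact_mod_cast hM
  have hsa : √(a : ℝ) ^ 2 = a := Real.sq_sqrt (by linarith)
  have hsb : √(b : ℝ) ^ 2 = b := Real.sq_sqrt (by linarith)
  have hsa1 : 1 ≤ √(a : ℝ) := Real.one_le_sqrt.2 ha'
  have hsb1 : 1 ≤ √(b : ℝ) := Real.one_le_sqrt.2 hb'
  have hΛ : (1 : ℝ) ≤ (a + b) * M := by nlinarith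
  have hlow : ∀ p ∈ S, 1 ≤ √(a : ℝ) * p.1 + √(b : ℝ) * p.2 := by
    intro p hp
    rcases Nat.eq_zero_or_pos p.1 with h0 | h0
    · have h2 := (hS p hp).1
      rw [h0, Nat.coprime_zero_left] at h2
      rw [h0, h2]; simp; linarith
    · have : (1 : ℝ) ≤ p.1 := by exact_mod_cast h0
      have : 0 ≤ √(b : ℝ) * p.2 := by positivity
      nlinarith
  refine sep_card S (fun p => √(a : ℝ) * p.1 + √(b : ℝ) * p.2) he' hΛ ?_ ?_
  · intro p hp
    refine ⟨hlow p hp, ?_⟩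
    have h1 : (p.1 : ℝ) ≤ M := by exact_mod_cast (hS p hp).2.1
    have h2 : (p.2 : ℝ) ≤ M := by exact_mod_cast (hS p hp).2.2.1
    have h3 : √(a : ℝ) ≤ a := by nlinarith
    have h4 : √(b : ℝ) ≤ b := by nlinarith
    calc √(a : ℝ) * p.1 + √(b : ℝ) * p.2 ≤ a * M + b * M := by gcongr
      _ = _ := by ring
  · intro p hp p' hp' hne hle
    set x := √(a : ℝ) * p.1 + √(b : ℝ) * p.2 with hx
    set y := √(a : ℝ) * p'.1 + √(b : ℝ) * p'.2 with hy
    set x' := √(a : ℝ) * p.1 - √(b : ℝ) * p.2 with hx'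
    set y' := √(a : ℝ) * p'.1 - √(b : ℝ) * p'.2 with hy'
    have hx1 : 1 ≤ x := hlow p hp
    have hy1 : 1 ≤ y := hlow p' hp'
    have hxx : x * x' = c := by
      have : (a : ℝ) * p.1 ^ 2 - b * p.2 ^ 2 = c := by exact_mod_cast (hS p hp).2.2.2
      rw [← this, hx, hx', ← hsa, ← hsb]; rw [hsa, hsb]; nlinarith
    have hyy : y * y' = c := by
      have : (a : ℝ) * p'.1 ^ 2 - b * p'.2 ^ 2 = c := by exact_mod_cast (hS p' hp').2.2.2
      rw [← this, hy, hy', ← hsa, ← hsb]; rw [hsa, hsb]; nlinarith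
    set D : ℤ := (p.1 : ℤ) * p'.2 - p'.1 * p.2 with hDdef
    have hD0 : D ≠ 0 := by
      intro h0
      have h1 : p.1 * p'.2 = p'.1 * p.2 := by
        have : (p.1 : ℤ) * p'.2 = p'.1 * p.2 := by linarith
        exact_mod_cast this
      have := coprime_pair_eq (hS p hp).1 (hS p' hp').1 h1
      exact hne (Prod.ext this.1 this.2)
    have hcD : |(c : ℝ)| ≤ e * |(D : ℝ)| := by
      have h1 := hD p hp p' hp'
      have h2 : |c| ≤ |e * D| := by
        rw [Int.abs_eq_natAbs, Int.abs_eq_natAbs]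
        exact Int.ofNat_le.2 (Int.natAbs_le_of_dvd_ne_zero h1 (mul_ne_zero (by exact_mod_cast he.ne') hD0))
      rw [abs_mul] at h2
      have h3 : |(e : ℤ)| = e := abs_of_nonneg (by positivity)
      rw [h3] at h2
      exact_mod_cast h2
    have hcross : y * x' - x * y' = 2 * (√(a : ℝ) * √(b : ℝ)) * D := by
      rw [hx, hy, hx', hy', hDdef]; push_cast; ring
    exact conic_sep hx1 hy1 hle hxx hyy hcD hcross (one_le_mul_of_one_le_of_one_le hsa1 hsb1)
      (by exact_mod_cast hc) he'

lemma conic_primitive {a b M : ℕ} {c : ℤ} (ha : 0 < a) (hb : 0 < b) (hab : Nat.Coprime a b)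
    (hc : c ≠ 0) (hM : 0 < M) (S : Finset (ℕ × ℕ)) (hS : ∀ p ∈ S, Nat.Coprime p.1 p.2 ∧ p.1 ≤ M ∧
      p.2 ≤ M ∧ (a : ℤ) * p.1 ^ 2 - b * p.2 ^ 2 = c) :
    (S.card : ℝ) ≤ c.natAbs.divisors.card *
      (1 + 4 * (sqs a * sqs b : ℕ) * Real.log ((a + b) * M)) := by
  have hab' : IsCoprime (a : ℤ) (b : ℤ) := Nat.isCoprime_iff_coprime.2 hab
  have hlog : 0 ≤ Real.log ((a + b) * M) := by
    refine Real.log_nonneg ?_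
    have : (1 : ℝ) ≤ a := by exact_mod_cast ha
    have : (0 : ℝ) ≤ b := by positivity
    have : (1 : ℝ) ≤ M := by exact_mod_cast hM
    nlinarith
  rcases S.eq_empty_or_nonempty with rfl | ⟨p₁, hp₁⟩
  · simp; positivity
  have hn0 : c.natAbs ≠ 0 := Int.natAbs_ne_zero.2 hc
  set D : ℕ × ℕ → ℕ × ℕ → ℤ := fun p p' => (p.1 : ℤ) * p'.2 - p'.1 * p.2 with hDdef
  set E : ℕ × ℕ → ℕ × ℕ → ℤ := fun p p' => (p.1 : ℤ) * p'.2 + p'.1 * p.2 with hEdef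
  have hDE : ∀ p ∈ S, ∀ p' ∈ S, c ∣ D p p' * E p p' := by
    intro p hp p' hp'
    have h1 := (hS p hp).2.2.2
    have h2 := (hS p' hp').2.2.2
    obtain ⟨x, y, hxy⟩ := hab'
    refine ⟨x * ((p'.2 : ℤ) ^ 2 - p.2 ^ 2) + y * ((p'.1 : ℤ) ^ 2 - p.1 ^ 2), ?_⟩
    simp only [hDdef, hEdef]
    have e1 : (a : ℤ) * (((p.1 : ℤ) * p'.2 - p'.1 * p.2) * ((p.1 : ℤ) * p'.2 + p'.1 * p.2)) =
        c * ((p'.2 : ℤ) ^ 2 - p.2 ^ 2) := by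
      linear_combination (p'.2 : ℤ) ^ 2 * h1 - (p.2 : ℤ) ^ 2 * h2
    have e2 : (b : ℤ) * (((p.1 : ℤ) * p'.2 - p'.1 * p.2) * ((p.1 : ℤ) * p'.2 + p'.1 * p.2)) =
        c * ((p'.1 : ℤ) ^ 2 - p.1 ^ 2) := by
      linear_combination (p'.1 : ℤ) ^ 2 * h1 - (p.1 : ℤ) ^ 2 * h2
    linear_combination x * e1 + y * e2 -
      (((p.1 : ℤ) * p'.2 - p'.1 * p.2) * ((p.1 : ℤ) * p'.2 + p'.1 * p.2)) * hxy
  set g : ℕ × ℕ → ℕ := fun p => Nat.gcd c.natAbs (D p₁ p).natAbs with hg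
  have hmaps : ∀ p ∈ S, g p ∈ c.natAbs.divisors := fun p _ =>
    Nat.mem_divisors.2 ⟨Nat.gcd_dvd_left _ _, hn0⟩
  rw [card_eq_sum_card_fiberwise hmaps, Nat.cast_sum, ← nsmul_eq_mul, ← sum_const]
  refine sum_le_sum fun d hd => ?_
  set Sd := S.filter fun p => g p = d with hSd
  rcases Sd.eq_empty_or_nonempty with h0 | ⟨p₂, hp₂⟩
  · rw [h0]; simp; positivity
  obtain ⟨f, hf⟩ := (Nat.mem_divisors.1 hd).1
  have hd0 : 0 < d := Nat.pos_of_ne_zero (by rintro rfl; simp at hf; omega)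
  have hdD : ∀ p ∈ Sd, (d : ℤ) ∣ D p₁ p := by
    intro p hp
    rw [hSd, mem_filter] at hp
    rw [← hp.2, Int.natCast_dvd]; exact Nat.gcd_dvd_right _ _
  have hfE : ∀ p ∈ Sd, (f : ℤ) ∣ E p₁ p := by
    intro p hp
    rw [hSd, mem_filter] at hp
    have h1 := hDE p₁ hp₁ p hp.1
    have h2 : d * f ∣ (D p₁ p).natAbs * (E p₁ p).natAbs := by
      rw [← hf, ← Int.natAbs_mul]; exact Int.natAbs_dvd_natAbs.2 h1
    have h3 : Nat.Coprime f ((D p₁ p).natAbs / d) := by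
      have h4 := Nat.coprime_div_gcd_div_gcd (m := c.natAbs) (n := (D p₁ p).natAbs)
        (Nat.gcd_pos_of_pos_left _ (Nat.pos_of_ne_zero hn0))
      have h5 : Nat.gcd c.natAbs (D p₁ p).natAbs = d := hp.2
      rw [h5, hf, Nat.mul_div_cancel_left _ hd0] at h4
      exact h4
    obtain ⟨k, hk⟩ : d ∣ (D p₁ p).natAbs := Int.natCast_dvd.1 (hdD p (by rw [hSd, mem_filter]; exact hp))
    rw [hk, Nat.mul_div_cancel_left _ hd0] at h3
    rw [hk, mul_assoc] at h2
    exact Int.natCast_dvd.2 (h3.dvd_of_dvd_mul_left (Nat.dvd_of_mul_dvd_mul_left hd0 h2))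
  set e := Nat.gcd d f with he
  have hepos : 0 < e := Nat.gcd_pos_of_pos_left _ hd0
  have hcop1 : IsCoprime (p₁.1 : ℤ) (p₁.2 : ℤ) := Nat.isCoprime_iff_coprime.2 (hS p₁ hp₁).1
  have hdvd : ∀ p ∈ Sd, ∀ p' ∈ Sd, c ∣ e * D p p' := by
    intro p hp p' hp'
    obtain ⟨x, y, hxy⟩ := hcop1
    have h1 : (d : ℤ) ∣ D p p' := by
      have e1 : D p p' = x * (p.1 * D p₁ p' - p'.1 * D p₁ p) + y * (p.2 * D p₁ p' - p'.2 * D p₁ p) := by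
        simp only [hDdef]
        linear_combination (-(p.1 : ℤ) * p'.2 + p'.1 * p.2) * hxy
      rw [e1]
      exact dvd_add (dvd_mul_of_dvd_right (dvd_sub (dvd_mul_of_dvd_right (hdD p' hp') _)
        (dvd_mul_of_dvd_right (hdD p hp) _)) _) (dvd_mul_of_dvd_right (dvd_sub
        (dvd_mul_of_dvd_right (hdD p' hp') _) (dvd_mul_of_dvd_right (hdD p hp) _)) _)
    have h2 : (f : ℤ) ∣ D p p' := by
      have e1 : D p p' = x * (p.1 * E p₁ p' - p'.1 * E p₁ p) + y * (p'.2 * E p₁ p - p.2 * E p₁ p') := by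
        simp only [hDdef, hEdef]
        linear_combination (-(p.1 : ℤ) * p'.2 + p'.1 * p.2) * hxy
      rw [e1]
      exact dvd_add (dvd_mul_of_dvd_right (dvd_sub (dvd_mul_of_dvd_right (hfE p' hp') _)
        (dvd_mul_of_dvd_right (hfE p hp) _)) _) (dvd_mul_of_dvd_right (dvd_sub
        (dvd_mul_of_dvd_right (hfE p hp) _) (dvd_mul_of_dvd_right (hfE p' hp') _)) _)
    rw [← Int.natAbs_dvd, hf, ← Nat.gcd_mul_lcm d f, Nat.cast_mul]
    refine mul_dvd_mul_left _ ?_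
    rw [Int.natCast_dvd] at h1 h2 ⊢
    exact Nat.lcm_dvd h1 h2
  have hele : e ≤ 2 * (sqs a * sqs b) := by
    have hp₂S : p₂ ∈ S := (mem_filter.1 hp₂).1
    have h1 : (e : ℤ) ∣ D p₁ p₂ :=
      (Int.natCast_dvd_natCast.2 (Nat.gcd_dvd_left d f)).trans (hdD p₂ hp₂)
    have h2 : (e : ℤ) ∣ E p₁ p₂ :=
      (Int.natCast_dvd_natCast.2 (Nat.gcd_dvd_right d f)).trans (hfE p₂ hp₂)
    have h3 : e ∣ 2 * (p₁.1 * p₂.2) := by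
      have h := dvd_add h1 h2
      have e1 : D p₁ p₂ + E p₁ p₂ = ((2 * (p₁.1 * p₂.2) : ℕ) : ℤ) := by
        simp only [hDdef, hEdef]; push_cast; ring
      rw [e1] at h; exact_mod_cast h
    have h4 : e ∣ 2 * (p₂.1 * p₁.2) := by
      have h := dvd_sub h2 h1
      have e1 : E p₁ p₂ - D p₁ p₂ = ((2 * (p₂.1 * p₁.2) : ℕ) : ℤ) := by
        simp only [hDdef, hEdef]; push_cast; ring
      rw [e1] at h; exact_mod_cast h
    have h5 : e ∣ 2 * (p₁.1 * p₁.2) := by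
      have h6 : e ∣ (2 * (p₁.1 * p₁.2)) * p₂.1 := by
        have := dvd_mul_of_dvd_left h4 p₁.1
        rwa [show 2 * (p₂.1 * p₁.2) * p₁.1 = 2 * (p₁.1 * p₁.2) * p₂.1 by ring] at this
      have h7 : e ∣ (2 * (p₁.1 * p₁.2)) * p₂.2 := by
        have := dvd_mul_of_dvd_left h3 p₁.2
        rwa [show 2 * (p₁.1 * p₂.2) * p₁.2 = 2 * (p₁.1 * p₁.2) * p₂.2 by ring] at this
      have h8 := Nat.dvd_gcd h6 h7
      rw [Nat.gcd_mul_left, (hS p₂ hp₂S).1.gcd_eq_one, mul_one] at h8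
      exact h8
    have hee : e ^ 2 ∣ c.natAbs := by
      rw [hf, sq]; exact mul_dvd_mul (Nat.gcd_dvd_left d f) (Nat.gcd_dvd_right d f)
    have heq := (hS p₁ hp₁).2.2.2
    have hcopn := (hS p₁ hp₁).1
    set e₁ := Nat.gcd e p₁.1
    set e₂ := Nat.gcd e p₁.2
    have he₁ : e₁ ^ 2 ∣ b := by
      have h9 : (e₁ : ℤ) ^ 2 ∣ c := by
        rw [← Int.dvd_natAbs]
        exact_mod_cast (pow_dvd_pow_of_dvd (Nat.gcd_dvd_left e p₁.1) 2).trans hee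
      have h10 : (e₁ : ℤ) ^ 2 ∣ (p₁.1 : ℤ) ^ 2 := by
        exact_mod_cast pow_dvd_pow_of_dvd (Nat.gcd_dvd_right e p₁.1) 2
      have h11 : (e₁ : ℤ) ^ 2 ∣ (b : ℤ) * (p₁.2 : ℤ) ^ 2 := by
        have : (b : ℤ) * (p₁.2 : ℤ) ^ 2 = a * p₁.1 ^ 2 - c := by linarith
        rw [this]; exact dvd_sub (dvd_mul_of_dvd_right h10 _) h9
      have h12 : e₁ ^ 2 ∣ b * p₁.2 ^ 2 := by exact_mod_cast h11
      refine Nat.Coprime.dvd_of_dvd_mul_right ?_ h12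
      exact Nat.Coprime.pow 2 2 (Nat.Coprime.coprime_dvd_left (Nat.gcd_dvd_right e p₁.1) hcopn)
    have he₂ : e₂ ^ 2 ∣ a := by
      have h9 : (e₂ : ℤ) ^ 2 ∣ c := by
        rw [← Int.dvd_natAbs]
        exact_mod_cast (pow_dvd_pow_of_dvd (Nat.gcd_dvd_left e p₁.2) 2).trans hee
      have h10 : (e₂ : ℤ) ^ 2 ∣ (p₁.2 : ℤ) ^ 2 := by
        exact_mod_cast pow_dvd_pow_of_dvd (Nat.gcd_dvd_right e p₁.2) 2
      have h11 : (e₂ : ℤ) ^ 2 ∣ (a : ℤ) * (p₁.1 : ℤ) ^ 2 := by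
        have : (a : ℤ) * (p₁.1 : ℤ) ^ 2 = c + b * p₁.2 ^ 2 := by linarith
        rw [this]; exact dvd_add h9 (dvd_mul_of_dvd_right h10 _)
      have h12 : e₂ ^ 2 ∣ a * p₁.1 ^ 2 := by exact_mod_cast h11
      refine Nat.Coprime.dvd_of_dvd_mul_right ?_ h12
      exact Nat.Coprime.pow 2 2 (Nat.Coprime.coprime_dvd_left (Nat.gcd_dvd_right e p₁.2) hcopn.symm)
    have h13 : e ∣ 2 * (e₁ * e₂) := by
      have h14 : Nat.gcd e (p₁.1 * p₁.2) = e₁ * e₂ := Nat.Coprime.gcd_mul e hcopn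
      rw [← h14, ← Nat.gcd_mul_left]
      exact Nat.dvd_gcd (dvd_mul_left _ _) h5
    have hpos : 0 < 2 * (e₁ * e₂) := by
      have := Nat.gcd_pos_of_pos_left p₁.1 hepos
      have := Nat.gcd_pos_of_pos_left p₁.2 hepos
      positivity
    calc e ≤ 2 * (e₁ * e₂) := Nat.le_of_dvd hpos h13
      _ = 2 * (e₂ * e₁) := by ring
      _ ≤ _ := by
        gcongr
        · exact le_sqs ha he₂
        · exact le_sqs hb he₁
  refine (conic_class ha hb hc hepos hM Sd (fun p hp => hS p (mem_filter.1 hp).1) hdvd).trans ?_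
  have : (e : ℝ) ≤ 2 * (sqs a * sqs b : ℕ) := by exact_mod_cast hele
  have : 2 * (e : ℝ) * Real.log ((a + b) * M) ≤
      2 * (2 * (sqs a * sqs b : ℕ)) * Real.log ((a + b) * M) := by gcongr
  linarith

lemma log_le_dom {B n : ℕ} {T : ℝ} (hT : Dom B T) (hn : n ≤ B) (hn0 : 0 < n) :
    Real.log n ≤ T := by
  have h1 := log_add_one_le_harmonic n
  have h2 := hT.harm_le n hn
  rw [harmonic_eq_sum_Icc] at h1
  push_cast at h1
  have h3 : Real.log n ≤ Real.log (n + 1) :=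
    Real.log_le_log (by exact_mod_cast hn0) (by linarith)
  simp only [one_div] at h2
  linarith

lemma conic_general {a b M B : ℕ} {c : ℤ} {T : ℝ} (hT : Dom B T) (ha : 0 < a) (hb : 0 < b)
    (hab : Nat.Coprime a b) (hc : c ≠ 0) (hM : 0 < M) (hB : (a + b) * M ≤ B) (hcB : c.natAbs ≤ B)
    (S : Finset (ℕ × ℕ)) (hS : ∀ p ∈ S, p.1 ≤ M ∧ p.2 ≤ M ∧
      (a : ℤ) * p.1 ^ 2 - b * p.2 ^ 2 = c) :
    (S.card : ℝ) ≤ 5 * T ^ 3 * (sqs a * sqs b) := by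
  have hT1 := hT.one_le
  have hca : 0 < c.natAbs := Int.natAbs_pos.2 hc
  have hsa : (1 : ℝ) ≤ sqs a := by exact_mod_cast one_le_sqs ha
  have hsb : (1 : ℝ) ≤ sqs b := by exact_mod_cast one_le_sqs hb
  have hlog0 : 0 ≤ Real.log (((a : ℝ) + b) * M) := by
    have : 1 ≤ (a + b) * M := Nat.mul_pos (by omega) hM
    exact Real.log_nonneg (by exact_mod_cast this)
  have hss : (1 : ℝ) ≤ sqs a * sqs b := one_le_mul_of_one_le_of_one_le hsa hsb
  have hlog : Real.log ((a + b) * M) ≤ T := by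
    have := log_le_dom hT hB (Nat.mul_pos (by omega) hM)
    push_cast at this; exact this
  have hκ : ∀ p ∈ S, 0 < Nat.gcd p.1 p.2 ∧ ((Nat.gcd p.1 p.2 : ℤ) ^ 2) ∣ c := by
    intro p hp
    obtain ⟨h1, h2, h3⟩ := hS p hp
    refine ⟨Nat.pos_of_ne_zero fun h0 => ?_, ?_⟩
    · rw [Nat.gcd_eq_zero_iff] at h0
      rw [h0.1, h0.2] at h3
      exact hc (by rw [← h3]; simp)
    · rw [← h3]
      have e1 : (Nat.gcd p.1 p.2 : ℤ) ∣ p.1 := Int.natCast_dvd_natCast.2 (Nat.gcd_dvd_left _ _)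
      have e2 : (Nat.gcd p.1 p.2 : ℤ) ∣ p.2 := Int.natCast_dvd_natCast.2 (Nat.gcd_dvd_right _ _)
      exact dvd_sub (dvd_mul_of_dvd_right (pow_dvd_pow_of_dvd e1 2) _)
        (dvd_mul_of_dvd_right (pow_dvd_pow_of_dvd e2 2) _)
  have hmaps : ∀ p ∈ S, Nat.gcd p.1 p.2 ∈ c.natAbs.divisors := by
    intro p hp
    rw [Nat.mem_divisors]
    refine ⟨?_, hca.ne'⟩
    have := (dvd_pow_self (Nat.gcd p.1 p.2 : ℤ) two_ne_zero).trans (hκ p hp).2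
    exact Int.natCast_dvd.1 this
  have hfib : ∀ κ ∈ c.natAbs.divisors,
      ((S.filter fun p => Nat.gcd p.1 p.2 = κ).card : ℝ) ≤ T * (1 + 4 * (sqs a * sqs b) * T) := by
    intro κ _
    rcases (S.filter fun p => Nat.gcd p.1 p.2 = κ).eq_empty_or_nonempty with h0 | ⟨p₀, hp₀⟩
    · rw [h0]; simp; positivity
    rw [mem_filter] at hp₀
    obtain ⟨hk0, hk2⟩ := hκ p₀ hp₀.1
    rw [hp₀.2] at hk0 hk2
    obtain ⟨c', hc'⟩ := hk2
    have hc'0 : c' ≠ 0 := by rintro rfl; simp at hc'; exact hc hc'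
    have hkz : (κ : ℤ) ^ 2 ≠ 0 := by positivity
    have hinj : Set.InjOn (fun p : ℕ × ℕ => (p.1 / κ, p.2 / κ))
        (S.filter fun p => Nat.gcd p.1 p.2 = κ) := by
      intro p hp p' hp' h
      rw [mem_coe, mem_filter] at hp hp'
      simp only [Prod.mk.injEq] at h
      have d1 : κ ∣ p.1 := hp.2 ▸ Nat.gcd_dvd_left _ _
      have d2 : κ ∣ p.2 := hp.2 ▸ Nat.gcd_dvd_right _ _
      have d3 : κ ∣ p'.1 := hp'.2 ▸ Nat.gcd_dvd_left _ _
      have d4 : κ ∣ p'.2 := hp'.2 ▸ Nat.gcd_dvd_right _ _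
      refine Prod.ext ?_ ?_
      · rw [← Nat.div_mul_cancel d1, h.1, Nat.div_mul_cancel d3]
      · rw [← Nat.div_mul_cancel d2, h.2, Nat.div_mul_cancel d4]
    rw [← card_image_of_injOn hinj]
    have h1 := conic_primitive ha hb hab hc'0 hM
      ((S.filter fun p => Nat.gcd p.1 p.2 = κ).image fun p : ℕ × ℕ => (p.1 / κ, p.2 / κ)) ?_
    · refine h1.trans ?_
      have h2 : (c'.natAbs.divisors.card : ℝ) ≤ T := by
        refine hT.div_le _ (Int.natAbs_pos.2 hc'0) (le_trans ?_ hcB)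
        rw [hc', Int.natAbs_mul]
        exact Nat.le_mul_of_pos_left _ (Int.natAbs_pos.2 hkz)
      push_cast
      refine mul_le_mul h2 (by gcongr) (by positivity) (by linarith)
    · intro p hp
      rw [mem_image] at hp
      obtain ⟨p', hp', rfl⟩ := hp
      rw [mem_filter] at hp'
      obtain ⟨e1, e2, e3⟩ := hS p' hp'.1
      refine ⟨?_, (Nat.div_le_self _ _).trans e1, (Nat.div_le_self _ _).trans e2, ?_⟩
      · have := Nat.coprime_div_gcd_div_gcd (m := p'.1) (n := p'.2) (by rw [hp'.2]; exact hk0)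
        rwa [hp'.2] at this
      · obtain ⟨x, hx⟩ : κ ∣ p'.1 := hp'.2 ▸ Nat.gcd_dvd_left _ _
        obtain ⟨y, hy⟩ : κ ∣ p'.2 := hp'.2 ▸ Nat.gcd_dvd_right _ _
        simp only
        rw [hx, hy, Nat.mul_div_cancel_left _ hk0, Nat.mul_div_cancel_left _ hk0]
        rw [hx, hy] at e3
        push_cast at e3
        refine mul_left_cancel₀ hkz ?_
        rw [← hc', ← e3]; ring
  rw [card_eq_sum_card_fiberwise hmaps]
  push_cast
  refine (sum_le_sum hfib).trans ?_
  rw [sum_const, nsmul_eq_mul]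
  have h2 : (c.natAbs.divisors.card : ℝ) ≤ T := hT.div_le _ hca hcB
  calc (c.natAbs.divisors.card : ℝ) * (T * (1 + 4 * (sqs a * sqs b) * T))
      ≤ T * (T * ((sqs a * sqs b) * T + 4 * (sqs a * sqs b) * T)) := by
        gcongr
        calc (1 : ℝ) = 1 * 1 := by ring
          _ ≤ _ := by gcongr
    _ = _ := by ring

/-- Pairs of values of the form `h(h² + 3 A²)` that agree, with `h` and `j` sharing a large divisor. -/
noncomputable def Wn (N G : ℕ) : Finset ((ℕ × ℕ) × (ℕ × ℕ)) :=
  ((Icc 1 (2 * N) ×ˢ Icc 1 (2 * N)) ×ˢ (range (2 * N + 1) ×ˢ range (2 * N + 1))).filter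
    fun w => w.1.1 * (w.1.1 ^ 2 + 3 * w.2.1 ^ 2) = w.1.2 * (w.1.2 ^ 2 + 3 * w.2.2 ^ 2) ∧
      w.1.1 ≠ w.1.2 ∧ G ≤ Nat.gcd w.1.1 w.1.2

lemma Wn_fiber {N G B : ℕ} {T : ℝ} (hT : Dom B T) (hN : 0 < N) (hB : 16 * N ^ 3 ≤ B)
    {h j : ℕ} (hh : h ∈ Icc 1 (2 * N)) (hj : j ∈ Icc 1 (2 * N)) :
    (((Wn N G).filter fun w => w.1 = (h, j)).card : ℝ) ≤
      5 * T ^ 3 * (sqs (h / Nat.gcd h j) * sqs (j / Nat.gcd h j)) := by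
  have hT1 := hT.one_le
  rcases ((Wn N G).filter fun w => w.1 = (h, j)).eq_empty_or_nonempty with h0 | ⟨w₀, hw₀⟩
  · rw [h0]; simp; positivity
  rw [mem_Icc] at hh hj
  obtain ⟨h', hh'⟩ := Nat.gcd_dvd_left h j
  obtain ⟨j', hj'⟩ := Nat.gcd_dvd_right h j
  have hcop : Nat.Coprime (h / Nat.gcd h j) (j / Nat.gcd h j) :=
    Nat.coprime_div_gcd_div_gcd (Nat.gcd_pos_of_pos_left _ hh.1)
  have hg0 : 0 < Nat.gcd h j := Nat.gcd_pos_of_pos_left _ hh.1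
  have eh : h / Nat.gcd h j = h' := by
    exact Nat.div_eq_of_eq_mul_right hg0 hh'
  have ej : j / Nat.gcd h j = j' := Nat.div_eq_of_eq_mul_right hg0 hj'
  rw [eh, ej] at hcop ⊢
  generalize Nat.gcd h j = g at hh' hj' hg0
  have hh0 : 0 < h' := Nat.pos_of_ne_zero (by rintro rfl; simp at hh'; omega)
  have hj0 : 0 < j' := Nat.pos_of_ne_zero (by rintro rfl; simp at hj'; omega)
  have hhN : h' ≤ 2 * N := le_trans (by rw [hh']; exact Nat.le_mul_of_pos_left _ hg0) hh.2
  have hjN : j' ≤ 2 * N := le_trans (by rw [hj']; exact Nat.le_mul_of_pos_left _ hg0) hj.2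
  have key : ∀ w ∈ (Wn N G).filter (fun w => w.1 = (h, j)),
      w.2.1 ≤ 2 * N ∧ w.2.2 ≤ 2 * N ∧ h' ≠ j' ∧
      3 * ((h' : ℤ) * w.2.1 ^ 2 - j' * w.2.2 ^ 2) = (g : ℤ) ^ 2 * ((j' : ℤ) ^ 3 - (h' : ℤ) ^ 3) := by
    intro w hw
    simp only [Wn, mem_filter, mem_product, mem_range] at hw
    obtain ⟨⟨⟨_, h3, h4⟩, h5, h6, _⟩, h8⟩ := hw
    rw [h8] at h5 h6
    simp only at h5 h6
    refine ⟨by omega, by omega, ?_, ?_⟩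
    · rintro rfl; exact h6 (hh'.trans hj'.symm)
    · have h9 : (h : ℤ) * ((h : ℤ) ^ 2 + 3 * (w.2.1 : ℤ) ^ 2) =
        j * ((j : ℤ) ^ 2 + 3 * (w.2.2 : ℤ) ^ 2) := by exact_mod_cast h5
      have e1 : (h : ℤ) = g * h' := by exact_mod_cast hh'
      have e2 : (j : ℤ) = g * j' := by exact_mod_cast hj'
      rw [e1, e2] at h9
      have hgz : (g : ℤ) ≠ 0 := by exact_mod_cast hg0.ne'
      refine mul_left_cancel₀ hgz ?_
      linear_combination h9
  obtain ⟨c1, c2, c3, c4⟩ := key w₀ hw₀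
  have hcz : (h' : ℤ) * w₀.2.1 ^ 2 - j' * w₀.2.2 ^ 2 ≠ 0 := by
    intro h0
    rw [h0, mul_zero] at c4
    have hgz : (g : ℤ) ^ 2 ≠ 0 := by positivity
    have h1 : (j' : ℤ) ^ 3 = (h' : ℤ) ^ 3 := by
      have := (mul_eq_zero.1 c4.symm).resolve_left hgz
      linarith
    have h2 : j' ^ 3 = h' ^ 3 := by exact_mod_cast h1
    exact c3 (Nat.pow_left_injective (n := 3) (by norm_num) h2).symm
  have hinj : Set.InjOn (fun w : (ℕ × ℕ) × (ℕ × ℕ) => w.2)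
      ((Wn N G).filter fun w => w.1 = (h, j)) := by
    intro w hw w' hw' e
    rw [mem_coe, mem_filter] at hw hw'
    exact Prod.ext (hw.2.trans hw'.2.symm) e
  rw [← card_image_of_injOn hinj]
  refine conic_general hT hh0 hj0 hcop hcz (M := 2 * N) (by omega) ?_ ?_ _ ?_
  · refine le_trans ?_ hB
    calc (h' + j') * (2 * N) ≤ (2 * N + 2 * N) * (2 * N) := by gcongr
      _ ≤ 16 * N ^ 3 := by nlinarith [Nat.mul_le_mul hN (le_refl (N ^ 2))]
  · refine le_trans ?_ hB
    have h1 : ((h' : ℤ) * w₀.2.1 ^ 2) ≤ 16 * N ^ 3 := by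
      calc ((h' : ℤ) * (w₀.2.1 : ℤ) ^ 2) ≤ ((2 * N : ℕ) : ℤ) * ((2 * N : ℕ) : ℤ) ^ 2 := by gcongr
        _ ≤ _ := by push_cast; nlinarith [pow_pos (Int.natCast_pos.2 hN) 3]
    have h2 : ((j' : ℤ) * w₀.2.2 ^ 2) ≤ 16 * N ^ 3 := by
      calc ((j' : ℤ) * (w₀.2.2 : ℤ) ^ 2) ≤ ((2 * N : ℕ) : ℤ) * ((2 * N : ℕ) : ℤ) ^ 2 := by gcongr
        _ ≤ _ := by push_cast; nlinarith [pow_pos (Int.natCast_pos.2 hN) 3]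
    have h3 : 0 ≤ (h' : ℤ) * w₀.2.1 ^ 2 := by positivity
    have h4 : 0 ≤ (j' : ℤ) * w₀.2.2 ^ 2 := by positivity
    zify
    rw [abs_le]
    constructor <;> linarith
  · intro p hp
    rw [mem_image] at hp
    obtain ⟨w, hw, rfl⟩ := hp
    obtain ⟨e1, e2, e3, e4⟩ := key w hw
    refine ⟨e1, e2, ?_⟩
    linarith

lemma sum_sqs_div_le {B N g : ℕ} {T : ℝ} (hT : Dom B T) (hB : 2 * N ≤ B) (hg : 0 < g) :
    ∑ h ∈ (Icc 1 (2 * N)).filter (fun h => g ∣ h), (sqs (h / g) : ℝ) ≤ 2 * N / g * T := by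
  have hT1 := hT.one_le
  have h2 : ∑ h ∈ (Icc 1 (2 * N)).filter (fun h => g ∣ h), (sqs (h / g) : ℝ) =
      ∑ k ∈ Icc 1 (2 * N / g), (sqs k : ℝ) := by
    symm
    refine sum_nbij (fun k => g * k) ?_ ?_ ?_ ?_
    · intro k hk
      rw [mem_Icc] at hk
      rw [mem_filter, mem_Icc]
      refine ⟨⟨Nat.mul_pos hg hk.1, ?_⟩, dvd_mul_right _ _⟩
      exact (Nat.mul_le_mul_left g hk.2).trans (Nat.mul_div_le (2 * N) g)
    · intro a _ b _ hab
      exact Nat.eq_of_mul_eq_mul_left hg hab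
    · intro q hq
      rw [mem_coe, mem_filter, mem_Icc] at hq
      obtain ⟨⟨h1, h2⟩, k, rfl⟩ := hq
      refine ⟨k, ?_, rfl⟩
      rw [mem_coe, mem_Icc]
      refine ⟨Nat.pos_of_mul_pos_left h1, (Nat.le_div_iff_mul_le hg).2 (by rwa [mul_comm])⟩
    · intro k _
      rw [Nat.mul_div_cancel_left _ hg]
  rw [h2]
  refine (sum_sqs_le hT ((Nat.div_le_self _ _).trans hB)).trans ?_
  refine mul_le_mul_of_nonneg_right ?_ (by linarith)
  refine Nat.cast_div_le.trans ?_
  push_cast; rfl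

lemma card_Wn_le {N G B : ℕ} {T : ℝ} (hT : Dom B T) (hN : 0 < N) (hB : 16 * N ^ 3 ≤ B)
    (hG : 0 < G) : ((Wn N G).card : ℝ) ≤ 40 * T ^ 5 * N ^ 2 / G := by
  have hT1 := hT.one_le
  have hNB : 2 * N ≤ B := le_trans (by nlinarith [Nat.pow_le_pow_right hN (show 1 ≤ 3 by norm_num)]) hB
  set I := Icc 1 (2 * N) with hI
  have hmaps : ∀ w ∈ Wn N G, w.1 ∈ (I ×ˢ I).filter fun p => G ≤ Nat.gcd p.1 p.2 := by
    intro w hw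
    simp only [Wn, mem_filter, mem_product] at hw ⊢
    exact ⟨hw.1.1, hw.2.2.2⟩
  rw [card_eq_sum_card_fiberwise hmaps]
  push_cast
  have h1 : ∀ p ∈ (I ×ˢ I).filter (fun p : ℕ × ℕ => G ≤ Nat.gcd p.1 p.2),
      (((Wn N G).filter fun w => w.1 = p).card : ℝ) ≤ ∑ g ∈ Icc G (2 * N),
        (5 * T ^ 3 * ((if g ∣ p.1 then (sqs (p.1 / g) : ℝ) else 0) *
          (if g ∣ p.2 then (sqs (p.2 / g) : ℝ) else 0))) := by
    intro p hp
    rw [mem_filter, mem_product] at hp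
    refine (Wn_fiber hT hN hB hp.1.1 hp.1.2).trans ?_
    have hp1 := mem_Icc.1 hp.1.1
    have := single_le_sum (s := Icc G (2 * N)) (a := Nat.gcd p.1 p.2)
      (f := fun g => 5 * T ^ 3 * ((if g ∣ p.1 then (sqs (p.1 / g) : ℝ) else 0) *
          (if g ∣ p.2 then (sqs (p.2 / g) : ℝ) else 0))) (fun g _ => by positivity)
      (mem_Icc.2 ⟨hp.2, (Nat.gcd_le_left _ hp1.1).trans hp1.2⟩)
    simpa only [Nat.gcd_dvd_left, Nat.gcd_dvd_right, if_true] using this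
  refine (sum_le_sum h1).trans ?_
  refine (sum_le_sum_of_subset_of_nonneg (filter_subset _ _)
    (fun p _ _ => sum_nonneg fun g _ => by positivity)).trans ?_
  rw [sum_comm]
  have h2 : ∀ g ∈ Icc G (2 * N), ∑ p ∈ I ×ˢ I,
      (5 * T ^ 3 * ((if g ∣ p.1 then (sqs (p.1 / g) : ℝ) else 0) *
          (if g ∣ p.2 then (sqs (p.2 / g) : ℝ) else 0))) ≤
      20 * T ^ 5 * N ^ 2 * (1 / (g : ℝ) ^ 2) := by
    intro g hg
    have hg0 : 0 < g := hG.trans_le (mem_Icc.1 hg).1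
    have h4 := sum_sqs_div_le hT hNB hg0
    rw [sum_filter] at h4
    have h5 : 0 ≤ ∑ h ∈ I, if g ∣ h then (sqs (h / g) : ℝ) else 0 :=
      sum_nonneg fun h _ => by positivity
    rw [← mul_sum, sum_product' I I (fun x y => (if g ∣ x then (sqs (x / g) : ℝ) else 0) *
      (if g ∣ y then (sqs (y / g) : ℝ) else 0)), ← sum_mul_sum]
    calc _ ≤ 5 * T ^ 3 * ((2 * N / g * T) * (2 * N / g * T)) := by gcongr
      _ = _ := by field_simp; ring
  refine (sum_le_sum h2).trans ?_
  rw [← mul_sum]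
  have h3 : ∑ g ∈ Icc G (2 * N), (1 / (g : ℝ) ^ 2) ≤ (2 : ℝ) / (G : ℝ) := by
    have h4 := sum_Ioo_inv_sq_le (α := ℝ) (G - 1) (2 * N + 1)
    have e : Ioo (G - 1) (2 * N + 1) = Icc G (2 * N) := by ext x; simp; omega
    rw [e, Nat.cast_sub hG] at h4
    simpa using h4
  calc _ ≤ 20 * T ^ 5 * N ^ 2 * (2 / (G : ℝ)) := by gcongr
    _ = _ := by ring

/-- Nontrivial solutions of `u³ + v³ = w³ + z³`. -/
noncomputable def Nt (N : ℕ) : Finset ((ℕ × ℕ) × (ℕ × ℕ)) :=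
  ((Icc 1 N ×ˢ Icc 1 N) ×ˢ (Icc 1 N ×ˢ Icc 1 N)).filter
    fun w => cub w.1 = cub w.2 ∧ w.1 ≠ w.2 ∧ w.1 ≠ w.2.swap

/-- The defect `u + v - w - z`. -/
def dfc (w : (ℕ × ℕ) × (ℕ × ℕ)) : ℤ := (w.1.1 : ℤ) + w.1.2 - w.2.1 - w.2.2

lemma mem_Nt {N : ℕ} {w : (ℕ × ℕ) × (ℕ × ℕ)} (hw : w ∈ Nt N) :
    (1 ≤ (w.1.1 : ℤ) ∧ (w.1.1 : ℤ) ≤ N) ∧ (1 ≤ (w.1.2 : ℤ) ∧ (w.1.2 : ℤ) ≤ N) ∧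
    (1 ≤ (w.2.1 : ℤ) ∧ (w.2.1 : ℤ) ≤ N) ∧ (1 ≤ (w.2.2 : ℤ) ∧ (w.2.2 : ℤ) ≤ N) ∧
    (w.1.1 : ℤ) ^ 3 + (w.1.2 : ℤ) ^ 3 = (w.2.1 : ℤ) ^ 3 + (w.2.2 : ℤ) ^ 3 ∧
    (w.1.1 : ℤ) ≠ w.2.1 ∧ (w.1.1 : ℤ) ≠ w.2.2 ∧ (w.1.2 : ℤ) ≠ w.2.1 ∧ (w.1.2 : ℤ) ≠ w.2.2 := by
  obtain ⟨⟨u, v⟩, ⟨a, z⟩⟩ := w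
  rw [Nt, mem_filter] at hw
  simp only [cub, mem_product, mem_Icc, ne_eq, Prod.mk.injEq, Prod.swap_prod_mk] at hw ⊢
  obtain ⟨⟨⟨⟨h1, h2⟩, h3, h4⟩, ⟨h5, h6⟩, h7, h8⟩, h9, h10, h11⟩ := hw
  have hinj := Nat.pow_left_injective (n := 3) (by norm_num)
  have e1 : u ≠ a := by
    rintro rfl
    exact h10 ⟨rfl, hinj (by simpa using h9)⟩
  have e2 : u ≠ z := by
    rintro rfl
    exact h11 ⟨rfl, hinj (by simp only; omega)⟩
  have e3 : v ≠ a := by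
    rintro rfl
    exact h11 ⟨hinj (by simp only; omega), rfl⟩
  have e4 : v ≠ z := by
    rintro rfl
    exact h10 ⟨hinj (by simp only; omega), rfl⟩
  refine ⟨by omega, by omega, by omega, by omega, by exact_mod_cast h9, ?_, ?_, ?_, ?_⟩ <;> omega

lemma dfc_ne_zero {N : ℕ} {w : (ℕ × ℕ) × (ℕ × ℕ)} (hw : w ∈ Nt N) : dfc w ≠ 0 := by
  obtain ⟨h1, h2, h3, h4, h5, h6, h7, h8, h9⟩ := mem_Nt hw
  intro h0
  rw [dfc] at h0
  have h10 : (w.2.2 : ℤ) = w.1.1 + w.1.2 - w.2.1 := by linarith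
  rw [h10] at h5
  have h11 : ((w.1.1 : ℤ) + w.1.2) * (((w.1.1 : ℤ) - w.2.1) * ((w.1.2 : ℤ) - w.2.1)) = 0 := by
    linarith
  rcases mul_eq_zero.1 h11 with h | h
  · linarith
  rcases mul_eq_zero.1 h with h | h
  · exact h6 (by linarith)
  · exact h8 (by linarith)

lemma card_small_le {N G B : ℕ} {T : ℝ} (hT : Dom B T) (hB : 32 * N ^ 3 ≤ B) :
    (((Nt N).filter fun w => |dfc w| < 3 * (G : ℤ) ^ 3).card : ℝ) ≤ 24 * T * G ^ 3 * N := by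
  have hT1 := hT.one_le
  set S := (Nt N).filter fun w => |dfc w| < 3 * (G : ℤ) ^ 3 with hS
  set t := (Ioo (-(3 * (G : ℤ) ^ 3)) (3 * (G : ℤ) ^ 3)) ×ˢ Icc 1 (2 * N) with ht
  have hmaps : ∀ w ∈ S, (dfc w, w.1.1 + w.2.1) ∈ t := by
    intro w hw
    rw [hS, mem_filter] at hw
    obtain ⟨h1, h2, h3, -⟩ := mem_Nt hw.1
    rw [ht, mem_product, mem_Ioo, mem_Icc, ← abs_lt]
    refine ⟨hw.2, ?_, ?_⟩ <;> simp only <;> omega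
  rw [card_eq_sum_card_fiberwise hmaps]
  push_cast
  have hfib : ∀ p ∈ t, ((S.filter fun w => (dfc w, w.1.1 + w.2.1) = p).card : ℝ) ≤ 2 * T := by
    rintro ⟨L, A⟩ hp
    rcases (S.filter fun w => (dfc w, w.1.1 + w.2.1) = (L, A)).eq_empty_or_nonempty with h0 | hne
    · rw [h0]; simp; linarith
    set m : ℤ := L * (L ^ 2 + 3 * (A : ℤ) ^ 2) with hm
    have hinj : Set.InjOn (fun w : (ℕ × ℕ) × (ℕ × ℕ) => (w.2.2 : ℤ) - w.1.2)
        (S.filter fun w => (dfc w, w.1.1 + w.2.1) = (L, A)) := by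
      intro w hw w' hw' e
      rw [mem_coe, mem_filter, hS, mem_filter, Prod.mk.injEq] at hw hw'
      obtain ⟨⟨a1, a2⟩, a3, a4⟩ := hw
      obtain ⟨⟨b1, b2⟩, b3, b4⟩ := hw'
      simp only at e
      obtain ⟨h1, h2, h3, h4, h5, h6, h7, h8, h9⟩ := mem_Nt a1
      obtain ⟨g1, g2, g3, g4, g5, g6, g7, g8, g9⟩ := mem_Nt b1
      rw [dfc] at a3 b3
      have a4' : (w.1.1 : ℤ) + w.2.1 = A := by exact_mod_cast a4
      have b4' : (w'.1.1 : ℤ) + w'.2.1 = A := by exact_mod_cast b4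
      have e1 : (w.1.1 : ℤ) = w'.1.1 := by linarith
      have e2 : (w.2.1 : ℤ) = w'.2.1 := by linarith
      have e3 : (w.1.2 : ℤ) = w'.1.2 := by
        rw [← e1, ← e2] at g5
        have k1 : (w'.2.2 : ℤ) = w.2.2 - w.1.2 + w'.1.2 := by linarith
        rw [k1] at g5
        have k2 : ((w.2.2 : ℤ) - w.1.2) * (((w.1.2 : ℤ) - w'.1.2) *
            ((w.2.2 : ℤ) + w'.1.2)) = 0 := by
          have : 3 * (((w.2.2 : ℤ) - w.1.2) * (((w.1.2 : ℤ) - w'.1.2) *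
            ((w.2.2 : ℤ) + w'.1.2))) = 0 := by linear_combination g5 - h5
          linarith
        rcases mul_eq_zero.1 k2 with h | h
        · exact absurd (by linarith) h9
        rcases mul_eq_zero.1 h with h | h
        · linarith
        · linarith
      have e4 : (w.2.2 : ℤ) = w'.2.2 := by linarith
      exact Prod.ext (Prod.ext (by exact_mod_cast e1) (by exact_mod_cast e3))
        (Prod.ext (by exact_mod_cast e2) (by exact_mod_cast e4))
    have hm0 : m ≠ 0 ∧ m.natAbs ≤ B := by
      obtain ⟨w, hw⟩ := hne
      rw [mem_filter, hS, mem_filter, Prod.mk.injEq] at hw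
      obtain ⟨⟨a1, a2⟩, a3, a4⟩ := hw
      have hL := dfc_ne_zero a1
      obtain ⟨h1, h2, h3, h4, -⟩ := mem_Nt a1
      have a4' : (w.1.1 : ℤ) + w.2.1 = A := by exact_mod_cast a4
      rw [a3] at hL
      rw [dfc] at a3
      refine ⟨mul_ne_zero hL (by positivity), ?_⟩
      have hL2 : |L| ≤ 2 * N := by rw [abs_le]; constructor <;> linarith
      have hB' : (32 * N ^ 3 : ℤ) ≤ B := by exact_mod_cast hB
      zify
      rw [hm, abs_mul, abs_of_nonneg (a := L ^ 2 + 3 * (A : ℤ) ^ 2) (by positivity), ← sq_abs]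
      refine le_trans ?_ hB'
      have hA : (A : ℤ) ≤ 2 * N := by linarith
      calc |L| * (|L| ^ 2 + 3 * (A : ℤ) ^ 2) ≤ (2 * N) * ((2 * N) ^ 2 + 3 * (2 * N) ^ 2) := by
            gcongr
        _ = _ := by ring
    rw [← card_image_of_injOn hinj]
    have hsub : ((S.filter fun w => (dfc w, w.1.1 + w.2.1) = (L, A)).image
        fun w : (ℕ × ℕ) × (ℕ × ℕ) => (w.2.2 : ℤ) - w.1.2) ⊆
        (m.natAbs.divisors.image (fun d : ℕ => (d : ℤ))) ∪
          (m.natAbs.divisors.image (fun d : ℕ => -(d : ℤ))) := by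
      intro j hj
      rw [mem_image] at hj
      obtain ⟨w, hw, rfl⟩ := hj
      rw [mem_filter, hS, mem_filter, Prod.mk.injEq] at hw
      obtain ⟨⟨a1, a2⟩, a3, a4⟩ := hw
      obtain ⟨h1, h2, h3, h4, h5, h6, h7, h8, h9⟩ := mem_Nt a1
      rw [dfc] at a3
      have a4' : (w.1.1 : ℤ) + w.2.1 = A := by exact_mod_cast a4
      have hd : ((w.2.2 : ℤ) - w.1.2) ∣ m := by
        refine ⟨4 * (w.2.2 ^ 2 + w.2.2 * w.1.2 + w.1.2 ^ 2) -
          (((w.2.2 : ℤ) - w.1.2) ^ 2 + 3 * ((w.2.2 : ℤ) - w.1.2) * L + 3 * L ^ 2 + 3 * A ^ 2), ?_⟩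
        rw [hm, ← a3, ← a4']
        linear_combination 4 * h5
      have hd' : ((w.2.2 : ℤ) - w.1.2).natAbs ∈ m.natAbs.divisors :=
        Nat.mem_divisors.2 ⟨Int.natAbs_dvd_natAbs.2 hd, Int.natAbs_ne_zero.2 hm0.1⟩
      rw [mem_union, mem_image, mem_image]
      rcases Int.natAbs_eq ((w.2.2 : ℤ) - w.1.2) with h | h
      · exact Or.inl ⟨_, hd', h.symm⟩
      · exact Or.inr ⟨_, hd', h.symm⟩
    have hc := (card_le_card hsub).trans ((card_union_le _ _).trans
      (add_le_add card_image_le card_image_le))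
    have hd := hT.div_le m.natAbs (Int.natAbs_pos.2 hm0.1) hm0.2
    have hc' : ((((S.filter fun w => (dfc w, w.1.1 + w.2.1) = (L, A)).image
        fun w : (ℕ × ℕ) × (ℕ × ℕ) => (w.2.2 : ℤ) - w.1.2).card : ℕ) : ℝ) ≤
        m.natAbs.divisors.card + m.natAbs.divisors.card := by exact_mod_cast hc
    linarith
  refine (sum_le_sum hfib).trans ?_
  rw [sum_const, nsmul_eq_mul]
  have ht1 : (t.card : ℝ) ≤ 6 * G ^ 3 * (2 * N) := by
    have : t.card ≤ 6 * G ^ 3 * (2 * N) := by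
      rw [ht, card_product, Int.card_Ioo, Nat.card_Icc, Nat.add_sub_cancel]
      refine Nat.mul_le_mul_right _ ?_
      have : (3 * (G : ℤ) ^ 3 - -(3 * (G : ℤ) ^ 3) - 1) ≤ ((6 * G ^ 3 : ℕ) : ℤ) := by
        push_cast; linarith
      exact Int.toNat_le.2 this
    exact_mod_cast this
  calc (t.card : ℝ) * (2 * T) ≤ 6 * G ^ 3 * (2 * N) * (2 * T) := by gcongr
    _ = _ := by ring

/-- Integer version of `Wn`. -/
noncomputable def Wz (N G : ℕ) : Finset ((ℤ × ℤ) × (ℤ × ℤ)) :=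
  ((Icc (-(2 * N : ℤ)) (2 * N) ×ˢ Icc (-(2 * N : ℤ)) (2 * N)) ×ˢ
    (Icc (-(2 * N : ℤ)) (2 * N) ×ˢ Icc (-(2 * N : ℤ)) (2 * N))).filter
    fun w => w.1.1 * (w.1.1 ^ 2 + 3 * w.2.1 ^ 2) = w.1.2 * (w.1.2 ^ 2 + 3 * w.2.2 ^ 2) ∧
      w.1.1 ≠ w.1.2 ∧ w.1.1 ≠ 0 ∧ w.1.2 ≠ 0 ∧ G ≤ Int.gcd w.1.1 w.1.2

lemma card_Wz_le (N G : ℕ) : (Wz N G).card ≤ 16 * (Wn N G).card := by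
  set f : (ℤ × ℤ) × (ℤ × ℤ) → (ℕ × ℕ) × (ℕ × ℕ) := fun w =>
    ((w.1.1.natAbs, w.1.2.natAbs), (w.2.1.natAbs, w.2.2.natAbs)) with hf
  have himg : (Wz N G).image f ⊆ Wn N G := by
    intro x hx
    rw [mem_image] at hx
    obtain ⟨⟨⟨h, j⟩, ⟨A, B⟩⟩, hw, rfl⟩ := hx
    rw [Wz, mem_filter] at hw
    simp only [mem_product, mem_Icc] at hw
    obtain ⟨⟨⟨h1, h2⟩, h3, h4⟩, h5, h6, h7, h8, h9⟩ := hw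
    simp only [Wn, hf, mem_filter, mem_product, mem_Icc, mem_range]
    have e : h.natAbs * (h.natAbs ^ 2 + 3 * A.natAbs ^ 2) =
        j.natAbs * (j.natAbs ^ 2 + 3 * B.natAbs ^ 2) := by
      have := congrArg (fun t : ℤ => |t|) h5
      rw [abs_mul, abs_mul, abs_of_nonneg (a := h ^ 2 + 3 * A ^ 2) (by positivity),
        abs_of_nonneg (a := j ^ 2 + 3 * B ^ 2) (by positivity)] at this
      zify
      simpa only [sq_abs] using this
    refine ⟨⟨⟨⟨by omega, by omega⟩, by omega, by omega⟩, by omega, by omega⟩, e, ?_, h9⟩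
    intro h10
    rcases Int.natAbs_eq_natAbs_iff.1 h10 with h11 | h11
    · exact h6 h11
    · rw [h11] at h5
      have k : j * (2 * j ^ 2 + 3 * A ^ 2 + 3 * B ^ 2) = 0 := by linarith
      rcases mul_eq_zero.1 k with k | k
      · exact h8 k
      · have : 0 < j ^ 2 := by positivity
        nlinarith [sq_nonneg A, sq_nonneg B]
  refine (card_le_mul_card_image (f := f) (Wz N G) 16 ?_).trans
    (Nat.mul_le_mul_left _ (card_le_card himg))
  rintro ⟨⟨a, b⟩, ⟨c, d⟩⟩ _
  have hsub : ((Wz N G).filter fun w => f w = ((a, b), (c, d))) ⊆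
      (({(a : ℤ), -(a : ℤ)} : Finset ℤ) ×ˢ ({(b : ℤ), -(b : ℤ)} : Finset ℤ)) ×ˢ
      (({(c : ℤ), -(c : ℤ)} : Finset ℤ) ×ˢ ({(d : ℤ), -(d : ℤ)} : Finset ℤ)) := by
    rintro ⟨⟨h, j⟩, ⟨A, B⟩⟩ hw
    rw [mem_filter] at hw
    simp only [hf, Prod.mk.injEq] at hw
    simp only [mem_product, mem_insert, mem_singleton]
    omega
  refine (card_le_card hsub).trans ?_
  rw [card_product, card_product, card_product]
  have h2 : ∀ x y : ℤ, ({x, y} : Finset ℤ).card ≤ 2 := fun x y => card_le_two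
  calc _ ≤ (2 * 2) * (2 * 2) := by gcongr <;> exact h2 _ _
    _ = 16 := by norm_num

lemma dfc_dvd {N : ℕ} {w : (ℕ × ℕ) × (ℕ × ℕ)} (hw : w ∈ Nt N) :
    dfc w ∣ 3 * (((w.1.1 : ℤ) + w.1.2) * (((w.1.1 : ℤ) - w.2.1) * ((w.1.2 : ℤ) - w.2.1))) := by
  obtain ⟨-, -, -, -, h5, -⟩ := mem_Nt hw
  obtain ⟨⟨u, v⟩, ⟨a, z⟩⟩ := w
  simp only [dfc] at h5 ⊢
  generalize (u : ℤ) = u at *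
  generalize (v : ℤ) = v at *
  generalize (a : ℤ) = a at *
  generalize (z : ℤ) = z at *
  refine ⟨(u + v - a) ^ 2 + (u + v - a) * z + z ^ 2, ?_⟩
  linear_combination -h5

lemma exists_gcd_ge {G L x y z : ℕ} (hL : 3 * G ^ 3 ≤ L) (hG : 0 < G) (h : L ∣ 3 * (x * (y * z))) :
    G ≤ Nat.gcd L x ∨ G ≤ Nat.gcd L y ∨ G ≤ Nat.gcd L z := by
  by_contra hcon
  push Not at hcon
  obtain ⟨h1, h2, h3⟩ := hcon
  have hL0 : 0 < L := lt_of_lt_of_le (by positivity) hL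
  have h4 : L ∣ 3 * (Nat.gcd L x * (Nat.gcd L y * Nat.gcd L z)) := by
    have e1 : L ∣ Nat.gcd L 3 * (Nat.gcd L x * (Nat.gcd L y * Nat.gcd L z)) := by
      have := Nat.dvd_gcd (dvd_refl L) h
      refine this.trans ((Nat.gcd_mul_right_dvd_mul_gcd _ _ _).trans ?_)
      refine mul_dvd_mul_left _ ((Nat.gcd_mul_right_dvd_mul_gcd _ _ _).trans ?_)
      exact mul_dvd_mul_left _ (Nat.gcd_mul_right_dvd_mul_gcd _ _ _)
    exact e1.trans (mul_dvd_mul_right (Nat.gcd_dvd_right _ _) _)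
  have p1 := Nat.gcd_pos_of_pos_left x hL0
  have p2 := Nat.gcd_pos_of_pos_left y hL0
  have p3 := Nat.gcd_pos_of_pos_left z hL0
  have h5 := Nat.le_of_dvd (by positivity) h4
  have h6 : Nat.gcd L x * (Nat.gcd L y * Nat.gcd L z) < G * (G * G) := by
    have := Nat.mul_lt_mul'' h2 h3
    exact Nat.mul_lt_mul'' h1 this
  nlinarith

lemma card_large_le {N G : ℕ} (hG : 0 < G) :
    ((Nt N).filter fun w => ¬ |dfc w| < 3 * (G : ℤ) ^ 3).card ≤ 3 * (Wz N G).card := by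
  set f₁ : (ℕ × ℕ) × (ℕ × ℕ) → (ℤ × ℤ) × (ℤ × ℤ) := fun w =>
    (((w.1.1 : ℤ) - w.2.1, (w.2.2 : ℤ) - w.1.2), ((w.1.1 : ℤ) + w.2.1, (w.2.2 : ℤ) + w.1.2)) with hf₁
  set f₂ : (ℕ × ℕ) × (ℕ × ℕ) → (ℤ × ℤ) × (ℤ × ℤ) := fun w =>
    (((w.1.1 : ℤ) + w.1.2, (w.2.1 : ℤ) + w.2.2), ((w.1.1 : ℤ) - w.1.2, (w.2.1 : ℤ) - w.2.2)) with hf₂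
  set f₃ : (ℕ × ℕ) × (ℕ × ℕ) → (ℤ × ℤ) × (ℤ × ℤ) := fun w =>
    (((w.1.2 : ℤ) - w.2.1, (w.2.2 : ℤ) - w.1.1), ((w.1.2 : ℤ) + w.2.1, (w.2.2 : ℤ) + w.1.1)) with hf₃
  have c₁ : ((Nt N).filter fun w => f₁ w ∈ Wz N G).card ≤ (Wz N G).card := by
    refine card_le_card_of_injOn f₁ (fun w hw => (mem_filter.1 hw).2) ?_
    rintro ⟨⟨a, b⟩, ⟨c, d⟩⟩ - ⟨⟨a', b'⟩, ⟨c', d'⟩⟩ - h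
    simp only [hf₁, Prod.mk.injEq] at h ⊢
    omega
  have c₂ : ((Nt N).filter fun w => f₂ w ∈ Wz N G).card ≤ (Wz N G).card := by
    refine card_le_card_of_injOn f₂ (fun w hw => (mem_filter.1 hw).2) ?_
    rintro ⟨⟨a, b⟩, ⟨c, d⟩⟩ - ⟨⟨a', b'⟩, ⟨c', d'⟩⟩ - h
    simp only [hf₂, Prod.mk.injEq] at h ⊢
    omega
  have c₃ : ((Nt N).filter fun w => f₃ w ∈ Wz N G).card ≤ (Wz N G).card := by
    refine card_le_card_of_injOn f₃ (fun w hw => (mem_filter.1 hw).2) ?_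
    rintro ⟨⟨a, b⟩, ⟨c, d⟩⟩ - ⟨⟨a', b'⟩, ⟨c', d'⟩⟩ - h
    simp only [hf₃, Prod.mk.injEq] at h ⊢
    omega
  have hsub : ((Nt N).filter fun w => ¬ |dfc w| < 3 * (G : ℤ) ^ 3) ⊆
      ((Nt N).filter fun w => f₁ w ∈ Wz N G) ∪ (((Nt N).filter fun w => f₂ w ∈ Wz N G) ∪
        ((Nt N).filter fun w => f₃ w ∈ Wz N G)) := by
    intro w hw
    rw [mem_filter, not_lt] at hw
    obtain ⟨hw, hL⟩ := hw
    have hL' : 3 * G ^ 3 ≤ (dfc w).natAbs := by zify; exact hL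
    have hd := Int.natAbs_dvd_natAbs.2 (dfc_dvd hw)
    have h0 := dfc_ne_zero hw
    rw [Int.natAbs_mul, Int.natAbs_mul, Int.natAbs_mul] at hd
    simp only [mem_union, mem_filter]
    obtain ⟨h1, h2, h3, h4, h5, h6, h7, h8, h9⟩ := mem_Nt hw
    rcases exists_gcd_ge hL' hG hd with h | h | h
    · refine Or.inr (Or.inl ⟨hw, ?_⟩)
      change G ≤ Int.gcd (dfc w) ((w.1.1 : ℤ) + w.1.2) at h
      rw [show dfc w = ((w.1.1 : ℤ) + w.1.2) - (w.2.1 + w.2.2) by rw [dfc]; ring] at h h0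
      rw [Wz, mem_filter]
      simp only [hf₂, mem_product, mem_Icc]
      refine ⟨by omega, by linear_combination 4 * h5, by omega, by omega, by omega, ?_⟩
      rwa [Int.gcd_self_sub_left, Int.gcd_comm] at h
    · refine Or.inl ⟨hw, ?_⟩
      change G ≤ Int.gcd (dfc w) ((w.1.1 : ℤ) - w.2.1) at h
      rw [show dfc w = ((w.1.1 : ℤ) - w.2.1) - (w.2.2 - w.1.2) by rw [dfc]; ring] at h h0
      rw [Wz, mem_filter]
      simp only [hf₁, mem_product, mem_Icc]
      refine ⟨by omega, by linear_combination 4 * h5, by omega, by omega, by omega, ?_⟩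
      rwa [Int.gcd_self_sub_left, Int.gcd_comm] at h
    · refine Or.inr (Or.inr ⟨hw, ?_⟩)
      change G ≤ Int.gcd (dfc w) ((w.1.2 : ℤ) - w.2.1) at h
      rw [show dfc w = ((w.1.2 : ℤ) - w.2.1) - (w.2.2 - w.1.1) by rw [dfc]; ring] at h h0
      rw [Wz, mem_filter]
      simp only [hf₃, mem_product, mem_Icc]
      refine ⟨by omega, by linear_combination 4 * h5, by omega, by omega, by omega, ?_⟩
      rwa [Int.gcd_self_sub_left, Int.gcd_comm] at h
  calc _ ≤ _ := card_le_card hsub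
    _ ≤ _ := card_union_le _ _
    _ ≤ (Wz N G).card + ((Wz N G).card + (Wz N G).card) :=
      add_le_add c₁ ((card_union_le _ _).trans (add_le_add c₂ c₃))
    _ = _ := by ring

lemma card_Nt_le {N X R1 K1 B : ℕ} {S T μ : ℝ} (h : Par N X R1 K1 B S T μ) :
    ((Nt N).card : ℝ) ≤ 3864 * T ^ 5 * S ^ 7 := by
  have hT1 := h.dom.one_le
  have hS := h.hS
  have hS0 := h.S_pos
  have hN := h.N_ge
  set G := ⌊S⌋₊ with hG
  have hG0 : 0 < G := Nat.floor_pos.2 (by linarith)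
  have hG1 : (G : ℝ) ≤ S := Nat.floor_le hS0.le
  have hG2 : S / 2 ≤ G := by
    have := Nat.lt_floor_add_one S
    have : (1 : ℝ) ≤ G := by exact_mod_cast hG0
    linarith
  have h1 := card_small_le (N := N) (G := G) h.dom (h.big_of (c := 32) (k := 3) (by norm_num) (by norm_num))
  have h2 := card_large_le (N := N) hG0
  have h3 := card_Wz_le N G
  have h4 := card_Wn_le (N := N) (G := G) h.dom (by omega)
    (h.big_of (c := 16) (k := 3) (by norm_num) (by norm_num)) hG0
  have h5 := card_filter_add_card_filter_not (s := Nt N) (fun w => |dfc w| < 3 * (G : ℤ) ^ 3)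
  have h6 : (((Nt N).filter fun w => ¬ |dfc w| < 3 * (G : ℤ) ^ 3).card : ℝ) ≤
      48 * (Wn N G).card := by
    have : ((Nt N).filter fun w => ¬ |dfc w| < 3 * (G : ℤ) ^ 3).card ≤ 48 * (Wn N G).card := by
      omega
    exact_mod_cast this
  rw [← h5]
  push_cast
  rw [← h.S4] at h1 h4
  have h7 : 24 * T * (G : ℝ) ^ 3 * S ^ 4 ≤ 24 * T ^ 5 * S ^ 7 := by
    calc 24 * T * (G : ℝ) ^ 3 * S ^ 4 ≤ 24 * T ^ 5 * S ^ 3 * S ^ 4 := by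
          gcongr
          exact le_self_pow₀ hT1 (by norm_num)
      _ = _ := by ring
  have h8 : 40 * T ^ 5 * (S ^ 4) ^ 2 / (G : ℝ) ≤ 80 * T ^ 5 * S ^ 7 := by
    calc 40 * T ^ 5 * (S ^ 4) ^ 2 / (G : ℝ) ≤ 40 * T ^ 5 * (S ^ 4) ^ 2 / (S / 2) := by gcongr
      _ = _ := by field_simp; ring
  linarith

lemma Z_bounds {N X R1 K1 B : ℕ} {S T μ : ℝ} (h : Par N X R1 K1 B S T μ) :
    |(Z N X : ℝ) - 2 * (Om N X).card| ≤ 3865 * T ^ 5 * S ^ 7 := by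
  have hT1 := h.dom.one_le
  have hS := h.hS
  set W := (Om N X ×ˢ Om N X).filter fun p => cub p.1 = cub p.2 with hW
  have hZ : Z N X = W.card := rfl
  set A := (Om N X).image fun p => (p, p) with hA
  set A' := (Om N X).image fun p => (p, p.swap) with hA'
  have hAc : A.card = (Om N X).card := card_image_of_injective _ fun p q e => (Prod.mk.inj e).1
  have hAc' : A'.card = (Om N X).card := card_image_of_injective _ fun p q e => (Prod.mk.inj e).1
  have hsw : ∀ p ∈ Om N X, p.swap ∈ Om N X ∧ cub p = cub p.swap := by
    intro p hp
    simp only [Om, mem_filter, mem_product, Prod.fst_swap, Prod.snd_swap, cub] at hp ⊢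
    exact ⟨⟨⟨hp.1.2, hp.1.1⟩, by omega⟩, add_comm _ _⟩
  have hsub : A ∪ A' ⊆ W := by
    intro x hx
    rw [mem_union, hA, hA', mem_image, mem_image] at hx
    rw [hW, mem_filter, mem_product]
    rcases hx with ⟨p, hp, rfl⟩ | ⟨p, hp, rfl⟩
    · exact ⟨⟨hp, hp⟩, rfl⟩
    · exact ⟨⟨hp, (hsw p hp).1⟩, (hsw p hp).2⟩
  have hsub2 : W ⊆ (A ∪ A') ∪ Nt N := by
    intro x hx
    rw [hW, mem_filter, mem_product] at hx
    obtain ⟨⟨h1, h2⟩, h3⟩ := hx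
    rw [mem_union, mem_union, hA, hA', mem_image, mem_image]
    by_cases e1 : x.1 = x.2
    · exact Or.inl (Or.inl ⟨x.1, h1, Prod.ext rfl e1⟩)
    by_cases e2 : x.1 = x.2.swap
    · exact Or.inl (Or.inr ⟨x.1, h1, Prod.ext rfl (by simp [e2])⟩)
    · refine Or.inr ?_
      rw [Nt, mem_filter, mem_product]
      exact ⟨⟨(mem_filter.1 h1).1, (mem_filter.1 h2).1⟩, h3, e1, e2⟩
  have hint : (A ∩ A').card ≤ N := by
    have : A ∩ A' ⊆ (Icc 1 N).image fun u => ((u, u), (u, u)) := by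
      intro x hx
      rw [mem_inter, hA, hA', mem_image, mem_image] at hx
      obtain ⟨⟨p, hp, rfl⟩, ⟨q, hq, e⟩⟩ := hx
      obtain ⟨e1, e2⟩ := Prod.mk.inj e
      subst e1
      have e3 : q.1 = q.2 := (congrArg Prod.snd e2 : _)
      rw [mem_image]
      refine ⟨q.1, (mem_product.1 (mem_filter.1 hp).1).1, ?_⟩
      have : q = (q.1, q.1) := Prod.ext rfl e3.symm
      rw [← this]
    exact (card_le_card this).trans (card_image_le.trans (by simp))
  have hun := card_union_add_card_inter A A'
  have h1 := card_le_card hsub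
  have h2 := (card_le_card hsub2).trans (card_union_le _ _)
  have h3 := card_Nt_le h
  have h4 : (N : ℝ) ≤ T ^ 5 * S ^ 7 := by
    rw [← h.S4]
    calc S ^ 4 ≤ S ^ 7 := pow_le_pow_right₀ (by linarith) (by norm_num)
      _ = 1 * S ^ 7 := by ring
      _ ≤ _ := by gcongr; exact one_le_pow₀ hT1
  have h5 : (Z N X : ℝ) ≤ 2 * (Om N X).card + (Nt N).card := by
    have : Z N X ≤ 2 * (Om N X).card + (Nt N).card := by omega
    exact_mod_cast this
  have h6 : 2 * ((Om N X).card : ℝ) ≤ Z N X + N := by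
    have : 2 * (Om N X).card ≤ Z N X + N := by omega
    exact_mod_cast this
  rw [abs_le]
  constructor <;> linarith

/-- Harmonic sums. -/
noncomputable def Hn (n : ℕ) : ℝ := ∑ k ∈ Icc 1 n, (1 : ℝ) / k

lemma Hn_eq (n : ℕ) : Hn n = harmonic n := by
  rw [Hn, harmonic_eq_sum_Icc]; push_cast; simp

lemma floor_bounds {y : ℝ} (hy : 1 ≤ y) :
    (1 : ℝ) ≤ ⌊y⌋₊ ∧ (⌊y⌋₊ : ℝ) ≤ y ∧ y < ⌊y⌋₊ + 1 ∧ y / 2 ≤ ⌊y⌋₊ := by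
  have h1 : 0 < ⌊y⌋₊ := Nat.floor_pos.2 hy
  have h1' : (1 : ℝ) ≤ ⌊y⌋₊ := by exact_mod_cast h1
  have h2 := Nat.floor_le (show 0 ≤ y by linarith)
  have h3 := Nat.lt_floor_add_one y
  exact ⟨h1', h2, h3, by linarith⟩

lemma Hn_floor {y : ℝ} (hy : 1 ≤ y) :
    |Hn ⌊y⌋₊ - Real.log y - Real.eulerMascheroniConstant| ≤ 2 / y := by
  obtain ⟨h1, h2, h3, h4⟩ := floor_bounds hy
  have h5 := Real.eulerMascheroniSeq_lt_eulerMascheroniConstant ⌊y⌋₊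
  have h6 := Real.eulerMascheroniConstant_lt_eulerMascheroniSeq' ⌊y⌋₊
  rw [Real.eulerMascheroniSeq, ← Hn_eq] at h5
  rw [Real.eulerMascheroniSeq', if_neg (by rintro h0; rw [h0] at h1; norm_num at h1), ← Hn_eq] at h6
  set n : ℝ := (⌊y⌋₊ : ℝ)
  have h7 : Real.log n ≤ Real.log y := Real.log_le_log (by linarith) h2
  have h8 : Real.log y ≤ Real.log (n + 1) := Real.log_le_log (by linarith) h3.le
  have h9 : Real.log (n + 1) - Real.log n ≤ 2 / y := by
    rw [← Real.log_div (by linarith) (by linarith)]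
    have e := Real.log_le_sub_one_of_pos (show 0 < (n + 1) / n by positivity)
    have e2 : (n + 1) / n - 1 = 1 / n := by field_simp; ring
    have e3 : 1 / n ≤ 1 / (y / 2) := one_div_le_one_div_of_le (by linarith) h4
    have e4 : 1 / (y / 2) = 2 / y := by field_simp
    linarith
  rw [abs_le]
  constructor <;> linarith

lemma sum_inv_sq_bounds {m J : ℕ} (hm : 0 < m) (hmJ : m ≤ J) :
    |∑ j ∈ Ioc m J, (1 : ℝ) / (j : ℝ) ^ 2 - (1 / m - 1 / J)| ≤ 1 / (m : ℝ) ^ 2 := by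
  have hm' : (1 : ℝ) ≤ m := by exact_mod_cast hm
  have h1 : ∑ j ∈ Ioc m J, (1 : ℝ) / (j : ℝ) ^ 2 ≤ 1 / m - 1 / J ∧
      (1 : ℝ) / (m + 1) - 1 / (J + 1) ≤ ∑ j ∈ Ioc m J, (1 : ℝ) / (j : ℝ) ^ 2 := by
    induction J, hmJ using Nat.le_induction with
    | base => simp
    | succ n hn ih =>
      have hn' : (1 : ℝ) ≤ n := hm'.trans (by exact_mod_cast hn)
      rw [sum_Ioc_succ_top hn]
      have e1 : (1 : ℝ) / ((n + 1 : ℕ) : ℝ) ^ 2 ≤ 1 / n - 1 / ((n + 1 : ℕ) : ℝ) := by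
        push_cast
        rw [div_sub_div _ _ (by positivity) (by positivity), div_le_div_iff₀ (by positivity) (by positivity)]
        nlinarith
      have e2 : (1 : ℝ) / (n + 1) - 1 / (((n + 1 : ℕ) : ℝ) + 1) ≤ 1 / ((n + 1 : ℕ) : ℝ) ^ 2 := by
        push_cast
        rw [div_sub_div _ _ (by positivity) (by positivity), div_le_div_iff₀ (by positivity) (by positivity)]
        nlinarith
      constructor <;> linarith [ih.1, ih.2]
  have hJ' : (0 : ℝ) < J := by exact_mod_cast hm.trans_le hmJ
  have h2 : (1 : ℝ) / m - 1 / (m + 1) ≤ 1 / (m : ℝ) ^ 2 := by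
    rw [div_sub_div _ _ (by positivity) (by positivity), div_le_div_iff₀ (by positivity) (by positivity)]
    nlinarith
  have h3 : (1 : ℝ) / (J + 1) ≤ 1 / J := one_div_le_one_div_of_le hJ' (by linarith)
  have h4 : (0 : ℝ) ≤ 1 / (m : ℝ) ^ 2 := by positivity
  rw [abs_le]
  constructor <;> linarith [h1.1, h1.2]

lemma sum_pp_mul {r Y : ℝ} {M : ℕ} (hr : 0 < r) (hY : r ≤ Y) (hM : ⌊Y / r⌋₊ ≤ M) :
    |∑ j ∈ Icc 1 M, max (Y - r * j) 0 / (j : ℝ) -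
      (Y * (Real.log Y - Real.log r + Real.eulerMascheroniConstant) - Y)| ≤ 3 * r := by
  have hY0 : 0 < Y := by linarith
  have hy : 1 ≤ Y / r := (one_le_div hr).2 hY
  obtain ⟨h1, h2, h3, h4⟩ := floor_bounds hy
  have hH := Hn_floor hy
  rw [Real.log_div hY0.ne' hr.ne'] at hH
  set m := ⌊Y / r⌋₊ with hm
  have e1 : ∑ j ∈ Icc 1 M, max (Y - r * j) 0 / (j : ℝ) = ∑ j ∈ Icc 1 m, (Y * (1 / (j : ℝ)) - r) := by
    rw [← sum_subset (Icc_subset_Icc_right hM)]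
    · refine sum_congr rfl fun j hj => ?_
      rw [mem_Icc] at hj
      have hj0 : (0 : ℝ) < j := by exact_mod_cast hj.1
      have hj1 : (j : ℝ) ≤ m := by exact_mod_cast hj.2
      have : r * j ≤ Y := by
        rw [← le_div_iff₀' hr]; linarith
      rw [max_eq_left (by linarith)]
      field_simp
    · intro j hj hj'
      rw [mem_Icc] at hj hj'
      have hj1 : m + 1 ≤ j := by omega
      have hj2 : (m : ℝ) + 1 ≤ j := by exact_mod_cast hj1
      have : Y ≤ r * j := by
        rw [← div_le_iff₀' hr]; linarith
      rw [max_eq_right (by linarith), zero_div]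
  have e2 : ∑ j ∈ Icc 1 m, (Y * (1 / (j : ℝ)) - r) = Y * Hn m - r * m := by
    rw [sum_sub_distrib, ← mul_sum, Hn, sum_const, Nat.card_Icc, nsmul_eq_mul, Nat.add_sub_cancel]
    ring
  rw [e1, e2]
  have h5 : |Y * (Hn m - (Real.log Y - Real.log r) - Real.eulerMascheroniConstant)| ≤ 2 * r := by
    rw [abs_mul, abs_of_pos hY0]
    calc _ ≤ Y * (2 / (Y / r)) := by gcongr
      _ = _ := by field_simp
  have h6 : r * m ≤ Y := by rw [← le_div_iff₀' hr]; exact h2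
  have h7 : Y ≤ r * m + r := by
    have := (div_lt_iff₀' hr).1 h3
    linarith
  rw [abs_le] at h5 ⊢
  constructor <;> linarith [h5.1, h5.2]

lemma sum_pp_div {t Y : ℝ} {J : ℕ} (hY : 0 < Y) (ht : Y ≤ t) (hJ : ⌊t / Y⌋₊ ≤ J) :
    |∑ j ∈ Icc 1 J, max (Y - t / j) 0 / (j : ℝ) -
      (Y * (Hn J - Real.log t + Real.log Y - Real.eulerMascheroniConstant) - Y + t / J)| ≤
      8 * Y ^ 2 / t := by
  have ht0 : 0 < t := by linarith
  have hy : 1 ≤ t / Y := (one_le_div hY).2 ht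
  obtain ⟨h1, h2, h3, h4⟩ := floor_bounds hy
  have hH := Hn_floor hy
  rw [Real.log_div ht0.ne' hY.ne'] at hH
  set m := ⌊t / Y⌋₊ with hm
  have hm0 : 0 < m := by exact_mod_cast (show (0 : ℝ) < m by linarith)
  have hsplit : ∀ f : ℕ → ℝ, ∑ j ∈ Icc 1 J, f j = ∑ j ∈ Icc 1 m, f j + ∑ j ∈ Ioc m J, f j := by
    intro f
    rw [← sum_union]
    · congr 1; ext j; simp only [mem_Icc, mem_union, mem_Ioc]; omega
    · rw [disjoint_left]; intro j; simp only [mem_Icc, mem_Ioc]; omega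
  have e1 : ∑ j ∈ Icc 1 J, max (Y - t / j) 0 / (j : ℝ) =
      ∑ j ∈ Ioc m J, (Y * (1 / (j : ℝ)) - t * (1 / (j : ℝ) ^ 2)) := by
    rw [hsplit, sum_eq_zero, zero_add]
    · refine sum_congr rfl fun j hj => ?_
      rw [mem_Ioc] at hj
      have hj0 : (0 : ℝ) < j := by exact_mod_cast (show 0 < j by omega)
      have hj1 : (m : ℝ) + 1 ≤ j := by exact_mod_cast hj.1
      have : t / j ≤ Y := by
        rw [div_le_iff₀ hj0, ← div_le_iff₀' hY]; linarith
      rw [max_eq_left (by linarith)]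
      field_simp
    · intro j hj
      rw [mem_Icc] at hj
      have hj0 : (0 : ℝ) < j := by exact_mod_cast hj.1
      have hj1 : (j : ℝ) ≤ m := by exact_mod_cast hj.2
      have : Y ≤ t / j := by
        rw [le_div_iff₀ hj0, ← le_div_iff₀' hY]; linarith
      rw [max_eq_right (by linarith), zero_div]
  have e2 : ∑ j ∈ Ioc m J, (1 : ℝ) / j = Hn J - Hn m := by
    rw [Hn, Hn, hsplit]; ring
  rw [e1, sum_sub_distrib, ← mul_sum, ← mul_sum, e2]
  have hq := sum_inv_sq_bounds hm0 hJ
  set σ := ∑ j ∈ Ioc m J, (1 : ℝ) / (j : ℝ) ^ 2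
  have h5 : |Y * (Hn m - (Real.log t - Real.log Y) - Real.eulerMascheroniConstant)| ≤
      2 * Y ^ 2 / t := by
    rw [abs_mul, abs_of_pos hY]
    calc _ ≤ Y * (2 / (t / Y)) := by gcongr
      _ = _ := by field_simp
  have h6 : |t * (σ - (1 / m - 1 / J))| ≤ 4 * Y ^ 2 / t := by
    rw [abs_mul, abs_of_pos ht0]
    calc _ ≤ t * (1 / (t / Y / 2) ^ 2) := by
          refine mul_le_mul_of_nonneg_left (hq.trans ?_) ht0.le
          gcongr
        _ = _ := by field_simp; ring
  have h7 : |t * (1 / m) - Y| ≤ 2 * Y ^ 2 / t := by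
    have k1 : t * (1 / m) - Y = Y * ((t / Y - m) / m) := by
      field_simp
    rw [k1, abs_mul, abs_of_pos hY, abs_of_nonneg (div_nonneg (by linarith) (by linarith))]
    calc _ ≤ Y * (1 / (t / Y / 2)) := by gcongr; linarith
      _ = _ := by field_simp
  have h8 : 8 * Y ^ 2 / t = 2 * Y ^ 2 / t + 4 * Y ^ 2 / t + 2 * Y ^ 2 / t := by ring
  rw [h8]
  have h9 : t / J = t * (1 / J) := by ring
  rw [h9]
  rw [abs_le] at h5 h6 h7 ⊢
  constructor <;> nlinarith [h5.1, h5.2, h6.1, h6.2, h7.1, h7.2]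

/-- The weight: a combination of three tents equal to `Q - t` on `[2 Q₀, Q]` and `0` on `[0, Q₀]`. -/
noncomputable def wt (Q Q0 t : ℝ) : ℝ :=
  max (Q - t) 0 - (Q / Q0 - 1) * max (2 * Q0 - t) 0 + (Q / Q0 - 2) * max (Q0 - t) 0

section
variable {Q Q0 : ℝ}

lemma wt_eq_zero (h0 : 0 < Q0) (hQ : 2 * Q0 ≤ Q) {t : ℝ} (ht : t ≤ Q0) : wt Q Q0 t = 0 := by
  rw [wt, max_eq_left (by linarith), max_eq_left (by linarith), max_eq_left (by linarith)]
  field_simp; ring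

lemma wt_eq_sub (h0 : 0 < Q0) {t : ℝ} (ht : 2 * Q0 ≤ t) (ht' : t ≤ Q) :
    wt Q Q0 t = Q - t := by
  rw [wt, max_eq_left (by linarith), max_eq_right (by linarith), max_eq_right (by linarith)]
  ring

lemma wt_eq_zero_of_ge (h0 : 0 < Q0) (hQ : 2 * Q0 ≤ Q) {t : ℝ} (ht : Q ≤ t) : wt Q Q0 t = 0 := by
  rw [wt, max_eq_right (by linarith), max_eq_right (by linarith), max_eq_right (by linarith)]
  ring

lemma wt_mid (h0 : 0 < Q0) (hQ : 2 * Q0 ≤ Q) {t : ℝ} (ht : Q0 ≤ t) (ht' : t ≤ 2 * Q0) :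
    wt Q Q0 t = (Q / Q0 - 2) * (t - Q0) := by
  rw [wt, max_eq_left (by linarith), max_eq_left (by linarith), max_eq_right (by linarith)]
  field_simp; ring

lemma wt_nonneg (h0 : 0 < Q0) (hQ : 2 * Q0 ≤ Q) (t : ℝ) : 0 ≤ wt Q Q0 t := by
  rcases le_total t Q0 with h | h
  · rw [wt_eq_zero h0 hQ h]
  rcases le_total t (2 * Q0) with h' | h'
  · rw [wt_mid h0 hQ h h']
    have : 2 ≤ Q / Q0 := by rwa [le_div_iff₀ h0]
    exact mul_nonneg (by linarith) (by linarith)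
  rcases le_total t Q with h2 | h2
  · rw [wt_eq_sub h0 h' h2]; linarith
  · rw [wt_eq_zero_of_ge h0 hQ h2]

lemma wt_le (h0 : 0 < Q0) (hQ : 2 * Q0 ≤ Q) (t : ℝ) : wt Q Q0 t ≤ max (Q - t) 0 := by
  rcases le_total t Q0 with h | h
  · rw [wt_eq_zero h0 hQ h]; exact le_max_right _ _
  rcases le_total t (2 * Q0) with h' | h'
  · rw [wt_mid h0 hQ h h']
    have h2 : 2 ≤ Q / Q0 := by rwa [le_div_iff₀ h0]
    refine le_trans ?_ (le_max_left _ _)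
    calc (Q / Q0 - 2) * (t - Q0) ≤ (Q / Q0 - 2) * Q0 := by
          refine mul_le_mul_of_nonneg_left ?_ ?_ <;> linarith
      _ = Q - 2 * Q0 := by field_simp
      _ ≤ Q - t := by linarith
  rcases le_total t Q with h2 | h2
  · rw [wt_eq_sub h0 h' h2]; exact le_max_left _ _
  · rw [wt_eq_zero_of_ge h0 hQ h2]; exact le_max_right _ _

lemma wt_le_Q (h0 : 0 < Q0) (hQ : 2 * Q0 ≤ Q) {t : ℝ} (ht : 0 ≤ t) : wt Q Q0 t ≤ Q :=
  (wt_le h0 hQ t).trans (max_le (by linarith) (by linarith))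

lemma wt_sum (s : Finset ℕ) (f : ℕ → ℝ) (c : ℕ → ℝ) :
    ∑ j ∈ s, wt Q Q0 (f j) / c j = ∑ j ∈ s, max (Q - f j) 0 / c j -
      (Q / Q0 - 1) * ∑ j ∈ s, max (2 * Q0 - f j) 0 / c j +
      (Q / Q0 - 2) * ∑ j ∈ s, max (Q0 - f j) 0 / c j := by
  rw [mul_sum, mul_sum, ← sum_sub_distrib, ← sum_add_distrib]
  refine sum_congr rfl fun j _ => ?_
  rw [wt]; ring

lemma wt_compare {B J M : ℕ} {r t T : ℝ} (hT : Dom B T) (h0 : 0 < Q0) (hQ : 2 * Q0 ≤ Q)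
    (hr : 0 < r) (hrQ : r ≤ Q0) (ht : 0 < t) (hJ : ⌊t / Q0⌋₊ ≤ J) (hM : ⌊Q / r⌋₊ ≤ M)
    (hJB : J ≤ B) (hMB : M ≤ B) :
    |∑ j ∈ Icc 1 J, wt Q Q0 (t / j) / (j : ℝ) - ∑ j ∈ Icc 1 M, wt Q Q0 (r * j) / (j : ℝ)| ≤
      6 * (Q / Q0) * r + 28 * T * Q * min 1 (Q / t) := by
  have hT1 := hT.one_le
  have hQ0 : 0 < Q := by linarith
  have hκ : 2 ≤ Q / Q0 := by rwa [le_div_iff₀ h0]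
  rcases le_or_gt Q t with hQt | hQt
  · have f1 : ∀ {Y : ℝ}, 0 < Y → Y ≤ Q → ⌊Y / r⌋₊ ≤ M := fun {Y} hY hYQ =>
      le_trans (Nat.floor_le_floor (by gcongr)) hM
    have f2 : ∀ {Y : ℝ}, Q0 ≤ Y → ⌊t / Y⌋₊ ≤ J := fun {Y} hY =>
      le_trans (Nat.floor_le_floor (by gcongr)) hJ
    have a1 := sum_pp_mul hr (show r ≤ Q by linarith) (f1 hQ0 le_rfl)
    have a2 := sum_pp_mul hr (show r ≤ 2 * Q0 by linarith) (f1 (by linarith) hQ)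
    have a3 := sum_pp_mul hr hrQ (f1 h0 (by linarith))
    have b1 := sum_pp_div hQ0 hQt (f2 (show Q0 ≤ Q by linarith))
    have b2 := sum_pp_div (show 0 < 2 * Q0 by linarith) (show 2 * Q0 ≤ t by linarith)
      (f2 (show Q0 ≤ 2 * Q0 by linarith))
    have b3 := sum_pp_div h0 (show Q0 ≤ t by linarith) (f2 le_rfl)
    rw [wt_sum, wt_sum, min_eq_right ((div_le_one ht).2 hQt)]
    set A1 := ∑ j ∈ Icc 1 M, max (Q - r * j) 0 / (j : ℝ)
    set A2 := ∑ j ∈ Icc 1 M, max (2 * Q0 - r * j) 0 / (j : ℝ)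
    set A3 := ∑ j ∈ Icc 1 M, max (Q0 - r * j) 0 / (j : ℝ)
    set B1 := ∑ j ∈ Icc 1 J, max (Q - t / j) 0 / (j : ℝ)
    set B2 := ∑ j ∈ Icc 1 J, max (2 * Q0 - t / j) 0 / (j : ℝ)
    set B3 := ∑ j ∈ Icc 1 J, max (Q0 - t / j) 0 / (j : ℝ)
    set γ := Real.eulerMascheroniConstant
    set x1 := Q * (Real.log Q - Real.log r + γ) - Q
    set x2 := 2 * Q0 * (Real.log (2 * Q0) - Real.log r + γ) - 2 * Q0
    set x3 := Q0 * (Real.log Q0 - Real.log r + γ) - Q0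
    set y1 := Q * (Hn J - Real.log t + Real.log Q - γ) - Q + t / J
    set y2 := 2 * Q0 * (Hn J - Real.log t + Real.log (2 * Q0) - γ) - 2 * Q0 + t / J
    set y3 := Q0 * (Hn J - Real.log t + Real.log Q0 - γ) - Q0 + t / J
    have key : (y1 - (Q / Q0 - 1) * y2 + (Q / Q0 - 2) * y3) =
        (x1 - (Q / Q0 - 1) * x2 + (Q / Q0 - 2) * x3) := by
      simp only [x1, x2, x3, y1, y2, y3]
      field_simp
      ring
    have e1 : B1 - (Q / Q0 - 1) * B2 + (Q / Q0 - 2) * B3 - (A1 - (Q / Q0 - 1) * A2 +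
        (Q / Q0 - 2) * A3) = ((B1 - y1) - (A1 - x1)) - (Q / Q0 - 1) * ((B2 - y2) - (A2 - x2)) +
        (Q / Q0 - 2) * ((B3 - y3) - (A3 - x3)) := by linear_combination key
    rw [e1]
    have g1 : |(B1 - y1) - (A1 - x1)| ≤ 8 * Q ^ 2 / t + 3 * r := (abs_sub _ _).trans (add_le_add b1 a1)
    have g2 : |(B2 - y2) - (A2 - x2)| ≤ 8 * (2 * Q0) ^ 2 / t + 3 * r :=
      (abs_sub _ _).trans (add_le_add b2 a2)
    have g3 : |(B3 - y3) - (A3 - x3)| ≤ 8 * Q0 ^ 2 / t + 3 * r := (abs_sub _ _).trans (add_le_add b3 a3)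
    have g4 : (Q / Q0) * Q0 ^ 2 ≤ Q ^ 2 / 2 := by
      have : (Q / Q0) * Q0 ^ 2 = Q * Q0 := by field_simp
      rw [this]; nlinarith
    calc _ ≤ |(B1 - y1) - (A1 - x1)| + (Q / Q0 - 1) * |(B2 - y2) - (A2 - x2)| +
          (Q / Q0 - 2) * |(B3 - y3) - (A3 - x3)| := by
          refine (abs_add_le _ _).trans (add_le_add ((abs_sub _ _).trans (add_le_add le_rfl ?_)) ?_)
          · rw [abs_mul, abs_of_nonneg (by linarith)]
          · rw [abs_mul, abs_of_nonneg (by linarith)]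
      _ ≤ (8 * Q ^ 2 / t + 3 * r) + (Q / Q0 - 1) * (8 * (2 * Q0) ^ 2 / t + 3 * r) +
          (Q / Q0 - 2) * (8 * Q0 ^ 2 / t + 3 * r) := by
          have : 0 ≤ Q / Q0 - 1 := by linarith
          have : 0 ≤ Q / Q0 - 2 := by linarith
          gcongr
      _ = 6 * (Q / Q0) * r - 6 * r + (8 * Q ^ 2 + 40 * ((Q / Q0) * Q0 ^ 2) - 48 * Q0 ^ 2) / t := by ring
      _ ≤ 6 * (Q / Q0) * r + 28 * Q ^ 2 / t := by
          have : (8 * Q ^ 2 + 40 * ((Q / Q0) * Q0 ^ 2) - 48 * Q0 ^ 2) / t ≤ 28 * Q ^ 2 / t := by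
            gcongr; nlinarith
          linarith
      _ = 6 * (Q / Q0) * r + 28 * 1 * Q * (Q / t) := by ring
      _ ≤ _ := by gcongr
  · rw [min_eq_left ((one_le_div ht).2 hQt.le)]
    have h1 : ∀ (K : ℕ) (f : ℕ → ℝ), (∀ j, 0 ≤ f j) → K ≤ B →
        0 ≤ ∑ j ∈ Icc 1 K, wt Q Q0 (f j) / (j : ℝ) ∧
        ∑ j ∈ Icc 1 K, wt Q Q0 (f j) / (j : ℝ) ≤ T * Q := by
      intro K f hf hK
      refine ⟨sum_nonneg fun j _ => div_nonneg (wt_nonneg h0 hQ _) (by positivity), ?_⟩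
      calc _ ≤ ∑ j ∈ Icc 1 K, Q * (1 / (j : ℝ)) := by
            refine sum_le_sum fun j _ => ?_
            rw [mul_one_div]
            have := wt_le_Q h0 hQ (hf j)
            gcongr
        _ = (∑ j ∈ Icc 1 K, 1 / (j : ℝ)) * Q := by rw [← mul_sum, mul_comm]
        _ ≤ _ := by gcongr; exact hT.harm_le K hK
    have h2 := h1 J (fun j => t / j) (fun j => by positivity) hJB
    have h3 := h1 M (fun j => r * j) (fun j => by positivity) hMB
    have h4 : 0 ≤ (Q / Q0) * r := by positivity
    have h5 : 0 ≤ T * Q := by positivity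
    rw [abs_le]
    constructor <;> linarith [h2.1, h2.2, h3.1, h3.2]

end

lemma sum_filter_dvd {r : ℕ} (hr : 0 < r) (Q : ℕ) (f : ℕ → ℝ) :
    ∑ q ∈ (Icc 1 Q).filter (fun q => r ∣ q), f q = ∑ j ∈ Icc 1 (Q / r), f (r * j) := by
  symm
  refine sum_nbij (fun k => r * k) ?_ ?_ ?_ ?_
  · intro k hk
    rw [mem_Icc] at hk
    simp only [mem_filter, mem_Icc]
    refine ⟨⟨Nat.mul_pos hr hk.1, ?_⟩, dvd_mul_right _ _⟩
    rw [mul_comm]; exact (Nat.le_div_iff_mul_le hr).1 hk.2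
  · intro a _ b _ hab
    exact Nat.eq_of_mul_eq_mul_left hr hab
  · intro q hq
    simp only [coe_filter, mem_Icc, Set.mem_ofPred_eq] at hq
    obtain ⟨⟨h1, h2⟩, k, rfl⟩ := hq
    refine ⟨k, ?_, rfl⟩
    simp only [coe_Icc, Set.mem_Icc]
    refine ⟨Nat.pos_of_ne_zero fun h => by simp [h] at h1, ?_⟩
    rw [Nat.le_div_iff_mul_le hr, mul_comm]; exact h2
  · intros; rfl

/-- The weight attached to `r` by the moduli divisible by `r`. -/
noncomputable def om (Q Q0 r : ℕ) : ℝ :=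
  ∑ q ∈ (Icc 1 Q).filter (fun q => r ∣ q), wt Q Q0 q / q

lemma om_nonneg {Q Q0 : ℕ} (h0 : 0 < Q0) (hQ : 2 * Q0 ≤ Q) (r : ℕ) : 0 ≤ om Q Q0 r :=
  sum_nonneg fun q _ => div_nonneg
    (wt_nonneg (by exact_mod_cast h0) (by exact_mod_cast hQ) _) (Nat.cast_nonneg _)

lemma om_le {B Q Q0 r : ℕ} {T : ℝ} (hT : Dom B T) (hQB : Q ≤ B) (h0 : 0 < Q0) (hQ : 2 * Q0 ≤ Q)
    (hr : 0 < r) : om Q Q0 r ≤ Q * (T / r) := by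
  refine le_trans ?_ (mul_le_mul_of_nonneg_left (sum_inv_dvd_le hT hQB hr) (Nat.cast_nonneg Q))
  rw [om, mul_sum]
  refine sum_le_sum fun q _ => ?_
  rw [mul_one_div]
  gcongr
  exact wt_le_Q (by exact_mod_cast h0) (by exact_mod_cast hQ) (Nat.cast_nonneg _)

lemma abs_dual_sub_om_le {B X Q Q0 r : ℕ} {T : ℝ} (hT : Dom B T) (hQB : Q ≤ B) (hXB : X ≤ B)
    (h0 : 0 < Q0) (hQ : 2 * Q0 ≤ Q) (hr : 0 < r) (hrQ : r ≤ Q0) {h : ℤ} (hh : h ≠ 0)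
    (hX : h.natAbs ≤ X) :
    |∑ k ∈ (Icc 1 (X / Q0)).filter (fun k => r ∣ k), wt Q Q0 (h.natAbs / (k : ℝ)) / (k : ℝ) -
      om Q Q0 r| ≤ 6 * ((Q : ℝ) / Q0) + 28 * T * (Q / r) * min 1 ((r : ℝ) * Q / h.natAbs) := by
  have hr' : (0 : ℝ) < r := by exact_mod_cast hr
  have hh' : (0 : ℝ) < h.natAbs := by exact_mod_cast Int.natAbs_pos.2 hh
  have h1 := wt_compare (B := B) (J := X / Q0 / r) (M := Q / r) (Q := Q) (Q0 := Q0) (r := r)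
    (t := h.natAbs / r) hT (by exact_mod_cast h0) (by exact_mod_cast hQ) hr'
    (by exact_mod_cast hrQ) (by positivity) ?_ ?_ ?_ ?_
  · rw [om, sum_filter_dvd hr, sum_filter_dvd hr]
    have e1 : ∑ j ∈ Icc 1 (X / Q0 / r), wt Q Q0 (h.natAbs / ((r * j : ℕ) : ℝ)) / ((r * j : ℕ) : ℝ) =
        1 / r * ∑ j ∈ Icc 1 (X / Q0 / r), wt Q Q0 (h.natAbs / r / (j : ℝ)) / (j : ℝ) := by
      rw [mul_sum]
      refine sum_congr rfl fun j _ => ?_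
      push_cast
      rw [div_div, one_div, div_mul_eq_div_div, div_div, div_eq_mul_inv, mul_inv]
      ring
    have e2 : ∑ j ∈ Icc 1 (Q / r), wt Q Q0 ((r * j : ℕ) : ℝ) / ((r * j : ℕ) : ℝ) =
        1 / r * ∑ j ∈ Icc 1 (Q / r), wt Q Q0 (r * (j : ℝ)) / (j : ℝ) := by
      rw [mul_sum]
      refine sum_congr rfl fun j _ => ?_
      push_cast
      rw [div_eq_mul_inv, mul_inv]
      ring
    rw [e1, e2, ← mul_sub, abs_mul, abs_of_pos (by positivity : (0 : ℝ) < 1 / r)]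
    refine (mul_le_mul_of_nonneg_left h1 (by positivity)).trans (le_of_eq ?_)
    have : (Q : ℝ) / (h.natAbs / r) = r * Q / h.natAbs := by field_simp
    rw [this]
    field_simp
  · rw [Nat.floor_div_natCast, Nat.floor_div_natCast, Nat.floor_natCast, Nat.div_div_eq_div_mul,
      Nat.div_div_eq_div_mul, mul_comm r]
    exact Nat.div_le_div_right hX
  · rw [Nat.floor_div_eq_div]
  · exact (Nat.div_le_self _ _).trans ((Nat.div_le_self _ _).trans hXB)
  · exact (Nat.div_le_self _ _).trans hQB

lemma sum_abs_Ram_div_le {B R : ℕ} {T : ℝ} (hT : Dom B T) (hR : R ≤ B) {h : ℤ} (hh : h ≠ 0)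
    (hB : h.natAbs ≤ B) : ∑ r ∈ Icc 1 R, |Ram r h| / r ≤ T ^ 2 := by
  have hT1 := hT.one_le
  have hh' : 0 < h.natAbs := Int.natAbs_pos.2 hh
  calc ∑ r ∈ Icc 1 R, |Ram r h| / r
      ≤ ∑ r ∈ Icc 1 R, ∑ d ∈ h.natAbs.divisors, if d ∣ r then (d : ℝ) * (1 / r) else 0 := by
        refine sum_le_sum fun r hr => ?_
        rw [mem_Icc] at hr
        have h1 := abs_Ram_le (r := r) (by omega) h
        rw [← sum_filter] at h1 ⊢
        have h2 : r.divisors.filter (fun d : ℕ => (d : ℤ) ∣ h) = h.natAbs.divisors.filter (fun d => d ∣ r) := by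
          ext d
          simp only [mem_filter, Nat.mem_divisors, Int.natCast_dvd]
          constructor
          · rintro ⟨⟨a, b⟩, c⟩; exact ⟨⟨c, hh'.ne'⟩, a⟩
          · rintro ⟨⟨a, b⟩, c⟩; exact ⟨⟨c, by omega⟩, a⟩
        rw [h2] at h1
        rw [← sum_mul, mul_one_div]
        gcongr
    _ = ∑ d ∈ h.natAbs.divisors, (d : ℝ) * ∑ r ∈ (Icc 1 R).filter (fun r => d ∣ r), (1 : ℝ) / r := by
        rw [sum_comm]
        refine sum_congr rfl fun d _ => ?_
        rw [mul_sum, sum_filter]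
    _ ≤ ∑ d ∈ h.natAbs.divisors, T := by
        refine sum_le_sum fun d hd => ?_
        have hd0 := Nat.pos_of_mem_divisors hd
        have hd' : (0 : ℝ) < d := by exact_mod_cast hd0
        calc _ ≤ (d : ℝ) * (T / d) :=
              mul_le_mul_of_nonneg_left (sum_inv_dvd_le hT hR hd0) hd'.le
          _ = T := by field_simp
    _ = h.natAbs.divisors.card * T := by rw [sum_const, nsmul_eq_mul]
    _ ≤ T * T := by
        gcongr
        exact hT.div_le _ hh' hB
    _ = T ^ 2 := by ring

lemma sum_abs_Ram_le {B R : ℕ} {T : ℝ} (hT : Dom B T) (hR : R ≤ B) {h : ℤ} (hh : h ≠ 0)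
    (hB : h.natAbs ≤ B) : ∑ r ∈ Icc 1 R, |Ram r h| ≤ R * T ^ 2 := by
  refine le_trans ?_ (mul_le_mul_of_nonneg_left (sum_abs_Ram_div_le hT hR hh hB) (Nat.cast_nonneg R))
  rw [mul_sum]
  refine sum_le_sum fun r hr => ?_
  rw [mem_Icc] at hr
  have hr' : (0 : ℝ) < r := by exact_mod_cast hr.1
  rw [mul_div_assoc', le_div_iff₀ hr', mul_comm]
  gcongr
  exact hr.2

lemma sum_min_cube_le {B N : ℕ} {T y : ℝ} (hT : Dom B T) (hN : N ≤ B) (hy : 0 ≤ y) (t : ℤ) :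
    ∑ z ∈ (Icc 1 N).filter (fun z : ℕ => (z : ℤ) ^ 3 ≠ t), min 1 (y ^ 3 / 2 / |((z : ℝ) ^ 3 - t)|) ≤
      1 + 2 * y * T := by
  have hT1 := hT.one_le
  rcases (Icc 1 N).eq_empty_or_nonempty with he | hne
  · rw [he]; simp; positivity
  obtain ⟨z0, hz0, hmin⟩ := exists_min_image (Icc 1 N) (fun z : ℕ => |((z : ℝ) ^ 3 - t)|) hne
  have hpos : ∀ z : ℕ, 0 ≤ min 1 (y ^ 3 / 2 / |((z : ℝ) ^ 3 - t)|) := fun z =>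
    le_min zero_le_one (by positivity)
  have hb : ∀ z ∈ Icc 1 N, z ≠ z0 → min 1 (y ^ 3 / 2 / |((z : ℝ) ^ 3 - t)|) ≤ y / |(z : ℝ) - z0| := by
    intro z hz hzz
    have hd : 0 < |(z : ℝ) - z0| := abs_pos.2 (sub_ne_zero.2 (by exact_mod_cast hzz))
    have h1 : |(z : ℝ) - z0| ^ 3 ≤ |(z : ℝ) ^ 3 - z0 ^ 3| := by
      have ha : (0 : ℝ) ≤ z := Nat.cast_nonneg _
      have hb : (0 : ℝ) ≤ z0 := Nat.cast_nonneg _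
      have : (z : ℝ) ^ 3 - z0 ^ 3 = (z - z0) * (z ^ 2 + z * z0 + z0 ^ 2) := by ring
      rw [this, abs_mul, pow_succ', sq_abs]
      gcongr
      refine le_trans ?_ (le_abs_self _)
      nlinarith [mul_nonneg ha hb]
    have h2 : |(z : ℝ) ^ 3 - z0 ^ 3| ≤ 2 * |((z : ℝ) ^ 3 - t)| := by
      have := hmin z hz
      calc |(z : ℝ) ^ 3 - z0 ^ 3| = |((z : ℝ) ^ 3 - t) - (z0 ^ 3 - t)| := by congr 1; ring
        _ ≤ |((z : ℝ) ^ 3 - t)| + |(z0 : ℝ) ^ 3 - t| := abs_sub _ _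
        _ ≤ _ := by linarith
    have h3 : |(z : ℝ) - z0| ^ 3 ≤ 2 * |((z : ℝ) ^ 3 - t)| := h1.trans h2
    have hd3 : 0 < |(z : ℝ) - z0| ^ 3 := by positivity
    rcases le_or_gt |(z : ℝ) - z0| y with hc | hc
    · exact (min_le_left _ _).trans ((one_le_div hd).2 hc)
    · refine (min_le_right _ _).trans ?_
      calc y ^ 3 / 2 / |((z : ℝ) ^ 3 - t)| = y ^ 3 / (2 * |((z : ℝ) ^ 3 - t)|) := by rw [div_div]
        _ ≤ y ^ 3 / |(z : ℝ) - z0| ^ 3 := by gcongr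
        _ ≤ y / |(z : ℝ) - z0| := by
          rw [← div_pow]
          refine pow_le_of_le_one (by positivity) ((div_le_one hd).2 hc.le) (by norm_num)
  have hs : ∑ z ∈ (Icc 1 N).erase z0, y / |(z : ℝ) - z0| ≤ 2 * y * T := by
    rw [mem_Icc] at hz0
    have e : (Icc 1 N).erase z0 = Icc 1 (z0 - 1) ∪ Icc (z0 + 1) N := by
      ext z; simp only [mem_erase, mem_union, mem_Icc]; omega
    have hdj : Disjoint (Icc 1 (z0 - 1)) (Icc (z0 + 1) N) := by
      rw [Finset.disjoint_left]; intro z; simp only [mem_Icc]; omega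
    rw [e, sum_union hdj]
    have s1 : ∑ z ∈ Icc 1 (z0 - 1), y / |(z : ℝ) - z0| = y * ∑ k ∈ Icc 1 (z0 - 1), (1 : ℝ) / k := by
      rw [mul_sum]
      refine sum_nbij' (fun z => z0 - z) (fun z => z0 - z) ?_ ?_ ?_ ?_ ?_
      · intro z; simp only [mem_Icc]; omega
      · intro z; simp only [mem_Icc]; omega
      · intro z; simp only [mem_Icc]; omega
      · intro z; simp only [mem_Icc]; omega
      · intro z hz
        rw [mem_Icc] at hz
        rw [Nat.cast_sub (by omega), mul_one_div, abs_sub_comm, abs_of_nonneg]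
        rw [sub_nonneg]; exact_mod_cast (by omega : z ≤ z0)
    have s2 : ∑ z ∈ Icc (z0 + 1) N, y / |(z : ℝ) - z0| = y * ∑ k ∈ Icc 1 (N - z0), (1 : ℝ) / k := by
      rw [mul_sum]
      refine sum_nbij' (fun z => z - z0) (fun z => z + z0) ?_ ?_ ?_ ?_ ?_
      · intro z; simp only [mem_Icc]; omega
      · intro z; simp only [mem_Icc]; omega
      · intro z; simp only [mem_Icc]; omega
      · intro z; simp only [mem_Icc]; omega
      · intro z hz
        rw [mem_Icc] at hz
        rw [Nat.cast_sub (by omega), mul_one_div, abs_of_nonneg]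
        rw [sub_nonneg]; exact_mod_cast (by omega : z0 ≤ z)
    rw [s1, s2]
    have := hT.harm_le (z0 - 1) (by omega)
    have := hT.harm_le (N - z0) (by omega)
    nlinarith
  calc _ ≤ ∑ z ∈ Icc 1 N, min 1 (y ^ 3 / 2 / |((z : ℝ) ^ 3 - t)|) :=
        sum_le_sum_of_subset_of_nonneg (filter_subset _ _) fun z _ _ => hpos z
    _ = min 1 (y ^ 3 / 2 / |((z0 : ℝ) ^ 3 - t)|) +
        ∑ z ∈ (Icc 1 N).erase z0, min 1 (y ^ 3 / 2 / |((z : ℝ) ^ 3 - t)|) :=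
        (add_sum_erase _ _ hz0).symm
    _ ≤ 1 + ∑ z ∈ (Icc 1 N).erase z0, y / |(z : ℝ) - z0| := by
        gcongr with z hz
        · exact min_le_left _ _
        · rw [mem_erase] at hz; exact hb z hz.2 hz.1
    _ ≤ _ := by linarith

/-- Pairs of pairs with distinct sums of two cubes. -/
noncomputable def Od (N X : ℕ) : Finset ((ℕ × ℕ) × (ℕ × ℕ)) :=
  (Om N X ×ˢ Om N X).filter fun p => cub p.1 ≠ cub p.2

/-- The difference of the two sums of cubes. -/
def hd (p : (ℕ × ℕ) × (ℕ × ℕ)) : ℤ := (cub p.1 : ℤ) - cub p.2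

lemma hd_ne_zero {N X : ℕ} {p : (ℕ × ℕ) × (ℕ × ℕ)} (hp : p ∈ Od N X) : hd p ≠ 0 := by
  have := (mem_filter.1 hp).2
  unfold hd
  rw [sub_ne_zero]
  exact_mod_cast this

lemma hd_le {N X : ℕ} {p : (ℕ × ℕ) × (ℕ × ℕ)} (hp : p ∈ Om N X ×ˢ Om N X) : (hd p).natAbs ≤ X := by
  rw [mem_product] at hp
  have h1 := cub_le hp.1
  have h2 := cub_le hp.2
  unfold hd
  omega

lemma card_Om_sq_le (N X : ℕ) : (Om N X ×ˢ Om N X).card ≤ N ^ 4 := by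
  have h : (Om N X).card ≤ N * N := by
    refine (card_filter_le _ _).trans ?_
    simp
  rw [card_product]
  calc _ ≤ (N * N) * (N * N) := Nat.mul_le_mul h h
    _ = N ^ 4 := by ring

lemma card_Od_le (N X : ℕ) : (Od N X).card ≤ N ^ 4 :=
  (card_filter_le _ _).trans (card_Om_sq_le N X)

lemma sum_min_hd_le {B N X : ℕ} {T y Y0 : ℝ} (hT : Dom B T) (hN : N ≤ B) (hy : 0 ≤ y)
    (hY : y ^ 3 = 2 * Y0) :
    ∑ p ∈ Od N X, min 1 (Y0 / (hd p).natAbs) ≤ N ^ 3 * (1 + 2 * y * T) := by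
  have hY0 : 0 ≤ Y0 := by have : 0 ≤ y ^ 3 := by positivity
                          linarith
  set I := Icc 1 N
  have hnn : ∀ p, 0 ≤ min 1 (Y0 / ((hd p).natAbs : ℝ)) := fun p => le_min zero_le_one (by positivity)
  have hsub : Od N X ⊆ ((I ×ˢ I) ×ˢ (I ×ˢ I)).filter fun p => cub p.1 ≠ cub p.2 := by
    refine filter_subset_filter _ ?_
    exact product_subset_product (filter_subset _ _) (filter_subset _ _)
  calc _ ≤ ∑ p ∈ ((I ×ˢ I) ×ˢ (I ×ˢ I)).filter fun p => cub p.1 ≠ cub p.2,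
          min 1 (Y0 / ((hd p).natAbs : ℝ)) := sum_le_sum_of_subset_of_nonneg hsub fun p _ _ => hnn p
    _ = ∑ u ∈ I, ∑ v ∈ I, ∑ w ∈ I, ∑ z ∈ I, if cub (u, v) ≠ cub (w, z) then
          min 1 (Y0 / ((hd ((u, v), (w, z))).natAbs : ℝ)) else 0 := by
        rw [sum_filter, sum_product, sum_product]
        refine sum_congr rfl fun u _ => sum_congr rfl fun v _ => ?_
        rw [sum_product]
    _ ≤ ∑ u ∈ I, ∑ v ∈ I, ∑ w ∈ I, (1 + 2 * y * T) := by
        refine sum_le_sum fun u _ => sum_le_sum fun v _ => sum_le_sum fun w _ => ?_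
        refine le_trans (le_of_eq ?_) (sum_min_cube_le hT hN hy ((u : ℤ) ^ 3 + v ^ 3 - w ^ 3))
        rw [sum_filter]
        refine sum_congr rfl fun z _ => ?_
        have e : cub (u, v) ≠ cub (w, z) ↔ (z : ℤ) ^ 3 ≠ (u : ℤ) ^ 3 + v ^ 3 - w ^ 3 := by
          unfold cub
          rw [not_iff_not]
          constructor
          · intro h
            have : (u : ℤ) ^ 3 + v ^ 3 = w ^ 3 + z ^ 3 := by exact_mod_cast h
            linarith
          · intro h
            have : (u : ℤ) ^ 3 + v ^ 3 = w ^ 3 + z ^ 3 := by linarith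
            exact_mod_cast this
        have e2 : ((hd ((u, v), (w, z))).natAbs : ℝ) =
            |(z : ℝ) ^ 3 - (((u : ℤ) ^ 3 + v ^ 3 - w ^ 3 : ℤ) : ℝ)| := by
          rw [Nat.cast_natAbs, Int.cast_abs, abs_sub_comm]
          unfold hd cub
          push_cast
          congr 1; ring
        rw [e2, hY, mul_div_cancel_left₀ _ (two_ne_zero)]
        simp only [e]
    _ = N ^ 3 * (1 + 2 * y * T) := by
        simp only [sum_const, I, Nat.card_Icc, nsmul_eq_mul, add_tsub_cancel_right]
        ring

lemma small_r_error {B N X Q Q0 R1 : ℕ} {T y : ℝ} (hT : Dom B T) (hQB : Q ≤ B) (hXB : X ≤ B)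
    (hNB : N ≤ B) (h0 : 0 < Q0) (hQ : 2 * Q0 ≤ Q) (hR : R1 ≤ Q0) (hy : 0 ≤ y)
    (hy3 : y ^ 3 = 2 * (R1 * Q)) :
    |∑ p ∈ Od N X, ∑ r ∈ Icc 1 R1, Ram r (hd p) *
      (∑ k ∈ (Icc 1 (X / Q0)).filter (fun k => r ∣ k), wt Q Q0 ((hd p).natAbs / (k : ℝ)) / (k : ℝ) -
        om Q Q0 r)| ≤
      6 * ((Q : ℝ) / Q0) * R1 * T ^ 2 * N ^ 4 + 28 * T ^ 3 * Q * (N ^ 3 * (1 + 2 * y * T)) := by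
  have hT1 := hT.one_le
  have hRB : R1 ≤ B := by omega
  have hpt : ∀ p ∈ Od N X, |∑ r ∈ Icc 1 R1, Ram r (hd p) *
      (∑ k ∈ (Icc 1 (X / Q0)).filter (fun k => r ∣ k), wt Q Q0 ((hd p).natAbs / (k : ℝ)) / (k : ℝ) -
        om Q Q0 r)| ≤ 6 * ((Q : ℝ) / Q0) * (R1 * T ^ 2) +
          28 * T ^ 3 * Q * min 1 (R1 * Q / ((hd p).natAbs : ℝ)) := by
    intro p hp
    have hh := hd_ne_zero hp
    have hX := hd_le (mem_filter.1 hp).1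
    set m := min 1 ((R1 : ℝ) * Q / ((hd p).natAbs : ℝ)) with hm
    have hm0 : 0 ≤ m := le_min zero_le_one (by positivity)
    calc _ ≤ ∑ r ∈ Icc 1 R1, (6 * ((Q : ℝ) / Q0) * |Ram r (hd p)| +
          28 * T * Q * m * (|Ram r (hd p)| / r)) := by
          refine (abs_sum_le_sum_abs _ _).trans (sum_le_sum fun r hr => ?_)
          rw [mem_Icc] at hr
          have h1 := abs_dual_sub_om_le hT hQB hXB h0 hQ (r := r) (by omega) (by omega) hh hX
          rw [abs_mul]
          have h2 : min 1 ((r : ℝ) * Q / (hd p).natAbs) ≤ m := by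
            rw [hm]
            have : (r : ℝ) ≤ R1 := by exact_mod_cast hr.2
            gcongr
          have h3 : 28 * T * ((Q : ℝ) / r) * min 1 ((r : ℝ) * Q / (hd p).natAbs) ≤
              28 * T * ((Q : ℝ) / r) * m := by gcongr
          calc _ ≤ |Ram r (hd p)| * (6 * ((Q : ℝ) / Q0) + 28 * T * ((Q : ℝ) / r) * m) := by
                gcongr; linarith
            _ = _ := by ring
      _ = 6 * ((Q : ℝ) / Q0) * (∑ r ∈ Icc 1 R1, |Ram r (hd p)|) +
          28 * T * Q * m * ∑ r ∈ Icc 1 R1, |Ram r (hd p)| / r := by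
          rw [sum_add_distrib, mul_sum, mul_sum]
      _ ≤ 6 * ((Q : ℝ) / Q0) * (R1 * T ^ 2) + 28 * T * Q * m * T ^ 2 := by
          gcongr
          · exact sum_abs_Ram_le hT hRB hh (hX.trans hXB)
          · exact sum_abs_Ram_div_le hT hRB hh (hX.trans hXB)
      _ = _ := by ring
  calc _ ≤ ∑ p ∈ Od N X, (6 * ((Q : ℝ) / Q0) * (R1 * T ^ 2) +
          28 * T ^ 3 * Q * min 1 (R1 * Q / ((hd p).natAbs : ℝ))) :=
        (abs_sum_le_sum_abs _ _).trans (sum_le_sum hpt)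
    _ = (Od N X).card * (6 * ((Q : ℝ) / Q0) * (R1 * T ^ 2)) +
        28 * T ^ 3 * Q * ∑ p ∈ Od N X, min 1 (R1 * Q / ((hd p).natAbs : ℝ)) := by
        rw [sum_add_distrib, sum_const, nsmul_eq_mul, mul_sum]
    _ ≤ (N : ℝ) ^ 4 * (6 * ((Q : ℝ) / Q0) * (R1 * T ^ 2)) +
        28 * T ^ 3 * Q * (N ^ 3 * (1 + 2 * y * T)) := by
        gcongr
        · exact_mod_cast card_Od_le N X
        · exact sum_min_hd_le hT hNB hy hy3
    _ = _ := by ring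

/-- Unnormalised Fejér kernel. -/
noncomputable def fej (Y : ℕ) (α : ℝ) : ℝ := ‖∑ j ∈ range Y, ex (j * α)‖ ^ 2

lemma fej_nonneg (Y : ℕ) (α : ℝ) : 0 ≤ fej Y α := by unfold fej; positivity

lemma fej_eq (Y : ℕ) (α : ℝ) :
    (fej Y α : ℂ) = ∑ i ∈ range Y, ∑ j ∈ range Y, ex (((i : ℤ) - j : ℤ) * α) := by
  unfold fej
  push_cast
  rw [← Complex.mul_conj', map_sum, sum_mul_sum]
  refine sum_congr rfl fun i _ => sum_congr rfl fun j _ => ?_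
  rw [← ex_sub]; congr 1; ring

lemma fej_le (Y : ℕ) {α : ℝ} (h : 0 < nd α) : fej Y α ≤ 1 / (4 * nd α ^ 2) := by
  have h1 := (norm_geom_le Y α).trans (gmin_le_inv h le_rfl)
  calc fej Y α ≤ (1 / (2 * nd α)) ^ 2 := by unfold fej; gcongr
    _ = _ := by rw [div_pow, mul_pow]; norm_num

lemma card_shift (Y : ℕ) (h : ℤ) :
    ((range Y ×ˢ range Y).filter fun p : ℕ × ℕ => (p.1 : ℤ) - p.2 + h = 0).card = Y - h.natAbs := by
  rcases le_total 0 h with hh | hh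
  · obtain ⟨n, rfl⟩ := Int.eq_ofNat_of_zero_le hh
    have : ((range Y ×ˢ range Y).filter fun p : ℕ × ℕ => (p.1 : ℤ) - p.2 + n = 0) =
        (range (Y - n)).image fun i => (i, i + n) := by
      ext ⟨a, b⟩
      simp only [mem_filter, mem_product, mem_range, mem_image, Prod.mk.injEq]
      constructor
      · rintro ⟨⟨h1, h2⟩, h3⟩; exact ⟨a, by omega, rfl, by omega⟩
      · rintro ⟨i, h1, rfl, rfl⟩; omega
    rw [this, card_image_of_injective _ fun a b e => (Prod.mk.inj e).1]
    simp
  · obtain ⟨n, hn⟩ := Int.eq_ofNat_of_zero_le (neg_nonneg.2 hh)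
    obtain rfl : h = -n := by omega
    have : ((range Y ×ˢ range Y).filter fun p : ℕ × ℕ => (p.1 : ℤ) - p.2 + -n = 0) =
        (range (Y - n)).image fun i => (i + n, i) := by
      ext ⟨a, b⟩
      simp only [mem_filter, mem_product, mem_range, mem_image, Prod.mk.injEq]
      constructor
      · rintro ⟨⟨h1, h2⟩, h3⟩; exact ⟨b, by omega, by omega, rfl⟩
      · rintro ⟨i, h1, rfl, rfl⟩; omega
    rw [this, card_image_of_injective _ fun a b e => (Prod.mk.inj e).2]
    simp

lemma sum_fej_ex {Y L : ℕ} {h : ℤ} (hL : 0 < L) (hY : h.natAbs + Y ≤ L) :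
    ∑ m ∈ range L, (fej Y (m / L) : ℂ) * ex (m / L * h) = L * ((Y - h.natAbs : ℕ) : ℂ) := by
  calc _ = ∑ m ∈ range L, ∑ p ∈ range Y ×ˢ range Y, ex (m * (((p.1 : ℤ) - p.2 + h : ℤ) : ℝ) / L) := by
        refine sum_congr rfl fun m _ => ?_
        rw [fej_eq, sum_product, sum_mul]
        refine sum_congr rfl fun i _ => ?_
        rw [sum_mul]
        refine sum_congr rfl fun j _ => ?_
        rw [← ex_add]; congr 1; push_cast; ring
    _ = ∑ p ∈ range Y ×ˢ range Y, if (p.1 : ℤ) - p.2 + h = 0 then (L : ℂ) else 0 := by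
        rw [sum_comm]
        refine sum_congr rfl fun p hp => ?_
        rw [sum_ex_orth L hL]
        simp only [mem_product, mem_range] at hp
        have : (L : ℤ) ∣ (p.1 : ℤ) - p.2 + h ↔ (p.1 : ℤ) - p.2 + h = 0 := by
          refine ⟨fun hd => Int.eq_zero_of_abs_lt_dvd hd ?_, fun e => e ▸ dvd_zero _⟩
          rw [abs_lt]; omega
        simp only [this]
    _ = _ := by
        rw [← sum_filter, sum_const, card_shift, nsmul_eq_mul, mul_comm]

lemma sum_fej {Y L : ℕ} (hL : 0 < L) (hY : Y ≤ L) : ∑ m ∈ range L, fej Y (m / L) = L * Y := by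
  have h := sum_fej_ex (Y := Y) (h := 0) hL (by simpa using hY)
  simp only [Int.cast_zero, mul_zero, ex_zero, mul_one, Int.natAbs_zero, Nat.sub_zero] at h
  exact_mod_cast h

/-- Star mean square at a shifted argument. -/
noncomputable def fs (N X r : ℕ) (β : ℝ) : ℝ := ∑ b ∈ star r, ‖F N X (b / r + β)‖ ^ 2

lemma fs_nonneg (N X r : ℕ) (β : ℝ) : 0 ≤ fs N X r β := sum_nonneg fun _ _ => by positivity

lemma F_add_int (N X : ℕ) (α : ℝ) (n : ℤ) : F N X (α + n) = F N X α := by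
  unfold F
  refine sum_congr rfl fun p _ => ?_
  have : (α + n) * (cub p : ℝ) = α * cub p + ((n * cub p : ℤ) : ℝ) := by push_cast; ring
  rw [this, ex_add_int]

lemma fs_add_int (N X r : ℕ) (β : ℝ) (n : ℤ) : fs N X r (β + n) = fs N X r β := by
  unfold fs
  refine sum_congr rfl fun b _ => ?_
  rw [← add_assoc, F_add_int]

lemma normSq_F (N X : ℕ) (α : ℝ) :
    ((‖F N X α‖ ^ 2 : ℝ) : ℂ) = ∑ p ∈ Om N X ×ˢ Om N X, ex (α * hd p) := by
  push_cast
  rw [← Complex.mul_conj', F, map_sum, sum_mul_sum, sum_product]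
  refine sum_congr rfl fun i _ => sum_congr rfl fun j _ => ?_
  rw [← ex_sub]; congr 1; unfold hd; push_cast; ring

lemma Ram_eq_re (r : ℕ) (h : ℤ) : Ram r h = (∑ b ∈ star r, ex (b / r * h)).re := by
  rw [Complex.re_sum, Ram]
  refine sum_congr rfl fun b _ => ?_
  rw [re_ex]; congr 1; ring

lemma sum_Ram_tent {N X L Y : ℕ} (hL : 0 < L) (hY : X + Y ≤ L) (r : ℕ) :
    L * ∑ p ∈ Om N X ×ˢ Om N X, Ram r (hd p) * ((Y - (hd p).natAbs : ℕ) : ℝ) =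
      ∑ m ∈ range L, fej Y (m / L) * fs N X r (m / L) := by
  have key : ((∑ m ∈ range L, fej Y (m / L) * fs N X r (m / L) : ℝ) : ℂ) =
      ∑ p ∈ Om N X ×ˢ Om N X, (∑ b ∈ star r, ex (b / r * hd p)) *
        (L * ((Y - (hd p).natAbs : ℕ) : ℂ)) := by
    calc _ = ∑ m ∈ range L, ∑ p ∈ Om N X ×ˢ Om N X, (∑ b ∈ star r, ex (b / r * hd p)) *
          ((fej Y (m / L) : ℂ) * ex (m / L * hd p)) := by
          rw [Complex.ofReal_sum]
          refine sum_congr rfl fun m _ => ?_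
          rw [Complex.ofReal_mul, fs, Complex.ofReal_sum]
          simp_rw [normSq_F]
          rw [sum_comm, mul_sum]
          refine sum_congr rfl fun p _ => ?_
          rw [mul_sum, sum_mul]
          refine sum_congr rfl fun b _ => ?_
          rw [add_mul, ex_add]; ring
      _ = _ := by
          rw [sum_comm]
          refine sum_congr rfl fun p hp => ?_
          rw [← mul_sum, sum_fej_ex hL]
          have := hd_le hp
          omega
  have h2 := congrArg Complex.re key
  rw [Complex.ofReal_re] at h2
  rw [h2, Complex.re_sum, mul_sum]
  refine sum_congr rfl fun p _ => ?_
  have : ((L : ℂ) * ((Y - (hd p).natAbs : ℕ) : ℂ)) = ((L * ((Y - (hd p).natAbs : ℕ) : ℝ) : ℝ) : ℂ) := by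
    push_cast; ring
  rw [this, Complex.re_mul_ofReal, ← Ram_eq_re]
  ring

lemma sum_divisors_fs_le {N X k : ℕ} (hk : 0 < k) (β : ℝ) :
    ∑ r ∈ k.divisors, fs N X r β ≤
      k * ((Om N X ×ˢ Om N X).filter fun p => (k : ℤ) ∣ hd p).card := by
  have h1 : ∑ r ∈ k.divisors, fs N X r β = ∑ b ∈ range k, ‖F N X (b / k + β)‖ ^ 2 := by
    symm
    refine sum_range_eq_sum_star (fun q b => ‖F N X ((b : ℝ) / q + β)‖ ^ 2) ?_ hk
    intro k q b hk hq
    have hk' : (k : ℝ) ≠ 0 := by positivity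
    have : (((k * b : ℕ) : ℝ)) / ((k * q : ℕ) : ℝ) = (b : ℝ) / q := by
      push_cast; rw [mul_div_mul_left _ _ hk']
    simp only [this]
  have h2 : ((∑ r ∈ k.divisors, fs N X r β : ℝ) : ℂ) =
      ∑ p ∈ (Om N X ×ˢ Om N X).filter (fun p => (k : ℤ) ∣ hd p), ex (β * hd p) * k := by
    rw [h1, Complex.ofReal_sum]
    simp_rw [normSq_F]
    rw [sum_comm, sum_filter]
    refine sum_congr rfl fun p _ => ?_
    have : ∀ b : ℕ, ex ((b / k + β) * hd p) = ex (β * hd p) * ex (b * (hd p : ℤ) / k) := by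
      intro b; rw [← ex_add]; congr 1; ring
    simp_rw [this]
    rw [← mul_sum, sum_ex_orth k hk]
    split_ifs <;> simp
  have h3 : ∑ r ∈ k.divisors, fs N X r β ≤ ‖((∑ r ∈ k.divisors, fs N X r β : ℝ) : ℂ)‖ := by
    rw [Complex.norm_real]; exact le_abs_self _
  refine h3.trans ?_
  rw [h2]
  refine (norm_sum_le _ _).trans ?_
  simp only [norm_mul, norm_ex, one_mul, Complex.norm_natCast, sum_const, nsmul_eq_mul]
  rw [mul_comm]

lemma sum_dvd_count_le {B N X K : ℕ} {T : ℝ} (hT : Dom B T) (hXB : X ≤ B) :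
    ∑ k ∈ Icc 1 K, (k : ℝ) * ((Om N X ×ˢ Om N X).filter fun p => (k : ℤ) ∣ hd p).card ≤
      K ^ 2 * Z N X + K * T * N ^ 4 := by
  have hT1 := hT.one_le
  have hsplit : ∀ p ∈ Om N X ×ˢ Om N X,
      ∑ k ∈ Icc 1 K, (if (k : ℤ) ∣ hd p then (k : ℝ) else 0) ≤
        (if cub p.1 = cub p.2 then (K : ℝ) ^ 2 else 0) + K * T := by
    intro p hp
    have hle : ∑ k ∈ Icc 1 K, (if (k : ℤ) ∣ hd p then (k : ℝ) else 0) ≤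
        ∑ k ∈ (Icc 1 K).filter (fun k : ℕ => (k : ℤ) ∣ hd p), (K : ℝ) := by
      rw [← sum_filter]
      refine sum_le_sum fun k hk => ?_
      have := (mem_Icc.1 (mem_filter.1 hk).1).2
      exact_mod_cast this
    refine hle.trans ?_
    rw [sum_const, nsmul_eq_mul]
    split_ifs with h
    · have : (((Icc 1 K).filter (fun k : ℕ => (k : ℤ) ∣ hd p)).card : ℝ) ≤ K := by
        have := card_filter_le (Icc 1 K) (fun k : ℕ => (k : ℤ) ∣ hd p)
        simp only [Nat.card_Icc, add_tsub_cancel_right] at this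
        exact_mod_cast this
      have h0 : (0 : ℝ) ≤ K := Nat.cast_nonneg _
      have : (0 : ℝ) ≤ K * T := by positivity
      nlinarith
    · have hh : hd p ≠ 0 := hd_ne_zero (mem_filter.2 ⟨hp, h⟩)
      have h1 := hT.div_le _ (Int.natAbs_pos.2 hh) ((hd_le hp).trans hXB)
      have h2 : ((Icc 1 K).filter (fun k : ℕ => (k : ℤ) ∣ hd p)).card ≤ (hd p).natAbs.divisors.card := by
        refine card_le_card fun k hk => ?_
        rw [mem_filter, Int.natCast_dvd] at hk
        exact Nat.mem_divisors.2 ⟨hk.2, Int.natAbs_ne_zero.2 hh⟩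
      have h3 : (((Icc 1 K).filter (fun k : ℕ => (k : ℤ) ∣ hd p)).card : ℝ) ≤ T :=
        le_trans (by exact_mod_cast h2) h1
      rw [zero_add, mul_comm]
      gcongr
  calc _ = ∑ p ∈ Om N X ×ˢ Om N X, ∑ k ∈ Icc 1 K, (if (k : ℤ) ∣ hd p then (k : ℝ) else 0) := by
        rw [sum_comm]
        refine sum_congr rfl fun k _ => ?_
        rw [← sum_filter, sum_const, nsmul_eq_mul, mul_comm]
    _ ≤ ∑ p ∈ Om N X ×ˢ Om N X, ((if cub p.1 = cub p.2 then (K : ℝ) ^ 2 else 0) + K * T) :=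
        sum_le_sum hsplit
    _ = K ^ 2 * Z N X + (Om N X ×ˢ Om N X).card * (K * T) := by
        rw [sum_add_distrib, ← sum_filter, sum_const, sum_const, nsmul_eq_mul, nsmul_eq_mul, Z, mul_comm]
    _ ≤ K ^ 2 * Z N X + (N : ℝ) ^ 4 * (K * T) := by
        have : ((Om N X ×ˢ Om N X).card : ℝ) ≤ (N : ℝ) ^ 4 := by exact_mod_cast card_Om_sq_le N X
        gcongr
    _ = _ := by ring

lemma sum_inv_nd_le {B L : ℕ} {T : ℝ} (hT : Dom B T) (hL : 0 < L) (hLB : L ≤ B) :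
    ∑ m ∈ (range L).filter (fun m : ℕ => 0 < nd (m / L)), 1 / nd (m / L) ≤ L * (2 * T) := by
  have hL' : (0 : ℝ) < L := by exact_mod_cast hL
  have hlow : ∀ m : ℕ, 1 ≤ m → m < L → min (m : ℝ) ((L : ℝ) - m) / L ≤ nd (m / L) := by
    intro m h1 h2
    have h1' : (1 : ℝ) ≤ m := by exact_mod_cast h1
    have h2' : (m : ℝ) < L := by exact_mod_cast h2
    rw [nd]
    set n := round ((m : ℝ) / L)
    have h : |(m : ℝ) / L - n| = |(m : ℝ) - n * L| / L := by
      rw [← abs_of_pos hL', ← abs_div, abs_of_pos hL']; congr 1; field_simp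
    rw [h]
    gcongr
    rcases le_or_gt n 0 with hn | hn
    · have : (n : ℝ) ≤ 0 := by exact_mod_cast hn
      refine (min_le_left _ _).trans (le_trans ?_ (le_abs_self _))
      nlinarith
    · have : (1 : ℝ) ≤ n := by exact_mod_cast hn
      refine (min_le_right _ _).trans (le_trans ?_ (neg_le_abs _))
      nlinarith
  have hpt : ∀ m : ℕ, 1 ≤ m → m < L → 1 / nd (m / L) ≤ L * (1 / m + 1 / ((L - m : ℕ) : ℝ)) := by
    intro m h1 h2
    have h1' : (0 : ℝ) < m := by exact_mod_cast h1
    have h2' : (m : ℝ) < L := by exact_mod_cast h2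
    have h3 := hlow m h1 h2
    rw [Nat.cast_sub h2.le]
    have hd : (0 : ℝ) < L - m := by linarith
    have hmin : 0 < min (m : ℝ) ((L : ℝ) - m) := lt_min h1' hd
    calc 1 / nd (m / L) ≤ 1 / (min (m : ℝ) ((L : ℝ) - m) / L) := by gcongr
      _ = L * (1 / min (m : ℝ) ((L : ℝ) - m)) := by rw [one_div_div, mul_one_div]
      _ ≤ _ := by
        gcongr
        rcases min_choice (m : ℝ) ((L : ℝ) - m) with e | e
        · rw [e]; have : 0 < 1 / ((L : ℝ) - m) := by positivity
          linarith
        · rw [e]; have : 0 < 1 / (m : ℝ) := by positivity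
          linarith
  calc _ ≤ ∑ m ∈ Icc 1 (L - 1), (L : ℝ) * (1 / m + 1 / ((L - m : ℕ) : ℝ)) := by
        refine (sum_le_sum fun m hm => ?_).trans (sum_le_sum_of_subset_of_nonneg ?_ ?_)
        · rw [mem_filter, mem_range] at hm
          refine hpt m (Nat.pos_of_ne_zero fun h => ?_) hm.1
          rw [h] at hm; simp [nd] at hm
        · intro m hm
          rw [mem_filter, mem_range] at hm
          have : m ≠ 0 := fun h => by rw [h] at hm; simp [nd] at hm
          rw [mem_Icc]; omega
        · intros; positivity
    _ = L * (∑ m ∈ Icc 1 (L - 1), 1 / (m : ℝ) + ∑ m ∈ Icc 1 (L - 1), 1 / ((L - m : ℕ) : ℝ)) := by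
        rw [← sum_add_distrib, mul_sum]
    _ = L * (∑ m ∈ Icc 1 (L - 1), 1 / (m : ℝ) + ∑ m ∈ Icc 1 (L - 1), 1 / (m : ℝ)) := by
        congr 2
        refine sum_nbij' (fun m => L - m) (fun m => L - m) ?_ ?_ ?_ ?_ ?_
        · intro z; simp only [mem_Icc]; omega
        · intro z; simp only [mem_Icc]; omega
        · intro z; simp only [mem_Icc]; omega
        · intro z; simp only [mem_Icc]; omega
        · intros; rfl
    _ ≤ _ := by
        have := hT.harm_le (L - 1) (by omega)
        gcongr
        linarith

section
variable {N X R1 K1 B : ℕ} {S T μ : ℝ}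

lemma fej_mul_fs_le (h : Par N X R1 K1 B S T μ) {k r : ℕ} (hk : 0 < k) (hkK : k ≤ K1)
    (hr : r ∣ k) (Y : ℕ) (α : ℝ) :
    fej Y α * fs N X r α ≤ fej Y α * (r * (625 * T ^ 3 * (Ew N r * Nr N r))) +
      (if 0 < nd α then (k : ℝ) ^ 2 * (1 / 4 * (1 / nd α) * fs N X r α) else 0) := by
  have hT := h.dom.one_le
  have hr0 := Nat.pos_of_dvd_of_pos hr hk
  have hrk := Nat.le_of_dvd hk hr
  have hr' : (0 : ℝ) < r := by exact_mod_cast hr0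
  have hk' : (0 : ℝ) < k := by exact_mod_cast hk
  have hrk' : (r : ℝ) ≤ k := by exact_mod_cast hrk
  have hfs := fs_nonneg N X r α
  have hEw : 0 ≤ Ew N r := Real.sqrt_nonneg _
  rcases le_or_gt (nd α) (1 / (k : ℝ) ^ 2) with hc | hc
  · have h1 := starMeanSq_le_Ew h hr0 (hrk.trans hkK) (β := α - round α)
      (hc.trans (by gcongr))
    have h2 : fs N X r (α - round α) = fs N X r α := by
      rw [← fs_add_int N X r (α - round α) (round α), sub_add_cancel]
    change fs N X r (α - round α) / r ≤ _ at h1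
    rw [h2, div_le_iff₀ hr'] at h1
    have h3 : 0 ≤ (if 0 < nd α then (k : ℝ) ^ 2 * (1 / 4 * (1 / nd α) * fs N X r α) else 0) := by
      split_ifs
      · have := nd_nonneg α; positivity
      · rfl
    have := mul_le_mul_of_nonneg_left h1 (fej_nonneg Y α)
    linarith
  · have hn : 0 < nd α := lt_trans (by positivity) hc
    rw [if_pos hn]
    have h1 := fej_le Y hn
    have h2 : 1 / (4 * nd α ^ 2) ≤ (k : ℝ) ^ 2 * (1 / 4 * (1 / nd α)) := by
      rw [div_lt_iff₀ (by positivity)] at hc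
      rw [div_le_iff₀ (by positivity)]
      have : (k : ℝ) ^ 2 * (1 / 4 * (1 / nd α)) * (4 * nd α ^ 2) = nd α * k ^ 2 := by field_simp
      linarith
    have h3 := mul_le_mul_of_nonneg_right (h1.trans h2) hfs
    have h4 : 0 ≤ fej Y α * (r * (625 * T ^ 3 * (Ew N r * Nr N r))) := by
      have := fej_nonneg Y α; positivity
    linarith

/-- Weighted correlation of large Ramanujan sums with a tent of slope scale `q`. -/
noncomputable def Et (N X R1 K q : ℕ) : ℝ :=
  ∑ k ∈ Icc 1 K, 1 / (k : ℝ) ^ 2 * ∑ r ∈ k.divisors.filter (fun r => R1 < r),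
    ∑ p ∈ Om N X ×ˢ Om N X, Ram r (hd p) * ((q * k - (hd p).natAbs : ℕ) : ℝ)

lemma abs_Et_le (h : Par N X R1 K1 B S T μ) {K q L : ℕ} (hK : K ≤ K1) (hL : 0 < L) (hLB : L ≤ B)
    (hqL : X + q * K ≤ L) :
    |Et N X R1 K q| ≤ 5000 * T ^ 5 * q * S ^ 15 +
      T / 2 * (K ^ 2 * Z N X + K * T * N ^ 4) := by
  have hT := h.dom.one_le
  have hL' : (0 : ℝ) < L := by exact_mod_cast hL
  have hXB : X ≤ B := by omega
  have hKB : K ≤ B := by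
    have := h.big_of (c := 1) (k := 2) (by norm_num) (by norm_num)
    have := h.K1_le_sq; omega
  set W : ℕ → ℝ := fun r => 625 * T ^ 3 * (Ew N r * Nr N r) with hW
  have hW0 : ∀ r, 0 ≤ W r := fun r => by
    have : 0 ≤ Ew N r := Real.sqrt_nonneg _
    simp only [hW]; positivity
  have hin : ∀ k ∈ Icc 1 K, ∀ r ∈ k.divisors.filter (fun r => R1 < r),
      0 ≤ ∑ p ∈ Om N X ×ˢ Om N X, Ram r (hd p) * ((q * k - (hd p).natAbs : ℕ) : ℝ) ∧
      ∑ p ∈ Om N X ×ˢ Om N X, Ram r (hd p) * ((q * k - (hd p).natAbs : ℕ) : ℝ) ≤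
        (q : ℝ) * k * (r * W r) + 1 / (L : ℝ) * ∑ m ∈ (range L).filter (fun m : ℕ => 0 < nd (m / L)),
          (k : ℝ) ^ 2 * (1 / 4 * (1 / nd (m / L)) * fs N X r (m / L)) := by
    intro k hk r hr
    rw [mem_Icc] at hk
    rw [mem_filter, Nat.mem_divisors] at hr
    have hqk : q * k ≤ q * K := Nat.mul_le_mul_left _ hk.2
    have h1 := sum_Ram_tent (N := N) (X := X) (Y := q * k) hL (by omega) r
    have h2 : ∑ m ∈ range L, fej (q * k) (m / L) * fs N X r (m / L) ≤
        L * ((q : ℝ) * k * (r * W r)) + ∑ m ∈ (range L).filter (fun m : ℕ => 0 < nd (m / L)),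
          (k : ℝ) ^ 2 * (1 / 4 * (1 / nd (m / L)) * fs N X r (m / L)) := by
      refine le_trans (sum_le_sum fun m _ => fej_mul_fs_le h (k := k) (r := r) (by omega) (by omega) hr.1.1 (q * k) ((m : ℝ) / L)) ?_
      rw [sum_add_distrib, ← sum_mul, sum_fej hL (by omega), ← sum_filter]
      push_cast
      rw [mul_assoc]
    have h3 : 0 ≤ ∑ m ∈ range L, fej (q * k) (m / L) * fs N X r (m / L) :=
      sum_nonneg fun m _ => mul_nonneg (fej_nonneg _ _) (fs_nonneg _ _ _ _)
    rw [← h1] at h2 h3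
    refine ⟨nonneg_of_mul_nonneg_right h3 hL', ?_⟩
    refine le_of_mul_le_mul_left (h2.trans (le_of_eq ?_)) hL'
    rw [mul_add, ← mul_assoc (L : ℝ) (1 / L), mul_one_div_cancel hL'.ne', one_mul]
  have hnn : 0 ≤ Et N X R1 K q := sum_nonneg fun k hk => mul_nonneg (by positivity)
    (sum_nonneg fun r hr => (hin k hk r hr).1)
  rw [abs_of_nonneg hnn]
  have hnear : ∑ k ∈ Icc 1 K, 1 / (k : ℝ) ^ 2 * ∑ r ∈ k.divisors.filter (fun r => R1 < r),
      (q : ℝ) * k * (r * W r) ≤ 5000 * T ^ 5 * q * S ^ 15 := by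
    calc _ = q * ∑ k ∈ Icc 1 K, ∑ r ∈ Ioc R1 K, if r ∣ k then r * W r * (1 / k) else 0 := by
          rw [mul_sum]
          refine sum_congr rfl fun k hk => ?_
          rw [mem_Icc] at hk
          have hk' : (0 : ℝ) < k := by exact_mod_cast hk.1
          have e : k.divisors.filter (fun r => R1 < r) = (Ioc R1 K).filter (fun r => r ∣ k) := by
            ext r
            simp only [mem_filter, Nat.mem_divisors, mem_Ioc]
            constructor
            · rintro ⟨⟨a, b⟩, c⟩; exact ⟨⟨c, (Nat.le_of_dvd hk.1 a).trans hk.2⟩, a⟩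
            · rintro ⟨⟨a, b⟩, c⟩; exact ⟨⟨c, by omega⟩, a⟩
          rw [e, ← sum_filter, mul_sum, mul_sum]
          refine sum_congr rfl fun r _ => ?_
          field_simp
      _ = q * ∑ r ∈ Ioc R1 K, r * W r * ∑ k ∈ (Icc 1 K).filter (fun k => r ∣ k), (1 : ℝ) / k := by
          rw [sum_comm]
          congr 1
          refine sum_congr rfl fun r _ => ?_
          rw [← sum_filter, mul_sum]
      _ ≤ q * ∑ r ∈ Ioc R1 K, T * W r := by
          refine mul_le_mul_of_nonneg_left (sum_le_sum fun r hr => ?_) (Nat.cast_nonneg q)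
          rw [mem_Ioc] at hr
          have hr' : (0 : ℝ) < r := by exact_mod_cast (by omega : 0 < r)
          calc _ ≤ r * W r * (T / r) :=
                mul_le_mul_of_nonneg_left (sum_inv_dvd_le h.dom hKB (by omega))
                  (mul_nonneg hr'.le (hW0 r))
            _ = T * W r := by field_simp
      _ ≤ q * ∑ r ∈ Ioc R1 K1, T * W r := by
          gcongr ?_ * ?_
          exact sum_le_sum_of_subset_of_nonneg (Ioc_subset_Ioc_right hK)
            fun r _ _ => mul_nonneg (by linarith) (hW0 r)
      _ = q * (T * (625 * T ^ 3)) * ∑ r ∈ Ioc R1 K1, Ew N r * Nr N r := by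
          rw [mul_sum, mul_sum]
          refine sum_congr rfl fun r _ => ?_
          simp only [hW]; ring
      _ ≤ q * (T * (625 * T ^ 3)) * (8 * T * S ^ 15) := by
          gcongr
          exact sum_Ew_Nr_le h
      _ = _ := by ring
  have hfar : ∑ k ∈ Icc 1 K, 1 / (k : ℝ) ^ 2 * ∑ r ∈ k.divisors.filter (fun r => R1 < r),
      1 / (L : ℝ) * ∑ m ∈ (range L).filter (fun m : ℕ => 0 < nd (m / L)),
          (k : ℝ) ^ 2 * (1 / 4 * (1 / nd (m / L)) * fs N X r (m / L)) ≤
      T / 2 * (K ^ 2 * Z N X + K * T * N ^ 4) := by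
    calc _ = 1 / (L : ℝ) * ∑ m ∈ (range L).filter (fun m : ℕ => 0 < nd (m / L)), 1 / 4 * (1 / nd (m / L)) *
          ∑ k ∈ Icc 1 K, ∑ r ∈ k.divisors.filter (fun r => R1 < r), fs N X r (m / L) := by
          simp only [mul_sum (s := range L |>.filter _), mul_sum (s := Icc 1 K)]
          rw [sum_comm]
          refine sum_congr rfl fun k hk => ?_
          simp only [mul_sum]
          rw [sum_comm]
          refine sum_congr rfl fun m _ => sum_congr rfl fun r _ => ?_
          rw [mem_Icc] at hk
          have hk' : (0 : ℝ) < k := by exact_mod_cast hk.1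
          field_simp
      _ ≤ 1 / (L : ℝ) * ∑ m ∈ (range L).filter (fun m : ℕ => 0 < nd (m / L)), 1 / 4 * (1 / nd (m / L)) *
          (K ^ 2 * Z N X + K * T * N ^ 4) := by
          gcongr with m hm
          · have := nd_nonneg ((m : ℝ) / L); positivity
          refine le_trans ?_ (sum_dvd_count_le h.dom hXB)
          refine sum_le_sum fun k hk => ?_
          rw [mem_Icc] at hk
          refine le_trans ?_ (sum_divisors_fs_le hk.1 ((m : ℝ) / L))
          exact sum_le_sum_of_subset_of_nonneg (filter_subset _ _) fun r _ _ => fs_nonneg _ _ _ _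
      _ = 1 / (L : ℝ) * (1 / 4 * (K ^ 2 * Z N X + K * T * N ^ 4)) *
          ∑ m ∈ (range L).filter (fun m : ℕ => 0 < nd (m / L)), 1 / nd (m / L) := by
          rw [← sum_mul, ← mul_sum]
          ring
      _ ≤ 1 / (L : ℝ) * (1 / 4 * (K ^ 2 * Z N X + K * T * N ^ 4)) * (L * (2 * T)) := by
          gcongr
          exact sum_inv_nd_le h.dom hL hLB
      _ = _ := by field_simp; ring
  calc Et N X R1 K q ≤ ∑ k ∈ Icc 1 K, 1 / (k : ℝ) ^ 2 * ∑ r ∈ k.divisors.filter (fun r => R1 < r),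
      ((q : ℝ) * k * (r * W r) + 1 / (L : ℝ) * ∑ m ∈ (range L).filter (fun m : ℕ => 0 < nd (m / L)),
          (k : ℝ) ^ 2 * (1 / 4 * (1 / nd (m / L)) * fs N X r (m / L))) := by
        unfold Et
        gcongr with k hk r hr
        exact (hin k hk r hr).2
    _ = ∑ k ∈ Icc 1 K, 1 / (k : ℝ) ^ 2 * ∑ r ∈ k.divisors.filter (fun r => R1 < r),
          (q : ℝ) * k * (r * W r) +
        ∑ k ∈ Icc 1 K, 1 / (k : ℝ) ^ 2 * ∑ r ∈ k.divisors.filter (fun r => R1 < r),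
          1 / (L : ℝ) * ∑ m ∈ (range L).filter (fun m : ℕ => 0 < nd (m / L)),
          (k : ℝ) ^ 2 * (1 / 4 * (1 / nd (m / L)) * fs N X r (m / L)) := by
        rw [← sum_add_distrib]
        refine sum_congr rfl fun k _ => ?_
        rw [sum_add_distrib, mul_add]
    _ ≤ _ := add_le_add hnear hfar

end

lemma sum_om_Ram {Q Q0 : ℕ} (h : ℤ) :
    ∑ r ∈ Icc 1 Q, om Q Q0 r * Ram r h =
      ∑ q ∈ (Icc 1 Q).filter (fun q : ℕ => (q : ℤ) ∣ h), wt Q Q0 q := by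
  calc _ = ∑ r ∈ Icc 1 Q, ∑ q ∈ Icc 1 Q, if r ∣ q then wt Q Q0 q / q * Ram r h else 0 := by
        refine sum_congr rfl fun r _ => ?_
        rw [om, sum_mul, sum_filter]
    _ = ∑ q ∈ Icc 1 Q, wt Q Q0 q / q * ∑ r ∈ q.divisors, Ram r h := by
        rw [sum_comm]
        refine sum_congr rfl fun q hq => ?_
        rw [mem_Icc] at hq
        rw [← sum_filter, mul_sum]
        refine sum_congr ?_ fun _ _ => rfl
        ext r
        simp only [mem_filter, mem_Icc, Nat.mem_divisors]
        constructor
        · rintro ⟨_, b⟩; exact ⟨b, by omega⟩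
        · rintro ⟨a, _⟩
          exact ⟨⟨Nat.pos_of_dvd_of_pos a hq.1, (Nat.le_of_dvd hq.1 a).trans hq.2⟩, a⟩
    _ = _ := by
        rw [sum_filter]
        refine sum_congr rfl fun q hq => ?_
        rw [mem_Icc] at hq
        have hq' : (0 : ℝ) < q := by exact_mod_cast hq.1
        rw [sum_Ram hq.1]
        split_ifs
        · field_simp
        · simp

lemma sum_wt_dual {X Q Q0 : ℕ} (h0 : 0 < Q0) (hQ : 2 * Q0 ≤ Q) {h : ℤ} (hh : h ≠ 0)
    (hX : h.natAbs ≤ X) :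
    ∑ q ∈ (Icc 1 Q).filter (fun q : ℕ => (q : ℤ) ∣ h), wt Q Q0 q =
      ∑ k ∈ (Icc 1 (X / Q0)).filter (fun k : ℕ => (k : ℤ) ∣ h), wt Q Q0 (h.natAbs / (k : ℝ)) := by
  have h0' : (0 : ℝ) < Q0 := by exact_mod_cast h0
  have hQ' : 2 * (Q0 : ℝ) ≤ Q := by exact_mod_cast hQ
  have hn : 0 < h.natAbs := Int.natAbs_pos.2 hh
  simp only [Int.natCast_dvd]
  generalize h.natAbs = n at *
  have e1 : ∑ q ∈ (Icc 1 Q).filter (fun q : ℕ => q ∣ n), wt Q Q0 q = ∑ q ∈ n.divisors, wt Q Q0 q := by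
    refine sum_subset ?_ ?_
    · intro q hq
      rw [mem_filter] at hq
      exact Nat.mem_divisors.2 ⟨hq.2, hn.ne'⟩
    · intro q hq hq'
      rw [Nat.mem_divisors] at hq
      rw [mem_filter, mem_Icc] at hq'
      have : 0 < q := Nat.pos_of_dvd_of_pos hq.1 hn
      refine wt_eq_zero_of_ge h0' hQ' ?_
      have : Q < q := by
        by_contra hc
        exact hq' ⟨⟨this, by omega⟩, hq.1⟩
      exact_mod_cast this.le
  have e2 : ∑ k ∈ (Icc 1 (X / Q0)).filter (fun k : ℕ => k ∣ n), wt Q Q0 (n / (k : ℝ)) =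
      ∑ k ∈ n.divisors, wt Q Q0 (n / (k : ℝ)) := by
    refine sum_subset ?_ ?_
    · intro q hq
      rw [mem_filter] at hq
      exact Nat.mem_divisors.2 ⟨hq.2, hn.ne'⟩
    · intro k hk hk'
      rw [Nat.mem_divisors] at hk
      rw [mem_filter, mem_Icc] at hk'
      have hk0 : 0 < k := Nat.pos_of_dvd_of_pos hk.1 hn
      have hk0' : (0 : ℝ) < k := by exact_mod_cast hk0
      refine wt_eq_zero h0' hQ' ?_
      have : X / Q0 < k := by
        by_contra hc
        exact hk' ⟨⟨hk0, by omega⟩, hk.1⟩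
      rw [Nat.div_lt_iff_lt_mul h0] at this
      rw [div_le_iff₀ hk0']
      have h3 : n ≤ Q0 * k := by rw [mul_comm]; omega
      exact_mod_cast h3
  rw [e1, e2, ← Nat.sum_div_divisors n]
  refine sum_congr rfl fun k hk => ?_
  have hk1 := (Nat.mem_divisors.1 hk).1
  have hk0 : (k : ℝ) ≠ 0 := by exact_mod_cast (Nat.pos_of_mem_divisors hk).ne'
  rw [Nat.cast_div hk1 hk0]

/-- Dual contribution of the large Ramanujan sums. -/
noncomputable def Gd (X Q Q0 R1 : ℕ) (h : ℤ) : ℝ :=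
  ∑ k ∈ Icc 1 (X / Q0), wt Q Q0 (h.natAbs / (k : ℝ)) / k *
    ∑ r ∈ k.divisors.filter (fun r => R1 < r), Ram r h

lemma sum_om_Ram_large {X Q Q0 R1 : ℕ} (h0 : 0 < Q0) (hQ : 2 * Q0 ≤ Q) (hR : R1 ≤ Q0) {h : ℤ}
    (hh : h ≠ 0) (hX : h.natAbs ≤ X) :
    ∑ r ∈ Ioc R1 Q, om Q Q0 r * Ram r h = ∑ r ∈ Icc 1 R1, Ram r h *
      (∑ k ∈ (Icc 1 (X / Q0)).filter (fun k => r ∣ k), wt Q Q0 (h.natAbs / (k : ℝ)) / (k : ℝ) -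
        om Q Q0 r) + Gd X Q Q0 R1 h := by
  have hsp : ∑ r ∈ Icc 1 Q, om Q Q0 r * Ram r h =
      ∑ r ∈ Icc 1 R1, om Q Q0 r * Ram r h + ∑ r ∈ Ioc R1 Q, om Q Q0 r * Ram r h := by
    rw [← sum_union]
    · congr 1; ext r; simp only [mem_union, mem_Icc, mem_Ioc]; omega
    · rw [Finset.disjoint_left]; intro r; simp only [mem_Icc, mem_Ioc]; omega
  rw [sum_om_Ram, sum_wt_dual h0 hQ hh hX] at hsp
  have e : ∑ k ∈ (Icc 1 (X / Q0)).filter (fun k : ℕ => (k : ℤ) ∣ h), wt Q Q0 (h.natAbs / (k : ℝ)) =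
      ∑ r ∈ Icc 1 R1, Ram r h * (∑ k ∈ (Icc 1 (X / Q0)).filter (fun k => r ∣ k),
        wt Q Q0 (h.natAbs / (k : ℝ)) / (k : ℝ)) + Gd X Q Q0 R1 h := by
    have e1 : ∑ r ∈ Icc 1 R1, Ram r h * (∑ k ∈ (Icc 1 (X / Q0)).filter (fun k => r ∣ k),
        wt Q Q0 (h.natAbs / (k : ℝ)) / (k : ℝ)) = ∑ k ∈ Icc 1 (X / Q0),
        wt Q Q0 (h.natAbs / (k : ℝ)) / k * ∑ r ∈ k.divisors.filter (fun r => ¬ R1 < r), Ram r h := by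
      calc _ = ∑ r ∈ Icc 1 R1, ∑ k ∈ Icc 1 (X / Q0),
            if r ∣ k then wt Q Q0 (h.natAbs / (k : ℝ)) / k * Ram r h else 0 := by
            refine sum_congr rfl fun r _ => ?_
            rw [mul_sum, sum_filter]
            refine sum_congr rfl fun k _ => ?_
            rw [mul_comm]
        _ = _ := by
            rw [sum_comm]
            refine sum_congr rfl fun k hk => ?_
            rw [mem_Icc] at hk
            rw [← sum_filter, mul_sum]
            refine sum_congr ?_ fun _ _ => rfl
            ext r
            simp only [mem_filter, mem_Icc, Nat.mem_divisors, not_lt]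
            constructor
            · rintro ⟨a, b⟩; exact ⟨⟨b, by omega⟩, a.2⟩
            · rintro ⟨⟨a, _⟩, c⟩
              exact ⟨⟨Nat.pos_of_dvd_of_pos a hk.1, c⟩, a⟩
    rw [e1, Gd, ← sum_add_distrib, sum_filter]
    refine sum_congr rfl fun k hk => ?_
    rw [mem_Icc] at hk
    have hk' : (0 : ℝ) < k := by exact_mod_cast hk.1
    rw [← mul_add, add_comm, sum_filter_add_sum_filter_not, sum_Ram hk.1]
    split_ifs
    · field_simp
    · simp
  rw [e] at hsp
  simp only [mul_sub, sum_sub_distrib]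
  have e3 : ∑ r ∈ Icc 1 R1, om Q Q0 r * Ram r h = ∑ r ∈ Icc 1 R1, Ram r h * om Q Q0 r :=
    sum_congr rfl fun r _ => mul_comm _ _
  linarith

lemma wt_div_eq {Q Q0 n k : ℕ} (hk : 0 < k) :
    wt Q Q0 (n / (k : ℝ)) / k = 1 / (k : ℝ) ^ 2 * (((Q * k - n : ℕ) : ℝ) -
      ((Q : ℝ) / Q0 - 1) * ((2 * Q0 * k - n : ℕ) : ℝ) + ((Q : ℝ) / Q0 - 2) * ((Q0 * k - n : ℕ) : ℝ)) := by
  have hk' : (0 : ℝ) < k := by exact_mod_cast hk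
  have e : ∀ Y : ℕ, max ((Y : ℝ) - n / k) 0 = 1 / k * ((Y * k - n : ℕ) : ℝ) := by
    intro Y
    have : ((Y * k - n : ℕ) : ℝ) = max ((Y : ℝ) * k - n) 0 := by
      rcases le_total n (Y * k) with hc | hc
      · rw [Nat.cast_sub hc, max_eq_left]
        · push_cast; ring
        · rw [sub_nonneg]; exact_mod_cast hc
      · rw [Nat.sub_eq_zero_of_le hc, max_eq_right]
        · simp
        · rw [sub_nonpos]; exact_mod_cast hc
    rw [this, mul_max_of_nonneg _ _ (by positivity)]
    congr 1
    · field_simp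
    · simp
  have e2 := e (2 * Q0)
  push_cast at e2
  rw [wt, e Q, e2, e Q0]
  field_simp

lemma sum_Gd (N X Q Q0 R1 : ℕ) :
    ∑ p ∈ Om N X ×ˢ Om N X, Gd X Q Q0 R1 (hd p) = Et N X R1 (X / Q0) Q -
      ((Q : ℝ) / Q0 - 1) * Et N X R1 (X / Q0) (2 * Q0) + ((Q : ℝ) / Q0 - 2) * Et N X R1 (X / Q0) Q0 := by
  unfold Gd Et
  rw [sum_comm, mul_sum, mul_sum, ← sum_sub_distrib, ← sum_add_distrib]
  refine sum_congr rfl fun k hk => ?_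
  rw [mem_Icc] at hk
  simp_rw [wt_div_eq hk.1]
  simp_rw [sum_comm (t := Om N X ×ˢ Om N X)]
  rw [mul_sum, mul_sum, mul_sum, mul_sum, mul_sum, ← sum_sub_distrib, ← sum_add_distrib]
  refine sum_congr rfl fun p _ => ?_
  simp_rw [← sum_mul]
  ring

lemma Ram_zero_le (r : ℕ) : |Ram r 0| ≤ r := by
  have : Ram r 0 = (star r).card := by simp [Ram]
  rw [this, abs_of_nonneg (Nat.cast_nonneg _)]
  have := card_le_card (star_subset r)
  rw [card_range] at this
  exact_mod_cast this

variable {N X R1 K1 B : ℕ} {S T μ : ℝ}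

lemma abs_sum_Gd_le (h : Par N X R1 K1 B S T μ) {Q Q0 L : ℕ} (h0 : 0 < Q0) (hQ : 2 * Q0 ≤ Q)
    (hK : X / Q0 ≤ K1) (hL : 0 < L) (hLB : L ≤ B) (hqL : X + Q * (X / Q0) ≤ L) :
    |∑ p ∈ Om N X ×ˢ Om N X, Gd X Q Q0 R1 (hd p)| ≤ 20000 * T ^ 5 * Q * S ^ 15 +
      (Q : ℝ) / Q0 * (T * (((X / Q0 : ℕ) : ℝ) ^ 2 * Z N X + ((X / Q0 : ℕ) : ℝ) * T * N ^ 4)) := by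
  have hT := h.dom.one_le
  have hSp := h.S_pos
  have h0' : (0 : ℝ) < Q0 := by exact_mod_cast h0
  have hκ : 2 ≤ (Q : ℝ) / Q0 := by rw [le_div_iff₀ h0']; exact_mod_cast hQ
  have hκQ : (Q : ℝ) / Q0 * Q0 = Q := by field_simp
  have b1 := abs_Et_le h hK hL hLB hqL
  have b2 := abs_Et_le (q := 2 * Q0) h hK hL hLB (by nlinarith [Nat.mul_le_mul_right (X / Q0) hQ])
  have b3 := abs_Et_le (q := Q0) h hK hL hLB
    (by nlinarith [Nat.mul_le_mul_right (X / Q0) (by omega : Q0 ≤ Q)])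
  set M := T / 2 * (((X / Q0 : ℕ) : ℝ) ^ 2 * Z N X + ((X / Q0 : ℕ) : ℝ) * T * N ^ 4) with hM
  have hM0 : 0 ≤ M := by positivity
  rw [sum_Gd]
  push_cast at b2
  set κ := (Q : ℝ) / Q0
  set P := 5000 * T ^ 5
  have hP : 0 ≤ P * S ^ 15 := by positivity
  calc _ ≤ |Et N X R1 (X / Q0) Q| + (κ - 1) * |Et N X R1 (X / Q0) (2 * Q0)| +
        (κ - 2) * |Et N X R1 (X / Q0) Q0| := by
        refine (abs_add_le _ _).trans ?_
        refine add_le_add ((abs_sub _ _).trans ?_) ?_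
        · rw [abs_mul, abs_of_nonneg (by linarith : 0 ≤ κ - 1)]
        · rw [abs_mul, abs_of_nonneg (by linarith : 0 ≤ κ - 2)]
    _ ≤ (P * Q * S ^ 15 + M) + (κ - 1) * (P * (2 * Q0) * S ^ 15 + M) +
        (κ - 2) * (P * Q0 * S ^ 15 + M) := by
        have : 0 ≤ κ - 1 := by linarith
        have : 0 ≤ κ - 2 := by linarith
        gcongr
    _ = P * S ^ 15 * (Q + 3 * (κ * Q0) - 4 * Q0) + (2 * κ - 2) * M := by ring
    _ ≤ P * S ^ 15 * (4 * Q) + 2 * κ * M := by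
        gcongr
        · rw [hκQ]; linarith
        · linarith
    _ = _ := by rw [hM]; ring

lemma abs_main_sub_le (h : Par N X R1 K1 B S T μ) {Q Q0 L : ℕ} {y : ℝ} (h0 : 0 < Q0)
    (hQ : 2 * Q0 ≤ Q) (hR : R1 ≤ Q0)
    (hK : X / Q0 ≤ K1) (hL : 0 < L) (hLB : L ≤ B) (hqL : X + Q * (X / Q0) ≤ L) (hQB : Q ≤ B)
    (hy : 0 ≤ y) (hy3 : y ^ 3 = 2 * (R1 * Q)) :
    |∑ r ∈ Ioc R1 Q, om Q Q0 r * fr N X r - Z N X * ∑ q ∈ Icc 1 Q, wt Q Q0 q| ≤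
      Z N X * (R1 * Q * T) + (6 * ((Q : ℝ) / Q0) * R1 * T ^ 2 * N ^ 4 +
        28 * T ^ 3 * Q * (N ^ 3 * (1 + 2 * y * T))) + (20000 * T ^ 5 * Q * S ^ 15 +
      (Q : ℝ) / Q0 * (T * (((X / Q0 : ℕ) : ℝ) ^ 2 * Z N X + ((X / Q0 : ℕ) : ℝ) * T * N ^ 4))) := by
  have hT := h.dom.one_le
  have h0' : (0 : ℝ) < Q0 := by exact_mod_cast h0
  have hQ' : 2 * (Q0 : ℝ) ≤ Q := by exact_mod_cast hQ
  have hNB : N ≤ B := by simpa using h.big_of (c := 1) (k := 1) (by norm_num) (by norm_num)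
  set Dg := (Om N X ×ˢ Om N X).filter fun p => cub p.1 = cub p.2 with hDg
  have hsplit : ∀ f : (ℕ × ℕ) × (ℕ × ℕ) → ℝ, ∑ p ∈ Om N X ×ˢ Om N X, f p =
      ∑ p ∈ Dg, f p + ∑ p ∈ Od N X, f p := fun f =>
    (sum_filter_add_sum_filter_not (Om N X ×ˢ Om N X) (fun p => cub p.1 = cub p.2) f).symm
  have hd0 : ∀ p ∈ Dg, hd p = 0 := fun p hp => by
    have := (mem_filter.1 hp).2
    unfold hd; rw [this, sub_self]
  have hG0 : Gd X Q Q0 R1 0 = 0 := by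
    unfold Gd
    refine sum_eq_zero fun k _ => ?_
    simp [wt_eq_zero h0' hQ' h0'.le]
  have e1 : ∑ r ∈ Ioc R1 Q, om Q Q0 r * fr N X r =
      ∑ p ∈ Om N X ×ˢ Om N X, ∑ r ∈ Ioc R1 Q, om Q Q0 r * Ram r (hd p) := by
    rw [sum_comm]
    refine sum_congr rfl fun r _ => ?_
    rw [fr_eq_sum_Ram, ← sum_product', mul_sum]
    rfl
  have e2 : ∑ p ∈ Dg, ∑ r ∈ Ioc R1 Q, om Q Q0 r * Ram r (hd p) =
      Z N X * ∑ q ∈ Icc 1 Q, wt Q Q0 q - Z N X * ∑ r ∈ Icc 1 R1, om Q Q0 r * Ram r 0 := by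
    have : ∀ p ∈ Dg, ∑ r ∈ Ioc R1 Q, om Q Q0 r * Ram r (hd p) =
        ∑ q ∈ Icc 1 Q, wt Q Q0 q - ∑ r ∈ Icc 1 R1, om Q Q0 r * Ram r 0 := by
      intro p hp
      rw [hd0 p hp]
      have h3 := sum_om_Ram (Q := Q) (Q0 := Q0) 0
      simp only [dvd_zero, filter_true] at h3
      rw [← h3, eq_sub_iff_add_eq, ← sum_union]
      · congr 1; ext r; simp only [mem_union, mem_Icc, mem_Ioc]; omega
      · rw [Finset.disjoint_left]; intro r; simp only [mem_Icc, mem_Ioc]; omega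
    rw [sum_congr rfl this, sum_const, nsmul_eq_mul, mul_sub]
    rfl
  have e3 : ∑ p ∈ Od N X, ∑ r ∈ Ioc R1 Q, om Q Q0 r * Ram r (hd p) =
      ∑ p ∈ Od N X, ∑ r ∈ Icc 1 R1, Ram r (hd p) *
      (∑ k ∈ (Icc 1 (X / Q0)).filter (fun k => r ∣ k), wt Q Q0 ((hd p).natAbs / (k : ℝ)) / (k : ℝ) -
        om Q Q0 r) + ∑ p ∈ Om N X ×ˢ Om N X, Gd X Q Q0 R1 (hd p) := by
    rw [hsplit (fun p => Gd X Q Q0 R1 (hd p)),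
      sum_eq_zero (s := Dg) (fun p hp => by rw [hd0 p hp, hG0]), zero_add, ← sum_add_distrib]
    exact sum_congr rfl fun p hp => sum_om_Ram_large h0 hQ hR (hd_ne_zero hp)
      (hd_le (mem_filter.1 hp).1)
  have b1 : |(Z N X : ℝ) * ∑ r ∈ Icc 1 R1, om Q Q0 r * Ram r 0| ≤ Z N X * (R1 * Q * T) := by
    rw [abs_mul, abs_of_nonneg (Nat.cast_nonneg _)]
    gcongr
    calc _ ≤ ∑ r ∈ Icc 1 R1, Q * T := by
          refine (abs_sum_le_sum_abs _ _).trans (sum_le_sum fun r hr => ?_)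
          rw [mem_Icc] at hr
          have hr' : (0 : ℝ) < r := by exact_mod_cast hr.1
          rw [abs_mul, abs_of_nonneg (om_nonneg h0 hQ r)]
          calc _ ≤ Q * (T / r) * r :=
                mul_le_mul (om_le h.dom hQB h0 hQ hr.1) (Ram_zero_le r) (abs_nonneg _) (by positivity)
            _ = Q * T := by field_simp
      _ = R1 * Q * T := by simp; ring
  have b2 := small_r_error (N := N) (X := X) h.dom hQB (by omega) hNB h0 hQ hR hy hy3
  have b3 := abs_sum_Gd_le h h0 hQ hK hL hLB hqL
  rw [e1, hsplit, e2, e3]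
  rw [abs_le] at b1 b2 b3 ⊢
  constructor <;> linarith [b1.1, b1.2, b2.1, b2.2, b3.1, b3.2]

lemma abs_sum_wt_Vq_sub_le (h : Par N X R1 K1 B S T μ) {Q Q0 : ℕ} (h0 : 0 < Q0) (hQ : 2 * Q0 ≤ Q)
    (hR : R1 ≤ Q0) (hQN : Q ≤ 8 * N ^ 3) {θ : ℝ} (hθ : 0 < θ) :
    |∑ q ∈ Icc 1 Q, wt Q Q0 q * Vq N X μ q - ∑ r ∈ Ioc R1 Q, om Q Q0 r * fr N X r| ≤
      100 * (Q * T) * S ^ 14 + θ * ∑ r ∈ Ioc R1 Q, om Q Q0 r * fr N X r +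
        (1 + 1 / θ) * (4128 * (Q * T) * T ^ 3 * S ^ 15) := by
  have hT := h.dom.one_le
  have hQB : Q ≤ B := hQN.trans (h.big_of (by norm_num) (by norm_num))
  have hom : ∀ r : ℕ, 0 < r → om Q Q0 r ≤ Q * T * (1 / r) := fun r hr =>
    (om_le h.dom hQB h0 hQ hr).trans (le_of_eq (by ring))
  have e : ∑ q ∈ Icc 1 Q, wt Q Q0 q * Vq N X μ q = ∑ r ∈ Icc 1 R1, om Q Q0 r * vr N X μ r +
      ∑ r ∈ Ioc R1 Q, om Q Q0 r * vr N X μ r := by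
    have := sum_weight_Vq N X Q μ (fun q : ℕ => wt Q Q0 q)
    rw [this, ← sum_union]
    · refine sum_congr ?_ fun _ _ => rfl
      ext r; simp only [mem_union, mem_Icc, mem_Ioc]; omega
    · rw [Finset.disjoint_left]; intro r; simp only [mem_Icc, mem_Ioc]; omega
  have b1 : |∑ r ∈ Icc 1 R1, om Q Q0 r * vr N X μ r| ≤ 100 * (Q * T) * S ^ 14 := by
    rw [abs_of_nonneg (sum_nonneg fun r _ => mul_nonneg (om_nonneg h0 hQ r) (vr_nonneg _ _ _ _))]
    calc _ ≤ ∑ r ∈ Icc 1 R1, Q * T * (vr N X μ r / r) := by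
          refine sum_le_sum fun r hr => ?_
          refine (mul_le_mul_of_nonneg_right (hom r (mem_Icc.1 hr).1) (vr_nonneg _ _ _ _)).trans
            (le_of_eq ?_)
          ring
      _ ≤ Q * T * (100 * S ^ 14) := by
          rw [← mul_sum]
          gcongr
          exact sum_vr_small_le h
      _ = _ := by ring
  have b2 : |∑ r ∈ Ioc R1 Q, om Q Q0 r * vr N X μ r - ∑ r ∈ Ioc R1 Q, om Q Q0 r * fr N X r| ≤
      θ * ∑ r ∈ Ioc R1 Q, om Q Q0 r * fr N X r + (1 + 1 / θ) * (4128 * (Q * T) * T ^ 3 * S ^ 15) := by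
    calc _ ≤ ∑ r ∈ Ioc R1 Q, (θ * (om Q Q0 r * fr N X r) +
          (1 + 1 / θ) * (Q * T * (mr μ r / r))) := by
          rw [← sum_sub_distrib]
          refine (abs_sum_le_sum_abs _ _).trans (sum_le_sum fun r hr => ?_)
          rw [mem_Ioc] at hr
          rw [← mul_sub, abs_mul, abs_of_nonneg (om_nonneg h0 hQ r)]
          have h1 := mul_le_mul_of_nonneg_left (abs_vr_sub_fr_le N X μ r hθ) (om_nonneg h0 hQ r)
          have h2 : (1 + 1 / θ) * (om Q Q0 r * mr μ r) ≤ (1 + 1 / θ) * (Q * T * (1 / r) * mr μ r) := by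
            gcongr
            · exact mr_nonneg _ _
            · exact hom r (by omega)
          have h3 : (Q : ℝ) * T * (1 / r) * mr μ r = Q * T * (mr μ r / r) := by ring
          rw [h3] at h2
          linarith
      _ = θ * ∑ r ∈ Ioc R1 Q, om Q Q0 r * fr N X r +
          (1 + 1 / θ) * (Q * T * ∑ r ∈ Ioc R1 Q, mr μ r / r) := by
          rw [sum_add_distrib, ← mul_sum, ← mul_sum, ← mul_sum]
      _ ≤ θ * ∑ r ∈ Ioc R1 Q, om Q Q0 r * fr N X r +
          (1 + 1 / θ) * (Q * T * (4128 * T ^ 3 * S ^ 15)) := by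
          gcongr
          exact sum_mr_large_le h hQN
      _ = _ := by ring
  rw [e]
  rw [abs_le] at b1 b2 ⊢
  constructor <;> linarith [b1.1, b1.2, b2.1, b2.2]

/-- The linearly weighted variance. -/
noncomputable def Uq (N X : ℕ) (μ : ℝ) (Q : ℕ) : ℝ := ∑ q ∈ Icc 1 Q, ((Q : ℝ) - q) * Vq N X μ q

lemma sum_linear (Q : ℕ) : ∑ q ∈ Icc 1 Q, ((Q : ℝ) - q) = Q * (Q - 1) / 2 := by
  rw [sum_sub_distrib, sum_const, Nat.card_Icc, nsmul_eq_mul]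
  have : ∑ q ∈ Icc 1 Q, (q : ℝ) = Q * (Q + 1) / 2 := by
    induction Q with
    | zero => simp
    | succ n ih => rw [sum_Icc_succ_top (by omega), ih]; push_cast; ring
  rw [this]; simp; ring

lemma wt_gap {Q Q0 : ℕ} (h0 : 0 < Q0) (hQ : 2 * Q0 ≤ Q) (f : ℕ → ℝ) (hf : ∀ q, 0 ≤ f q) :
    0 ≤ ∑ q ∈ Icc 1 Q, ((Q : ℝ) - q) * f q - ∑ q ∈ Icc 1 Q, wt Q Q0 q * f q ∧
    ∑ q ∈ Icc 1 Q, ((Q : ℝ) - q) * f q - ∑ q ∈ Icc 1 Q, wt Q Q0 q * f q ≤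
      Q * ∑ q ∈ Icc 1 (2 * Q0), f q := by
  have h0' : (0 : ℝ) < Q0 := by exact_mod_cast h0
  have hQ' : 2 * (Q0 : ℝ) ≤ Q := by exact_mod_cast hQ
  rw [← sum_sub_distrib]
  have hle : ∀ q ∈ Icc 1 Q, 0 ≤ ((Q : ℝ) - q) * f q - wt Q Q0 q * f q := by
    intro q hq
    have hq' : (q : ℝ) ≤ Q := by exact_mod_cast (mem_Icc.1 hq).2
    have := wt_le h0' hQ' q
    rw [max_eq_left (by linarith)] at this
    have := mul_le_mul_of_nonneg_right this (hf q)
    linarith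
  refine ⟨sum_nonneg hle, ?_⟩
  have hsub : ∑ q ∈ Icc 1 Q, (((Q : ℝ) - q) * f q - wt Q Q0 q * f q) =
      ∑ q ∈ Icc 1 (2 * Q0), (((Q : ℝ) - q) * f q - wt Q Q0 q * f q) := by
    symm
    refine sum_subset (Icc_subset_Icc_right hQ) fun q hq hq' => ?_
    rw [mem_Icc] at hq hq'
    rw [wt_eq_sub h0' (by exact_mod_cast (by omega : 2 * Q0 ≤ q)) (by exact_mod_cast hq.2), sub_self]
  rw [hsub, mul_sum]
  refine sum_le_sum fun q _ => ?_
  have h1 := mul_nonneg (wt_nonneg h0' hQ' q) (hf q)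
  have h2 := mul_nonneg (Nat.cast_nonneg (α := ℝ) q) (hf q)
  linarith

lemma sum_wt_bounds {Q Q0 : ℕ} (h0 : 0 < Q0) (hQ : 2 * Q0 ≤ Q) :
    |(∑ q ∈ Icc 1 Q, wt Q Q0 q) - (Q : ℝ) ^ 2 / 2| ≤ (Q : ℝ) / 2 + 2 * Q0 * Q ∧
      (∑ q ∈ Icc 1 Q, wt Q Q0 q) ≤ (Q : ℝ) ^ 2 / 2 := by
  obtain ⟨h1, h2⟩ := wt_gap h0 hQ (fun _ => 1) (fun _ => zero_le_one)
  simp only [mul_one, sum_linear] at h1 h2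
  simp only [sum_const, Nat.card_Icc, add_tsub_cancel_right, nsmul_eq_mul, mul_one] at h2
  push_cast at h2
  have hQ0 : (0 : ℝ) ≤ Q := Nat.cast_nonneg _
  have h00 : (0 : ℝ) ≤ Q0 := Nat.cast_nonneg _
  have := mul_nonneg hQ0 h00
  refine ⟨?_, by nlinarith⟩
  rw [abs_le]
  constructor <;> nlinarith

set_option maxHeartbeats 2000000 in
/-- All error terms are a small proportion of the main term. -/
lemma abs_Uq_sub_le (h : Par N X R1 K1 B S T μ) {Q : ℕ} (hT8 : 8 ≤ T) (hZ : (Z N X : ℝ) ≤ 3 * S ^ 8)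
    (hQ1 : S ^ 7 * T ^ 30 ≤ Q) (hQN : Q ≤ 8 * N ^ 3) :
    |Uq N X μ Q - Z N X * ((Q : ℝ) ^ 2 / 2)| ≤ 10 ^ 6 / T * (Q ^ 2 * S ^ 8) := by
  have hS := h.hS
  have hSp := h.S_pos
  have hTp : 0 < T := by linarith
  have hS1 : 1 ≤ S := by linarith
  have hT1 : 1 ≤ T := by linarith
  have hN : (N : ℝ) = S ^ 4 := h.S4.symm
  have hNr : 16 ≤ N := h.N_ge
  have hQpos : (0 : ℝ) < Q := lt_of_lt_of_le (by positivity) hQ1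
  set κ₀ := T ^ 3 with hκ₀
  have hκ512 : 512 ≤ κ₀ := by
    calc (512 : ℝ) = 8 ^ 3 := by norm_num
      _ ≤ T ^ 3 := by gcongr
  have hκp : 0 < κ₀ := by positivity
  have hpow : ∀ {i j : ℕ}, i ≤ j → T ^ i ≤ T ^ j := fun hij => pow_le_pow_right₀ hT1 hij
  have hpowS : ∀ {i j : ℕ}, i ≤ j → S ^ i ≤ S ^ j := fun hij => pow_le_pow_right₀ hS1 hij
  have hQT : ∀ {i : ℕ}, i ≤ 30 → S ^ 7 * T ^ i ≤ Q := fun hi =>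
    le_trans (mul_le_mul_of_nonneg_left (hpow hi) (by positivity)) hQ1
  have hQκ : S ^ 7 * T ^ 27 ≤ Q / κ₀ := by
    rw [le_div_iff₀ hκp, hκ₀]
    calc S ^ 7 * T ^ 27 * T ^ 3 = S ^ 7 * T ^ 30 := by ring
      _ ≤ (Q : ℝ) := hQ1
  set Q0 := ⌊(Q : ℝ) / κ₀⌋₊ with hQ0
  have hQκ2 : 128 * 8 ^ 27 ≤ (Q : ℝ) / κ₀ := by
    refine le_trans ?_ hQκ
    have h1 : (2 : ℝ) ^ 7 ≤ S ^ 7 := by gcongr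
    have h2 : (8 : ℝ) ^ 27 ≤ T ^ 27 := by gcongr
    calc (128 : ℝ) * 8 ^ 27 = 2 ^ 7 * 8 ^ 27 := by norm_num
      _ ≤ _ := by gcongr
  have hf1 : (Q0 : ℝ) ≤ Q / κ₀ := Nat.floor_le (by positivity)
  have hf2 : (Q : ℝ) / κ₀ < Q0 + 1 := Nat.lt_floor_add_one _
  have hf3 : (Q : ℝ) / κ₀ ≤ 2 * Q0 := by
    have : (1 : ℝ) * 1 ≤ 128 * 8 ^ 27 := by norm_num
    linarith
  have hQ0p' : (0 : ℝ) < Q0 := by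
    have : (1 : ℝ) * 1 ≤ 128 * 8 ^ 27 := by norm_num
    linarith
  have hQ0p : 0 < Q0 := by exact_mod_cast hQ0p'
  have hκQ : (Q : ℝ) / Q0 ≤ 2 * κ₀ := by
    rw [div_le_iff₀ hQ0p']
    rw [div_le_iff₀ hκp] at hf3
    linarith
  have hQ0Q : (Q0 : ℝ) * κ₀ ≤ Q := by rwa [le_div_iff₀ hκp] at hf1
  have h2Q0 : 2 * Q0 ≤ Q := by
    have : 2 * (Q0 : ℝ) ≤ Q := by nlinarith
    exact_mod_cast this
  have hR1Q0 : R1 ≤ Q0 := by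
    have h1 : (2 : ℝ) * S ^ 2 ≤ S ^ 7 * T ^ 27 := by
      have : S ^ 2 ≤ S ^ 7 := hpowS (by norm_num)
      have : (2 : ℝ) ≤ T ^ 27 := by
        calc (2 : ℝ) ≤ T ^ 1 := by linarith
          _ ≤ T ^ 27 := hpow (by norm_num)
      calc (2 : ℝ) * S ^ 2 ≤ T ^ 27 * S ^ 7 := by gcongr
        _ = _ := by ring
    have h2 := h.R1_le
    have : (R1 : ℝ) ≤ Q0 := by linarith
    exact_mod_cast this
  have hKle : X / Q0 ≤ K1 := by
    have h1 : (X : ℝ) ≤ 2 * S ^ 12 := by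
      have : (X : ℝ) ≤ 2 * (N : ℝ) ^ 3 := by exact_mod_cast h.X_le
      rw [hN] at this
      calc (X : ℝ) ≤ _ := this
        _ = _ := by ring
    have h2 : (X : ℝ) / Q0 ≤ K1 := by
      rw [div_le_iff₀ hQ0p']
      have h3 := h.K1_ge
      have h4 : S ^ 7 * 4 ≤ (Q0 : ℝ) := by
        have : (8 : ℝ) ≤ T ^ 27 := by
          calc (8 : ℝ) ≤ T ^ 1 := by linarith
            _ ≤ T ^ 27 := hpow (by norm_num)
        have : S ^ 7 * 8 ≤ S ^ 7 * T ^ 27 := by gcongr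
        linarith
      calc (X : ℝ) ≤ 2 * S ^ 12 := h1
        _ = S ^ 5 / 2 * (S ^ 7 * 4) := by ring
        _ ≤ K1 * Q0 := by gcongr
    have h5 : ((X / Q0 : ℕ) : ℝ) ≤ K1 := Nat.cast_div_le.trans h2
    exact_mod_cast h5
  set K := X / Q0 with hK
  have hKS : (K : ℝ) ≤ S ^ 5 := le_trans (by exact_mod_cast hKle) h.K1_le
  have hQB : Q ≤ B := hQN.trans (h.big_of (by norm_num) (by norm_num))
  have hLB : X + Q * K + 1 ≤ B := by
    have h1 := h.X_le
    have h2 : K ≤ N ^ 2 := hKle.trans h.K1_le_sq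
    have h3 : Q * K ≤ 8 * N ^ 3 * N ^ 2 := Nat.mul_le_mul hQN h2
    have h4 : N ^ 3 ≤ N ^ 5 := Nat.pow_le_pow_right (by omega) (by norm_num)
    have h5 : 1 ≤ N ^ 5 := Nat.one_le_pow _ _ (by omega)
    have h6 := h.big_of (c := 20) (k := 5) (by norm_num) (by norm_num)
    have h7 : 8 * N ^ 3 * N ^ 2 = 8 * N ^ 5 := by ring
    omega
  set y : ℝ := (2 * (R1 * Q)) ^ ((1 : ℝ) / 3) with hy
  have hy0 : 0 ≤ y := by positivity
  have hy3 : y ^ 3 = 2 * (R1 * Q) := by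
    rw [hy, ← Real.rpow_natCast, ← Real.rpow_mul (by positivity)]
    norm_num
  have hyb : S ^ 4 * y * T ^ 10 ≤ Q := by
    refine le_of_pow_le_pow_left₀ (n := 3) (by norm_num) hQpos.le ?_
    have h1 := hQT (i := 30) le_rfl
    have h2 := h.R1_le
    calc (S ^ 4 * y * T ^ 10) ^ 3 = S ^ 12 * T ^ 30 * y ^ 3 := by ring
      _ = S ^ 12 * T ^ 30 * (2 * (R1 * Q)) := by rw [hy3]
      _ ≤ S ^ 12 * T ^ 30 * (2 * (S ^ 2 * Q)) := by gcongr
      _ = (2 * S ^ 7) * (S ^ 7 * T ^ 30) * Q := by ring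
      _ ≤ (T * S ^ 7) * Q * Q := by gcongr; linarith
      _ ≤ Q * Q * Q := by
        have := hQT (i := 1) (by norm_num)
        rw [pow_one, mul_comm] at this
        gcongr
      _ = (Q : ℝ) ^ 3 := by ring
  have hZT : (Z N X : ℝ) ≤ T * S ^ 8 := hZ.trans (by gcongr; linarith)
  have hQ0N : 2 * Q0 ≤ 8 * N ^ 3 := h2Q0.trans hQN
  -- the four comparisons
  have c1 := wt_gap hQ0p h2Q0 (Vq N X μ) (fun q => Vq_nonneg N X μ q)
  have c1' := sum_Vq_le h hQ0N hZT
  have c2 := abs_sum_wt_Vq_sub_le h hQ0p h2Q0 hR1Q0 hQN (θ := 1 / T) (by positivity)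
  have c3 := abs_main_sub_le h hQ0p h2Q0 hR1Q0 hKle (Nat.succ_pos _) hLB (Nat.le_succ _) hQB hy0 hy3
  obtain ⟨c4, c4'⟩ := sum_wt_bounds hQ0p h2Q0
  set A := ∑ r ∈ Ioc R1 Q, om Q Q0 r * fr N X r with hA
  set W := ∑ q ∈ Icc 1 Q, wt Q Q0 q * Vq N X μ q with hW
  set w := ∑ q ∈ Icc 1 Q, wt Q Q0 q with hw
  set G := (Q : ℝ) ^ 2 * S ^ 8 / T with hG
  have hG0 : 0 ≤ G := by positivity
  have key : ∀ {t c : ℝ}, t * T ≤ c * (Q ^ 2 * S ^ 8) → t ≤ c * G := by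
    intro t c ht
    rw [hG, ← mul_div_assoc, le_div_iff₀ hTp]; exact ht
  -- error terms
  have t1 : Q * (20000 * T ^ 5 * S ^ 15) ≤ 20000 * G := by
    apply key
    have := hQT (i := 6) (by norm_num)
    calc _ = 20000 * ((S ^ 7 * T ^ 6) * Q * S ^ 8) := by ring
      _ ≤ 20000 * (Q * Q * S ^ 8) := by gcongr
      _ = _ := by ring
  have t2 : Q * (32 * T ^ 2 * ((2 * Q0 : ℕ) : ℝ) * S ^ 8) ≤ 64 * G := by
    apply key
    push_cast
    calc _ = 64 * (Q0 * κ₀) * Q * S ^ 8 := by rw [hκ₀]; ring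
      _ ≤ 64 * Q * Q * S ^ 8 := by gcongr
      _ = _ := by ring
  have t3 : 100 * (Q * T) * S ^ 14 ≤ 100 * G := by
    apply key
    have := hQT (i := 2) (by norm_num)
    calc _ = 100 * (S ^ 6 * T ^ 2 * Q * S ^ 8) := by ring
      _ ≤ 100 * (S ^ 7 * T ^ 2 * Q * S ^ 8) := by
        have := hpowS (i := 6) (j := 7) (by norm_num)
        gcongr
      _ ≤ 100 * (Q * Q * S ^ 8) := by gcongr
      _ = _ := by ring
  have t4 : (1 + 1 / (1 / T)) * (4128 * (Q * T) * T ^ 3 * S ^ 15) ≤ 8256 * G := by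
    apply key
    rw [one_div_one_div]
    have := hQT (i := 6) (by norm_num)
    calc _ ≤ (T + T) * (4128 * (Q * T) * T ^ 3 * S ^ 15) * T := by gcongr
      _ = 8256 * ((S ^ 7 * T ^ 6) * Q * S ^ 8) := by ring
      _ ≤ 8256 * (Q * Q * S ^ 8) := by gcongr
      _ = _ := by ring
  have t5 : Z N X * (R1 * Q * T) ≤ 3 * G := by
    apply key
    have h1 := hQT (i := 2) (by norm_num)
    have h2 := h.R1_le
    calc _ ≤ 3 * S ^ 8 * (S ^ 2 * Q * T) * T := by gcongr
      _ = 3 * (S ^ 2 * T ^ 2 * Q * S ^ 8) := by ring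
      _ ≤ 3 * (S ^ 7 * T ^ 2 * Q * S ^ 8) := by
        have := hpowS (i := 2) (j := 7) (by norm_num)
        gcongr
      _ ≤ 3 * (Q * Q * S ^ 8) := by gcongr
      _ = _ := by ring
  have t6 : 6 * ((Q : ℝ) / Q0) * R1 * T ^ 2 * N ^ 4 ≤ 12 * G := by
    apply key
    have h1 := hQT (i := 6) (by norm_num)
    have h1' := hQT (i := 0) (by norm_num)
    rw [pow_zero, mul_one] at h1'
    have h2 := h.R1_le
    have h3 := hpowS (i := 10) (j := 14) (by norm_num)
    calc _ ≤ 6 * (2 * κ₀) * S ^ 2 * T ^ 2 * N ^ 4 * T := by gcongr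
      _ = 12 * (S ^ 10 * T ^ 6 * S ^ 8) := by rw [hN, hκ₀]; ring
      _ ≤ 12 * (S ^ 14 * T ^ 6 * S ^ 8) := by gcongr
      _ = 12 * ((S ^ 7 * T ^ 6) * S ^ 7 * S ^ 8) := by ring
      _ ≤ 12 * (Q * Q * S ^ 8) := by gcongr
      _ = _ := by ring
  have t7 : 28 * T ^ 3 * Q * (N ^ 3 * (1 + 2 * y * T)) ≤ 84 * G := by
    apply key
    have h1 := hQT (i := 4) (by norm_num)
    have h3 := hpowS (i := 4) (j := 7) (by norm_num)
    have e1 : S ^ 4 * T ^ 4 ≤ Q :=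
      le_trans (mul_le_mul_of_nonneg_right h3 (by positivity)) h1
    have e2 : S ^ 4 * y * T ^ 5 ≤ Q :=
      le_trans (mul_le_mul_of_nonneg_left (hpow (by norm_num)) (by positivity)) hyb
    calc _ = 28 * ((S ^ 4 * T ^ 4) + 2 * (S ^ 4 * y * T ^ 5)) * (Q * S ^ 8) := by rw [hN]; ring
      _ ≤ 28 * (Q + 2 * Q) * (Q * S ^ 8) := by gcongr
      _ = _ := by ring
  have t8 : 20000 * T ^ 5 * Q * S ^ 15 ≤ 20000 * G := le_trans (le_of_eq (by ring)) t1
  have t9 : (Q : ℝ) / Q0 * (T * ((K : ℝ) ^ 2 * Z N X + (K : ℝ) * T * N ^ 4)) ≤ 8 * G := by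
    apply key
    have h1 := hQT (i := 6) (by norm_num)
    have h1' := hQT (i := 0) (by norm_num)
    rw [pow_zero, mul_one] at h1'
    have h2 : S ^ 18 ≤ S ^ 21 := hpowS (by norm_num)
    have h3 : S ^ 21 ≤ S ^ 22 := hpowS (by norm_num)
    calc _ ≤ 2 * κ₀ * (T * ((S ^ 5) ^ 2 * (3 * S ^ 8) + S ^ 5 * T * N ^ 4)) * T := by gcongr
      _ = 2 * T ^ 5 * (3 * S ^ 18 + T * S ^ 21) := by rw [hN, hκ₀]; ring
      _ ≤ 2 * T ^ 5 * (3 * T * S ^ 21 + T * S ^ 21) := by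
        gcongr
        nlinarith
      _ = 8 * (T ^ 6 * S ^ 21) := by ring
      _ ≤ 8 * (T ^ 6 * S ^ 22) := by gcongr
      _ = 8 * ((S ^ 7 * T ^ 6) * S ^ 7 * S ^ 8) := by ring
      _ ≤ 8 * (Q * Q * S ^ 8) := by gcongr
      _ = _ := by ring
  have t10 : Z N X * ((Q : ℝ) / 2 + 2 * Q0 * Q) ≤ 9 * G := by
    apply key
    have h1 : T ≤ Q := by
      have := hQT (i := 1) (by norm_num)
      rw [pow_one] at this
      refine le_trans ?_ this
      have := one_le_pow₀ hS1 (n := 7)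
      nlinarith
    have h2 : Q0 * T ≤ (Q : ℝ) := by
      refine le_trans ?_ hQ0Q
      rw [hκ₀]
      have := hpow (i := 1) (j := 3) (by norm_num)
      rw [pow_one] at this
      gcongr
    calc _ ≤ 3 * S ^ 8 * ((Q : ℝ) / 2 + 2 * Q0 * Q) * T := by gcongr
      _ = 3 * S ^ 8 * Q * (T / 2 + 2 * (Q0 * T)) := by ring
      _ ≤ 3 * S ^ 8 * Q * (Q / 2 + 2 * Q) := by gcongr
      _ ≤ 3 * S ^ 8 * Q * (3 * Q) := by gcongr; linarith
      _ = _ := by ring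
  have t11 : 1 / T * (Z N X * w) ≤ 2 * G := by
    apply key
    have e : 1 / T * (Z N X * w) * T = Z N X * w := by field_simp
    rw [e]
    calc _ ≤ 3 * S ^ 8 * ((Q : ℝ) ^ 2 / 2) := by
          refine (mul_le_mul_of_nonneg_left c4' (Nat.cast_nonneg _)).trans ?_
          gcongr
      _ ≤ _ := by nlinarith [show 0 ≤ (Q : ℝ) ^ 2 * S ^ 8 by positivity]
  have hG' : 10 ^ 6 / T * ((Q : ℝ) ^ 2 * S ^ 8) = 10 ^ 6 * G := by rw [hG]; ring
  rw [hG']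
  have c3b : |A - Z N X * w| ≤ 21000 * G := c3.trans (by linarith)
  have c2b : |W - A| ≤ 40000 * G := by
    have a1 : A ≤ Z N X * w + 21000 * G := by linarith [(abs_le.1 c3b).2]
    have a2 : 1 / T * A ≤ 1 / T * (Z N X * w) + 21000 * G := by
      have hT' : 1 / T ≤ 1 := by rw [div_le_one hTp]; exact hT1
      calc _ ≤ 1 / T * (Z N X * w + 21000 * G) := by gcongr
        _ = 1 / T * (Z N X * w) + 1 / T * (21000 * G) := by ring
        _ ≤ 1 / T * (Z N X * w) + 1 * (21000 * G) := by gcongr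
        _ = _ := by ring
    refine c2.trans ?_
    linarith
  have c1b : |Uq N X μ Q - W| ≤ 20064 * G := by
    have e : Uq N X μ Q = ∑ q ∈ Icc 1 Q, ((Q : ℝ) - q) * Vq N X μ q := rfl
    rw [e, abs_of_nonneg c1.1]
    refine c1.2.trans ((mul_le_mul_of_nonneg_left c1' hQpos.le).trans ?_)
    rw [mul_add]; linarith
  have c4b : |Z N X * w - Z N X * ((Q : ℝ) ^ 2 / 2)| ≤ 9 * G := by
    rw [← mul_sub, abs_mul, abs_of_nonneg (Nat.cast_nonneg _)]
    exact (mul_le_mul_of_nonneg_left c4 (Nat.cast_nonneg _)).trans t10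
  rw [abs_le] at c1b c2b c3b c4b ⊢
  constructor <;> linarith [c1b.1, c1b.2, c2b.1, c2b.2, c3b.1, c3b.2, c4b.1, c4b.2]

lemma rhotwocubes_eq {q : ℕ} (hq : 0 < q) (a : ℕ) : rhotwocubes q a = rho q a := by
  have : NeZero q := ⟨hq.ne'⟩
  rw [rhotwocubes, Nat.card_eq_fintype_card, Fintype.card_subtype, rho]
  refine card_nbij' (fun p => (p.1.val, p.2.val)) (fun p => ((p.1 : ZMod q), (p.2 : ZMod q)))
    ?_ ?_ ?_ ?_
  · rintro ⟨u, v⟩ hp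
    have hp' : u ^ 3 + v ^ 3 = (a : ZMod q) := by simpa using hp
    refine mem_coe.2 (mem_filter.2
      ⟨mem_product.2 ⟨mem_range.2 (ZMod.val_lt u), mem_range.2 (ZMod.val_lt v)⟩, ?_⟩)
    change u.val ^ 3 + v.val ^ 3 ≡ a [MOD q]
    rw [← ZMod.natCast_eq_natCast_iff]
    push_cast
    rw [ZMod.natCast_zmod_val, ZMod.natCast_zmod_val, hp']
  · rintro ⟨u, v⟩ hp
    have h : u ^ 3 + v ^ 3 ≡ a [MOD q] := (mem_filter.1 (mem_coe.1 hp)).2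
    rw [← ZMod.natCast_eq_natCast_iff] at h
    push_cast at h
    simpa using h
  · rintro ⟨u, v⟩ _
    simp
  · rintro ⟨u, v⟩ hp
    simp only [coe_filter, mem_product, mem_range, Set.mem_ofPred_eq] at hp
    simp [ZMod.val_natCast, Nat.mod_eq_of_lt hp.1.1, Nat.mod_eq_of_lt hp.1.2]

lemma rtwocubes_eq {N X n : ℕ} (hX : X < (N + 1) ^ 3) (hn : n ≤ X) :
    rtwocubes n = ((Om N X).filter fun p => cub p = n).card := by
  rw [rtwocubes, ← Nat.card_eq_finsetCard]
  refine Nat.card_congr (Equiv.subtypeEquivRight fun p => ?_)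
  rw [mem_filter, Om, mem_filter, mem_product, mem_Icc, mem_Icc, cub]
  constructor
  · rintro ⟨h1, h2, h3⟩
    have hb : ∀ {t : ℕ}, t ^ 3 ≤ X → t ≤ N := fun {t} ht =>
      Nat.lt_succ_iff.1 (lt_of_pow_lt_pow_left₀ 3 (Nat.zero_le _) (ht.trans_lt hX))
    exact ⟨⟨⟨⟨h1, hb (by omega)⟩, h2, hb (by omega)⟩, by omega⟩, h3⟩
  · rintro ⟨⟨⟨⟨h1, _⟩, h2, _⟩, _⟩, h3⟩
    exact ⟨h1, h2, h3⟩

lemma sum_rtwocubes_eq {N X : ℕ} (hX : X < (N + 1) ^ 3) (q a : ℕ) :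
    ∑ n ∈ (Icc 1 X).filter (fun n => n % q = a % q), (rtwocubes n : ℝ) = Rc N X q a := by
  have hmaps : ∀ p ∈ (Om N X).filter (fun p => cub p % q = a % q),
      cub p ∈ (Icc 1 X).filter (fun n => n % q = a % q) := by
    intro p hp
    obtain ⟨h1, h2⟩ := mem_filter.1 hp
    refine mem_filter.2 ⟨mem_Icc.2 ⟨?_, cub_le h1⟩, h2⟩
    simp only [Om, mem_filter, mem_product, mem_Icc] at h1
    exact Nat.add_pos_left (pow_pos (by omega) 3) _
  rw [Rc, card_eq_sum_card_fiberwise hmaps, Nat.cast_sum]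
  refine sum_congr rfl fun n hn => ?_
  obtain ⟨h1, h2⟩ := mem_filter.1 hn
  rw [rtwocubes_eq hX (mem_Icc.1 h1).2, filter_filter]
  congr 2
  refine filter_congr fun p _ => ?_
  constructor
  · intro h; exact ⟨by rw [h]; exact h2, h⟩
  · exact fun h => h.2

lemma Vtwocubes_eq {N : ℕ} {x Q : ℝ} (hX : ⌊x⌋₊ < (N + 1) ^ 3) :
    Vtwocubes x Q =
      ∑ q ∈ Icc 1 ⌊Q⌋₊, Vq N ⌊x⌋₊ (Ctwocubes * x ^ ((2 : ℝ) / 3)) q := by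
  rw [Vtwocubes]
  refine sum_congr rfl fun q hq => ?_
  have hq0 : 0 < q := (mem_Icc.1 hq).1
  set g : ℕ → ℝ := fun a => ((Rc N ⌊x⌋₊ q a : ℝ) -
    rho q a / (q : ℝ) ^ 2 * (Ctwocubes * x ^ ((2 : ℝ) / 3))) ^ 2 with hg
  have hRc : Rc N ⌊x⌋₊ q q = Rc N ⌊x⌋₊ q 0 := by rw [Rc, Rc, Nat.mod_self, Nat.zero_mod]
  have hrho : rho q q = rho q 0 := by rw [rho, rho, Nat.mod_self, Nat.zero_mod]
  have hg0 : g q = g 0 := by simp only [hg, hRc, hrho]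
  have h1 : ∑ a ∈ Icc 1 q, g a = ∑ a ∈ range q, g a := by
    obtain ⟨m, rfl⟩ : ∃ m, q = m + 1 := ⟨q - 1, by omega⟩
    rw [sum_range_succ', ← hg0, range_eq_Ico, sum_Ico_add' g 0 m 1, sum_Icc_succ_top (by omega)]
    rfl
  rw [Vq]
  refine Eq.trans ?_ h1
  refine sum_congr rfl fun a _ => ?_
  rw [sum_rtwocubes_eq hX, rhotwocubes_eq hq0, hg, mul_assoc]

/-- Differences of the linearly weighted sum enclose the plain sum. -/
lemma sum_Vq_le_Uq_sub (N X : ℕ) (μ : ℝ) (Q H : ℕ) :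
    H * ∑ q ∈ Icc 1 Q, Vq N X μ q ≤ Uq N X μ (Q + H) - Uq N X μ Q := by
  have h1 : ∑ q ∈ Icc 1 Q, (((Q + H : ℕ) : ℝ) - q) * Vq N X μ q ≤ Uq N X μ (Q + H) := by
    refine sum_le_sum_of_subset_of_nonneg (Icc_subset_Icc_right (by omega)) fun q hq _ => ?_
    refine mul_nonneg (sub_nonneg.2 ?_) (Vq_nonneg _ _ _ _)
    exact_mod_cast (mem_Icc.1 hq).2
  have h2 : ∑ q ∈ Icc 1 Q, (((Q + H : ℕ) : ℝ) - q) * Vq N X μ q =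
      H * ∑ q ∈ Icc 1 Q, Vq N X μ q + Uq N X μ Q := by
    rw [Uq, mul_sum, ← sum_add_distrib]
    refine sum_congr rfl fun q _ => ?_
    push_cast; ring
  linarith

lemma Uq_sub_le_sum_Vq (N X : ℕ) (μ : ℝ) (Q H : ℕ) :
    Uq N X μ (Q + H) - Uq N X μ Q ≤ H * ∑ q ∈ Icc 1 (Q + H), Vq N X μ q := by
  have h1 : Uq N X μ (Q + H) - H * ∑ q ∈ Icc 1 (Q + H), Vq N X μ q =
      ∑ q ∈ Icc 1 (Q + H), ((Q : ℝ) - q) * Vq N X μ q := by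
    rw [Uq, mul_sum, ← sum_sub_distrib]
    refine sum_congr rfl fun q _ => ?_
    push_cast; ring
  have h2 : ∑ q ∈ Icc 1 (Q + H), ((Q : ℝ) - q) * Vq N X μ q ≤ Uq N X μ Q := by
    rw [Uq, ← sub_nonneg, ← neg_sub, neg_nonneg]
    rw [← sum_sdiff (Icc_subset_Icc_right (by omega) : Icc 1 Q ⊆ Icc 1 (Q + H))]
    rw [add_sub_cancel_right]
    refine sum_nonpos fun q hq => ?_
    simp only [mem_sdiff, mem_Icc] at hq
    refine mul_nonpos_of_nonpos_of_nonneg (sub_nonpos.2 ?_) (Vq_nonneg _ _ _ _)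
    exact_mod_cast (by omega : Q ≤ q)
  linarith

lemma Dom.mono_right {B : ℕ} {T T' : ℝ} (h : Dom B T) (hT : T ≤ T') : Dom B T' :=
  ⟨h.one_le.trans hT, fun n h1 h2 => (h.div_le n h1 h2).trans hT,
    fun n h1 => (h.harm_le n h1).trans hT⟩

lemma card_Om_le (N X : ℕ) : (Om N X).card ≤ N ^ 2 := by
  refine (card_filter_le _ _).trans ?_
  rw [card_product, Nat.card_Icc, Nat.add_sub_cancel, sq]

/-- Admissible parameters exist for all large `N`. -/
lemma exists_par : ∃ T₀ : ℝ, 8 ≤ T₀ ∧ ∀ (N : ℕ) (S T x P : ℝ), T₀ ≤ T → T ≤ S → S ^ 4 = N →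
    (N : ℝ) ^ ((1 : ℝ) / 1600) = √T → 1 ≤ P → P ^ 3 = x → N = ⌊P⌋₊ →
    ∃ R1 K1 B : ℕ, Par N ⌊x⌋₊ R1 K1 B S T (Ctwocubes * P ^ 2) := by
  obtain ⟨C, hC1, hC⟩ := exists_dom (τ := 1 / 16000) (by norm_num)
  refine ⟨max 8 ((C * 10 ^ 4) ^ 2), le_max_left _ _, fun N S T x P hT hTS hS4 hNT hP hPx hN => ?_⟩
  have hT8 : 8 ≤ T := (le_max_left _ _).trans hT
  have hTC : (C * 10 ^ 4) ^ 2 ≤ T := (le_max_right _ _).trans hT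
  have hTp : 0 < T := by linarith
  have hP0 : 0 < P := by linarith
  have hS8 : 8 ≤ S := hT8.trans hTS
  have hS2 : 64 ≤ S ^ 2 := by nlinarith
  have hS5 : 64 ≤ S ^ 5 := hS2.trans (pow_le_pow_right₀ (by linarith) (by norm_num))
  have hN64 : (64 : ℝ) ≤ N := by
    rw [← hS4]; exact hS2.trans (pow_le_pow_right₀ (by linarith) (by norm_num))
  have hNP : (N : ℝ) ≤ P := hN ▸ Nat.floor_le hP0.le
  have hPN : P < N + 1 := hN ▸ Nat.lt_floor_add_one P
  have hB1 : 1 ≤ 10 ^ 4 * N ^ 10 := by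
    have : 0 < N := by exact_mod_cast (by linarith : (0 : ℝ) < N)
    exact Nat.mul_pos (by norm_num) (pow_pos this 10)
  obtain ⟨b1, b2⟩ := card_Om_bounds (x := x) hP hPx hN rfl
  have b3 : ((Om N ⌊x⌋₊).card : ℝ) ≤ (N : ℝ) ^ 2 := by exact_mod_cast card_Om_le N ⌊x⌋₊
  have hfl : ∀ {y : ℝ}, 64 ≤ y → y / 2 ≤ (⌊y⌋₊ : ℝ) := fun {y} hy => by
    have := Nat.lt_floor_add_one y
    linarith
  refine ⟨⌊S ^ 2⌋₊, ⌊S ^ 5⌋₊, 10 ^ 4 * N ^ 10, ⟨hS4, by linarith, Nat.floor_le (by positivity),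
    hfl hS2, Nat.floor_le (by positivity), hfl hS5, ?_, ?_, ?_, le_rfl, ?_, ?_, ?_⟩⟩
  · refine Nat.le_floor ?_
    rw [← hPx]
    push_cast
    gcongr
  · have hx0 : 0 ≤ x := hPx ▸ by positivity
    rw [Nat.floor_lt hx0, ← hPx]
    push_cast
    gcongr
  · refine (hC _ hB1).mono_right ?_
    have h2 : C * 10 ^ 4 ≤ √T := Real.le_sqrt_of_sq_le hTC
    have e : ∀ D : ℝ, 1 ≤ D → C * D ≤ √T → C * (D * (N : ℝ) ^ 10) ^ ((1 : ℝ) / 16000) ≤ T := by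
      intro D hD hDT
      have h3 : ((10 : ℕ) : ℝ) * (1 / 16000) = 1 / 1600 := by norm_num
      rw [Real.mul_rpow (by positivity) (by positivity), ← Real.rpow_natCast (N : ℝ),
        ← Real.rpow_mul (Nat.cast_nonneg _), h3, hNT]
      have h1 : D ^ ((1 : ℝ) / 16000) ≤ D := by
        refine (Real.rpow_le_rpow_of_exponent_le hD
          (by norm_num : (1 : ℝ) / 16000 ≤ 1)).trans ?_
        rw [Real.rpow_one]
      calc C * (D ^ ((1 : ℝ) / 16000) * √T) ≤ C * (D * √T) := by gcongr
        _ = C * D * √T := by ring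
        _ ≤ √T * √T := by gcongr
        _ = T := Real.mul_self_sqrt hTp.le
    push_cast
    exact e _ (by norm_num) (by linarith)
  · have := Ctwocubes_pos
    positivity
  · have : (4 : ℝ) * S ^ 8 = 4 * (N : ℝ) ^ 2 := by rw [← hS4]; ring
    rw [this]
    nlinarith
  · rw [abs_le]
    constructor <;> linarith

lemma abs_sum_Vq_sub_le {N X R1 K1 B : ℕ} {S T μ : ℝ} (h : Par N X R1 K1 B S T μ) {Q : ℕ}
    (hT8 : 8 ≤ T) (hZ : (Z N X : ℝ) ≤ 3 * S ^ 8) (hQ1 : 2 * (S ^ 7 * T ^ 30) ≤ Q)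
    (hQN : 2 * Q ≤ 8 * N ^ 3) {φ : ℝ} (hφ : 0 < φ) (hφ1 : φ ≤ 1 / 2) (hφQ : 2 ≤ φ * Q) :
    |∑ q ∈ Icc 1 Q, Vq N X μ q - Z N X * Q| ≤ Q * S ^ 8 * (2 * φ + 10 ^ 7 / (T * φ)) := by
  have hSp := h.S_pos
  have hTp : 0 < T := by linarith
  have hQp : (0 : ℝ) < Q := lt_of_lt_of_le (by positivity) hQ1
  have hZ0 : (0 : ℝ) ≤ Z N X := Nat.cast_nonneg _
  set H := ⌊φ * Q⌋₊ with hH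
  have hH1 : (H : ℝ) ≤ φ * Q := Nat.floor_le (by positivity)
  have hH2 : φ * Q / 2 ≤ H := by
    have := Nat.lt_floor_add_one (φ * Q)
    rw [← hH] at this
    linarith
  have hHp : (0 : ℝ) < H := by linarith
  have hHQ : (H : ℝ) ≤ Q / 2 := hH1.trans (by nlinarith)
  have hHQ' : H ≤ Q := by
    have : (H : ℝ) ≤ Q := by linarith
    exact_mod_cast this
  have r1 : (Q + H : ℝ) ^ 2 + (Q : ℝ) ^ 2 ≤ 5 * (Q : ℝ) ^ 2 := by
    have : (Q + H : ℝ) ^ 2 ≤ (2 * Q) ^ 2 := by gcongr; linarith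
    linarith
  have r2 : (Q - H : ℝ) ^ 2 + (Q : ℝ) ^ 2 ≤ 5 * (Q : ℝ) ^ 2 := by
    have : (Q - H : ℝ) ^ 2 ≤ Q ^ 2 := by
      refine pow_le_pow_left₀ ?_ ?_ 2 <;> linarith
    linarith [sq_nonneg (Q : ℝ)]
  obtain ⟨Q', hQ'⟩ : ∃ Q', Q = Q' + H := ⟨Q - H, by omega⟩
  have hQ'r : (Q : ℝ) = Q' + H := by exact_mod_cast hQ'
  have hQ'0 : (0 : ℝ) ≤ Q' := Nat.cast_nonneg _
  set E := 10 ^ 6 / T * S ^ 8 with hE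
  have hE0 : 0 ≤ E := by positivity
  have u : ∀ {R : ℕ}, S ^ 7 * T ^ 30 ≤ R → R ≤ 8 * N ^ 3 →
      |Uq N X μ R - Z N X * ((R : ℝ) ^ 2 / 2)| ≤ E * (R : ℝ) ^ 2 := fun h1 h2 =>
    (abs_Uq_sub_le h hT8 hZ h1 h2).trans (le_of_eq (by rw [hE]; ring))
  have hbase : S ^ 7 * T ^ 30 ≤ (Q : ℝ) / 2 := by linarith
  have u1 := abs_le.1 (u (R := Q) (by linarith) (by omega))
  have u2 := abs_le.1 (u (R := Q + H) (by push_cast; linarith) (by omega))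
  have u3 := abs_le.1 (u (R := Q') (by linarith) (by omega))
  have v1 := sum_Vq_le_Uq_sub N X μ Q H
  have v2 := Uq_sub_le_sum_Vq N X μ Q' H
  rw [← hQ'] at v2
  push_cast at u2
  set V := ∑ q ∈ Icc 1 Q, Vq N X μ q with hV
  have eQ' : (Q' : ℝ) = Q - H := by linarith
  rw [eQ'] at u3 hQ'0
  have w1 : H * (V - Z N X * Q) ≤ Z N X * ((H : ℝ) ^ 2 / 2) + E * (5 * (Q : ℝ) ^ 2) := by
    have : E * ((Q + H : ℝ) ^ 2 + (Q : ℝ) ^ 2) ≤ E * (5 * (Q : ℝ) ^ 2) :=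
      mul_le_mul_of_nonneg_left r1 hE0
    linarith [u1.1, u2.2]
  have w2 : -(Z N X * ((H : ℝ) ^ 2 / 2) + E * (5 * (Q : ℝ) ^ 2)) ≤ H * (V - Z N X * Q) := by
    have : E * ((Q - H : ℝ) ^ 2 + (Q : ℝ) ^ 2) ≤ E * (5 * (Q : ℝ) ^ 2) :=
      mul_le_mul_of_nonneg_left r2 hE0
    linarith [u1.2, u3.1, u1.1, u3.2]
  have w3 : Z N X * ((H : ℝ) ^ 2 / 2) + E * (5 * (Q : ℝ) ^ 2) ≤
      H * (Q * S ^ 8 * (2 * φ + 10 ^ 7 / (T * φ))) := by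
    have a1 : Z N X * ((H : ℝ) ^ 2 / 2) ≤ H * (Q * S ^ 8 * (2 * φ)) := by
      calc _ ≤ 3 * S ^ 8 * (H * (φ * Q) / 2) := by
            rw [sq]; gcongr
        _ = H * (Q * S ^ 8 * (3 / 2 * φ)) := by ring
        _ ≤ _ := by gcongr; norm_num
    have a2 : E * (5 * (Q : ℝ) ^ 2) ≤ H * (Q * S ^ 8 * (10 ^ 7 / (T * φ))) := by
      have e : E * (5 * (Q : ℝ) ^ 2) = φ * Q / 2 * (Q * S ^ 8 * (10 ^ 7 / (T * φ))) := by
        rw [hE]; field_simp; norm_num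
      rw [e]; gcongr
    linarith
  rw [abs_le]
  constructor
  · refine le_of_mul_le_mul_left ?_ hHp
    linarith
  · refine le_of_mul_le_mul_left ?_ hHp
    linarith

lemma abs_sum_Vq_sub_main_le {N X R1 K1 B : ℕ} {S T μ : ℝ} (h : Par N X R1 K1 B S T μ) {Q : ℝ}
    (hT8 : 8 ≤ T) (hST : T ^ 12 ≤ S) (hQ1 : 2 * (S ^ 7 * T ^ 30) + 1 ≤ Q)
    (hQN : Q ≤ 4 * N ^ 3) {φ : ℝ} (hφ : 0 < φ) (hφ1 : φ ≤ 1 / 2) (hφT : 2 ≤ φ * T) :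
    |∑ q ∈ Icc 1 ⌊Q⌋₊, Vq N X μ q - 2 * μ * Q| ≤
      Q * S ^ 8 * (2 * φ + 10 ^ 7 / (T * φ) + 4000 / T) := by
  have hSp := h.S_pos
  have hTp : 0 < T := by linarith
  have hT1 : 1 ≤ T := by linarith
  have hS2 := h.hS
  have hS1 : 1 ≤ S := by linarith
  have hN : (N : ℝ) = S ^ 4 := h.S4.symm
  have hTS : T ≤ S ^ 7 * T ^ 30 := by
    calc T = 1 * T ^ 1 := by ring
      _ ≤ S ^ 7 * T ^ 30 := by
        gcongr
        · exact one_le_pow₀ hS1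
        · norm_num
  have hQT : T ≤ Q := by linarith
  have hQp : 0 < Q := by linarith
  set q := ⌊Q⌋₊ with hq
  have f1 : (q : ℝ) ≤ Q := Nat.floor_le hQp.le
  have f2 : Q < q + 1 := Nat.lt_floor_add_one Q
  have hq0 : (0 : ℝ) ≤ q := Nat.cast_nonneg _
  have hTpow : 3865 * T ^ 5 ≤ S / T := by
    rw [le_div_iff₀ hTp]
    refine le_trans ?_ hST
    have : (8 : ℝ) ^ 6 ≤ T ^ 6 := by gcongr
    calc 3865 * T ^ 5 * T = 3865 * T ^ 6 := by ring
      _ ≤ T ^ 6 * T ^ 6 := by gcongr; exact le_trans (by norm_num) this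
      _ = T ^ 12 := by ring
  have z1 : |(Z N X : ℝ) - 2 * (Om N X).card| ≤ S ^ 8 / T := by
    refine (Z_bounds h).trans ?_
    calc _ ≤ S / T * S ^ 7 := by gcongr
      _ = _ := by ring
  have o1 : ((Om N X).card : ℝ) ≤ S ^ 8 := by
    have : ((Om N X).card : ℝ) ≤ (N : ℝ) ^ 2 := by exact_mod_cast card_Om_le N X
    rw [hN] at this
    exact this.trans (le_of_eq (by ring))
  have hZ : (Z N X : ℝ) ≤ 3 * S ^ 8 := by
    have : S ^ 8 / T ≤ S ^ 8 := div_le_self (by positivity) hT1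
    linarith [(abs_le.1 z1).2]
  have o2 : |((Om N X).card : ℝ) - μ| ≤ 6 * (S ^ 8 / T) := by
    refine h.om.trans ?_
    rw [hN]
    have hTS' : T ≤ S := le_trans (by
      calc T = T ^ 1 := by ring
        _ ≤ T ^ 12 := pow_le_pow_right₀ hT1 (by norm_num)) hST
    gcongr
    rw [le_div_iff₀ hTp]
    calc S ^ 4 * T ≤ S ^ 4 * S := by gcongr
      _ = S ^ 5 := by ring
      _ ≤ S ^ 8 := pow_le_pow_right₀ hS1 (by norm_num)
  have hqN : 2 * q ≤ 8 * N ^ 3 := by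
    have : 2 * (q : ℝ) ≤ 8 * (N : ℝ) ^ 3 := by linarith
    exact_mod_cast this
  have hqT : T ≤ q := by linarith
  have m := abs_sum_Vq_sub_le h (Q := q) hT8 hZ (by linarith) hqN hφ hφ1
    (hφT.trans (mul_le_mul_of_nonneg_left hqT hφ.le))
  have s1 : |(q : ℝ) * (Z N X - 2 * (Om N X).card)| ≤ Q * (S ^ 8 / T) := by
    rw [abs_mul, abs_of_nonneg hq0]
    gcongr
  have s2 : |(q : ℝ) * (2 * ((Om N X).card - μ))| ≤ Q * (12 * (S ^ 8 / T)) := by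
    rw [abs_mul, abs_of_nonneg hq0, abs_mul, abs_two]
    refine mul_le_mul f1 (by linarith) (by positivity) hQp.le
  have s3 : |2 * μ * (q - Q)| ≤ Q * (8 * (S ^ 8 / T)) := by
    have h0 := h.mu_nonneg
    rw [abs_mul, abs_of_nonneg (by positivity)]
    have h1 : |(q : ℝ) - Q| ≤ 1 := by rw [abs_le]; constructor <;> linarith
    have h2 := h.mu_le
    calc _ ≤ 2 * (4 * S ^ 8) * 1 := by gcongr
      _ = T * (8 * (S ^ 8 / T)) := by field_simp; norm_num
      _ ≤ _ := by gcongr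
  have m' : |∑ q ∈ Icc 1 q, Vq N X μ q - Z N X * q| ≤
      Q * S ^ 8 * (2 * φ + 10 ^ 7 / (T * φ)) := m.trans (by gcongr)
  have e : Q * S ^ 8 * (2 * φ + 10 ^ 7 / (T * φ) + 4000 / T) =
      Q * S ^ 8 * (2 * φ + 10 ^ 7 / (T * φ)) + 4000 * (Q * (S ^ 8 / T)) := by ring
  rw [e]
  have p0 : 0 ≤ Q * (S ^ 8 / T) := by positivity
  rw [abs_le] at m' s1 s2 s3 ⊢
  constructor <;> linarith [m'.1, m'.2, s1.1, s1.2, s2.1, s2.2, s3.1, s3.2]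

/-- The scales `S = N ^ (1 / 4)` and `T = N ^ (1 / 800)`. -/
lemma exists_scale (T₁ : ℝ) (hT₁ : 8 ≤ T₁) : ∃ x₀ : ℝ, ∀ x P : ℝ, x₀ < x → 0 < P → P ^ 3 = x →
    1 ≤ P ∧ ∃ S T : ℝ, T₁ ≤ T ∧ T ≤ S ∧ T ^ 12 ≤ S ∧ S ^ 4 = (⌊P⌋₊ : ℝ) ∧
      (⌊P⌋₊ : ℝ) ^ ((1 : ℝ) / 1600) = √T ∧ 2 * (S ^ 7 * T ^ 30) + 1 ≤ x ^ ((3 : ℝ) / 5) := by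
  refine ⟨(T₁ ^ 800 + 1) ^ 3, fun x P hx hP0 hP3 => ?_⟩
  have hPT : T₁ ^ 800 + 1 < P := lt_of_pow_lt_pow_left₀ 3 hP0.le (by rwa [hP3])
  have hT₁0 : 0 ≤ T₁ := by linarith
  have hpow0 : 0 ≤ T₁ ^ 800 := pow_nonneg hT₁0 _
  have hNT : T₁ ^ 800 ≤ (⌊P⌋₊ : ℝ) :=
    (lt_of_add_lt_add_right (hPT.trans (Nat.lt_floor_add_one P))).le
  refine ⟨(le_add_of_nonneg_left hpow0).trans hPT.le, ?_⟩
  have hNP : (⌊P⌋₊ : ℝ) ≤ P := Nat.floor_le hP0.le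
  clear hx hPT
  generalize ⌊P⌋₊ = N at *
  set T : ℝ := (N : ℝ) ^ ((1 : ℝ) / 800) with hT
  have hT0 : 0 ≤ T := by positivity
  have hTN : T ^ 800 = N := by
    rw [hT, ← Real.rpow_natCast, ← Real.rpow_mul (Nat.cast_nonneg _)]; norm_num
  have hT1T : T₁ ≤ T := le_of_pow_le_pow_left₀ (by norm_num) hT0 (hNT.trans hTN.ge)
  clear hNT hpow0
  have hT8 : 8 ≤ T := hT₁.trans hT1T
  have hT1 : 1 ≤ T := le_trans (by norm_num) hT8
  have hT2400 : (T ^ 800) ^ 3 ≤ x := by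
    rw [hTN, ← hP3]
    exact pow_le_pow_left₀ (Nat.cast_nonneg _) hNP 3
  refine ⟨T ^ 200, T, hT1T, le_self_pow₀ hT1 (by norm_num), pow_le_pow_right₀ hT1 (by norm_num),
    ?_, ?_, ?_⟩
  · rw [← hTN, ← pow_mul]
  · rw [hT, Real.sqrt_eq_rpow, ← Real.rpow_mul (Nat.cast_nonneg _)]; norm_num
  · have a1 : T ^ 1440 ≤ x ^ ((3 : ℝ) / 5) := by
      have : ((T ^ 800) ^ 3) ^ ((3 : ℝ) / 5) = T ^ 1440 := by
        rw [← pow_mul, ← Real.rpow_natCast T, ← Real.rpow_mul hT0, ← Real.rpow_natCast T]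
        norm_num
      rw [← this]
      exact Real.rpow_le_rpow (by positivity) hT2400 (by norm_num)
    clear hT2400 hTN
    have a3 : 1 ≤ T ^ 1430 := one_le_pow₀ hT1
    have a5 : (T ^ 200) ^ 7 * T ^ 30 = T ^ 1430 := by rw [← pow_mul, ← pow_add]
    have a4 : 8 * T ^ 1430 ≤ T ^ 1440 := by
      have : T ^ 1440 = T ^ 10 * T ^ 1430 := by rw [← pow_add]
      rw [this]
      exact mul_le_mul_of_nonneg_right (hT8.trans (le_self_pow₀ hT1 (by norm_num)))
        (le_trans zero_le_one a3)
    rw [a5]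
    refine le_trans ?_ (a4.trans a1)
    clear a1 a4 a5
    generalize T ^ 1430 = y at a3
    linarith

end TwoCubes

open TwoCubes in
/-- Brüdern–Vaughan: `V(x,Q) ∼ 2CQx^{2/3}` uniformly for `x^{3/5+ε} < Q ≤ x`. -/
theorem bruedern_vaughan_two_cubes (ε : ℝ) (hε : 0 < ε) (δ : ℝ) (hδ : 0 < δ) :
    ∃ x₀ : ℝ, ∀ x Q : ℝ, x₀ < x → x ^ ((3 : ℝ) / 5 + ε) < Q → Q ≤ x →
      |Vtwocubes x Q / (2 * Ctwocubes * Q * x ^ ((2 : ℝ) / 3)) - 1| < δ := by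
  obtain ⟨T₀, hT₀8, hpar⟩ := exists_par
  have hC := Ctwocubes_pos
  set φ : ℝ := min (1 / 2) (Ctwocubes * δ / 4) with hφd
  have hφ : 0 < φ := lt_min (by norm_num) (by positivity)
  have hφ1 : φ ≤ 1 / 2 := min_le_left _ _
  have hφ2 : φ ≤ Ctwocubes * δ / 4 := min_le_right _ _
  set L : ℝ := 10 ^ 7 / φ + 4000 with hL
  have hLp : 0 < L := by positivity
  have g1 : 0 < 2 / φ := by positivity
  have g2 : 0 < L / (Ctwocubes * δ) := by positivity
  obtain ⟨x₀, hscale⟩ := exists_scale (T₀ + 2 / φ + L / (Ctwocubes * δ)) (by linarith)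
  refine ⟨max 1 x₀, fun x Q hx hQ hQx => ?_⟩
  have hx1 : 1 < x := (le_max_left _ _).trans_lt hx
  have hx0 : 0 < x := by linarith
  set P := x ^ ((1 : ℝ) / 3) with hP
  have hP0 : 0 < P := by positivity
  have hP3 : P ^ 3 = x := by
    rw [hP, ← Real.rpow_natCast, ← Real.rpow_mul hx0.le]; norm_num
  have hP2 : x ^ ((2 : ℝ) / 3) = P ^ 2 := by
    rw [hP, ← Real.rpow_natCast, ← Real.rpow_mul hx0.le]; norm_num
  obtain ⟨hP1, S, T, hT1T, hTS, hT12, hS4, hsqrt, hQ1⟩ :=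
    hscale x P ((le_max_right _ _).trans_lt hx) hP0 hP3
  have hNP : (⌊P⌋₊ : ℝ) ≤ P := Nat.floor_le hP0.le
  have hPN : P < ⌊P⌋₊ + 1 := Nat.lt_floor_add_one P
  have hT0T : T₀ ≤ T := by linarith
  have hT8 : 8 ≤ T := by linarith
  have hTp : 0 < T := by linarith
  have hSp : 0 < S := by linarith
  have hφT : 2 ≤ φ * T := by
    have : 2 / φ ≤ T := by linarith
    rwa [div_le_iff₀ hφ, mul_comm] at this
  have hLT : L < Ctwocubes * δ * T := by
    have : L / (Ctwocubes * δ) < T := by linarith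
    rwa [div_lt_iff₀ (by positivity), mul_comm] at this
  obtain ⟨R1, K1, B, h⟩ := hpar ⌊P⌋₊ S T x P hT0T hTS hS4 hsqrt hP1 hP3 rfl
  generalize ⌊P⌋₊ = N at *
  have hQ1' : 2 * (S ^ 7 * T ^ 30) + 1 ≤ Q :=
    hQ1.trans ((Real.rpow_le_rpow_of_exponent_le hx1.le (by linarith)).trans hQ.le)
  have hQp : 0 < Q := lt_of_lt_of_le (by positivity) hQ1'
  have hQN : Q ≤ 4 * (N : ℝ) ^ 3 := by
    have hN16 : (16 : ℝ) ≤ N := by exact_mod_cast h.N_ge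
    have h1 : P ^ 3 ≤ ((3 / 2 : ℝ) * N) ^ 3 := pow_le_pow_left₀ hP0.le (by linarith) 3
    have h2 : ((3 / 2 : ℝ) * N) ^ 3 = 27 / 8 * (N : ℝ) ^ 3 := by ring
    have h3 : 0 ≤ (N : ℝ) ^ 3 := by positivity
    rw [hP3, h2] at h1
    linarith
  have key := abs_sum_Vq_sub_main_le h hT8 hT12 hQ1' hQN hφ hφ1 hφT
  rw [Vtwocubes_eq h.X_lt, hP2]
  set V := ∑ q ∈ Icc 1 ⌊Q⌋₊, Vq N ⌊x⌋₊ (Ctwocubes * P ^ 2) q with hV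
  have hD : 0 < 2 * Ctwocubes * Q * P ^ 2 := by positivity
  have e : V / (2 * Ctwocubes * Q * P ^ 2) - 1 =
      (V - 2 * (Ctwocubes * P ^ 2) * Q) / (2 * Ctwocubes * Q * P ^ 2) := by
    field_simp
  rw [e, abs_div, abs_of_pos hD, div_lt_iff₀ hD]
  refine key.trans_lt ?_
  have hS8 : S ^ 8 ≤ P ^ 2 := by
    calc S ^ 8 = (S ^ 4) ^ 2 := by ring
      _ ≤ P ^ 2 := by rw [hS4]; gcongr
  have hsum : 2 * φ + 10 ^ 7 / (T * φ) + 4000 / T < 2 * Ctwocubes * δ := by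
    have h1 : 10 ^ 7 / (T * φ) + 4000 / T = L / T := by rw [hL]; field_simp
    have h2 : L / T < Ctwocubes * δ := by rwa [div_lt_iff₀ hTp]
    have h3 : 0 < Ctwocubes * δ := by positivity
    linarith
  calc Q * S ^ 8 * (2 * φ + 10 ^ 7 / (T * φ) + 4000 / T)
      ≤ Q * P ^ 2 * (2 * φ + 10 ^ 7 / (T * φ) + 4000 / T) := by gcongr
    _ < Q * P ^ 2 * (2 * Ctwocubes * δ) := by gcongr
    _ = _ := by ring
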